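/- Let k ≥ 2 and m ≥ 1, and let φ be a weak elliptic form of index m and parity (−1)^k. Then: (i) if k > 2, there exist a weak Jacobi form ψ of weight k and index m and a cuspidal elliptic form ρ of index m and parity (−1)^k with φ = ψ + ρ; (ii) if k = 2, such a decomposition (with ψ a weak Jacobi form of weight 2 and index m and ρ a cuspidal elliptic form of index m and parity +1) exists if and only if R_{m₁,m₂}(φ) = 0 for every unordered factorization m = m₁·m₂; (iii) if k = 2 and m is a prime power, then there exist a weak Jacobi form ψ of weight 2 and index m and a holomorphic elliptic form ρ of index m and parity +1 with φ = ψ + ρ. -/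

import Mathlib

noncomputable section

open Complex Filter Topology MeasureTheory
open scoped Classical

/-- `ee x = e^{2πix}`. -/
def ee (x : ℂ) : ℂ := Complex.exp (2 * (Real.pi : ℂ) * Complex.I * x)

/-- The index-`m` elliptic transformation law on `ℍ × ℂ`. -/
def EllipticLaw (m : ℕ) (φ : ℂ → ℂ → ℂ) : Prop :=
  ∀ τ : ℂ, 0 < τ.im → ∀ z : ℂ, ∀ lam mu : ℤ,
    φ τ (z + (lam : ℂ) * τ + (mu : ℂ)) =
      ee (-(m : ℂ) * ((lam : ℂ) ^ 2 * τ + 2 * (lam : ℂ) * z)) * φ τ z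

/-- The weight-`k` index-`m` modular transformation law on `ℍ × ℂ`. -/
def ModularLaw (k : ℤ) (m : ℕ) (φ : ℂ → ℂ → ℂ) : Prop :=
  ∀ τ : ℂ, 0 < τ.im → ∀ z : ℂ, ∀ a b c d : ℤ, a * d - b * c = 1 →
    φ (((a : ℂ) * τ + (b : ℂ)) / ((c : ℂ) * τ + (d : ℂ))) (z / ((c : ℂ) * τ + (d : ℂ))) =
      ((c : ℂ) * τ + (d : ℂ)) ^ k *
        ee ((m : ℂ) * (c : ℂ) * z ^ 2 / ((c : ℂ) * τ + (d : ℂ))) * φ τ z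

/-- The theta function `θ_{m,ℓ}(τ,z) = ∑_{r ≡ ℓ (mod 2m)} q^{r²/4m} y^r`. -/
def jTheta (m : ℕ) (l : ℤ) (τ z : ℂ) : ℂ :=
  ∑' n : ℤ, ee (((l : ℂ) + 2 * (m : ℂ) * (n : ℂ)) ^ 2 / (4 * (m : ℂ)) * τ +
      ((l : ℂ) + 2 * (m : ℂ) * (n : ℂ)) * z)

/-- The point `z_s = ατ + β` for `s = (α,β) ∈ ℚ²`. -/
def zpt (s : ℚ × ℚ) (τ : ℂ) : ℂ := (s.1 : ℚ) * τ + (s.2 : ℚ)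

/-- A holomorphic function on `ℍ × ℂ` satisfying the index-`m` elliptic transformation law,
together with its Fourier coefficient data `coeff Δ ℓ = C(Δ,ℓ)` (so that
`c(n,r) = C(4nm - r², r)`, `C(Δ,ℓ)` depends on `ℓ` only modulo `2m`, and `C(Δ,ℓ) = 0` on
pairs with `Δ + ℓ² ≢ 0 (mod 4m)`). -/
structure EllFormData (m : ℕ) where
  toFun : ℂ → ℂ → ℂ
  coeff : ℤ → ℤ → ℂ
  holo : ∀ τ z : ℂ, 0 < τ.im → DifferentiableAt ℂ (fun p : ℂ × ℂ => toFun p.1 p.2) (τ, z)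
  elliptic : EllipticLaw m toFun
  expansion : ∀ τ z : ℂ, 0 < τ.im →
    HasSum (fun p : ℤ × ℤ => coeff (4 * (m : ℤ) * p.1 - p.2 ^ 2) p.2 *
      ee ((p.1 : ℂ) * τ + (p.2 : ℂ) * z)) (toFun τ z)
  periodic : ∀ Δ l : ℤ, coeff Δ (l + 2 * (m : ℤ)) = coeff Δ l
  support : ∀ Δ l : ℤ, ¬ (4 * (m : ℤ)) ∣ (Δ + l ^ 2) → coeff Δ l = 0

/-- An elliptic form is weak if `c(n,r) = 0` for `n < 0`. -/
def IsWeakC (m : ℕ) (C : ℤ → ℤ → ℂ) : Prop :=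
  ∀ n r : ℤ, n < 0 → C (4 * (m : ℤ) * n - r ^ 2) r = 0

/-- Even coefficients: `C(Δ,-ℓ) = C(Δ,ℓ)`. -/
def IsEvenC (C : ℤ → ℤ → ℂ) : Prop := ∀ Δ l : ℤ, C Δ (-l) = C Δ l

/-- Holomorphic (as opposed to weak): `C(Δ,ℓ) = 0` for `Δ < 0`. -/
def IsHolC (C : ℤ → ℤ → ℂ) : Prop := ∀ Δ l : ℤ, Δ < 0 → C Δ l = 0

/-- Cuspidal: `C(Δ,ℓ) = 0` for `Δ ≤ 0`. -/
def IsCuspC (C : ℤ → ℤ → ℂ) : Prop := ∀ Δ l : ℤ, Δ ≤ 0 → C Δ l = 0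

/-- Optimal growth: `C(Δ,ℓ) = 0` for `Δ < -1`. -/
def IsOGC (C : ℤ → ℤ → ℂ) : Prop := ∀ Δ l : ℤ, Δ < -1 → C Δ l = 0

/-- A representative `ℓ* = ℓ·(a·x - b·y)` (with `ax + by = gcd(a,b) = 1`) of the residue
class determined by `ℓ* ≡ -ℓ (mod 2a)`, `ℓ* ≡ ℓ (mod 2b)`, used to define the
Atkin–Lehner involution `W_a` on coefficients. -/
def lstar (a b : ℕ) (l : ℤ) : ℤ := l * ((a : ℤ) * Nat.gcdA a b - (b : ℤ) * Nat.gcdB a b)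

/-- The coefficients of `φ|u_t` (index `m/t²`):
`C_{φ|u_t}(Δ,ℓ) = ∑_{r mod 2m/t, r ≡ ℓ (mod 2m/t²)} C_φ(Δt², rt)`. -/
def CoeffU (m t : ℕ) (C : ℤ → ℤ → ℂ) (Δ l : ℤ) : ℂ :=
  ∑ j ∈ Finset.range t,
    C (Δ * (t : ℤ) ^ 2) ((l + 2 * (m : ℤ) / (t : ℤ) ^ 2 * (j : ℤ)) * (t : ℤ))

/-- For an unordered factorization `m = m₁·m₂` with `t = gcd(m₁,m₂)`,
`R_{m₁,m₂}(φ) = R[(φ|u_t)|W_{m₁/t}] = ∑_{r∈ℤ} C_{(φ|u_t)|W_{m₁/t}}(-r², r)`. -/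
def Rfactor (m : ℕ) (C : ℤ → ℤ → ℂ) (m₁ m₂ : ℕ) : ℂ :=
  ∑' r : ℤ, CoeffU m (Nat.gcd m₁ m₂) C (-(r ^ 2))
      (lstar (m₁ / Nat.gcd m₁ m₂) (m₂ / Nat.gcd m₁ m₂) r)

theorem ee_add (a b : ℂ) : ee (a + b) = ee a * ee b := by
  unfold ee; rw [← Complex.exp_add]; ring_nf

theorem ee_zero : ee 0 = 1 := by simp [ee]

theorem ee_ne (a : ℂ) : ee a ≠ 0 := Complex.exp_ne_zero _

theorem ee_neg (a : ℂ) : ee (-a) = (ee a)⁻¹ := by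
  unfold ee; rw [← Complex.exp_neg]; ring_nf

theorem ee_int (n : ℤ) : ee n = 1 := by
  unfold ee; rw [Complex.exp_eq_one_iff]; exact ⟨n, by ring⟩

theorem ee_nat (n : ℕ) : ee n = 1 := by exact_mod_cast ee_int n

theorem ee_add_int (a : ℂ) (n : ℤ) : ee (a + n) = ee a := by rw [ee_add, ee_int, mul_one]

theorem ee_pow (a : ℂ) (n : ℕ) : ee a ^ n = ee (n * a) := by
  unfold ee; rw [← Complex.exp_nat_mul]; ring_nf

theorem ee_zpow (a : ℂ) (n : ℤ) : ee a ^ n = ee (n * a) := by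
  unfold ee; rw [← Complex.exp_int_mul]; ring_nf

theorem norm_ee (a : ℂ) : ‖ee a‖ = Real.exp (-(2 * Real.pi * a.im)) := by
  unfold ee; rw [Complex.norm_exp]; congr 1; simp

theorem norm_ee_real (a : ℝ) : ‖ee a‖ = 1 := by rw [norm_ee]; simp

theorem ee_eq_one_iff (a : ℂ) : ee a = 1 ↔ ∃ n : ℤ, a = n := by
  unfold ee; rw [Complex.exp_eq_one_iff]
  refine exists_congr fun n => ?_
  have : (2 * (Real.pi : ℂ) * Complex.I) ≠ 0 := Complex.two_pi_I_ne_zero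
  constructor
  · intro h; apply mul_left_cancel₀ this; rw [h]; ring
  · intro h; rw [h]; ring

theorem hasDerivAt_ee (a : ℂ) : HasDerivAt ee (2 * Real.pi * I * ee a) a := by
  unfold ee
  have := ((hasDerivAt_id a).const_mul (2 * (Real.pi : ℂ) * I)).cexp
  simp only [id, mul_one] at this
  rw [mul_comm _ (cexp _)]; exact this

theorem differentiable_ee : Differentiable ℂ ee := fun a => (hasDerivAt_ee a).differentiableAt

theorem DifferentiableAt.ee {E : Type*} [NormedAddCommGroup E] [NormedSpace ℂ E] {f : E → ℂ} {x : E}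
    (h : DifferentiableAt ℂ f x) : DifferentiableAt ℂ (fun y => ee (f y)) x :=
  (differentiable_ee _).comp x h

theorem continuous_ee : Continuous ee := differentiable_ee.continuous

/-- averaged exponential -/
theorem avg_ee (g T : ℝ) (hg : g ≠ 0) :
    ‖∫ t in (0:ℝ)..T, ee (g * t)‖ ≤ 1 / (Real.pi * |g|) := by
  have hc : (2 * (Real.pi : ℂ) * I * g) ≠ 0 := by
    simp [Real.pi_ne_zero, hg]
  have : ∀ t : ℝ, ee (g * t) = Complex.exp ((2 * (Real.pi : ℂ) * I * g) * t) := by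
    intro t; unfold ee; ring_nf
  simp_rw [this]
  rw [integral_exp_mul_complex hc, norm_div]
  have e1 : ‖(2 * (Real.pi : ℂ) * I * g)‖ = 2 * (Real.pi * |g|) := by
    simp [abs_of_pos Real.pi_pos]; ring
  have e2 : ‖Complex.exp ((2 * (Real.pi : ℂ) * I * g) * T) - Complex.exp ((2 * (Real.pi : ℂ) * I * g) * (0:ℝ))‖ ≤ 2 := by
    refine (norm_sub_le _ _).trans ?_
    rw [← this, ← this]
    have a1 : ‖ee (g * T)‖ = 1 := by exact_mod_cast norm_ee_real (g * T)
    have a2 : ‖ee (g * (0:ℝ))‖ = 1 := by exact_mod_cast norm_ee_real (g * 0)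
    rw [a1, a2]; norm_num
  rw [e1]
  have : 0 < Real.pi * |g| := by positivity
  rw [div_le_div_iff₀ (by positivity) this]
  nlinarith

theorem freq {ι : Type*} [Countable ι] (c : ι → ℂ) (f : ι → ℝ) (hc : Summable fun i => ‖c i‖)
    (h : ∀ t : ℝ, ∑' i, c i * ee (f i * t) = 0) (y : ℝ) :
    ∑' i, (if f i = y then c i else 0) = 0 := by
  have hn : ∀ g t : ℝ, ‖ee (g * t)‖ = 1 := fun g t => by exact_mod_cast norm_ee_real (g * t)
  have key : ∀ T : ℝ, ∑' i, c i * ((1 / T : ℝ) * ∫ t in (0:ℝ)..T, ee ((f i - y : ℝ) * t)) = 0 := by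
    intro T
    have hs : ∀ t : ℝ, ∑' i, c i * ee ((f i - y : ℝ) * t) = 0 := by
      intro t
      have := h t
      have h2 : ∀ i, c i * ee ((f i - y : ℝ) * t) = ee (-(y * t)) * (c i * ee (f i * t)) := by
        intro i
        have : ((f i - y : ℝ) : ℂ) * t = -(y * t) + f i * t := by push_cast; ring
        rw [this, ee_add]; ring
      simp_rw [h2, tsum_mul_left, this, mul_zero]
    have hcont : ∀ i, Continuous fun t : ℝ => c i * ee ((f i - y : ℝ) * t) := fun i =>
      continuous_const.mul (continuous_ee.comp (by fun_prop))
    have := intervalIntegral.hasSum_integral_of_dominated_convergence (μ := volume) (a := 0) (b := T)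
      (F := fun i t => c i * ee ((f i - y : ℝ) * t)) (f := fun _ => 0) (fun i _ => ‖c i‖)
      (fun i => (hcont i).aestronglyMeasurable)
      (fun i => Eventually.of_forall fun t _ => by simp only [norm_mul, hn, mul_one, le_refl])
      (Eventually.of_forall fun t _ => hc)
      (by simp)
      (Eventually.of_forall fun t _ => by
        rw [← hs t]
        refine Summable.hasSum (Summable.of_norm ?_)
        simp only [norm_mul, hn, mul_one]; exact hc)
    simp only [intervalIntegral.integral_const_mul, intervalIntegral.integral_zero] at this
    have h3 := (this.mul_left ((1 / T : ℝ) : ℂ)).tsum_eq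
    rw [mul_zero] at h3
    rw [← h3]; congr 1; ext i; ring
  have lim := tendsto_tsum_of_dominated_convergence (𝓕 := atTop)
    (f := fun (T : ℝ) i => c i * ((1 / T : ℝ) * ∫ t in (0:ℝ)..T, ee ((f i - y : ℝ) * t)))
    (g := fun i => if f i = y then c i else 0) hc ?_ ?_
  · simp_rw [key] at lim
    exact (tendsto_nhds_unique lim tendsto_const_nhds)
  · intro i
    by_cases hi : f i = y
    · simp only [hi, if_true, sub_self]
      refine Tendsto.congr' (f₁ := fun _ => c i) ?_ tendsto_const_nhds
      filter_upwards [eventually_gt_atTop 0] with T hT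
      have : (T : ℂ) ≠ 0 := by exact_mod_cast hT.ne'
      simp [ee_zero, this]
    · simp only [hi, if_false]
      have hg : f i - y ≠ 0 := sub_ne_zero.mpr hi
      have : Tendsto (fun T : ℝ => ((1 / T : ℝ) : ℂ) * ∫ t in (0:ℝ)..T, ee ((f i - y : ℝ) * t)) atTop (𝓝 0) := by
        refine squeeze_zero_norm' (a := fun T : ℝ => 1 / (Real.pi * |f i - y|) * (T)⁻¹) ?_ ?_
        · filter_upwards [eventually_gt_atTop 0] with T hT
          rw [norm_mul, mul_comm]
          refine mul_le_mul (avg_ee _ _ hg) ?_ (norm_nonneg _) (by positivity)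
          simp [abs_of_pos hT]
        · simpa using tendsto_inv_atTop_zero.const_mul (1 / (Real.pi * |f i - y|))
      simpa using this.const_mul (c i)
  · filter_upwards [eventually_gt_atTop 0] with T hT i
    rw [norm_mul]
    refine mul_le_of_le_one_right (norm_nonneg _) ?_
    rw [norm_mul]
    have : ‖∫ t in (0:ℝ)..T, ee ((f i - y : ℝ) * t)‖ ≤ 1 * |T - 0| :=
      intervalIntegral.norm_integral_le_of_norm_le_const fun t _ => (hn _ _).le
    rw [sub_zero, one_mul, abs_of_pos hT] at this
    calc _ ≤ 1 / T * T := by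
          refine mul_le_mul ?_ this (norm_nonneg _) (by positivity)
          rw [Complex.norm_real, Real.norm_eq_abs, abs_of_pos (by positivity)]
      _ = 1 := by field_simp

def conv {Γ : Type*} [AddCommGroup Γ] (x y : Γ → ℂ) (γ : Γ) : ℂ := ∑' i, x i * y (γ - i)

theorem hasSum_conv {Γ : Type*} [AddCommGroup Γ] {x y χ : Γ → ℂ} {X Y : ℂ}
    (hχ : ∀ a b, χ (a + b) = χ a * χ b) (h0 : ∀ a, χ a ≠ 0)
    (hx : HasSum (fun i => x i * χ i) X) (hy : HasSum (fun i => y i * χ i) Y) :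
    (∀ γ, Summable fun i => x i * y (γ - i)) ∧ HasSum (fun γ => conv x y γ * χ γ) (X * Y) := by
  have hs := summable_mul_of_summable_norm hx.summable.norm hy.summable.norm
  have h := hx.mul hy hs
  let e : Γ × Γ ≃ Γ × Γ :=
    { toFun := fun p => (p.2, p.1 - p.2), invFun := fun p => (p.1 + p.2, p.1)
      left_inv := fun p => by simp
      right_inv := fun p => by simp }
  have h2 := (e.hasSum_iff (f := fun p : Γ × Γ => x p.1 * χ p.1 * (y p.2 * χ p.2))).mpr h
  have h3 : HasSum (fun p : Γ × Γ => χ p.1 * (x p.2 * y (p.1 - p.2))) (X * Y) := by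
    convert h2 using 1
    ext p
    simp only [Function.comp, e, Equiv.coe_fn_mk]
    have : χ p.1 = χ p.2 * χ (p.1 - p.2) := by rw [← hχ]; simp
    rw [this]; ring
  have h4 : ∀ γ, Summable fun i => χ γ * (x i * y (γ - i)) := fun γ => h3.summable.prod_factor γ
  have h5 : ∀ γ, Summable fun i => x i * y (γ - i) := fun γ =>
    (summable_mul_left_iff (h0 γ)).mp (h4 γ)
  refine ⟨h5, ?_⟩
  convert h3.prod_fiberwise (fun γ => (h4 γ).hasSum) using 1
  ext γ
  rw [tsum_mul_left, conv, mul_comm]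

def QRep (c : ℤ × ℤ → ℂ) (φ : ℂ → ℂ → ℂ) : Prop := ∀ τ z : ℂ, 0 < τ.im →
  HasSum (fun p : ℤ × ℤ => c p * ee ((p.1 : ℂ) * τ + (p.2 : ℂ) * z)) (φ τ z)

def IntC {Γ : Type*} (c : Γ → ℂ) : Prop := ∀ p, ∃ n : ℤ, c p = n

theorem QRep.mul' {c d : ℤ × ℤ → ℂ} {φ ψ : ℂ → ℂ → ℂ} (h : QRep c φ) (h' : QRep d ψ) :
    (∀ γ, Summable fun i => c i * d (γ - i)) ∧ QRep (conv c d) (fun τ z => φ τ z * ψ τ z) := by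
  have := fun (τ z : ℂ) (hτ : 0 < τ.im) => hasSum_conv
    (χ := fun p : ℤ × ℤ => ee ((p.1 : ℂ) * τ + (p.2 : ℂ) * z))
    (fun a b => by rw [← ee_add]; congr 1; push_cast [Prod.fst_add, Prod.snd_add]; ring)
    (fun a => ee_ne _) (h τ z hτ) (h' τ z hτ)
  exact ⟨(this I 0 (by simp)).1, fun τ z hτ => (this τ z hτ).2⟩

theorem QRep.mul {c d : ℤ × ℤ → ℂ} {φ ψ : ℂ → ℂ → ℂ} (h : QRep c φ) (h' : QRep d ψ) :
    QRep (conv c d) (fun τ z => φ τ z * ψ τ z) := (h.mul' h').2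

theorem QRep.add {c d : ℤ × ℤ → ℂ} {φ ψ : ℂ → ℂ → ℂ} (h : QRep c φ) (h' : QRep d ψ) :
    QRep (fun p => c p + d p) (fun τ z => φ τ z + ψ τ z) := fun τ z hτ => by
  simpa only [add_mul] using (h τ z hτ).add (h' τ z hτ)

theorem QRep.smul {c : ℤ × ℤ → ℂ} {φ : ℂ → ℂ → ℂ} (a : ℂ) (h : QRep c φ) :
    QRep (fun p => a * c p) (fun τ z => a * φ τ z) := fun τ z hτ => by
  simpa only [mul_assoc] using (h τ z hτ).mul_left a

theorem QRep.congr {c d : ℤ × ℤ → ℂ} {φ ψ : ℂ → ℂ → ℂ} (h : QRep c φ) (hc : ∀ p, c p = d p)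
    (hp : ∀ τ z, 0 < τ.im → φ τ z = ψ τ z) : QRep d ψ := fun τ z hτ => by
  simp only [← hc, ← hp τ z hτ]; exact h τ z hτ

theorem QRep.sum {ι : Type*} (s : Finset ι) {c : ι → ℤ × ℤ → ℂ} {φ : ι → ℂ → ℂ → ℂ}
    (h : ∀ i ∈ s, QRep (c i) (φ i)) :
    QRep (fun p => ∑ i ∈ s, c i p) (fun τ z => ∑ i ∈ s, φ i τ z) := fun τ z hτ => by
  simpa only [Finset.sum_mul] using hasSum_sum fun i hi => h i hi τ z hτ

theorem QRep.one : QRep (fun p => if p = 0 then 1 else 0) (fun _ _ => 1) := fun τ z _ => by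
  convert hasSum_ite_eq (0 : ℤ × ℤ) (1 : ℂ) using 2 with p
  split_ifs with h <;> simp [h, ee_zero]

theorem QRep.unique0 {c : ℤ × ℤ → ℂ} (h : QRep c fun _ _ => 0) (p : ℤ × ℤ) : c p = 0 := by
  let α : ℝ := Real.sqrt 2
  have hα : Irrational α := irrational_sqrt_two
  have hinj : Function.Injective fun p : ℤ × ℤ => (p.1 : ℝ) + p.2 * α := by
    rintro ⟨a, b⟩ ⟨c, d⟩ hab
    simp only at hab
    have h1 : ((b - d : ℤ) : ℝ) * α = ((c - a : ℤ) : ℝ) := by push_cast; linarith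
    have hbd : b - d = 0 := by
      by_contra hne
      exact (hα.intCast_mul hne).ne_int _ h1
    rw [hbd] at h1
    have : ((c - a : ℤ) : ℝ) = 0 := by rw [← h1]; simp
    have : c - a = 0 := by exact_mod_cast this
    ext <;> simp <;> omega
  have hs : Summable fun p : ℤ × ℤ => ‖c p * ee (p.1 * I)‖ := by
    have := (h I 0 (by simp)).summable.norm
    simpa using this
  have := freq (fun p : ℤ × ℤ => c p * ee (p.1 * I)) (fun p : ℤ × ℤ => (p.1 : ℝ) + p.2 * α) hs
    (fun t => by
      have := (h (I + t) (α * t) (by simp)).tsum_eq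
      refine Eq.trans ?_ this; congr 1; ext q
      rw [mul_assoc, ← ee_add]; congr 2; push_cast; ring) ((p.1 : ℝ) + p.2 * α)
  rw [tsum_eq_single p (fun q hq => by
    rw [if_neg]; intro h; exact hq (hinj h))] at this
  simpa [ee_ne] using this

theorem QRep.unique {c d : ℤ × ℤ → ℂ} {φ : ℂ → ℂ → ℂ} (h : QRep c φ) (h' : QRep d φ) : c = d := by
  ext p
  have := QRep.unique0 ((h.add (h'.smul (-1))).congr (fun _ => rfl) (ψ := fun _ _ => 0)
    (fun τ z _ => by ring)) p
  linear_combination this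

theorem IntC.tsum {Γ : Type*} {x : Γ → ℂ} (hs : Summable x) (hx : IntC x) :
    ∃ n : ℤ, ∑' i, x i = n := by
  have hfin : (Function.support x).Finite := by
    have := (hs.norm.tendsto_cofinite_zero).eventually (gt_mem_nhds one_pos)
    rw [eventually_cofinite] at this
    refine this.subset fun i hi => ?_
    obtain ⟨n, hn⟩ := hx i
    have : n ≠ 0 := by rintro rfl; exact hi (by simpa using hn)
    simp only [Set.mem_ofPred_eq, not_lt, hn, Complex.norm_intCast]
    exact_mod_cast Int.one_le_abs this
  choose f hf using hx
  rw [tsum_eq_sum (s := hfin.toFinset) (fun i hi => by simpa using hi)]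
  exact ⟨∑ i ∈ hfin.toFinset, f i, by push_cast; exact Finset.sum_congr rfl fun i _ => hf i⟩

theorem IntC.conv {c d : ℤ × ℤ → ℂ} {φ ψ : ℂ → ℂ → ℂ} (h : QRep c φ) (h' : QRep d ψ)
    (hc : IntC c) (hd : IntC d) : IntC (conv c d) := fun γ =>
  IntC.tsum ((h.mul' h').1 γ) fun i => by
    obtain ⟨a, ha⟩ := hc i; obtain ⟨b, hb⟩ := hd (γ - i)
    exact ⟨a * b, by rw [ha, hb]; push_cast; ring⟩

def lexlt (p q : ℤ × ℤ) : Prop := p.1 < q.1 ∨ (p.1 = q.1 ∧ p.2 < q.2)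

/-- leading term `1·(γ)` -/
def Lead (c : ℤ × ℤ → ℂ) (γ : ℤ × ℤ) : Prop := (∀ p, lexlt p γ → c p = 0) ∧ c γ = 1

theorem Lead.conv {c d : ℤ × ℤ → ℂ} {γ δ : ℤ × ℤ} (h : Lead c γ) (h' : Lead d δ) :
    Lead (conv c d) (γ + δ) := by
  have key : ∀ p i : ℤ × ℤ, (lexlt p (γ + δ) ∨ (p = γ + δ ∧ i ≠ γ)) → c i * d (p - i) = 0 := by
    intro p i hp
    by_cases hi : lexlt i γ
    · rw [h.1 i hi, zero_mul]
    · rw [h'.1 (p - i), mul_zero]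
      unfold lexlt at *
      simp only [Prod.fst_add, Prod.snd_add, Prod.fst_sub, Prod.snd_sub, Prod.ext_iff, ne_eq] at *
      omega
  constructor
  · intro p hp
    unfold _root_.conv
    rw [show (fun i => c i * d (p - i)) = fun _ => 0 from funext fun i => key p i (Or.inl hp)]
    simp
  · unfold _root_.conv
    rw [tsum_eq_single γ (fun i hi => key _ i (Or.inr ⟨rfl, hi⟩))]
    simp [h.2, h'.2]

def BddN (c : ℤ × ℤ → ℂ) : Prop := ∃ N : ℤ, ∀ p : ℤ × ℤ, p.1 < N → c p = 0

theorem BddN.conv {c d : ℤ × ℤ → ℂ} (h : BddN c) (h' : BddN d) : BddN (conv c d) := by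
  obtain ⟨N, hN⟩ := h
  obtain ⟨M, hM⟩ := h'
  refine ⟨N + M, fun p hp => ?_⟩
  unfold _root_.conv
  rw [show (fun i => c i * d (p - i)) = fun _ => 0 from ?_]
  · simp
  · ext i
    by_cases hi : i.1 < N
    · rw [hN i hi, zero_mul]
    · rw [hM (p - i) (by simp; omega), mul_zero]

def Hol (φ : ℂ → ℂ → ℂ) : Prop :=
  ∀ τ z : ℂ, 0 < τ.im → DifferentiableAt ℂ (fun p : ℂ × ℂ => φ p.1 p.2) (τ, z)

def SLaw (k : ℤ) (m : ℕ) (φ : ℂ → ℂ → ℂ) : Prop := ∀ τ z : ℂ, 0 < τ.im →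
  φ (-1 / τ) (z / τ) = τ ^ k * ee (m * z ^ 2 / τ) * φ τ z

/-- weakly holomorphic Jacobi form (index 0 allowed) -/
structure JF (k : ℤ) (m : ℕ) (φ : ℂ → ℂ → ℂ) (c : ℤ × ℤ → ℂ) : Prop where
  hol : Hol φ
  ell : EllipticLaw m φ
  slaw : SLaw k m φ
  rep : QRep c φ
  bdd : BddN c

theorem ne_zero_of_im {τ : ℂ} (h : 0 < τ.im) : τ ≠ 0 := by rintro rfl; simp at h

theorem im_S {τ : ℂ} (h : 0 < τ.im) : 0 < (-1 / τ).im := by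
  have : 0 < Complex.normSq τ := Complex.normSq_pos.mpr (ne_zero_of_im h)
  rw [neg_div, one_div, Complex.neg_im, Complex.inv_im, neg_div, neg_neg]; positivity

theorem JF.mul {k k' : ℤ} {m m' : ℕ} {φ ψ c d} (h : JF k m φ c) (h' : JF k' m' ψ d) :
    JF (k + k') (m + m') (fun τ z => φ τ z * ψ τ z) (conv c d) where
  hol := fun τ z hτ => (h.hol τ z hτ).mul (h'.hol τ z hτ)
  ell := fun τ hτ z l n => by
    beta_reduce
    rw [h.ell τ hτ, h'.ell τ hτ,
      show (-((m + m' : ℕ) : ℂ) * ((l : ℂ) ^ 2 * τ + 2 * l * z)) =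
        -(m : ℂ) * ((l : ℂ) ^ 2 * τ + 2 * l * z) + -(m' : ℂ) * ((l : ℂ) ^ 2 * τ + 2 * l * z) by
        push_cast; ring, ee_add]; ring
  slaw := fun τ z hτ => by
    beta_reduce
    rw [h.slaw τ z hτ, h'.slaw τ z hτ, zpow_add₀ (ne_zero_of_im hτ),
      show (((m + m' : ℕ) : ℂ) * z ^ 2 / τ) = m * z ^ 2 / τ + m' * z ^ 2 / τ by push_cast; ring,
      ee_add]; ring
  rep := h.rep.mul h'.rep
  bdd := h.bdd.conv h'.bdd

theorem JF.add {k : ℤ} {m : ℕ} {φ ψ c d} (h : JF k m φ c) (h' : JF k m ψ d) :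
    JF k m (fun τ z => φ τ z + ψ τ z) (fun p => c p + d p) where
  hol := fun τ z hτ => (h.hol τ z hτ).add (h'.hol τ z hτ)
  ell := fun τ hτ z l n => by beta_reduce; rw [h.ell τ hτ, h'.ell τ hτ]; ring
  slaw := fun τ z hτ => by
    beta_reduce
    rw [h.slaw τ z hτ, h'.slaw τ z hτ]; ring
  rep := h.rep.add h'.rep
  bdd := by
    obtain ⟨N, hN⟩ := h.bdd
    obtain ⟨M, hM⟩ := h'.bdd
    exact ⟨min N M, fun p hp => by beta_reduce; rw [hN p (by omega), hM p (by omega), add_zero]⟩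

theorem JF.smul {k : ℤ} {m : ℕ} {φ c} (a : ℂ) (h : JF k m φ c) :
    JF k m (fun τ z => a * φ τ z) (fun p => a * c p) where
  hol := fun τ z hτ => (h.hol τ z hτ).const_mul a
  ell := fun τ hτ z l n => by beta_reduce; rw [h.ell τ hτ]; ring
  slaw := fun τ z hτ => by
    beta_reduce
    rw [h.slaw τ z hτ]; ring
  rep := h.rep.smul a
  bdd := by
    obtain ⟨N, hN⟩ := h.bdd
    exact ⟨N, fun p hp => by beta_reduce; rw [hN p hp, mul_zero]⟩

theorem JF.one : JF 0 0 (fun _ _ => 1) (fun p => if p = 0 then 1 else 0) where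
  hol := fun τ z hτ => differentiableAt_const _
  ell := fun τ hτ z l n => by simp [ee_zero]
  slaw := fun τ z hτ => by simp [ee_zero]
  rep := QRep.one
  bdd := ⟨0, fun p hp => if_neg (by rintro rfl; simp at hp)⟩

def convpow (c : ℤ × ℤ → ℂ) : ℕ → ℤ × ℤ → ℂ
  | 0 => fun p => if p = 0 then 1 else 0
  | n + 1 => conv (convpow c n) c

theorem JF.pow {k : ℤ} {m : ℕ} {φ c} (h : JF k m φ c) (n : ℕ) :
    JF (n * k) (n * m) (fun τ z => φ τ z ^ n) (convpow c n) := by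
  induction n with
  | zero => simpa [convpow] using JF.one
  | succ n ih =>
    have := ih.mul h
    simp only [← pow_succ] at this
    convert this using 1
    · push_cast; ring
    · ring
    · rfl

theorem QRep.pow {φ c} (h : QRep c φ) (n : ℕ) : QRep (convpow c n) (fun τ z => φ τ z ^ n) := by
  induction n with
  | zero => simpa [convpow] using QRep.one
  | succ n ih =>
    have := ih.mul h
    simp only [← pow_succ] at this
    exact this

theorem Lead.pow {c γ} (h : Lead c γ) (n : ℕ) : Lead (convpow c n) (n • γ) := by
  induction n with
  | zero =>
    constructor
    · intro p hp; exact if_neg (by rintro rfl; simp [lexlt] at hp)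
    · simp [convpow]
  | succ n ih => rw [succ_nsmul]; exact ih.conv h

theorem IntC.pow {c φ} (h : QRep c φ) (hc : IntC c) (n : ℕ) : IntC (convpow c n) := by
  induction n with
  | zero => intro p; by_cases hp : p = 0 <;> [exact ⟨1, by simp [convpow, hp]⟩; exact ⟨0, by simp [convpow, hp]⟩]
  | succ n ih => exact IntC.conv (h.pow n) h ih hc

theorem QRep.tlaw {c φ} (h : QRep c φ) (τ z : ℂ) (hτ : 0 < τ.im) (n : ℤ) : φ (τ + n) z = φ τ z := by
  have h1 := h (τ + n) z (by simpa using hτ)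
  refine h1.unique ?_
  convert h τ z hτ using 2 with p
  rw [← ee_add_int (p.1 * τ + p.2 * z) (p.1 * n)]; congr 2; push_cast; ring

theorem im_mob (a b c d : ℤ) (hd : a * d - b * c = 1) (τ : ℂ) (hτ : 0 < τ.im) :
    (c : ℂ) * τ + d ≠ 0 ∧ 0 < (((a : ℂ) * τ + b) / (c * τ + d)).im := by
  have h1 : (c : ℂ) * τ + d ≠ 0 := by
    intro h
    have h2 := congrArg Complex.im h
    have h3 := congrArg Complex.re h
    simp at h2 h3
    have hc : c = 0 := by
      rcases h2 with h | h
      · exact h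
      · exact absurd h hτ.ne'
    subst hc
    simp at h3
    subst h3
    simp at hd
  refine ⟨h1, ?_⟩
  have e : (((a : ℂ) * τ + b) / (c * τ + d)).im = τ.im / Complex.normSq (c * τ + d) := by
    rw [Complex.div_im]
    have hd' : (a : ℝ) * d - b * c = 1 := by exact_mod_cast hd
    simp
    rw [← sub_div]; congr 1
    linear_combination τ.im * hd'
  rw [e]
  have := Complex.normSq_pos.mpr h1
  positivity

theorem JF.modular {k m φ c} (h : JF k m φ c) : ModularLaw k m φ := by
  let P : ℤ → ℤ → ℤ → ℤ → Prop := fun a b c d => ∀ τ : ℂ, 0 < τ.im → ∀ z : ℂ,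
    φ (((a : ℂ) * τ + (b : ℂ)) / ((c : ℂ) * τ + (d : ℂ))) (z / ((c : ℂ) * τ + (d : ℂ))) =
      ((c : ℂ) * τ + (d : ℂ)) ^ k *
        ee ((m : ℂ) * (c : ℂ) * z ^ 2 / ((c : ℂ) * τ + (d : ℂ))) * φ τ z
  have hS : ∀ a b c d : ℤ, a * d - b * c = 1 → (P a b c d ↔ P (-c) (-d) a b) := by
    intro a b c d hd
    refine forall_congr' fun τ => forall_congr' fun hτ => forall_congr' fun z => ?_
    obtain ⟨hj, hi⟩ := im_mob a b c d hd τ hτ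
    obtain ⟨hn, -⟩ := im_mob (-c) (-d) a b (by linarith) τ hτ
    have hd' : (a : ℂ) * d - b * c = 1 := by exact_mod_cast hd
    have hs := h.slaw _ (z / ((c : ℂ) * τ + d)) hi
    have hrel : (a : ℂ) * (c * τ + d) = 1 + c * (a * τ + b) := by linear_combination hd'
    have e0 : ((-c : ℤ) : ℂ) * τ + (-d : ℤ) = -(c * τ + d) := by push_cast; ring
    rw [e0]
    generalize (c : ℂ) * τ + d = j at *
    generalize (a : ℂ) * τ + b = n at *
    have e1 : -j / n = -1 / (n / j) := by field_simp
    have e2 : z / j / (n / j) = z / n := by field_simp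
    have e3 : (m : ℂ) * a * z ^ 2 / n = m * (z / j) ^ 2 / (n / j) + m * c * z ^ 2 / j := by
      field_simp; linear_combination ((m:ℂ) * z ^ 2) * hrel
    rw [e2] at hs
    rw [e1, hs, e3, ee_add, div_zpow]
    have h4 := ee_ne (m * (z / j) ^ 2 / (n / j))
    have h5 := zpow_ne_zero k hj
    have h6 := zpow_ne_zero k hn
    generalize ee (m * (z / j) ^ 2 / (n / j)) = x1 at *
    generalize ee ((m : ℂ) * c * z ^ 2 / j) = x2 at *
    generalize j ^ k = x3 at *
    generalize n ^ k = x4 at *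
    constructor
    · intro h; rw [h]; field_simp
    · intro h
      apply mul_left_cancel₀ (mul_ne_zero (div_ne_zero h6 h5) h4)
      rw [h]; field_simp
  have hT : ∀ a b c d n : ℤ, a * d - b * c = 1 → (P a b c d ↔ P (a + n * c) (b + n * d) c d) := by
    intro a b c d n hd
    refine forall_congr' fun τ => forall_congr' fun hτ => forall_congr' fun z => ?_
    obtain ⟨hj, hi⟩ := im_mob a b c d hd τ hτ
    rw [← h.rep.tlaw _ _ hi n]
    have : ((a + n * c : ℤ) : ℂ) * τ + (b + n * d : ℤ) = (a * τ + b) + n * (c * τ + d) := by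
      push_cast; ring
    rw [this, add_div _ ((n : ℂ) * _), mul_div_cancel_right₀ _ hj]
  have gen : ∀ γ : Matrix.SpecialLinearGroup (Fin 2) ℤ, P (γ 0 0) (γ 0 1) (γ 1 0) (γ 1 1) := by
    intro γ
    have hγ : γ ∈ Subgroup.closure {ModularGroup.S, ModularGroup.T} := by
      rw [SpecialLinearGroup.SL2Z_generators]; trivial
    have det : ∀ y : Matrix.SpecialLinearGroup (Fin 2) ℤ, y 0 0 * y 1 1 - y 0 1 * y 1 0 = 1 := by
      intro y
      have := y.det_coe
      rwa [Matrix.det_fin_two] at this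
    have hs' : ∀ y : Matrix.SpecialLinearGroup (Fin 2) ℤ, P (y 0 0) (y 0 1) (y 1 0) (y 1 1) ↔
      P ((ModularGroup.S * y) 0 0) ((ModularGroup.S * y) 0 1) ((ModularGroup.S * y) 1 0) ((ModularGroup.S * y) 1 1) := by
      intro y
      convert hS _ _ _ _ (det y) using 2 <;>
        simp [ModularGroup.coe_S, Matrix.SpecialLinearGroup.coe_mul, Matrix.mul_apply, Fin.sum_univ_two]
    have ht' : ∀ y : Matrix.SpecialLinearGroup (Fin 2) ℤ, P (y 0 0) (y 0 1) (y 1 0) (y 1 1) ↔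
      P ((ModularGroup.T * y) 0 0) ((ModularGroup.T * y) 0 1) ((ModularGroup.T * y) 1 0) ((ModularGroup.T * y) 1 1) := by
      intro y
      convert hT _ _ _ _ 1 (det y) using 2 <;>
        simp [ModularGroup.coe_T, Matrix.SpecialLinearGroup.coe_mul, Matrix.mul_apply, Fin.sum_univ_two]
    induction hγ using Subgroup.closure_induction_left with
    | one => intro τ hτ z; simp [ee_zero]
    | mul_left x hx y hy ih =>
      rcases hx with rfl | rfl
      · exact (hs' y).mp ih
      · exact (ht' y).mp ih
    | inv_mul_cancel x hx y hy ih =>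
      rcases hx with rfl | rfl
      · rw [hs', mul_inv_cancel_left]; exact ih
      · rw [ht', mul_inv_cancel_left]; exact ih
  intro τ hτ z a b c d hd
  have := gen ⟨!![a, b; c, d], by rw [Matrix.det_fin_two_of]; exact hd⟩ τ hτ z
  simpa using this

theorem JF.parity {k m φ c} (h : JF k m φ c) (n r : ℤ) : c (n, -r) = (-1 : ℂ) ^ k * c (n, r) := by
  have hz : ∀ τ z, 0 < τ.im → φ τ (-z) = (-1 : ℂ) ^ k * φ τ z := by
    intro τ z hτ
    have := h.modular τ hτ z (-1) 0 0 (-1) (by norm_num)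
    simpa [ee_zero, div_neg] using this
  have h1 : QRep (fun p => c (p.1, -p.2)) (fun τ z => φ τ (-z)) := by
    intro τ z hτ
    have := ((Equiv.prodCongr (Equiv.refl ℤ) (Equiv.neg ℤ)).hasSum_iff).mpr (h.rep τ (-z) hτ)
    convert this using 2 with p
    simp [Prod.map]
  have h2 := (h.rep.smul ((-1 : ℂ) ^ k)).congr (fun _ => rfl) (fun τ z hτ => (hz τ z hτ).symm)
  exact congrFun (h1.unique h2) (n, r)

theorem EllipticLaw.shift {m φ c} (h : EllipticLaw m φ) (hr : QRep c φ) (n r : ℤ) :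
    c (n + r + m, r + 2 * m) = c (n, r) := by
  let e1 : ℤ × ℤ ≃ ℤ × ℤ :=
    { toFun := fun p => (p.1 + p.2 + m, p.2 + 2 * m), invFun := fun p => (p.1 - p.2 + m, p.2 - 2 * m)
      left_inv := fun p => by ext <;> simp <;> ring
      right_inv := fun p => by ext <;> simp <;> ring }
  have h1 : QRep (fun p => c (e1 p)) φ := by
    intro τ z hτ
    have h2 := (hr τ (z - τ) hτ)
    have h3 := h τ hτ (z - τ) 1 0
    simp at h3
    have h4 := (e1.hasSum_iff).mpr h2
    have h5 := h4.mul_left (ee (-(m * (τ + 2 * (z - τ)))))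
    rw [← h3] at h5
    refine cast (congrArg (fun f => HasSum f _) (funext fun p => ?_)) h5
    simp only [Function.comp]
    symm
    rw [mul_left_comm, ← ee_add]; congr 2; simp only [e1, Equiv.coe_fn_mk]; push_cast; ring
  exact congrFun (h1.unique hr) (n, r)

def mkE {m : ℕ} (hm : 0 < m) {φ c} (hol : Hol φ) (ell : EllipticLaw m φ) (rep : QRep c φ) :
    EllFormData m where
  toFun := φ
  coeff := fun Δ l => if (4 * (m : ℤ)) ∣ (Δ + l ^ 2) then c ((Δ + l ^ 2) / (4 * m), l) else 0
  holo := hol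
  elliptic := ell
  expansion := fun τ z hτ => by
    convert rep τ z hτ using 3 with p
    rw [sub_add_cancel, if_pos (dvd_mul_right _ _), Int.mul_ediv_cancel_left _ (by positivity)]
  periodic := fun Δ l => by
    have e : Δ + (l + 2 * m) ^ 2 = Δ + l ^ 2 + 4 * (m : ℤ) * (l + m) := by ring
    have hd : (4 * (m : ℤ)) ∣ Δ + (l + 2 * m) ^ 2 ↔ (4 * (m : ℤ)) ∣ Δ + l ^ 2 := by
      rw [e]; exact Int.dvd_add_left (dvd_mul_right _ _)
    simp only [hd]
    split_ifs with h
    · rw [e, Int.add_mul_ediv_left _ _ (by positivity), ← ell.shift rep ((Δ + l ^ 2) / (4 * m)), ← add_assoc]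
    · rfl
  support := fun Δ l h => if_neg h

theorem mkE_coeff {m : ℕ} (hm : 0 < m) {φ c} (hol : Hol φ) (ell : EllipticLaw m φ) (rep : QRep c φ)
    (n r : ℤ) : (mkE hm hol ell rep).coeff (4 * m * n - r ^ 2) r = c (n, r) := by
  simp only [mkE]
  rw [sub_add_cancel, if_pos (dvd_mul_right _ _), Int.mul_ediv_cancel_left _ (by positivity)]

/-- `E` is a weakly holomorphic Jacobi form of weight `k`. -/
def JB (k : ℤ) {m : ℕ} (E : EllFormData m) : Prop :=
  JF k m E.toFun (fun p => E.coeff (4 * (m : ℤ) * p.1 - p.2 ^ 2) p.2)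

theorem JF.mkE {k m φ c} (hm : 0 < m) (h : JF k m φ c) : JB k (mkE hm h.hol h.ell h.rep) := by
  unfold JB
  simp only [mkE_coeff]
  exact h

theorem coeff_eq_iff {m : ℕ} (E : EllFormData m) {c} (hr : QRep c E.toFun) (n r : ℤ) :
    E.coeff (4 * m * n - r ^ 2) r = c (n, r) :=
  congrFun (QRep.unique (c := fun p => E.coeff (4 * (m : ℤ) * p.1 - p.2 ^ 2) p.2) E.expansion hr) (n, r)

theorem per_int {f : ℤ → ℂ} {N : ℤ} (h : ∀ l, f (l + N) = f l) (l j : ℤ) : f (l + N * j) = f l := by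
  induction j using Int.induction_on with
  | zero => simp
  | succ j ih => rw [mul_add, mul_one, ← add_assoc, h, ih]
  | pred j ih => rw [← ih, ← h (l + N * (-j - 1))]; congr 1; ring

theorem per_mod {f : ℤ → ℂ} {N : ℤ} (h : ∀ l, f (l + N) = f l) {l l' : ℤ} (hl : N ∣ l - l') : f l = f l' := by
  obtain ⟨j, hj⟩ := hl
  rw [show l = l' + N * j by linarith, per_int h]

theorem JB.bdd {k m} {E : EllFormData m} (hm : 0 < m) (h : JB k E) :
    ∃ B : ℤ, ∀ Δ l : ℤ, Δ < B → E.coeff Δ l = 0 := by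
  obtain ⟨N, hN⟩ := JF.bdd h
  refine ⟨4 * m * N - 4 * m ^ 2, fun Δ l hΔ => ?_⟩
  have hm' : (0 : ℤ) < 2 * m := by positivity
  let r := l % (2 * m)
  have hr0 : 0 ≤ r := Int.emod_nonneg _ hm'.ne'
  have hr1 : r < 2 * m := Int.emod_lt_of_pos _ hm'
  have : E.coeff Δ l = E.coeff Δ r := per_mod (E.periodic Δ) (Int.dvd_self_sub_emod)
  rw [this]
  by_cases hd : (4 * (m : ℤ)) ∣ Δ + r ^ 2
  · obtain ⟨n, hn⟩ := hd
    have := hN (n, r) (by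
      simp only
      have : r ^ 2 < 4 * m ^ 2 := by nlinarith
      nlinarith)
    simp only at this
    rw [← hn] at this
    simpa using this
  · exact E.support _ _ hd

def sqI (τ : ℂ) : ℂ := (-I * τ) ^ (1 / 2 : ℂ)

theorem sq_sq {τ : ℂ} (h : 0 < τ.im) : sqI τ ^ 2 = -I * τ := by
  unfold sqI
  rw [← Complex.cpow_nat_mul]
  norm_num

theorem sq_ne {τ : ℂ} (h : 0 < τ.im) : sqI τ ≠ 0 := by
  intro h0
  have := sq_sq h
  rw [h0] at this
  simp [ne_zero_of_im h] at this

theorem jt2_eq (z τ : ℂ) : jacobiTheta₂ z τ = ∑' n : ℤ, ee ((n : ℂ) ^ 2 * τ / 2 + n * z) := by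
  unfold jacobiTheta₂ jacobiTheta₂_term ee
  congr 1; funext n; congr 1; ring

theorem jt2_sum (z : ℂ) {τ : ℂ} (h : 0 < τ.im) :
    HasSum (fun n : ℤ => ee ((n : ℂ) ^ 2 * τ / 2 + n * z)) (jacobiTheta₂ z τ) := by
  convert hasSum_jacobiTheta₂_term z h using 1
  funext n; unfold jacobiTheta₂_term ee; congr 1; ring

theorem im_nat_mul {m : ℕ} (hm : 0 < m) {τ : ℂ} (h : 0 < τ.im) : 0 < (2 * m * τ : ℂ).im := by
  have : (2 * m * τ : ℂ).im = 2 * m * τ.im := by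
    rw [show (2 * m * τ : ℂ) = ((2 * m : ℝ) : ℂ) * τ by push_cast; ring, Complex.im_ofReal_mul]
  rw [this]; positivity

theorem im_nat_div {m : ℕ} (hm : 0 < m) {τ : ℂ} (h : 0 < τ.im) : 0 < (τ / (2 * m) : ℂ).im := by
  have : (τ / (2 * m) : ℂ).im = τ.im / (2 * m) := by
    rw [show (2 * m : ℂ) = ((2 * m : ℝ) : ℂ) by push_cast; ring, Complex.div_ofReal_im]
  rw [this]; positivity

theorem jTheta_hasSum {m : ℕ} (hm : 0 < m) (l : ℤ) {τ : ℂ} (h : 0 < τ.im) (z : ℂ) :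
    HasSum (fun n : ℤ => ee (((l : ℂ) + 2 * (m : ℂ) * (n : ℂ)) ^ 2 / (4 * (m : ℂ)) * τ +
      ((l : ℂ) + 2 * (m : ℂ) * (n : ℂ)) * z)) (jTheta m l τ z) ∧
    jTheta m l τ z = ee (l ^ 2 / (4 * m) * τ + l * z) * jacobiTheta₂ (l * τ + 2 * m * z) (2 * m * τ) := by
  have hm' : (m : ℂ) ≠ 0 := by exact_mod_cast hm.ne'
  have h1 := (jt2_sum (l * τ + 2 * m * z) (im_nat_mul hm h)).mul_left (ee (l ^ 2 / (4 * m) * τ + l * z))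
  have h2 : (fun n : ℤ => ee (((l : ℂ) + 2 * (m : ℂ) * (n : ℂ)) ^ 2 / (4 * (m : ℂ)) * τ +
      ((l : ℂ) + 2 * (m : ℂ) * (n : ℂ)) * z)) = fun n : ℤ => ee (l ^ 2 / (4 * m) * τ + l * z) *
        ee ((n : ℂ) ^ 2 * (2 * m * τ) / 2 + n * (l * τ + 2 * m * z)) := by
    funext n; rw [← ee_add]; congr 1; field_simp; ring
  rw [← h2] at h1
  have h3 : jTheta m l τ z = _ := h1.tsum_eq
  exact ⟨h3 ▸ h1, h3⟩

theorem jTheta_hol {m : ℕ} (hm : 0 < m) (l : ℤ) : Hol (jTheta m l) := by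
  intro τ z hτ
  have h1 : DifferentiableAt ℂ (fun p : ℂ × ℂ => ee (l ^ 2 / (4 * m) * p.1 + l * p.2) *
      jacobiTheta₂ (l * p.1 + 2 * m * p.2) (2 * m * p.1)) (τ, z) := by
    refine DifferentiableAt.mul ?_ ?_
    · exact (differentiable_ee _).comp (τ, z) (by fun_prop)
    · have := (hasFDerivAt_jacobiTheta₂ (l * τ + 2 * m * z) (im_nat_mul hm hτ)).differentiableAt
      exact DifferentiableAt.comp (τ, z) (f := fun p : ℂ × ℂ => ((l * p.1 + 2 * m * p.2 : ℂ), (2 * m * p.1 : ℂ))) this (by fun_prop)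
  refine h1.congr_of_eventuallyEq ?_
  have : ∀ᶠ p : ℂ × ℂ in 𝓝 (τ, z), 0 < p.1.im :=
    (Complex.continuous_im.comp continuous_fst).continuousAt.eventually (lt_mem_nhds hτ)
  filter_upwards [this] with p hp
  exact (jTheta_hasSum hm l hp p.2).2

theorem jTheta_per (m : ℕ) (l j : ℤ) (τ z : ℂ) : jTheta m (l + 2 * m * j) τ z = jTheta m l τ z := by
  unfold jTheta
  rw [← (Equiv.addLeft j).tsum_eq (fun n : ℤ => ee (((l : ℂ) + 2 * (m : ℂ) * (n : ℂ)) ^ 2 / (4 * (m : ℂ)) * τ +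
      ((l : ℂ) + 2 * (m : ℂ) * (n : ℂ)) * z))]
  congr 1; funext n
  rw [Equiv.coe_addLeft]
  congr 1; push_cast; ring

theorem jTheta_ell {m : ℕ} (hm : 0 < m) (l : ℤ) : EllipticLaw m (jTheta m l) := by
  intro τ hτ z lam mu
  have hm' : (m : ℂ) ≠ 0 := by exact_mod_cast hm.ne'
  unfold jTheta
  rw [← (Equiv.addRight lam).tsum_eq (fun n : ℤ => ee (((l : ℂ) + 2 * (m : ℂ) * (n : ℂ)) ^ 2 / (4 * (m : ℂ)) * τ +
      ((l : ℂ) + 2 * (m : ℂ) * (n : ℂ)) * z)), ← tsum_mul_left]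
  congr 1; funext n
  rw [← ee_add, Equiv.coe_addRight, ← ee_add_int (_ + _) (-((l + 2 * m * n) * mu))]
  congr 1; push_cast; field_simp; ring

/-- splitting `ℤ = ⊔ (l + 2mℤ)` -/
theorem hasSum_residues {N : ℕ} (hN : 0 < N) {f : ℤ → ℂ} {s : ℂ} (h : HasSum f s) :
    ∑ l ∈ Finset.range N, ∑' n : ℤ, f (l + N * n) = s := by
  have : NeZero N := ⟨hN.ne'⟩
  have h1 : HasSum (fun p : ℤ × Fin N => f ((Int.divModEquiv N).symm p)) s := ((Int.divModEquiv N).symm.hasSum_iff).mpr h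
  have h2 := ((Equiv.prodComm _ _).hasSum_iff).mpr h1
  have h4 := h2.summable.tsum_prod
  rw [h2.tsum_eq] at h4
  rw [h4, tsum_fintype, Finset.sum_range]
  refine Finset.sum_congr rfl fun l _ => ?_
  congr 1; funext n
  simp [Int.divModEquiv, add_comm, mul_comm]

theorem jTheta_fourier {m : ℕ} (hm : 0 < m) (l : ℤ) {τ : ℂ} (h : 0 < τ.im) (z : ℂ) :
    ∑ j ∈ Finset.range (2 * m), ee (-(l * j : ℂ) / (2 * m)) * jTheta m j τ z =
      jacobiTheta₂ (z - l / (2 * m)) (τ / (2 * m)) := by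
  have hm' : (m : ℂ) ≠ 0 := by exact_mod_cast hm.ne'
  rw [← hasSum_residues (by positivity : 0 < 2 * m) (jt2_sum (z - l / (2 * m)) (im_nat_div hm h))]
  refine Finset.sum_congr rfl fun j _ => ?_
  unfold jTheta
  rw [← tsum_mul_left]
  congr 1; funext n
  rw [← ee_add, ← ee_add_int _ (- (l * n))]
  congr 1; push_cast; field_simp; ring

theorem jTheta_S {m : ℕ} (hm : 0 < m) (l : ℤ) {τ : ℂ} (h : 0 < τ.im) (z : ℂ) :
    jTheta m l (-1 / τ) (z / τ) = sqI (τ / (2 * m)) * ee (m * z ^ 2 / τ) *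
      ∑ j ∈ Finset.range (2 * m), ee (-(l * j : ℂ) / (2 * m)) * jTheta m j τ z := by
  have hm' : (m : ℂ) ≠ 0 := by exact_mod_cast hm.ne'
  have hτ0 := ne_zero_of_im h
  rw [jTheta_fourier hm l h, jacobiTheta₂_functional_equation, (jTheta_hasSum hm l (im_S h) _).2]
  have hs := sq_ne (im_nat_div hm h)
  have e1 : (z - l / (2 * m)) / (τ / (2 * m)) = l * (-1 / τ) + 2 * m * (z / τ) := by field_simp; ring
  have e2 : -1 / (τ / (2 * m)) = 2 * m * (-1 / τ) := by field_simp
  rw [e1, e2, ← sqI, ← mul_assoc]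
  congr 1
  have e3 : cexp (-Real.pi * I * (z - l / (2 * m)) ^ 2 / (τ / (2 * m))) =
    ee (-(m * (z - l / (2 * m)) ^ 2 / τ)) := by unfold ee; congr 1; field_simp
  rw [e3]
  rw [show sqI (τ / (2 * m)) * ee (m * z ^ 2 / τ) * (1 / sqI (τ / (2 * m)) * ee (-(m * (z - l / (2 * m)) ^ 2 / τ)))
    = ee (m * z ^ 2 / τ) * ee (-(m * (z - l / (2 * m)) ^ 2 / τ)) by field_simp, ← ee_add]
  congr 1; field_simp; ring

theorem jTheta_T {m : ℕ} (hm : 0 < m) (l : ℤ) (τ z : ℂ) :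
    jTheta m l (τ + 1) z = ee (l ^ 2 / (4 * m)) * jTheta m l τ z := by
  have hm' : (m : ℂ) ≠ 0 := by exact_mod_cast hm.ne'
  unfold jTheta
  rw [← tsum_mul_left]
  congr 1; funext n
  rw [← ee_add, ← ee_add_int _ (-(l * n + m * n ^ 2))]
  congr 1; push_cast; field_simp; ring

theorem jTheta_neg {m : ℕ} (l : ℤ) (τ z : ℂ) : jTheta m (-l) τ z = jTheta m l τ (-z) := by
  unfold jTheta
  rw [← (Equiv.neg ℤ).tsum_eq (fun n : ℤ => ee (((l : ℂ) + 2 * (m : ℂ) * (n : ℂ)) ^ 2 / (4 * (m : ℂ)) * τ +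
      ((l : ℂ) + 2 * (m : ℂ) * (n : ℂ)) * (-z)))]
  congr 1; funext n
  congr 1; simp; ring

theorem hs_congr {ι : Type*} {f g : ι → ℂ} {s : ℂ} (h : HasSum f s) (e : ∀ i, g i = f i) : HasSum g s := by
  rw [funext e]; exact h

def PConv (f : PowerSeries ℂ) : Prop := ∀ x : ℂ, ‖x‖ < 1 → Summable fun n => f.coeff n * x ^ n
def evP (f : PowerSeries ℂ) (x : ℂ) : ℂ := ∑' n, f.coeff n * x ^ n

theorem PConv.hasSum {f} (h : PConv f) {x : ℂ} (hx : ‖x‖ < 1) :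
    HasSum (fun n => f.coeff n * x ^ n) (evP f x) := (h x hx).hasSum

theorem PConv.of {f} {g : ℂ → ℂ} (h : ∀ x : ℂ, ‖x‖ < 1 → HasSum (fun n => f.coeff n * x ^ n) (g x)) :
    PConv f ∧ ∀ x : ℂ, ‖x‖ < 1 → evP f x = g x :=
  ⟨fun x hx => (h x hx).summable, fun x hx => (h x hx).tsum_eq⟩

theorem PConv.add {f g} (hf : PConv f) (hg : PConv g) :
    PConv (f + g) ∧ ∀ x : ℂ, ‖x‖ < 1 → evP (f + g) x = evP f x + evP g x :=
  PConv.of fun x hx => by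
    simpa only [map_add, add_mul] using (hf.hasSum hx).add (hg.hasSum hx)

theorem PConv.smul {f} (a : ℂ) (hf : PConv f) :
    PConv (PowerSeries.C a * f) ∧ ∀ x : ℂ, ‖x‖ < 1 → evP (PowerSeries.C a * f) x = a * evP f x :=
  PConv.of fun x hx => by
    simpa only [PowerSeries.coeff_C_mul, mul_assoc] using (hf.hasSum hx).mul_left a

theorem PConv.const (a : ℂ) :
    PConv (PowerSeries.C a) ∧ ∀ x : ℂ, ‖x‖ < 1 → evP (PowerSeries.C a) x = a :=
  PConv.of fun x hx => by
    have := hasSum_single (f := fun n => (PowerSeries.C a).coeff n * x ^ n) 0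
      (fun n hn => by rw [PowerSeries.coeff_C, if_neg hn, zero_mul])
    simpa using this

theorem PConv.mul {f g} (hf : PConv f) (hg : PConv g) :
    PConv (f * g) ∧ ∀ x : ℂ, ‖x‖ < 1 → evP (f * g) x = evP f x * evP g x :=
  PConv.of fun x hx => by
    have h1 := (hf x hx).norm
    have h2 := (hg x hx).norm
    have h3 := summable_norm_sum_mul_antidiagonal_of_summable_norm h1 h2
    have h4 := tsum_mul_tsum_eq_tsum_sum_antidiagonal_of_summable_norm h1 h2
    have e : (fun n => (f * g).coeff n * x ^ n) = fun n => ∑ kl ∈ Finset.HasAntidiagonal.antidiagonal n,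
        f.coeff kl.1 * x ^ kl.1 * (g.coeff kl.2 * x ^ kl.2) := by
      funext n
      rw [PowerSeries.coeff_mul, Finset.sum_mul]
      refine Finset.sum_congr rfl fun p hp => ?_
      rw [← Finset.HasAntidiagonal.mem_antidiagonal.mp hp, pow_add]; ring
    rw [e]
    unfold evP
    rw [h4]
    exact h3.of_norm.hasSum

theorem PConv.prod {ι : Type*} (s : Finset ι) {f : ι → PowerSeries ℂ} (hf : ∀ i ∈ s, PConv (f i)) :
    PConv (∏ i ∈ s, f i) ∧ ∀ x : ℂ, ‖x‖ < 1 → evP (∏ i ∈ s, f i) x = ∏ i ∈ s, evP (f i) x := by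
  induction s using Finset.induction_on with
  | empty => simpa using PConv.const 1
  | insert a s ha ih =>
    have h1 := ih fun i hi => hf i (Finset.mem_insert_of_mem hi)
    have h2 := (hf a (Finset.mem_insert_self a s)).mul h1.1
    rw [Finset.prod_insert ha]
    refine ⟨h2.1, fun x hx => ?_⟩
    rw [h2.2 x hx, h1.2 x hx, Finset.prod_insert ha]

theorem PConv.sum {ι : Type*} (s : Finset ι) {f : ι → PowerSeries ℂ} (hf : ∀ i ∈ s, PConv (f i)) :
    PConv (∑ i ∈ s, f i) ∧ ∀ x : ℂ, ‖x‖ < 1 → evP (∑ i ∈ s, f i) x = ∑ i ∈ s, evP (f i) x := by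
  induction s using Finset.induction_on with
  | empty => simpa using PConv.const 0
  | insert a s ha ih =>
    have h1 := ih fun i hi => hf i (Finset.mem_insert_of_mem hi)
    have h2 := (hf a (Finset.mem_insert_self a s)).add h1.1
    rw [Finset.sum_insert ha]
    refine ⟨h2.1, fun x hx => ?_⟩
    rw [h2.2 x hx, h1.2 x hx, Finset.sum_insert ha]

theorem PConv.fps {f} (hf : PConv f) :
    HasFPowerSeriesOnBall (evP f) (FormalMultilinearSeries.ofScalars ℂ fun n => f.coeff n) 0 1 := by
  have hr : (1 : ENNReal) ≤ (FormalMultilinearSeries.ofScalars ℂ fun n => f.coeff n).radius := by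
    refine ENNReal.le_of_forall_nnreal_lt fun r hr => ?_
    refine FormalMultilinearSeries.le_radius_of_summable_norm _ ?_
    have h1 : ‖((r : ℝ) : ℂ)‖ < 1 := by
      simpa using hr
    have := (hf _ h1).norm
    simpa [FormalMultilinearSeries.ofScalars_norm] using this
  refine ⟨hr, by norm_num, fun {y} hy => ?_⟩
  have hy' : ‖y‖ < 1 := by simpa [← ofReal_norm] using hy
  have := hf.hasSum hy'
  simpa [FormalMultilinearSeries.ofScalars_apply_eq, smul_eq_mul, mul_comm] using this

theorem PConv.diff {f} (hf : PConv f) : DifferentiableOn ℂ (evP f) (Metric.ball 0 1) := by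
  have := hf.fps.differentiableOn
  rwa [← ENNReal.ofReal_one, Metric.eball_ofReal] at this

theorem PConv.ext0 {f} (hf : PConv f) (h : ∀ᶠ x : ℂ in 𝓝 0, evP f x = 0) : f = 0 := by
  have h1 := hf.fps.hasFPowerSeriesAt
  have h2 := (h1.congr h).eq_zero
  ext n
  have := congrArg (fun p : FormalMultilinearSeries ℂ ℂ ℂ => p.coeff n) h2
  simp only [FormalMultilinearSeries.coeff_ofScalars] at this
  rw [this]; simp [FormalMultilinearSeries.coeff]

theorem PConv.of_diff {g : ℂ → ℂ} (h1 : DifferentiableOn ℂ g (Metric.ball 0 1)) :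
    ∃ f, PConv f ∧ ∀ x : ℂ, ‖x‖ < 1 → evP f x = g x := by
  have hp : ∀ x : ℂ, ‖x‖ < 1 → HasSum (fun n => (cauchyPowerSeries g 0 (1/2)).coeff n * x ^ n) (g x) := by
    intro x hx
    obtain ⟨r, hr1, hr2⟩ := exists_between (max_lt hx (by norm_num : (1/2 : ℝ) < 1))
    have hr0 : 0 < r := lt_trans (by norm_num) (lt_of_le_of_lt (le_max_right _ _) hr1)
    have hsub : Metric.closedBall (0 : ℂ) r ⊆ Metric.ball 0 1 := Metric.closedBall_subset_ball hr2
    lift r to NNReal using hr0.le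
    have h2 := (h1.mono hsub).hasFPowerSeriesOnBall (by exact_mod_cast hr0)
    have hsub' : Metric.closedBall (0 : ℂ) ((1/2 : NNReal) : ℝ) ⊆ Metric.ball 0 1 :=
      Metric.closedBall_subset_ball (by norm_num)
    have h3 := (h1.mono hsub').hasFPowerSeriesOnBall (by norm_num)
    have h4 := h2.hasFPowerSeriesAt.eq_formalMultilinearSeries h3.hasFPowerSeriesAt
    rw [h4] at h2
    have hxr : ‖x‖ < r := lt_of_le_of_lt (le_max_left _ _) hr1
    have h5 := h2.hasSum (y := x) (by
      rw [Metric.mem_eball, edist_zero_right, ← ofReal_norm, ← ENNReal.ofReal_coe_nnreal]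
      exact (ENNReal.ofReal_lt_ofReal_iff (by exact_mod_cast hr0)).mpr hxr)
    rw [zero_add] at h5
    refine hs_congr h5 fun n => ?_
    rw [FormalMultilinearSeries.apply_eq_pow_smul_coeff, smul_eq_mul, mul_comm]
    norm_num
  exact ⟨_, PConv.of (f := PowerSeries.mk (cauchyPowerSeries g 0 (1/2)).coeff) (g := g) (by simpa using hp)⟩

theorem PConv.inv {f} (hf : PConv f) (h0 : ∀ x : ℂ, ‖x‖ < 1 → evP f x ≠ 0) :
    PConv f⁻¹ ∧ (∀ x : ℂ, ‖x‖ < 1 → evP f⁻¹ x = (evP f x)⁻¹) ∧ f.constantCoeff ≠ 0 := by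
  have h1 : DifferentiableOn ℂ (fun x => (evP f x)⁻¹) (Metric.ball 0 1) :=
    hf.diff.inv fun x hx => h0 x (by simpa using hx)
  obtain ⟨e, h2, h3⟩ := PConv.of_diff h1
  have h4 := (h2.mul hf)
  have h5 := h4.1.add (PConv.const (-1)).1
  have h6 := h5.1.ext0 (by
    filter_upwards [Metric.ball_mem_nhds (0 : ℂ) one_pos] with x hx
    have hx' : ‖x‖ < 1 := by simpa using hx
    rw [h5.2 x hx', h4.2 x hx', h3 x hx', (PConv.const (-1)).2 x hx', inv_mul_cancel₀ (h0 x hx')]; ring)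
  have h7 : e * f = 1 := by
    rw [map_neg, map_one] at h6; exact add_neg_eq_zero.mp h6
  have hc : f.constantCoeff ≠ 0 := by
    intro h
    have := congrArg PowerSeries.constantCoeff h7
    simp [h] at this
  have h8 : e = f⁻¹ := (PowerSeries.eq_inv_iff_mul_eq_one hc).mpr h7
  rw [← h8]
  exact ⟨h2, h3, hc⟩

theorem norm_ee_lt {τ : ℂ} (h : 0 < τ.im) : ‖ee τ‖ < 1 := by
  rw [norm_ee, Real.exp_lt_one_iff]
  have := mul_pos Real.pi_pos h
  nlinarith

theorem exists_ee {x : ℂ} (h : x ≠ 0) (h1 : ‖x‖ < 1) : ∃ τ : ℂ, 0 < τ.im ∧ ee τ = x := by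
  have hp : (2 * (Real.pi : ℂ) * I) ≠ 0 := by simp [Real.pi_ne_zero]
  refine ⟨Complex.log x / (2 * Real.pi * I), ?_, ?_⟩
  · have he : ee (Complex.log x / (2 * Real.pi * I)) = x := by
      unfold ee; rw [mul_div_cancel₀ _ hp, Complex.exp_log h]
    have := norm_ee (Complex.log x / (2 * Real.pi * I))
    rw [he] at this
    rw [this, Real.exp_lt_one_iff] at h1
    by_contra hc
    have := mul_nonpos_of_nonneg_of_nonpos Real.pi_pos.le (not_lt.mp hc)
    nlinarith
  · unfold ee; rw [mul_div_cancel₀ _ hp, Complex.exp_log h]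

theorem evP_zero (f : PowerSeries ℂ) : evP f 0 = f.constantCoeff := by
  unfold evP
  rw [tsum_eq_single 0 (fun n hn => by simp [hn])]; simp

theorem PConv.of_ee {f : PowerSeries ℂ} {g : ℂ → ℂ}
    (h : ∀ τ : ℂ, 0 < τ.im → HasSum (fun n => f.coeff n * ee τ ^ n) (g τ)) :
    PConv f ∧ ∀ τ : ℂ, 0 < τ.im → evP f (ee τ) = g τ := by
  refine ⟨fun x hx => ?_, fun τ hτ => (h τ hτ).tsum_eq⟩
  by_cases h0 : x = 0
  · subst h0
    exact summable_of_ne_finset_zero (s := {0}) fun n hn => by simp at hn; simp [hn]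
  · obtain ⟨τ, hτ, rfl⟩ := exists_ee h0 hx
    exact (h τ hτ).summable

abbrev zC : ℤ →+* ℂ := Int.castRingHom ℂ

def PZ (F : PowerSeries ℤ) (f : ℂ → ℂ) : Prop :=
  PConv (F.map zC) ∧ ∀ τ : ℂ, 0 < τ.im → evP (F.map zC) (ee τ) = f τ

theorem PZ.add {F G f g} (h : PZ F f) (h' : PZ G g) : PZ (F + G) (fun τ => f τ + g τ) := by
  have := h.1.add h'.1
  rw [← map_add] at this
  exact ⟨this.1, fun τ hτ => by rw [this.2 _ (norm_ee_lt hτ), h.2 τ hτ, h'.2 τ hτ]⟩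

theorem PZ.mul {F G f g} (h : PZ F f) (h' : PZ G g) : PZ (F * G) (fun τ => f τ * g τ) := by
  have := h.1.mul h'.1
  rw [← map_mul] at this
  exact ⟨this.1, fun τ hτ => by rw [this.2 _ (norm_ee_lt hτ), h.2 τ hτ, h'.2 τ hτ]⟩

theorem PZ.const (n : ℤ) : PZ (PowerSeries.C n) (fun _ => n) := by
  have := PConv.const (n : ℂ)
  have e : (PowerSeries.C n).map zC = PowerSeries.C (n : ℂ) := by simp
  rw [← e] at this
  exact ⟨this.1, fun τ hτ => this.2 _ (norm_ee_lt hτ)⟩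

theorem PZ.smul {F f} (n : ℤ) (h : PZ F f) : PZ (PowerSeries.C n * F) (fun τ => n * f τ) :=
  (PZ.const n).mul h

theorem PZ.pow {F f} (h : PZ F f) (n : ℕ) : PZ (F ^ n) (fun τ => f τ ^ n) := by
  induction n with
  | zero => simpa using PZ.const 1
  | succ n ih => simp only [pow_succ]; exact ih.mul h

theorem PZ.congr {F G f g} (h : PZ F f) (e : F = G) (hp : ∀ τ, 0 < τ.im → f τ = g τ) : PZ G g :=
  e ▸ ⟨h.1, fun τ hτ => (h.2 τ hτ).trans (hp τ hτ)⟩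

theorem PZ.X : PZ PowerSeries.X ee := by
  refine PConv.of_ee (g := ee) fun τ hτ => ?_
  refine hs_congr (hasSum_ite_eq 1 (ee τ)) fun n => ?_
  rw [PowerSeries.map_X, PowerSeries.coeff_X]; split_ifs with h <;> simp [h]

theorem PZ.inv {F f} (h : PZ F f) (h0 : F.constantCoeff = 1) (hf : ∀ τ, 0 < τ.im → f τ ≠ 0) :
    ∃ G : PowerSeries ℤ, G.constantCoeff = 1 ∧ PZ G (fun τ => (f τ)⁻¹) := by
  have h1 : ∀ x : ℂ, ‖x‖ < 1 → evP (F.map zC) x ≠ 0 := fun x hx => by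
    by_cases hx0 : x = 0
    · rw [hx0, evP_zero, ← PowerSeries.coeff_zero_eq_constantCoeff_apply, PowerSeries.coeff_map,
        PowerSeries.coeff_zero_eq_constantCoeff_apply, h0]; simp
    · obtain ⟨τ, hτ, rfl⟩ := exists_ee hx0 hx
      rw [h.2 τ hτ]; exact hf τ hτ
  obtain ⟨p1, p2, p3⟩ := h.1.inv h1
  have hG := PowerSeries.mul_invOfUnit F 1 (by simpa using h0)
  have e : (PowerSeries.invOfUnit F 1).map zC = (F.map zC)⁻¹ := by
    rw [PowerSeries.eq_inv_iff_mul_eq_one p3, mul_comm, ← map_mul, hG, map_one]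
  refine ⟨PowerSeries.invOfUnit F 1, by simp, by rw [e]; exact p1, fun τ hτ => ?_⟩
  rw [e, p2 _ (norm_ee_lt hτ), h.2 τ hτ]

/-- integral expansion, vanishing below γ, with coefficient x at γ -/
def IR (φ : ℂ → ℂ → ℂ) (γ : ℤ × ℤ) (x : ℂ) : Prop :=
  ∃ c, QRep c φ ∧ IntC c ∧ (∀ p, lexlt p γ → c p = 0) ∧ c γ = x

theorem IR.congr {φ ψ γ x y} (h : IR φ γ x) (hx : x = y) (hp : ∀ τ z, 0 < τ.im → φ τ z = ψ τ z) :
    IR ψ γ y := by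
  obtain ⟨c, h1, h2, h3, h4⟩ := h
  exact ⟨c, h1.congr (fun _ => rfl) hp, h2, h3, h4.trans hx⟩

theorem IR.add {φ ψ γ x y} (h : IR φ γ x) (h' : IR ψ γ y) : IR (fun τ z => φ τ z + ψ τ z) γ (x + y) := by
  obtain ⟨c, h1, h2, h3, h4⟩ := h
  obtain ⟨d, k1, k2, k3, k4⟩ := h'
  refine ⟨_, h1.add k1, fun p => ?_, fun p hp => by beta_reduce; rw [h3 p hp, k3 p hp, add_zero], by
    beta_reduce; rw [h4, k4]⟩
  obtain ⟨a, ha⟩ := h2 p; obtain ⟨b, hb⟩ := k2 p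
  exact ⟨a + b, by beta_reduce; rw [ha, hb]; push_cast; rfl⟩

theorem IR.weak {φ γ x} (h : IR φ γ x) (δ : ℤ × ℤ) (hl : lexlt δ γ) : IR φ δ 0 := by
  obtain ⟨c, h1, h2, h3, h4⟩ := h
  refine ⟨c, h1, h2, fun p hp => h3 p ?_, h3 _ hl⟩
  unfold lexlt at *; omega

theorem IR.mul {φ ψ γ δ x y} (h : IR φ γ x) (h' : IR ψ δ y) :
    IR (fun τ z => φ τ z * ψ τ z) (γ + δ) (x * y) := by
  obtain ⟨c, h1, h2, h3, h4⟩ := h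
  obtain ⟨d, k1, k2, k3, k4⟩ := h'
  have key : ∀ p i : ℤ × ℤ, (lexlt p (γ + δ) ∨ (p = γ + δ ∧ i ≠ γ)) → c i * d (p - i) = 0 := by
    intro p i hp
    by_cases hi : lexlt i γ
    · rw [h3 i hi, zero_mul]
    · rw [k3 (p - i), mul_zero]
      unfold lexlt at *
      simp only [Prod.fst_add, Prod.snd_add, Prod.fst_sub, Prod.snd_sub, Prod.ext_iff, ne_eq] at *
      omega
  refine ⟨_, h1.mul k1, IntC.conv h1 k1 h2 k2, fun p hp => ?_, ?_⟩
  · unfold _root_.conv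
    rw [show (fun i => c i * d (p - i)) = fun _ => 0 from funext fun i => key p i (Or.inl hp)]
    simp
  · unfold _root_.conv
    rw [tsum_eq_single γ (fun i hi => key _ i (Or.inr ⟨rfl, hi⟩))]
    simp [h4, k4]

theorem QRep.inj {ι : Type*} (e : ι → ℤ × ℤ) (he : Function.Injective e) (a : ι → ℂ) {φ}
    (h : ∀ τ z : ℂ, 0 < τ.im → HasSum (fun i => a i * ee ((e i).1 * τ + (e i).2 * z)) (φ τ z)) :
    QRep (fun p => if hp : ∃ i, e i = p then a hp.choose else 0) φ := fun τ z hτ => by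
  have hc : ∀ i, (if hp : ∃ j, e j = e i then a hp.choose else 0) = a i := fun i => by
    have hp : ∃ j, e j = e i := ⟨i, rfl⟩
    rw [dif_pos hp, he hp.choose_spec]
  refine (he.hasSum_iff (f := fun p : ℤ × ℤ => (if hp : ∃ i, e i = p then a hp.choose else 0) *
    ee (p.1 * τ + p.2 * z)) ?_).mp ?_
  · intro p hp
    rw [dif_neg (by simpa using hp), zero_mul]
  · exact hs_congr (h τ z hτ) fun i => by simp only [Function.comp, hc]

theorem IR.inj {ι : Type*} (e : ι → ℤ × ℤ) (he : Function.Injective e) (a : ι → ℤ) {φ} {γ} (i0 : ι)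
    (h : ∀ τ z : ℂ, 0 < τ.im → HasSum (fun i => (a i : ℂ) * ee ((e i).1 * τ + (e i).2 * z)) (φ τ z))
    (hl : ∀ i, ¬ lexlt (e i) γ) (h0 : e i0 = γ) : IR φ γ (a i0) := by
  refine ⟨_, QRep.inj e he _ h, fun p => ?_, fun p hp => ?_, ?_⟩
  · beta_reduce
    split_ifs
    · exact ⟨_, rfl⟩
    · exact ⟨0, by simp⟩
  · refine dif_neg ?_
    rintro ⟨i, rfl⟩; exact hl i hp
  · have hp : ∃ j, e j = γ := ⟨i0, h0⟩
    beta_reduce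
    rw [dif_pos hp, show hp.choose = i0 from he (hp.choose_spec.trans h0.symm)]

theorem PZ.ir {F f} (h : PZ F f) : IR (fun τ _ => f τ) (0, 0) (F.constantCoeff : ℤ) := by
  have := IR.inj (fun n : ℕ => ((n : ℤ), (0 : ℤ))) (fun a b hab => by simpa using hab)
    (fun n => F.coeff n) (γ := (0, 0)) (φ := fun τ _ => f τ) 0 (fun τ z hτ => ?_)
    (fun i => by unfold lexlt; simp) rfl
  · simpa using this
  · rw [← h.2 τ hτ]
    refine hs_congr (h.1.hasSum (norm_ee_lt hτ)) fun n => ?_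
    rw [PowerSeries.coeff_map, ee_pow]; simp

theorem PZ.inj (e : ℕ → ℕ) (he : Function.Injective e) {f : ℂ → ℂ} (h0 : e 0 = 0)
    (h : ∀ τ : ℂ, 0 < τ.im → HasSum (fun n => ee τ ^ e n) (f τ)) :
    ∃ F : PowerSeries ℤ, F.constantCoeff = 1 ∧ PZ F f := by
  refine ⟨PowerSeries.mk fun k => if k ∈ Set.range e then 1 else 0, ?_, PConv.of_ee fun τ hτ => ?_⟩
  · rw [← PowerSeries.coeff_zero_eq_constantCoeff_apply, PowerSeries.coeff_mk, if_pos ⟨0, h0⟩]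
  · refine (he.hasSum_iff (fun k hk => ?_)).mp (hs_congr (h τ hτ) fun n => ?_)
    · rw [PowerSeries.coeff_map, PowerSeries.coeff_mk, if_neg hk]; simp
    · simp

def T0 (τ : ℂ) : ℂ := jTheta 1 0 τ 0
def T1 (τ : ℂ) : ℂ := jTheta 1 1 τ 0
def UU (τ : ℂ) : ℂ := T1 τ / (2 * ee (τ / 4))
def VV (τ z : ℂ) : ℂ := jTheta 1 1 τ z / ee (τ / 4)

theorem T1_eq (τ : ℂ) : T1 τ = 2 * ee (τ / 4) * UU τ := by
  unfold UU; have := ee_ne (τ / 4); field_simp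

theorem VV_eq (τ z : ℂ) : jTheta 1 1 τ z = ee (τ / 4) * VV τ z := by
  unfold VV; have := ee_ne (τ / 4); field_simp

theorem T0_pz : ∃ F : PowerSeries ℤ, F.constantCoeff = 1 ∧ PZ F T0 := by
  obtain ⟨F, h1, h2⟩ := PZ.inj (fun n => n ^ 2) (fun a b h => by simpa using h) (by simp)
    (f := fun τ => (T0 τ + 1) / 2) (fun τ hτ => by
      have h := ((jTheta_hasSum one_pos 0 hτ 0).1.nat_add_neg).div_const 2
      have e : (T0 τ + 1) / 2 = (jTheta 1 0 τ 0 + ee (((0 : ℤ) + 2 * ((1 : ℕ) : ℂ) * ((0 : ℤ) : ℂ)) ^ 2 / (4 * ((1 : ℕ) : ℂ)) * τ +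
          ((0 : ℤ) + 2 * ((1 : ℕ) : ℂ) * ((0 : ℤ) : ℂ)) * 0)) / 2 := by simp [ee_zero, T0]
      rw [e]
      refine hs_congr h fun n => ?_
      rw [ee_pow]
      have : ∀ x y z : ℂ, x = y → x = z → ee z = (ee x + ee y) / 2 := by rintro x _ _ rfl rfl; ring
      refine this _ _ _ ?_ ?_ <;> push_cast <;> ring)
  refine ⟨PowerSeries.C 2 * F + PowerSeries.C (-1), by rw [map_add, map_mul, h1, PowerSeries.constantCoeff_C, PowerSeries.constantCoeff_C]; norm_num, ((h2.smul 2).add (PZ.const (-1))).congr rfl ?_⟩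
  intro τ hτ; push_cast; ring

theorem UU_pz : ∃ F : PowerSeries ℤ, F.constantCoeff = 1 ∧ PZ F UU := by
  refine PZ.inj (fun n => n ^ 2 + n) (fun a b h => ?_) (by simp) fun τ hτ => ?_
  · simp only at h; nlinarith [lt_trichotomy a b, sq_nonneg (a - b : ℤ)]
  · have h := (jTheta_hasSum one_pos 1 hτ 0).1.nat_add_neg_add_one
    refine hs_congr (h.div_const (2 * ee (τ / 4))) fun n => ?_
    have : ∀ x y z : ℂ, x = y → x = z + τ / 4 → ee z = (ee x + ee y) / (2 * ee (τ / 4)) := by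
      rintro x _ z rfl rfl; have := ee_ne (τ / 4); rw [ee_add]; field_simp; ring
    rw [ee_pow]
    refine this _ _ _ ?_ ?_ <;> push_cast <;> ring

theorem Th0_ir : IR (jTheta 1 0) (0, 0) 1 := by
  have := IR.inj (fun n : ℤ => (n ^ 2, 2 * n)) (fun a b h => by simp at h; omega)
    (fun _ => 1) (γ := (0, 0)) (φ := jTheta 1 0) 0 (fun τ z hτ => ?_) (fun i => ?_) (by simp)
  · simpa using this
  · refine hs_congr (jTheta_hasSum one_pos 0 hτ z).1 fun n => ?_
    push_cast; rw [one_mul]; congr 1; ring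
  · unfold lexlt; simp only [not_or]; constructor
    · have := sq_nonneg i; omega
    · rintro ⟨h1, h2⟩; simp at h1; simp [h1] at h2

theorem VV_ir : IR VV (0, -1) 1 := by
  have := IR.inj (fun n : ℤ => (n ^ 2 + n, 2 * n + 1)) (fun a b h => by simp at h; omega)
    (fun _ => 1) (γ := (0, -1)) (φ := VV) (-1) (fun τ z hτ => ?_) (fun i => ?_) (by simp)
  · simpa using this
  · refine hs_congr ((jTheta_hasSum one_pos 1 hτ z).1.div_const (ee (τ / 4))) fun n => ?_
    have : ∀ x z : ℂ, x = z + τ / 4 → 1 * ee z = ee x / (ee (τ / 4)) := by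
      rintro x z rfl; have := ee_ne (τ / 4); rw [ee_add]; field_simp
    push_cast
    refine this _ _ ?_; ring
  · unfold lexlt; simp only [not_or]; constructor
    · rcases le_or_gt 0 i with h | h <;> nlinarith
    · rintro ⟨h1, h2⟩
      have : i * (i + 1) = 0 := by linarith
      rcases mul_eq_zero.mp this with h | h <;> omega

theorem Th_S (τ z : ℂ) (h : 0 < τ.im) :
    jTheta 1 0 (-1 / τ) (z / τ) = sqI (τ / 2) * ee (z ^ 2 / τ) * (jTheta 1 0 τ z + jTheta 1 1 τ z) ∧
    jTheta 1 1 (-1 / τ) (z / τ) = sqI (τ / 2) * ee (z ^ 2 / τ) * (jTheta 1 0 τ z - jTheta 1 1 τ z) := by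
  have e1 : ee (-1 / 2) = -1 := by
    unfold ee; rw [show 2 * (Real.pi : ℂ) * I * (-1 / 2) = -(Real.pi * I) by ring, Complex.exp_neg,
      Complex.exp_pi_mul_I]; norm_num
  constructor
  · rw [jTheta_S one_pos 0 h z]; simp [Finset.sum_range_succ, ee_zero]
  · rw [jTheta_S one_pos 1 h z]; simp [Finset.sum_range_succ, ee_zero, e1]; left; ring

theorem T_S (τ : ℂ) (h : 0 < τ.im) : T0 (-1 / τ) = sqI (τ / 2) * (T0 τ + T1 τ) ∧
    T1 (-1 / τ) = sqI (τ / 2) * (T0 τ - T1 τ) := by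
  have := Th_S τ 0 h
  simpa [ee_zero, T0, T1] using this

theorem sqI2 {τ : ℂ} (h : 0 < τ.im) : sqI (τ / 2) ^ 2 = -I * τ / 2 := by
  rw [sq_sq (by simpa using im_nat_div one_pos h)]; ring

theorem T_diff {τ : ℂ} (h : 0 < τ.im) : DifferentiableAt ℂ T0 τ ∧ DifferentiableAt ℂ T1 τ := by
  constructor
  · exact (jTheta_hol one_pos 0 τ 0 h).comp (f := fun t : ℂ => (t, (0 : ℂ))) τ (by fun_prop)
  · exact (jTheta_hol one_pos 1 τ 0 h).comp (f := fun t : ℂ => (t, (0 : ℂ))) τ (by fun_prop)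

open UpperHalfPlane in
open scoped ModularForm in
theorem wt12 (f : ℂ → ℂ) (F : PowerSeries ℂ) (hF : PConv F) (hF0 : F.constantCoeff = 0) (hF1 : F ≠ 0)
    (hf : ∀ τ : ℂ, 0 < τ.im → evP F (ee τ) = f τ) (hd : ∀ τ : ℂ, 0 < τ.im → DifferentiableAt ℂ f τ)
    (hS : ∀ τ : ℂ, 0 < τ.im → f (-1 / τ) = τ ^ 12 * f τ) (τ : ℂ) (hτ : 0 < τ.im) : f τ ≠ 0 := by
  let g : UpperHalfPlane → ℂ := fun z => f z
  have h1 : g ∣[(12 : ℤ)] ModularGroup.S = g := by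
    ext z
    suffices f (-(↑z)⁻¹) * ((z : ℂ) ^ 12)⁻¹ = f z by
      rw [ModularForm.SL_slash_apply, UpperHalfPlane.modular_S_smul]
      rw [ModularGroup.denom_apply, ModularGroup.coe_S]
      simp only [g, UpperHalfPlane.coe_mk]
      rw [zpow_neg]
      simpa [inv_neg] using this
    have := hS z z.2
    rw [neg_div, one_div] at this
    rw [this]; field_simp [z.ne_zero]
  have h2 : g ∣[(12 : ℤ)] ModularGroup.T = g := by
    ext z
    rw [ModularForm.SL_slash_apply, ModularGroup.denom_apply, modular_T_smul, ModularGroup.coe_T]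
    have : f (1 + z) = f z := by
      rw [← hf _ (by simpa using z.2), ← hf _ z.2, add_comm, ← ee_add_int z 1]; simp
    simp [g, this]
  have h3 : IsZeroAtImInfty g := by
    have hc : Tendsto (evP F) (𝓝 0) (𝓝 0) := by
      have := (hF.diff.differentiableAt (Metric.ball_mem_nhds 0 one_pos)).continuousAt.tendsto
      rwa [evP_zero, hF0] at this
    have := hc.comp (UpperHalfPlane.qParam_tendsto_atImInfty zero_lt_one)
    refine this.congr fun z => ?_
    show evP F (Function.Periodic.qParam 1 z) = f z
    rw [← hf z z.2]; unfold Function.Periodic.qParam ee; simp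
  let G : CuspForm (Matrix.SpecialLinearGroup.mapGL ℝ : Matrix.SpecialLinearGroup (Fin 2) ℤ →* _).range 12 :=
    { toFun := g
      slash_action_eq' := fun A hA => by
        obtain ⟨A, rfl⟩ := hA
        exact SlashInvariantForm.slash_action_generators_SL2Z h1 h2 A
      holo' := by
        rw [UpperHalfPlane.mdifferentiable_iff]
        refine .congr (fun z hz ↦ (hd z hz).differentiableWithinAt) fun z hz ↦ ?_
        simp [g, ofComplex_apply_of_im_pos hz]
      zero_at_cusps' := fun hc => by
        rw [Subgroup.IsArithmetic.isCusp_iff_isCusp_SL2Z] at hc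
        rw [OnePoint.isZeroAt_iff_forall_SL2Z hc]
        intro γ _
        rw [SlashInvariantForm.slash_action_generators_SL2Z h1 h2]
        exact h3 }
  obtain ⟨c, hc⟩ := CuspForm.exists_smul_discriminant_of_weight_eq_twelve G
  have hfc : ∀ z : UpperHalfPlane, c * ModularForm.discriminant z = f z := fun z =>
    congrArg (fun H : CuspForm _ 12 => (H : UpperHalfPlane → ℂ) z) hc
  have hc0 : c ≠ 0 := by
    rintro rfl
    apply hF1
    refine hF.ext0 ?_
    filter_upwards [Metric.ball_mem_nhds (0 : ℂ) one_pos] with x hx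
    by_cases hx0 : x = 0
    · rw [hx0, evP_zero, hF0]
    · obtain ⟨t, ht, rfl⟩ := exists_ee hx0 (by simpa using hx)
      rw [hf t ht]; simpa using (hfc ⟨t, ht⟩).symm
  have := hfc ⟨τ, hτ⟩
  simp only [UpperHalfPlane.coe_mk] at this
  rw [← this]
  exact mul_ne_zero hc0 (ModularForm.discriminant_ne_zero _)

def del (τ : ℂ) : ℂ := T0 τ * UU τ * (T0 τ ^ 4 - 16 * ee τ * UU τ ^ 4)
def DD (τ : ℂ) : ℂ := T0 τ * T1 τ * (T0 τ ^ 4 - T1 τ ^ 4)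

theorem ee4 (τ : ℂ) : ee (τ / 4) ^ 4 = ee τ := by rw [ee_pow]; congr 1; push_cast; ring

theorem DD_eq (τ : ℂ) : DD τ = 2 * ee (τ / 4) * del τ := by
  unfold DD del; rw [T1_eq, mul_pow, mul_pow, ee4]; ring

theorem DD_S {τ : ℂ} (h : 0 < τ.im) : DD (-1 / τ) = 8 * sqI (τ / 2) ^ 6 * DD τ := by
  unfold DD; rw [(T_S τ h).1, (T_S τ h).2]; ring

theorem DD_diff {τ : ℂ} (h : 0 < τ.im) : DifferentiableAt ℂ DD τ := by
  have := (T_diff h).1; have := (T_diff h).2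
  unfold DD; fun_prop

theorem del_pz : ∃ F : PowerSeries ℤ, F.constantCoeff = 1 ∧ PZ F del := by
  obtain ⟨F, f1, f2⟩ := T0_pz
  obtain ⟨G, g1, g2⟩ := UU_pz
  refine ⟨F * G * (F ^ 4 + PowerSeries.C (-16) * (PowerSeries.X * G ^ 4)), by simp [f1, g1],
    ((f2.mul g2).mul ((f2.pow 4).add ((PZ.X.mul (g2.pow 4)).smul (-16)))).congr rfl ?_⟩
  intro τ _; unfold del; push_cast; ring

theorem DD_ne {τ : ℂ} (h : 0 < τ.im) : DD τ ≠ 0 := by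
  obtain ⟨F, f1, f2⟩ := del_pz
  have hp := PZ.X.mul (f2.pow 4)
  have := wt12 (fun τ => DD τ ^ 4 / 16) _ hp.1 (by simp) (by
    intro h0
    have := congrArg (fun f => f.coeff 1) h0
    rw [PowerSeries.coeff_map, show (1 : ℕ) = 0 + 1 from rfl, PowerSeries.coeff_succ_X_mul,
      PowerSeries.coeff_zero_eq_constantCoeff_apply, map_pow, f1] at this
    simp at this) (fun τ hτ => by
    rw [hp.2 τ hτ, DD_eq]; rw [mul_pow, mul_pow, ee4]; ring) (fun τ hτ => ((DD_diff hτ).pow 4).div_const _)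
    (fun τ hτ => by
      rw [DD_S hτ]
      have e : sqI (τ / 2) ^ 24 = τ ^ 12 / 4096 := by
        rw [show 24 = 2 * 12 by norm_num, pow_mul, sqI2 hτ, div_pow, mul_pow,
          show (-I) ^ 12 = (I ^ 4) ^ 3 by ring, I_pow_four]; norm_num
      linear_combination 256 * DD τ ^ 4 * e) τ h
  intro h0; exact this (by simp [h0])

theorem del_ne {τ : ℂ} (h : 0 < τ.im) : del τ ≠ 0 := by
  have := DD_ne h; rw [DD_eq] at this; exact right_ne_zero_of_mul this

def GF (k : ℤ) (m : ℕ) (γ : ℤ × ℤ) (φ : ℂ → ℂ → ℂ) : Prop := ∃ c, JF k m φ c ∧ IntC c ∧ Lead c γ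

theorem GF.mul {k k' m m' γ γ' φ ψ} (h : GF k m γ φ) (h' : GF k' m' γ' ψ) :
    GF (k + k') (m + m') (γ + γ') (fun τ z => φ τ z * ψ τ z) := by
  obtain ⟨c, h1, h2, h3⟩ := h
  obtain ⟨d, k1, k2, k3⟩ := h'
  exact ⟨_, h1.mul k1, IntC.conv h1.rep k1.rep h2 k2, h3.conv k3⟩

theorem GF.pow {k m γ φ} (h : GF k m γ φ) (n : ℕ) : GF (n * k) (n * m) (n • γ) (fun τ z => φ τ z ^ n) := by
  obtain ⟨c, h1, h2, h3⟩ := h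
  exact ⟨_, h1.pow n, IntC.pow h1.rep h2 n, h3.pow n⟩

theorem GF.of {k m γ φ} (h1 : Hol φ) (h2 : EllipticLaw m φ) (h3 : SLaw k m φ) (h : IR φ γ 1) :
    GF k m γ φ := by
  obtain ⟨c, c1, c2, c3, c4⟩ := h
  exact ⟨c, ⟨h1, h2, h3, c1, γ.1, fun p hp => c3 p (Or.inl hp)⟩, c2, c3, c4⟩

theorem GF.scalar {k γ} {f : ℂ → ℂ} (h1 : ∀ τ : ℂ, 0 < τ.im → DifferentiableAt ℂ f τ)
    (h3 : ∀ τ : ℂ, 0 < τ.im → f (-1 / τ) = τ ^ k * f τ) (h : IR (fun τ _ => f τ) γ 1) :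
    GF k 0 γ (fun τ _ => f τ) := by
  refine GF.of (fun τ z hτ => ?_) (fun τ hτ z l n => by simp [ee_zero]) (fun τ z hτ => by
    simp [ee_zero, h3 τ hτ]) h
  exact (h1 τ hτ).comp (f := fun p : ℂ × ℂ => p.1) (τ, z) (by fun_prop)

theorem GF.theta {k γ} {a b : ℂ → ℂ} (ha : ∀ τ : ℂ, 0 < τ.im → DifferentiableAt ℂ a τ)
    (hb : ∀ τ : ℂ, 0 < τ.im → DifferentiableAt ℂ b τ)
    (h1 : ∀ τ : ℂ, 0 < τ.im → sqI (τ / 2) * (a (-1 / τ) + b (-1 / τ)) = τ ^ k * a τ)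
    (h2 : ∀ τ : ℂ, 0 < τ.im → sqI (τ / 2) * (a (-1 / τ) - b (-1 / τ)) = τ ^ k * b τ)
    (h : IR (fun τ z => a τ * jTheta 1 0 τ z + b τ * jTheta 1 1 τ z) γ 1) :
    GF k 1 γ (fun τ z => a τ * jTheta 1 0 τ z + b τ * jTheta 1 1 τ z) := by
  refine GF.of (fun τ z hτ => ?_) (fun τ hτ z l n => ?_) (fun τ z hτ => ?_) h
  · have := (ha τ hτ).comp (f := fun p : ℂ × ℂ => p.1) (τ, z) (by fun_prop)
    have := (hb τ hτ).comp (f := fun p : ℂ × ℂ => p.1) (τ, z) (by fun_prop)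
    have := jTheta_hol one_pos 0 τ z hτ
    have := jTheta_hol one_pos 1 τ z hτ
    simp only [Function.comp_def] at *
    fun_prop
  · beta_reduce
    rw [jTheta_ell one_pos 0 τ hτ, jTheta_ell one_pos 1 τ hτ]; ring
  · beta_reduce
    rw [(Th_S τ z hτ).1, (Th_S τ z hτ).2, Nat.cast_one, one_mul]
    linear_combination ee (z ^ 2 / τ) * (jTheta 1 0 τ z * h1 τ hτ + jTheta 1 1 τ z * h2 τ hτ)

theorem IR.mul0 {φ ψ γ x y} (h : IR φ (0, 0) x) (h' : IR ψ γ y) :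
    IR (fun τ z => φ τ z * ψ τ z) γ (x * y) := by
  have := h.mul h'; rwa [show ((0, 0) : ℤ × ℤ) = 0 from rfl, zero_add] at this

theorem PZ.poly {F f} (h : PZ F f) {x : ℤ} (hx : F.constantCoeff = x) : IR (fun τ _ => f τ) (0, 0) x := by
  rw [← hx]; exact h.ir

theorem ee_ir (j : ℤ) : IR (fun τ _ => ee (j * τ)) (j, 0) 1 := by
  have := IR.inj (fun n : Unit => (j, (0 : ℤ))) (fun a b h => rfl) (fun _ => 1)
    (γ := (j, 0)) (φ := fun τ _ => ee (j * τ)) () (fun τ z hτ => ?_) (by simp [lexlt]) rfl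
  · simpa using this
  · refine hs_congr (hasSum_unique (fun _ : Unit => ee (j * τ))) fun n => by simp

theorem sqI4 {τ : ℂ} (h : 0 < τ.im) : sqI (τ / 2) ^ 4 = -τ ^ 2 / 4 := by
  rw [show 4 = 2 * 2 by norm_num, pow_mul, sqI2 h, div_pow, mul_pow, neg_sq, I_sq]; ring

def PA (τ z : ℂ) : ℂ := (-2 * T1 τ / DD τ) * jTheta 1 0 τ z + (2 * T0 τ / DD τ) * jTheta 1 1 τ z
def PB (τ z : ℂ) : ℂ := (2 * (5 * T0 τ ^ 4 * T1 τ - T1 τ ^ 5) / DD τ) * jTheta 1 0 τ z +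
  (2 * (T0 τ ^ 5 - 5 * T0 τ * T1 τ ^ 4) / DD τ) * jTheta 1 1 τ z
def PE (τ z : ℂ) : ℂ := (T0 τ ^ 7 + 7 * T0 τ ^ 3 * T1 τ ^ 4) * jTheta 1 0 τ z +
  (7 * T0 τ ^ 4 * T1 τ ^ 3 + T1 τ ^ 7) * jTheta 1 1 τ z
def E4 (τ : ℂ) : ℂ := T0 τ ^ 8 + 14 * T0 τ ^ 4 * T1 τ ^ 4 + T1 τ ^ 8
def E6 (τ : ℂ) : ℂ := T0 τ ^ 12 - 33 * T0 τ ^ 8 * T1 τ ^ 4 - 33 * T0 τ ^ 4 * T1 τ ^ 8 + T1 τ ^ 12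
def Di (τ : ℂ) : ℂ := (DD τ ^ 4 / 16)⁻¹

theorem PA_zero (τ : ℂ) : PA τ 0 = 0 := by
  unfold PA; change _ * T0 τ + _ * T1 τ = 0; ring

theorem PB_zero {τ : ℂ} (h : 0 < τ.im) : PB τ 0 = 12 := by
  have := DD_ne h
  unfold PB; change _ * T0 τ + _ * T1 τ = 12; field_simp; unfold DD; ring

theorem deli_pz : ∃ F : PowerSeries ℤ, F.constantCoeff = 1 ∧ PZ F (fun τ => (del τ)⁻¹) := by
  obtain ⟨F, f1, f2⟩ := del_pz
  exact f2.inv f1 fun τ hτ => del_ne hτ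

theorem T1p4 (τ : ℂ) : T1 τ ^ 4 = 16 * ee τ * UU τ ^ 4 := by
  rw [T1_eq, mul_pow, mul_pow, ee4]; norm_num

theorem PA_gf : GF (-2) 1 (0, -1) PA := by
  refine GF.theta (fun τ hτ => ?_) (fun τ hτ => ?_) (fun τ hτ => ?_) (fun τ hτ => ?_) ?_
  · exact ((T_diff hτ).2.const_mul _).div (DD_diff hτ) (DD_ne hτ)
  · exact ((T_diff hτ).1.const_mul _).div (DD_diff hτ) (DD_ne hτ)
  · rw [(T_S τ hτ).1, (T_S τ hτ).2, DD_S hτ]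
    have := DD_ne hτ; have := sq_ne (show 0 < (τ / 2).im by simpa using im_nat_div one_pos hτ)
    have := ne_zero_of_im hτ
    have := sqI4 hτ
    rw [show ((-2 : ℤ)) = -((2 : ℕ) : ℤ) from rfl, zpow_neg, zpow_natCast]; field_simp
    linear_combination 8 * T1 τ * this
  · rw [(T_S τ hτ).1, (T_S τ hτ).2, DD_S hτ]
    have := DD_ne hτ; have := sq_ne (show 0 < (τ / 2).im by simpa using im_nat_div one_pos hτ)
    have := ne_zero_of_im hτ
    have := sqI4 hτ
    rw [show ((-2 : ℤ)) = -((2 : ℕ) : ℤ) from rfl, zpow_neg, zpow_natCast]; field_simp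
    linear_combination -8 * T0 τ * this
  · obtain ⟨F, f1, f2⟩ := T0_pz
    obtain ⟨G, g1, g2⟩ := UU_pz
    obtain ⟨H, h1, h2⟩ := deli_pz
    have i1 := ((f2.mul h2).poly (x := 1) (by simp [f1, h1])).mul0 VV_ir
    have i2 := (((g2.mul h2).smul (-2)).ir).mul0 Th0_ir
    refine (i1.add (i2.weak (0, -1) (by simp [lexlt]))).congr (by norm_num) fun τ z hτ => ?_
    have := del_ne hτ; have := ee_ne (τ / 4)
    rw [DD_eq, T1_eq, VV_eq]; push_cast; field_simp; ring

theorem PB_gf : GF 0 1 (0, -1) PB := by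
  refine GF.theta (fun τ hτ => ?_) (fun τ hτ => ?_) (fun τ hτ => ?_) (fun τ hτ => ?_) ?_
  · have := (T_diff hτ).1; have := (T_diff hτ).2
    exact DifferentiableAt.div (by fun_prop) (DD_diff hτ) (DD_ne hτ)
  · have := (T_diff hτ).1; have := (T_diff hτ).2
    exact DifferentiableAt.div (by fun_prop) (DD_diff hτ) (DD_ne hτ)
  · rw [(T_S τ hτ).1, (T_S τ hτ).2, DD_S hτ]
    have := DD_ne hτ; have := sq_ne (show 0 < (τ / 2).im by simpa using im_nat_div one_pos hτ)
    rw [zpow_zero]; field_simp; ring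
  · rw [(T_S τ hτ).1, (T_S τ hτ).2, DD_S hτ]
    have := DD_ne hτ; have := sq_ne (show 0 < (τ / 2).im by simpa using im_nat_div one_pos hτ)
    rw [zpow_zero]; field_simp; ring
  · obtain ⟨F, f1, f2⟩ := T0_pz
    obtain ⟨G, g1, g2⟩ := UU_pz
    obtain ⟨H, h1, h2⟩ := deli_pz
    have i1 := (((f2.pow 5).add ((f2.mul (PZ.X.mul (g2.pow 4))).smul (-80)) |>.mul h2).poly (x := 1)
      (by simp [f1, h1])).mul0 VV_ir
    have i2 := (((((f2.pow 4).mul g2).smul 10).add ((PZ.X.mul (g2.pow 5)).smul (-32)) |>.mul h2).ir).mul0 Th0_ir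
    refine (i1.add (i2.weak (0, -1) (by simp [lexlt]))).congr (by norm_num) fun τ z hτ => ?_
    have := del_ne hτ; have := ee_ne (τ / 4)
    have e5 : T1 τ ^ 5 = 16 * ee τ * UU τ ^ 4 * (2 * ee (τ / 4) * UU τ) := by rw [← T1p4, ← T1_eq]; ring
    rw [DD_eq, e5, T1p4, T1_eq, VV_eq]; push_cast; field_simp; ring

theorem PE_gf : GF 4 1 (0, 0) PE := by
  have e8 : ∀ {τ : ℂ}, 0 < τ.im → sqI (τ / 2) ^ 8 = τ ^ 4 / 16 := fun {τ} hτ => by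
    rw [show 8 = 4 * 2 by norm_num, pow_mul, sqI4 hτ]; ring
  refine GF.theta (fun τ hτ => ?_) (fun τ hτ => ?_) (fun τ hτ => ?_) (fun τ hτ => ?_) ?_
  · have := (T_diff hτ).1; have := (T_diff hτ).2; fun_prop
  · have := (T_diff hτ).1; have := (T_diff hτ).2; fun_prop
  · rw [(T_S τ hτ).1, (T_S τ hτ).2]
    norm_cast
    linear_combination 16 * (T0 τ ^ 7 + 7 * T0 τ ^ 3 * T1 τ ^ 4) * e8 hτ
  · rw [(T_S τ hτ).1, (T_S τ hτ).2]
    norm_cast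
    linear_combination 16 * (7 * T0 τ ^ 4 * T1 τ ^ 3 + T1 τ ^ 7) * e8 hτ
  · obtain ⟨F, f1, f2⟩ := T0_pz
    obtain ⟨G, g1, g2⟩ := UU_pz
    have i1 := (((f2.pow 7).add ((PZ.X.mul ((f2.pow 3).mul (g2.pow 4))).smul 112)).poly (x := 1)
      (by simp [f1])).mul0 Th0_ir
    have i4 := ee_ir 1
    have i6 := ((((((f2.pow 4).mul (g2.pow 3)).smul 56).add ((PZ.X.mul (g2.pow 7)).smul 128))).ir.mul0 VV_ir)
    refine (i1.add ((i4.mul i6).weak (0, 0) (by simp [lexlt]))).congr (by norm_num) fun τ z hτ => ?_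
    have e3 : T1 τ ^ 3 = 8 * ee (τ / 4) ^ 3 * UU τ ^ 3 := by rw [T1_eq]; ring
    have e7 : T1 τ ^ 7 = 16 * ee τ * UU τ ^ 4 * (8 * ee (τ / 4) ^ 3 * UU τ ^ 3) := by rw [← e3, ← T1p4]; ring
    rw [e7, e3, T1p4, VV_eq]; push_cast
    rw [one_mul, ← ee4]; ring

theorem E4_gf : GF 4 0 (0, 0) (fun τ _ => E4 τ) := by
  refine GF.scalar (fun τ hτ => ?_) (fun τ hτ => ?_) ?_
  · have := (T_diff hτ).1; have := (T_diff hτ).2; unfold E4; fun_prop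
  · unfold E4
    rw [(T_S τ hτ).1, (T_S τ hτ).2]
    have e8 : sqI (τ / 2) ^ 8 = τ ^ 4 / 16 := by
      rw [show 8 = 4 * 2 by norm_num, pow_mul, sqI4 hτ]; ring
    norm_cast
    linear_combination 16 * (T0 τ ^ 8 + 14 * T0 τ ^ 4 * T1 τ ^ 4 + T1 τ ^ 8) * e8
  · obtain ⟨F, f1, f2⟩ := T0_pz
    obtain ⟨G, g1, g2⟩ := UU_pz
    refine (((f2.pow 8).add (PZ.X.mul ((((f2.pow 4).mul (g2.pow 4)).smul 224).add
      ((PZ.X.mul (g2.pow 8)).smul 256)))).poly (x := 1) (by simp [f1])).congr (by simp) fun τ z hτ => ?_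
    unfold E4
    rw [show T1 τ ^ 8 = (T1 τ ^ 4) ^ 2 by ring, T1p4]; push_cast; ring

theorem E6_gf : GF 6 0 (0, 0) (fun τ _ => E6 τ) := by
  refine GF.scalar (fun τ hτ => ?_) (fun τ hτ => ?_) ?_
  · have := (T_diff hτ).1; have := (T_diff hτ).2; unfold E6; fun_prop
  · unfold E6
    rw [(T_S τ hτ).1, (T_S τ hτ).2]
    have e8 : sqI (τ / 2) ^ 12 = -τ ^ 6 / 64 := by
      rw [show 12 = 4 * 3 by norm_num, pow_mul, sqI4 hτ]; ring
    norm_cast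
    linear_combination -64 * (T0 τ ^ 12 - 33 * T0 τ ^ 8 * T1 τ ^ 4 - 33 * T0 τ ^ 4 * T1 τ ^ 8 + T1 τ ^ 12) * e8
  · obtain ⟨F, f1, f2⟩ := T0_pz
    obtain ⟨G, g1, g2⟩ := UU_pz
    refine (((f2.pow 12).add (PZ.X.mul ((((f2.pow 8).mul (g2.pow 4)).smul (-528)).add
      ((PZ.X.mul ((f2.pow 4).mul (g2.pow 8))).smul (-8448)) |>.add ((PZ.X.mul (PZ.X.mul (g2.pow 12))).smul 4096)))).poly
        (x := 1) (by simp [f1])).congr (by simp) fun τ z hτ => ?_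
    unfold E6
    rw [show T1 τ ^ 8 = (T1 τ ^ 4) ^ 2 by ring, show T1 τ ^ 12 = (T1 τ ^ 4) ^ 3 by ring, T1p4]; push_cast; ring

theorem Di_gf : GF (-12) 0 (-1, 0) (fun τ _ => Di τ) := by
  refine GF.scalar (fun τ hτ => ?_) (fun τ hτ => ?_) ?_
  · have := DD_diff hτ; have := DD_ne hτ; unfold Di
    exact DifferentiableAt.inv (by fun_prop) (div_ne_zero (pow_ne_zero _ this) (by norm_num))
  · unfold Di
    rw [DD_S hτ]
    have e : sqI (τ / 2) ^ 24 = τ ^ 12 / 4096 := by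
      rw [show 24 = 4 * 6 by norm_num, pow_mul, sqI4 hτ]; ring
    rw [show (8 * sqI (τ / 2) ^ 6 * DD τ) ^ 4 = 4096 * sqI (τ / 2) ^ 24 * DD τ ^ 4 by ring, e, zpow_neg,
      ← mul_inv]; norm_cast; congr 1; ring
  · obtain ⟨H, h1, h2⟩ := deli_pz
    have i4 := ee_ir (-1)
    refine (((h2.pow 4).poly (x := 1) (by simp [h1])).mul0 i4).congr (by simp) fun τ z hτ => ?_
    unfold Di
    rw [DD_eq, mul_pow, mul_pow, ee4]; push_cast; rw [neg_one_mul, ee_neg]; have := del_ne hτ; have := ee_ne τ; field_simp; norm_num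

theorem QRep.inj' {ι : Type*} (e : ι → ℤ × ℤ) (he : Function.Injective e) (a : ι → ℂ) {φ}
    (h : ∀ τ z : ℂ, 0 < τ.im → HasSum (fun i => a i * ee ((e i).1 * τ + (e i).2 * z)) (φ τ z))
    (h0 : ∀ i, 0 ≤ (e i).1) : ∃ c, QRep c φ ∧ BddN c := by
  refine ⟨_, QRep.inj e he a h, 0, fun p hp => dif_neg ?_⟩
  rintro ⟨i, rfl⟩
  exact absurd (h0 i) (by omega)

def PC (τ z : ℂ) : ℂ := (jTheta 2 1 τ z - jTheta 2 3 τ z) / ModularForm.eta τ ^ 3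

theorem ee_quarter : ee (-1 / 4) = -I := by
  unfold ee
  rw [show 2 * (Real.pi : ℂ) * I * (-1 / 4) = -(Real.pi / 2 * I) by ring, Complex.exp_neg, Complex.exp_pi_div_two_mul_I, Complex.inv_I]

theorem sq4I : (4 * I) ^ (1 / 2 : ℂ) = 2 * I ^ (1 / 2 : ℂ) := by
  have h4 : (4 : ℂ) = ((4 : ℝ) : ℂ) := by norm_num
  have h2 : Complex.exp (((1 / 2 * Real.log 4 : ℝ)) : ℂ) = 2 := by
    rw [← Complex.ofReal_exp, show (1 / 2 * Real.log 4 : ℝ) = Real.log 2 by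
      rw [show (4 : ℝ) = 2 ^ 2 by norm_num, Real.log_pow]; push_cast; ring, Real.exp_log two_pos]; norm_num
  rw [Complex.cpow_def_of_ne_zero (by simp), Complex.cpow_def_of_ne_zero (by simp), h4,
    Complex.log_ofReal_mul (by norm_num) I_ne_zero, add_mul, Complex.exp_add]
  refine congrArg (· * _) (Eq.trans ?_ h2)
  push_cast; ring_nf

theorem sqrt_rel {τ : ℂ} (h : 0 < τ.im) :
    τ ^ (1 / 2 : ℂ) = sqI (τ / 4) * (2 * I ^ (1 / 2 : ℂ)) := by
  have hτ := ne_zero_of_im h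
  have h1 : -I * (τ / 4) ≠ 0 := by simp [hτ]
  have h2 : (4 * I) ≠ 0 := by simp
  have h3 : |(-I * (τ / 4)).arg| < Real.pi / 2 := by
    rw [Complex.abs_arg_lt_pi_div_two_iff]; left; simp [h]
  have h4 : (4 * I).arg = Real.pi / 2 := by
    rw [show (4 * I) = ((4 : ℝ) : ℂ) * I by norm_num, Complex.arg_real_mul _ (by norm_num), Complex.arg_I]
  rw [abs_lt] at h3
  rw [← sq4I, sqI, Complex.cpow_def_of_ne_zero hτ, Complex.cpow_def_of_ne_zero h1, Complex.cpow_def_of_ne_zero h2,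
    ← Complex.exp_add, ← add_mul, ← Complex.log_mul h1 h2 ⟨by rw [h4]; linarith [Real.pi_pos], by rw [h4]; linarith [Real.pi_pos]⟩]
  congr 3; linear_combination (τ) * I_sq

theorem eta_S {τ : ℂ} (h : 0 < τ.im) : ModularForm.eta (-1 / τ) = 2 * sqI (τ / 4) * ModularForm.eta τ := by
  have h1 := ModularForm.eta_comp_eq_csqrt_I_inv (show τ ∈ UpperHalfPlane.upperHalfPlaneSet from h)
  have h6 : I ^ (1 / 2 : ℂ) ≠ 0 := by simp
  simp only [Function.comp, Pi.smul_apply, Pi.mul_apply, smul_eq_mul] at h1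
  rw [h1, Complex.sqrt, Complex.sqrt]
  simp only [show (2 : ℂ)⁻¹ = 1 / 2 by norm_num]
  rw [sqrt_rel h]; field_simp

theorem PC_S {τ : ℂ} (h : 0 < τ.im) (z : ℂ) :
    PC (-1 / τ) (z / τ) = τ ^ (-1 : ℤ) * ee ((2 : ℕ) * z ^ 2 / τ) * PC τ z := by
  have h1 := jTheta_S (m := 2) (by norm_num) 1 h z
  have h3 := jTheta_S (m := 2) (by norm_num) 3 h z
  have hh : 0 < (τ / 4).im := by simp [h]
  have ej : ∀ (j : ℕ) (x : ℂ), x = -(j / 4) → ee x = (-I) ^ j := fun j x hx => by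
    rw [← ee_quarter, ee_pow, hx]; congr 1; ring
  have i3 : I ^ 3 = -I := Complex.I_pow_three
  have i2 := Complex.I_sq
  simp only [show 2 * 2 = 4 by rfl, Finset.sum_range_succ, Finset.sum_range_zero] at h1 h3
  have k1 : ∀ j : ℕ, ee (-(((1 : ℤ) : ℂ) * (j : ℂ)) / (2 * ((2 : ℕ) : ℂ))) = (-I) ^ j := fun j => ej j _ (by push_cast; ring)
  have k3 : ∀ j : ℕ, ee (-(((3 : ℤ) : ℂ) * (j : ℂ)) / (2 * ((2 : ℕ) : ℂ))) = (-I) ^ (3 * j) := fun j => ej _ _ (by push_cast; ring)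
  simp only [k1] at h1
  simp only [k3] at h3
  have i6 : (-I) ^ 6 = -1 := by rw [show 6 = 2 * 3 by rfl, pow_mul, neg_sq, i2]; norm_num
  have i9 : (-I) ^ 9 = -I := by rw [show 9 = 2 * 4 + 1 by rfl, pow_succ, pow_mul, neg_sq, i2]; norm_num
  have i33 : (-I) ^ 3 = I := by rw [neg_pow, i3]; norm_num
  rw [i33, neg_sq, i2, pow_zero, pow_one] at h1
  norm_num only [i33, i6, i9] at h3
  have h4 : τ / (2 * ((2 : ℕ) : ℂ)) = τ / 4 := by norm_num
  unfold PC
  rw [h1, h3, eta_S h, zpow_neg_one, h4]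
  have hs := sq_sq hh; have hs0 := sq_ne hh
  have hη := ModularForm.eta_ne_zero (show τ ∈ UpperHalfPlane.upperHalfPlaneSet from h)
  have := ne_zero_of_im h
  push_cast
  field_simp
  rw [hs]
  linear_combination (0 : ℂ)

theorem PC_jf : ∃ c, JF (-1) 2 PC c := by
  have hη : ∀ τ : ℂ, 0 < τ.im → ModularForm.eta τ ≠ 0 := fun τ h => ModularForm.eta_ne_zero h
  have he : ∀ l : ℤ, EllipticLaw 2 (jTheta 2 l) := fun l => jTheta_ell (by norm_num) l
  have hP : ∀ τ : ℂ, 0 < τ.im → ∏' n, (1 - ModularForm.eta_q n τ) ≠ 0 := fun τ h => ModularForm.eta_tprod_ne_zero h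
  -- numerator
  obtain ⟨c1, r1, b1⟩ := QRep.inj' (ι := ℤ) (fun n => (n + 2 * n ^ 2, 1 + 4 * n)) (fun a b hab => by simp at hab; omega) (fun _ => 1)
    (φ := fun τ z => ee (-(τ / 8)) * jTheta 2 1 τ z) (fun τ z hτ => by
      refine hs_congr ((jTheta_hasSum (by norm_num) 1 hτ z).1.mul_left (ee (-(τ / 8)))) fun n => ?_
      rw [← ee_add, one_mul]; congr 1; push_cast; ring) (fun n => by simp; nlinarith [sq_nonneg n, sq_nonneg (n + 1), Int.le_self_sq (-n)])
  obtain ⟨c2, r2, b2⟩ := QRep.inj' (ι := ℤ) (fun n => (1 + 3 * n + 2 * n ^ 2, 3 + 4 * n)) (fun a b hab => by simp at hab; omega) (fun _ => -1)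
    (φ := fun τ z => - (ee (-(τ / 8)) * jTheta 2 3 τ z)) (fun τ z hτ => by
      refine hs_congr ((jTheta_hasSum (by norm_num) 3 hτ z).1.mul_left (ee (-(τ / 8)))).neg fun n => ?_
      rw [← ee_add, neg_one_mul]; congr 2; push_cast; ring) (fun n => by simp; nlinarith [sq_nonneg n, sq_nonneg (n + 1), Int.le_self_sq (-n-1)])
  -- denominator
  have hd := ModularForm.differentiableOn_tprod_one_sub_pow
  obtain ⟨f, f1, f2⟩ := PConv.of_diff (g := fun x => (∏' n : ℕ, (1 - x ^ (n + 1)))⁻¹ ^ 3) ((hd.inv fun x hx => by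
    have hx : ‖x‖ < 1 := by simpa using hx
    by_cases h0 : x = 0
    · subst h0; simp
    · obtain ⟨τ, hτ, rfl⟩ := exists_ee h0 hx
      have := hP τ hτ
      simpa [ModularForm.eta_q_eq_pow, ee] using this).pow 3)
  obtain ⟨c3, r3, b3⟩ := QRep.inj' (ι := ℕ) (fun n => (n, 0)) (fun a b hab => by simpa using hab) (fun n => f.coeff n)
    (φ := fun τ z => (∏' n, (1 - ModularForm.eta_q n τ))⁻¹ ^ 3) (fun τ z hτ => by
      have := f1.hasSum (x := ee τ) (norm_ee_lt hτ)
      rw [f2 _ (norm_ee_lt hτ)] at this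
      simp only [ModularForm.eta_q_eq_pow]
      refine hs_congr this fun n => ?_
      rw [ee_pow]; congr 2; push_cast; ring) (fun n => by simp)
  refine ⟨_, ⟨fun τ z hτ => ?_, fun τ hτ z lam mu => ?_, fun τ z hτ => PC_S hτ z, ((r1.add r2).mul r3).congr (fun _ => rfl) fun τ z hτ => ?_, BddN.conv ?_ b3⟩⟩
  · unfold PC
    have d1 := (jTheta_hol (m := 2) (by norm_num) 1 τ z hτ).sub (jTheta_hol (m := 2) (by norm_num) 3 τ z hτ)
    have d2 : DifferentiableAt ℂ (fun p : ℂ × ℂ => ModularForm.eta p.1 ^ 3) (τ, z) :=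
      (DifferentiableAt.comp (g := ModularForm.eta) (f := Prod.fst) (τ, z) (ModularForm.differentiableAt_eta_of_mem_upperHalfPlaneSet hτ) differentiableAt_fst).pow 3
    exact d1.mul (d2.inv (pow_ne_zero _ (hη τ hτ)))
  · unfold PC
    rw [he 1 τ hτ, he 3 τ hτ]; ring
  · unfold PC
    have h8 : (ModularForm.eta τ) ^ 3 = ee (τ / 8) * (∏' n, (1 - ModularForm.eta_q n τ)) ^ 3 := by
      unfold ModularForm.eta
      rw [mul_pow]; congr 1
      rw [show τ / 8 = (3 : ℕ) * (τ / 24) by push_cast; ring, ← ee_pow, Function.Periodic.qParam, ee]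
      congr 2; push_cast; ring
    have := ee_ne (τ / 8); have := hP τ hτ
    beta_reduce
    rw [h8, ee_neg]; field_simp; ring
  · obtain ⟨N1, b1⟩ := b1
    obtain ⟨N2, b2⟩ := b2
    exact ⟨min N1 N2, fun p hp => by beta_reduce; rw [b1 p (by omega), b2 p (by omega), add_zero]⟩

theorem theta_summable {m : ℕ} (hm : 0 < m) {τ : ℂ} (hτ : 0 < τ.im) (v : ℤ → ℂ) {B : ℝ} (hB : ∀ r, ‖v r‖ ≤ B) (z : ℂ) :
    Summable fun r : ℤ => v r * ee ((r : ℂ) ^ 2 * (τ / (2 * m)) / 2 + r * z) := by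
  refine Summable.of_norm_bounded ((jt2_sum z (im_nat_div hm hτ)).summable.norm.mul_left B) fun r => ?_
  rw [norm_mul]; exact mul_le_mul_of_nonneg_right (hB r) (norm_nonneg _)

theorem theta_indep {m : ℕ} (hm : 0 < m) {τ : ℂ} (hτ : 0 < τ.im) (v : ℤ → ℂ)
    (h : ∀ z, ∑ x ∈ Finset.range (2 * m), v x * jTheta m x τ z = 0) (x : ℕ) (hx : x < 2 * m) : v x = 0 := by
  have hm' : (m : ℂ) ≠ 0 := by exact_mod_cast hm.ne'
  let w : ℤ → ℂ := fun r => v (r % (2 * m))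
  have hB : ∀ r, ‖w r‖ ≤ ∑ x ∈ Finset.range (2 * m), ‖v x‖ := fun r => by
    have h0 := Int.emod_nonneg r (show (2 * m : ℤ) ≠ 0 by positivity)
    have h1 := Int.emod_lt_of_pos r (show (0 : ℤ) < 2 * m by positivity)
    have := Finset.single_le_sum (f := fun x : ℕ => ‖v x‖) (s := Finset.range (2 * m)) (fun i _ => norm_nonneg _)
      (a := (r % (2 * m)).toNat) (by simp; omega)
    simpa [Int.toNat_of_nonneg h0] using this
  have hs := theta_summable hm hτ w hB
  have key : ∀ z, ∑' r : ℤ, w r * ee ((r : ℂ) ^ 2 * (τ / (2 * m)) / 2 + r * z) = 0 := fun z => by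
    rw [← hasSum_residues (show 0 < 2 * m by positivity) (hs z).hasSum, ← h z]
    refine Finset.sum_congr rfl fun l hl => ?_
    rw [jTheta, ← tsum_mul_left]
    congr 1; funext n
    have : ((l : ℤ) + (2 * m : ℕ) * n) % (2 * m : ℤ) = l := by
      push_cast
      rw [Int.add_mul_emod_self_left, Int.emod_eq_of_lt (by positivity) (by have := Finset.mem_range.mp hl; exact_mod_cast this)]
    simp only [w, this]
    congr 2; push_cast; field_simp; ring
  have h2 := freq (fun r : ℤ => w r * ee ((r : ℂ) ^ 2 * (τ / (2 * m)) / 2)) (fun r => r)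
    (by simpa using (hs 0).norm) (fun t => by
      rw [← key t]; congr 1; funext r; rw [ee_add]; push_cast; ring) x
  rw [tsum_eq_single (x : ℤ) (fun r hr => by rw [if_neg]; exact_mod_cast hr)] at h2
  have h3 : (x : ℤ) % (2 * m : ℤ) = x := Int.emod_eq_of_lt (by positivity) (by exact_mod_cast hx)
  simpa [w, h3, ee_ne] using h2

theorem PC_ne {τ : ℂ} (hτ : 0 < τ.im) : ∃ z, PC τ z ≠ 0 := by
  by_contra! hc
  have hη : ModularForm.eta τ ≠ 0 := ModularForm.eta_ne_zero hτ
  have := theta_indep (m := 2) (by norm_num) hτ (fun x => if x = 1 then 1 else if x = 3 then -1 else 0) (fun z => by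
    have h1 := hc z
    unfold PC at h1
    rw [div_eq_zero_iff, or_iff_left (pow_ne_zero _ hη)] at h1
    simp [Finset.sum_range_succ]; linear_combination h1) 1 (by norm_num)
  simp at this

theorem PA_ne {τ : ℂ} (hτ : 0 < τ.im) : ∃ z, PA τ z ≠ 0 := by
  by_contra! hc
  have hD := DD_ne hτ
  have := theta_indep (m := 1) (by norm_num) hτ (fun x => if x = 1 then 2 * T0 τ / DD τ else -2 * T1 τ / DD τ) (fun z => by
    have h1 := hc z
    unfold PA at h1
    simp [Finset.sum_range_succ]; linear_combination h1) 1 (by norm_num)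
  simp [hD] at this
  apply hD; unfold DD; rw [this]; ring

theorem JF.entire {k m φ c} (h : JF k m φ c) {τ : ℂ} (hτ : 0 < τ.im) : AnalyticOnNhd ℂ (φ τ) Set.univ := by
  have : Differentiable ℂ (φ τ) := fun z =>
    (h.hol τ z hτ).comp z (f := fun z => (τ, z)) ((differentiableAt_const τ).prodMk differentiableAt_id)
  exact this.differentiableOn.analyticOnNhd isOpen_univ

theorem entire_dom {f g : ℂ → ℂ} (hf : AnalyticOnNhd ℂ f Set.univ) (hg : AnalyticOnNhd ℂ g Set.univ)
    (h : ∀ z, f z * g z = 0) (h0 : ∃ z, f z ≠ 0) : ∀ z, g z = 0 := by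
  rcases AnalyticOnNhd.eq_zero_or_eq_zero_of_mul_eq_zero hf hg (fun z _ => h z) isPreconnected_univ with h1 | h1
  · obtain ⟨z, hz⟩ := h0; exact absurd (h1 z trivial) hz
  · exact fun z => h1 z trivial

theorem poly_indep {A B : ℂ → ℂ} (hA : AnalyticOnNhd ℂ A Set.univ) (hB : AnalyticOnNhd ℂ B Set.univ)
    (hA0 : A 0 = 0) (hB0 : B 0 ≠ 0) (hA1 : ∃ z, A z ≠ 0) (n : ℕ) (v : ℕ → ℂ)
    (h : ∀ z, ∑ j ∈ Finset.range n, v j * (A z ^ j * B z ^ (n - 1 - j)) = 0) : ∀ j < n, v j = 0 := by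
  induction n generalizing v with
  | zero => intro j hj; omega
  | succ n ih =>
    have h0 : v 0 = 0 := by
      have := h 0
      rw [Finset.sum_range_succ'] at this
      simpa [hA0, hB0] using this
    have h1 : ∀ z, ∑ j ∈ Finset.range n, v (j + 1) * (A z ^ j * B z ^ (n - 1 - j)) = 0 := by
      refine entire_dom hA ?_ (fun z => ?_) hA1
      · refine Finset.analyticOnNhd_fun_sum _ fun j _ => ?_
        exact analyticOnNhd_const.mul ((hA.pow _).mul (hB.pow _))
      · rw [← h z, Finset.sum_range_succ', h0, zero_mul, add_zero, Finset.mul_sum]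
        refine Finset.sum_congr rfl fun j hj => ?_
        rw [show n + 1 - 1 - (j + 1) = n - 1 - j by omega]; ring
    intro j hj
    rcases j with _ | j
    · exact h0
    · exact ih (fun j => v (j + 1)) h1 j (by omega)

/-- scalar weakly holomorphic forms -/
structure SF (w : ℤ) (f : ℂ → ℂ) (c : ℤ → ℂ) : Prop where
  diff : ∀ τ : ℂ, 0 < τ.im → DifferentiableAt ℂ f τ
  slaw : ∀ τ : ℂ, 0 < τ.im → f (-1 / τ) = τ ^ w * f τ
  rep : ∀ τ : ℂ, 0 < τ.im → HasSum (fun n : ℤ => c n * ee (n * τ)) (f τ)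
  bdd : ∃ N : ℕ, ∀ n : ℤ, n < -N → c n = 0

theorem tail_split {c : ℤ → ℂ} {N : ℕ} (hN : ∀ n : ℤ, n < -N → c n = 0) {τ s : ℂ}
    (h : HasSum (fun n : ℤ => c n * ee (n * τ)) s) :
    HasSum (fun k : ℕ => c (k + 1) * ee τ ^ k) ((s - ∑ n ∈ Finset.Icc (-(N : ℤ)) 0, c n * ee (n * τ)) / ee τ) := by
  have h1 : HasSum (fun n : ℤ => if n ∈ Finset.Icc (-(N : ℤ)) 0 then c n * ee (n * τ) else 0)
      (∑ n ∈ Finset.Icc (-(N : ℤ)) 0, c n * ee (n * τ)) := by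
    have := hasSum_sum_of_ne_finset_zero (L := .unconditional ℤ) (f := fun n : ℤ => if n ∈ Finset.Icc (-(N : ℤ)) 0 then c n * ee (n * τ) else 0)
      (s := Finset.Icc (-(N : ℤ)) 0) (fun n hn => if_neg hn)
    rwa [Finset.sum_congr rfl (fun n hn => if_pos hn)] at this
  have h2 := h.sub h1
  have hi : Function.Injective (fun k : ℕ => (k : ℤ) + 1) := fun a b hab => by simpa using hab
  have h3 := (hi.hasSum_iff (by
    intro n hn
    beta_reduce
    split_ifs with h
    · exact sub_self _
    · have : n < -N := by
        by_contra hc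
        rw [Finset.mem_Icc] at h
        exact hn ⟨(n - 1).toNat, by simp; omega⟩
      simp [hN n this])).mpr h2
  refine hs_congr (h3.div_const (ee τ)) fun k => ?_
  have := ee_ne τ
  have hk : ¬ ((k : ℤ) + 1 ∈ Finset.Icc (-(N : ℤ)) 0) := by simp
  simp only [Function.comp, if_neg hk, sub_zero]
  rw [ee_pow, mul_div_assoc, eq_comm]; congr 1; rw [div_eq_iff this, ← ee_add]; congr 1; push_cast; ring

theorem SF.ct {f c} (h : SF 2 f c) : c 0 = 0 := by
  obtain ⟨N, hN⟩ := h.bdd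
  have h1 := PConv.of_ee (f := PowerSeries.mk fun k : ℕ => c (k + 1)) (g := fun τ => _)
    (fun τ hτ => by simpa using tail_split hN (h.rep τ hτ))
  obtain ⟨K, hK⟩ := h1.1.diff.isExactOn_ball
  set p2 : ℂ := 2 * Real.pi * I with hp2
  have hp0 : p2 ≠ 0 := by simp [p2, Real.pi_ne_zero]
  let P : ℂ → ℂ := fun τ => K (ee τ) / p2 + ∑ n ∈ Finset.Icc (-(N : ℤ)) 0, if n = 0 then c 0 * τ else c n / (p2 * n) * ee (n * τ)
  have hee : ∀ τ, HasDerivAt ee (p2 * ee τ) τ := fun τ => hasDerivAt_ee τ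
  have hP : ∀ τ : ℂ, 0 < τ.im → HasDerivAt P (f τ) τ := by
    intro τ hτ
    have d1 := ((hK (ee τ) (by simpa using norm_ee_lt hτ)).comp τ (hee τ)).div_const p2
    have d2 : HasDerivAt (fun τ => ∑ n ∈ Finset.Icc (-(N : ℤ)) 0, if n = 0 then c 0 * τ else c n / (p2 * n) * ee (n * τ))
        (∑ n ∈ Finset.Icc (-(N : ℤ)) 0, c n * ee (n * τ)) τ := by
      refine HasDerivAt.fun_sum fun n _ => ?_
      by_cases hn : n = 0
      · subst hn; simpa [ee_zero] using (hasDerivAt_id τ).const_mul (c 0)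
      · have hn' : (n : ℂ) ≠ 0 := by exact_mod_cast hn
        simp only [if_neg hn]
        have := ((hee (n * τ)).comp τ ((hasDerivAt_id τ).const_mul (n : ℂ))).const_mul (c n / (p2 * n))
        refine this.congr_deriv ?_
        field_simp
    refine (d1.add d2).congr_deriv ?_
    rw [h1.2 τ hτ]
    have := ee_ne τ
    generalize (∑ n ∈ Finset.Icc (-(N : ℤ)) 0, c n * ee (n * τ)) = S
    field_simp; ring
  have hT : ∀ τ, P (τ + 1) = P τ + c 0 := by
    intro τ
    simp only [P]
    rw [show ee (τ + 1) = ee τ by simpa using ee_add_int τ 1, add_assoc]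
    congr 1
    have h0 : (0 : ℤ) ∈ Finset.Icc (-(N : ℤ)) 0 := by simp
    rw [← Finset.add_sum_erase _ _ h0, ← Finset.add_sum_erase _ _ h0, if_pos rfl, if_pos rfl]
    rw [Finset.sum_congr rfl (g := fun n : ℤ => if n = 0 then c 0 * τ else c n / (p2 * n) * ee (n * τ))]
    · ring
    · intro n hn
      rw [if_neg (Finset.ne_of_mem_erase hn), if_neg (Finset.ne_of_mem_erase hn), mul_add, mul_one, ee_add_int]
  let U : Set ℂ := {τ | 0 < τ.im}
  have hU : IsOpen U := isOpen_lt continuous_const Complex.continuous_im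
  have hUc : IsPreconnected U := (convex_halfSpace_im_gt 0).isPreconnected
  have hG : ∀ τ ∈ U, HasDerivAt (fun τ => P (-1 / τ) - P τ) 0 τ := by
    intro τ hτ
    have hτ0 := ne_zero_of_im hτ
    have hd : HasDerivAt (fun τ : ℂ => -1 / τ) (1 / τ ^ 2) τ := by
      have := (hasDerivAt_inv hτ0).neg
      simp only [div_eq_mul_inv, neg_one_mul]
      refine this.congr_deriv (by simp)
    have := ((hP _ (im_S hτ)).comp τ hd).sub (hP τ hτ)
    refine this.congr_deriv ?_
    rw [h.slaw τ hτ, zpow_ofNat]; field_simp; ring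
  have hS : ∀ τ ∈ U, P (-1 / τ) = P τ := by
    intro τ hτ
    have := hU.is_const_of_deriv_eq_zero hUc (f := fun τ => P (-1 / τ) - P τ)
      (fun τ hτ => (hG τ hτ).differentiableAt.differentiableWithinAt) (fun τ hτ => (hG τ hτ).deriv) hτ (show I ∈ U by simp [U])
    have hI : (-1 / I : ℂ) = I := by rw [div_eq_iff I_ne_zero, I_mul_I]
    simp only [hI, sub_self] at this
    exact sub_eq_zero.mp this
  let ρ : ℂ := 1 / 2 + (Real.sqrt 3 / 2 : ℝ) * I
  have hρ : ρ ∈ U := by simp [U, ρ]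
  have hρ2 : -1 / ρ = ρ - 1 := by
    rw [div_eq_iff (ne_zero_of_im hρ)]
    have : ((Real.sqrt 3 : ℝ) : ℂ) ^ 2 = 3 := by rw [← Complex.ofReal_pow, Real.sq_sqrt (by norm_num)]; norm_num
    simp only [ρ]; push_cast
    linear_combination (-1 / 4 * I ^ 2) * this + (-3 / 4 : ℂ) * I_sq
  have h5 := hS ρ hρ
  have h6 := hT (ρ - 1)
  rw [hρ2] at h5
  rw [sub_add_cancel, h5] at h6
  exact (left_eq_add.mp h6)

theorem SF.mul {w w' f g c d} (h : SF w f c) (h' : SF w' g d) : SF (w + w') (fun τ => f τ * g τ) (conv c d) where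
  diff := fun τ hτ => (h.diff τ hτ).mul (h'.diff τ hτ)
  slaw := fun τ hτ => by
    beta_reduce
    rw [h.slaw τ hτ, h'.slaw τ hτ, zpow_add₀ (ne_zero_of_im hτ)]; ring
  rep := fun τ hτ => (hasSum_conv (χ := fun n : ℤ => ee (n * τ)) (fun a b => by rw [← ee_add]; push_cast; ring_nf)
    (fun a => ee_ne _) (h.rep τ hτ) (h'.rep τ hτ)).2
  bdd := by
    obtain ⟨N, hN⟩ := h.bdd
    obtain ⟨M, hM⟩ := h'.bdd
    refine ⟨N + M, fun n hn => ?_⟩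
    unfold conv
    rw [← tsum_zero (β := ℤ)]
    congr 1; funext i
    by_cases hi : i < -N
    · rw [hN i hi, zero_mul]
    · rw [hM (n - i) (by push_cast at hn; omega), mul_zero]

theorem SF.add {w f g c d} (h : SF w f c) (h' : SF w g d) : SF w (fun τ => f τ + g τ) (fun n => c n + d n) where
  diff := fun τ hτ => (h.diff τ hτ).add (h'.diff τ hτ)
  slaw := fun τ hτ => by beta_reduce; rw [h.slaw τ hτ, h'.slaw τ hτ]; ring
  rep := fun τ hτ => by simpa only [add_mul] using (h.rep τ hτ).add (h'.rep τ hτ)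
  bdd := by
    obtain ⟨N, hN⟩ := h.bdd
    obtain ⟨M, hM⟩ := h'.bdd
    exact ⟨max N M, fun n hn => by rw [hN n (by push_cast at hn; omega), hM n (by push_cast at hn; omega), add_zero]⟩

theorem SF.smul {w f c} (a : ℂ) (h : SF w f c) : SF w (fun τ => a * f τ) (fun n => a * c n) where
  diff := fun τ hτ => (h.diff τ hτ).const_mul a
  slaw := fun τ hτ => by beta_reduce; rw [h.slaw τ hτ]; ring
  rep := fun τ hτ => by simpa only [mul_assoc] using (h.rep τ hτ).mul_left a
  bdd := by
    obtain ⟨N, hN⟩ := h.bdd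
    exact ⟨N, fun n hn => by rw [hN n hn, mul_zero]⟩

theorem SF.zero (w) : SF w (fun _ => 0) (fun _ => 0) where
  diff := fun τ hτ => differentiableAt_const _
  slaw := fun τ hτ => by simp
  rep := fun τ hτ => by simpa using hasSum_zero
  bdd := ⟨0, fun _ _ => rfl⟩

theorem JF.col {k : ℤ} {f : ℂ → ℂ} {c} (h : JF k 0 (fun τ _ => f τ) c) (n r : ℤ) (hr : r ≠ 0) : c (n, r) = 0 := by
  obtain ⟨N, hN⟩ := h.bdd
  have h1 : ∀ n, c (n + r, r) = c (n, r) := fun n => by simpa using h.ell.shift h.rep n r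
  have h2 := fun j => per_int (f := fun n => c (n, r)) h1 n j
  rw [← h2 (-(r.sign) * (|n - N| + 1))]
  refine hN _ ?_
  rw [show r * (-r.sign * (|n - N| + 1)) = -((r * r.sign) * (|n - N| + 1)) by ring, Int.mul_sign_self]
  have : (1 : ℤ) ≤ r.natAbs := by omega
  have := le_abs_self (n - N)
  simp only
  nlinarith [abs_nonneg (n - N)]

theorem GF.sf {k : ℤ} {f : ℂ → ℂ} {γ : ℤ × ℤ} (h : GF k 0 γ (fun τ _ => f τ)) : ∃ c : ℤ → ℂ, SF k f c ∧ IntC c ∧ (γ.2 = 0 → c γ.1 = 1 ∧ ∀ n < γ.1, c n = 0) ∧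
    JF k 0 (fun τ _ => f τ) (fun p => if p.2 = 0 then c p.1 else 0) := by
  obtain ⟨c, hj, hi, hl⟩ := h
  have hc : (fun p : ℤ × ℤ => if p.2 = 0 then c (p.1, 0) else 0) = c := by
    funext ⟨n, r⟩
    by_cases hr : r = 0
    · simp [hr]
    · simp [hr, hj.col n r hr]
  refine ⟨fun n => c (n, 0), ⟨fun τ hτ => ?_, fun τ hτ => ?_, fun τ hτ => ?_, ?_⟩, fun n => hi _, fun h0 => ⟨?_, fun n hn => hl.1 _ (Or.inl hn)⟩, ?_⟩
  · exact (hj.hol τ 0 hτ).comp τ (f := fun τ => (τ, 0)) (differentiableAt_id.prodMk (differentiableAt_const _))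
  · simpa [ee_zero] using hj.slaw τ 0 hτ
  · have hin : Function.Injective (fun n : ℤ => (n, (0 : ℤ))) := fun a b hab => by simpa using hab
    refine hs_congr ((hin.hasSum_iff (fun p hp => ?_)).mpr (hj.rep τ 0 hτ)) fun n => by simp
    rw [hj.col p.1 p.2 (fun h0 => hp ⟨p.1, by rw [← h0]⟩), zero_mul]
  · obtain ⟨N, hN⟩ := hj.bdd
    exact ⟨N.natAbs, fun n hn => hN _ (by simp; omega)⟩
  · have := hl.2; rwa [← h0]
  · rw [hc]; exact hj

theorem De_gf : GF 12 0 (1, 0) (fun τ _ => DD τ ^ 4 / 16) := by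
  refine GF.scalar (fun τ hτ => ?_) (fun τ hτ => ?_) ?_
  · have := DD_diff hτ; fun_prop
  · beta_reduce
    rw [DD_S hτ]
    have e : sqI (τ / 2) ^ 24 = τ ^ 12 / 4096 := by
      rw [show 24 = 4 * 6 by norm_num, pow_mul, sqI4 hτ]; ring
    rw [show (8 * sqI (τ / 2) ^ 6 * DD τ) ^ 4 = 4096 * sqI (τ / 2) ^ 24 * DD τ ^ 4 by ring, e]; norm_cast; ring
  · obtain ⟨H, h1, h2⟩ := del_pz
    have i4 := ee_ir 1
    refine (((h2.pow 4).poly (x := 1) (by simp [h1])).mul0 i4).congr (by simp) fun τ z hτ => ?_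
    rw [DD_eq, mul_pow, mul_pow, ee4]; push_cast; rw [one_mul]; ring

/-- integral scalar forms with their coefficients -/
def SG (w : ℤ) (f : ℂ → ℂ) (c : ℤ → ℂ) : Prop :=
  SF w f c ∧ IntC c ∧ JF w 0 (fun τ _ => f τ) (fun p => if p.2 = 0 then c p.1 else 0)

theorem GF.cast {k k' : ℤ} {m m' : ℕ} {γ γ' : ℤ × ℤ} {φ ψ : ℂ → ℂ → ℂ} (h : GF k m γ φ) (hk : k = k') (hm : m = m') (hγ : γ = γ')
    (hp : φ = ψ) : GF k' m' γ' ψ := by subst hk hm hγ hp; exact h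

theorem sg_exists (w c o : ℤ) (a b : ℕ) (hw : w = 12 * c + 4 * a + 6 * b) (ho : o ≤ c) :
    ∃ f d, SG w f d ∧ d o = 1 ∧ ∀ n < o, d n = 0 := by
  obtain ⟨t, ht⟩ := Int.eq_ofNat_of_zero_le (sub_nonneg.mpr ho)
  have h1 := (E4_gf.pow (a + 3 * t)).mul (E6_gf.pow b)
  have key : ∃ f : ℂ → ℂ, GF (12 * o) 0 (o, 0) (fun τ _ => f τ) := by
    rcases Int.eq_nat_or_neg o with ⟨n, rfl | rfl⟩
    · exact ⟨_, (De_gf.pow n).cast (by ring) (by simp) (by simp) rfl⟩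
    · exact ⟨_, (Di_gf.pow n).cast (by ring) (by simp) (by simp) rfl⟩
  obtain ⟨g, hg⟩ := key
  obtain ⟨d, d1, d2, d3, d4⟩ := GF.sf ((h1.mul hg).cast (k' := w) (m' := 0) (γ' := (o, 0))
    (ψ := fun τ _ => E4 τ ^ (a + 3 * t) * E6 τ ^ b * g τ) (by push_cast; omega) (by simp) (by simp) rfl)
  exact ⟨_, d, ⟨d1, d2, d4⟩, d3 rfl⟩

theorem res_exists (w : ℤ) (hw : Even w) : ∃ (c : ℤ) (a b a' b' : ℕ), w = 12 * c + 4 * a + 6 * b ∧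
    2 - w = 12 * (-c - 1) + 4 * a' + 6 * b' := by
  obtain ⟨v, rfl⟩ := hw
  have h := Int.emod_add_mul_ediv v 6
  have h1 := Int.emod_nonneg v (show (6 : ℤ) ≠ 0 by norm_num)
  have h2 := Int.emod_lt_of_pos v (show (0 : ℤ) < 6 by norm_num)
  set r := v % 6
  set u := v / 6
  clear_value r u
  have : r = 0 ∨ r = 1 ∨ r = 2 ∨ r = 3 ∨ r = 4 ∨ r = 5 := by omega
  rcases this with rfl | rfl | rfl | rfl | rfl | rfl
  · exact ⟨u, 0, 0, 2, 1, by omega, by omega⟩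
  · exact ⟨u - 1, 2, 1, 0, 0, by omega, by omega⟩
  · exact ⟨u, 1, 0, 1, 1, by omega, by omega⟩
  · exact ⟨u, 0, 1, 2, 0, by omega, by omega⟩
  · exact ⟨u, 2, 0, 0, 1, by omega, by omega⟩
  · exact ⟨u, 1, 1, 1, 0, by omega, by omega⟩

theorem fin_pair {d α : ℤ → ℂ} {N M : ℕ} (h : ∀ n : ℤ, n < -N → d n = 0) (h' : ∀ n : ℤ, n < -M → α n = 0) :
    Summable fun i => d i * α (-i) := by
  refine summable_of_ne_finset_zero (s := Finset.Icc (-(N : ℤ)) M) fun i hi => ?_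
  by_cases h1 : i < -N
  · rw [h i h1, zero_mul]
  · rw [h' (-i) (by rw [Finset.mem_Icc] at hi; omega), mul_zero]

theorem sf_dual (w : ℤ) (hw : Even w) (α : ℤ → ℂ) (hb : ∃ N : ℕ, ∀ n : ℤ, n < -N → α n = 0)
    (H : ∀ f d, SG w f d → ∑' i, d i * α (-i) = 0) : ∃ h, SF (2 - w) h α := by
  obtain ⟨c, a, b, a', b', hab, hab'⟩ := res_exists w hw
  have main : ∀ t : ℕ, ∀ α : ℤ → ℂ, (∀ n : ℤ, n < -c - t → α n = 0) →
      (∀ f d, SG w f d → ∑' i, d i * α (-i) = 0) → ∃ h, SF (2 - w) h α := by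
    intro t
    induction t with
    | zero =>
      intro α h0 H
      have : ∀ s : ℕ, ∀ n : ℤ, n < -c + s → α n = 0 := by
        intro s
        induction s with
        | zero => intro n hn; exact h0 n (by push_cast at *; omega)
        | succ s ih =>
          intro n hn
          by_cases hn' : n < -c + s
          · exact ih n hn'
          obtain ⟨f, d, hd, d1, d2⟩ := sg_exists w c (-n) a b hab (by omega)
          have := H f d hd
          rw [tsum_eq_single (-n)] at this
          · simpa [d1] using this
          · intro i hi
            by_cases h1 : i < -n
            · rw [d2 i h1, zero_mul]
            · rw [ih (-i) (by push_cast at hn; omega), mul_zero]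
      have h0 : α = fun _ => 0 := funext fun n => this (n + c + 1).toNat n (by omega)
      exact ⟨_, h0 ▸ SF.zero _⟩
    | succ t ih =>
      intro α h0 H
      obtain ⟨g, e, he, e1, e2⟩ := sg_exists (2 - w) (-c - 1) (-c - 1 - t) a' b' hab' (by omega)
      set A := α (-c - 1 - t)
      have hα : ∀ n : ℤ, n < -((c + 1 + t).natAbs : ℤ) → α n = 0 := fun n hn => h0 n (by push_cast; omega)
      obtain ⟨M, hM⟩ := he.1.bdd
      obtain ⟨h, hh⟩ := ih (fun n => α n - A * e n) (fun n hn => by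
        rcases lt_or_eq_of_le (show n ≤ -c - 1 - t by omega) with h1 | h1
        · rw [h0 n (by push_cast; omega), e2 n h1]; ring
        · rw [h1, e1]; ring) (fun f d hd => by
        have h1 := (hd.1.mul he.1)
        rw [show w + (2 - w) = 2 by ring] at h1
        have h2 := h1.ct
        unfold conv at h2
        simp only [zero_sub] at h2
        obtain ⟨N, hN⟩ := hd.1.bdd
        have s1 := fin_pair hN hα
        have s2 := (fin_pair hN hM).mul_left A
        have := s1.tsum_sub s2
        rw [tsum_mul_left, h2, H f d hd] at this
        rw [show (0 : ℂ) = 0 - A * 0 by ring, ← this]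
        congr 1; funext i; ring)
      have := hh.add (he.1.smul A)
      rw [show (fun n => α n - A * e n + A * e n) = α by funext n; ring] at this
      exact ⟨_, this⟩
  obtain ⟨N, hN⟩ := hb
  exact main (N - c).natAbs α (fun n hn => hN n (by omega)) H

/-- theta components -/
def hc {m : ℕ} (E : EllFormData m) (x : ℤ) (τ : ℂ) : ℂ := ∑' Δ : ℤ, E.coeff Δ x * ee (Δ * (τ / (4 * m)))

theorem im_div4 {m : ℕ} (hm : 0 < m) {τ : ℂ} (h : 0 < τ.im) : 0 < (τ / (4 * m)).im := by
  have := im_nat_div hm (im_nat_div (m := 1) (by norm_num) h)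
  convert this using 2; push_cast; rw [div_div]; ring

theorem hc_row {m : ℕ} (hm : 0 < m) (E : EllFormData m) (x : ℤ) {τ : ℂ} (h : 0 < τ.im) (z : ℂ) :
    HasSum (fun Δ : ℤ => E.coeff Δ x * ee (Δ * (τ / (4 * m)))) (hc E x τ) ∧
    HasSum (fun n : ℤ => E.coeff (4 * m * n - x ^ 2) x * ee (n * τ + x * z)) (ee (x ^ 2 / (4 * m) * τ + x * z) * hc E x τ) := by
  have hm' : (m : ℂ) ≠ 0 := by exact_mod_cast hm.ne'
  have hi : Function.Injective (fun n : ℤ => (n, x)) := fun a b hab => by simpa using hab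
  have h1 := (E.expansion τ z h).summable.comp_injective hi
  have hi2 : Function.Injective (fun n : ℤ => 4 * (m : ℤ) * n - x ^ 2) := fun a b hab => by
    have : (4 * (m : ℤ)) ≠ 0 := by positivity
    simpa [hm.ne'] using hab
  have e : ∀ n : ℤ, E.coeff (4 * m * n - x ^ 2) x * ee (n * τ + x * z) = ee (x ^ 2 / (4 * m) * τ + x * z) *
     (E.coeff (4 * m * n - x ^ 2) x * ee ((4 * m * n - x ^ 2 : ℤ) * (τ / (4 * m)))) := fun n => by
    rw [mul_left_comm, ← ee_add]; congr 2; push_cast; field_simp; ring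
  have h2 : Summable (fun Δ : ℤ => E.coeff Δ x * ee (Δ * (τ / (4 * m)))) := by
    refine (hi2.summable_iff ?_).mp ((summable_mul_left_iff (ee_ne (x ^ 2 / (4 * m) * τ + x * z))).mp ?_)
    · intro Δ hΔ
      rw [E.support Δ x, zero_mul]
      rintro ⟨j, hj⟩; exact hΔ ⟨j, by simp; linarith⟩
    · exact h1.congr fun n => (e n)
  refine ⟨h2.hasSum, ?_⟩
  have h3 := (hi2.hasSum_iff (fun Δ hΔ => by
      rw [E.support Δ x, zero_mul]
      rintro ⟨j, hj⟩; exact hΔ ⟨j, by simp; linarith⟩)).mpr h2.hasSum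
  exact hs_congr (h3.mul_left _) e

theorem hc_per {m : ℕ} (E : EllFormData m) (x j : ℤ) (τ : ℂ) : hc E (x + 2 * m * j) τ = hc E x τ := by
  unfold hc; congr 1; funext Δ; rw [per_int (f := fun l => E.coeff Δ l) (E.periodic Δ)]

theorem theta_dec {m : ℕ} (hm : 0 < m) (E : EllFormData m) {τ : ℂ} (h : 0 < τ.im) (z : ℂ) :
    E.toFun τ z = ∑ x ∈ Finset.range (2 * m), hc E x τ * jTheta m x τ z := by
  have h1 := ((Equiv.prodComm ℤ ℤ).hasSum_iff).mpr (E.expansion τ z h)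
  have h2 := HasSum.prod_fiberwise h1 (fun r => (hc_row hm E r h z).2)
  rw [← hasSum_residues (by positivity : 0 < 2 * m) h2]
  refine Finset.sum_congr rfl fun x _ => ?_
  unfold jTheta
  rw [← tsum_mul_left]
  congr 1; funext n
  push_cast
  rw [hc_per, mul_comm]

theorem hc_ps {m : ℕ} (hm : 0 < m) (E : EllFormData m) (x : ℤ) (M : ℕ) (hM : ∀ Δ l : ℤ, Δ < -M → E.coeff Δ l = 0) :
    PConv (PowerSeries.mk fun i : ℕ => E.coeff (i - M) x) ∧ ∀ τ : ℂ, 0 < τ.im →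
      evP (PowerSeries.mk fun i : ℕ => E.coeff (i - M) x) (ee (τ / (4 * m))) = ee (M * (τ / (4 * m))) * hc E x τ := by
  have hm' : (m : ℂ) ≠ 0 := by exact_mod_cast hm.ne'
  have := PConv.of_ee (f := PowerSeries.mk fun i : ℕ => E.coeff (i - M) x) (g := fun τ => ee (M * τ) * hc E x (4 * m * τ)) (by
    intro τ hτ
    have h4 : 0 < (4 * m * τ).im := by
      have := im_nat_mul hm (im_nat_mul (m := 1) (by norm_num) hτ); convert this using 2; push_cast; ring
    have h1 := ((hc_row hm E x h4 0).1).mul_left (ee (M * τ))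
    have hi : Function.Injective (fun i : ℕ => (i : ℤ) - M) := fun a b hab => by simpa using hab
    refine hs_congr ((hi.hasSum_iff ?_).mpr h1) fun i => ?_
    · intro Δ hΔ
      rw [hM Δ x, zero_mul, mul_zero]
      by_contra hc
      exact hΔ ⟨(Δ + M).toNat, by simp; omega⟩
    · simp only [Function.comp, PowerSeries.coeff_mk]
      rw [mul_left_comm, ← ee_add, ee_pow]; congr 2; push_cast; field_simp; ring)
  refine ⟨this.1, fun τ hτ => ?_⟩
  rw [this.2 _ (im_div4 hm hτ), mul_div_cancel₀ τ (by simpa using hm')]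

theorem hc_S {k : ℤ} {m : ℕ} (hm : 0 < m) (E : EllFormData m) (hE : JB k E) {τ : ℂ} (h : 0 < τ.im) (y : ℕ) (hy : y < 2 * m) :
    sqI (τ / (2 * m)) * ∑ x ∈ Finset.range (2 * m), hc E x (-1 / τ) * ee (-(x * y : ℂ) / (2 * m)) = τ ^ k * hc E y τ := by
  have := theta_indep hm h (fun y => sqI (τ / (2 * m)) * ∑ x ∈ Finset.range (2 * m), hc E x (-1 / τ) * ee (-(x * y : ℂ) / (2 * m)) - τ ^ k * hc E y τ) (by
    intro z
    have h1 := JF.slaw hE τ z h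
    rw [theta_dec hm E h, theta_dec hm E (im_S h)] at h1
    simp only [jTheta_S hm _ h] at h1
    have h2 := ee_ne (m * z ^ 2 / τ)
    simp only [sub_mul, Finset.sum_sub_distrib, sub_eq_zero]
    refine mul_left_cancel₀ h2 ?_
    rw [show ee (m * z ^ 2 / τ) * ∑ x ∈ Finset.range (2 * m), τ ^ k * hc E x τ * jTheta m x τ z =
      τ ^ k * ee (m * z ^ 2 / τ) * ∑ x ∈ Finset.range (2 * m), hc E x τ * jTheta m x τ z by
        simp only [Finset.mul_sum]; exact Finset.sum_congr rfl fun _ _ => by ring, ← h1]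
    simp only [Finset.mul_sum, Finset.sum_mul]
    rw [Finset.sum_comm]
    refine Finset.sum_congr rfl fun _ _ => Finset.sum_congr rfl fun _ _ => ?_
    push_cast; ring) y hy
  simpa [sub_eq_zero] using this

theorem JF.even {k m φ c} (h : JF k m φ c) {τ : ℂ} (hτ : 0 < τ.im) (z : ℂ) : φ τ (-z) = (-1) ^ k * φ τ z := by
  have := h.modular τ hτ z (-1) 0 0 (-1) (by norm_num)
  simpa [ee_zero, div_neg] using this

theorem basis_exists {m : ℕ} (hm : 0 < m) : ∃ (κ : ℕ → ℤ) (E : ℕ → EllFormData m), (∀ j, JB (κ j) (E j)) ∧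
    ∀ τ : ℂ, 0 < τ.im → ∀ v : ℕ → ℂ, (∀ z, ∑ j ∈ Finset.range (2 * m), v j * (E j).toFun τ z = 0) →
      ∀ j < 2 * m, v j = 0 := by
  obtain ⟨cA, hA, -⟩ := PA_gf
  obtain ⟨cB, hB, -⟩ := PB_gf
  obtain ⟨cC, hC⟩ := PC_jf
  have key : ∀ j : ℕ, ∃ (κ : ℤ) (E : EllFormData m), JB κ E ∧
      (j ≤ m → E.toFun = fun τ z => PA τ z ^ j * PB τ z ^ (m - j)) ∧
      (m < j → j < 2 * m → E.toFun = fun τ z => PC τ z * (PA τ z ^ (j - (m + 1)) * PB τ z ^ (m - 2 - (j - (m + 1))))) := by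
    intro j
    by_cases hj : j ≤ m
    · have h := (hA.pow j).mul (hB.pow (m - j))
      rw [show j * 1 + (m - j) * 1 = m by omega] at h
      exact ⟨_, _, h.mkE hm, fun _ => rfl, fun h => by omega⟩
    by_cases hj' : j < 2 * m
    · have h := hC.mul ((hA.pow (j - (m + 1))).mul (hB.pow (m - 2 - (j - (m + 1)))))
      rw [show 2 + ((j - (m + 1)) * 1 + (m - 2 - (j - (m + 1))) * 1) = m by omega] at h
      exact ⟨_, _, h.mkE hm, fun h => by omega, fun _ _ => rfl⟩
    · have h := (hA.pow m)
      rw [mul_one] at h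
      exact ⟨_, _, h.mkE hm, fun h => by omega, fun _ h => by omega⟩
  choose κ E hE e1 e2 using key
  refine ⟨κ, E, hE, fun τ hτ v hv => ?_⟩
  have ev : ∀ z, PA τ (-z) = PA τ z := fun z => by simpa using hA.even hτ z
  have ev' : ∀ z, PB τ (-z) = PB τ z := fun z => by simpa using hB.even hτ z
  have od : ∀ z, PC τ (-z) = -PC τ z := fun z => by simpa using hC.even hτ z
  have hs : ∀ z, ∑ j ∈ Finset.range (m + 1), v j * (PA τ z ^ j * PB τ z ^ (m + 1 - 1 - j)) +
      PC τ z * ∑ i ∈ Finset.range (m - 1), v (m + 1 + i) * (PA τ z ^ i * PB τ z ^ (m - 1 - 1 - i)) = 0 := by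
    intro z
    refine Eq.trans ?_ (hv z)
    have hS : ∀ f : ℕ → ℂ, ∑ j ∈ Finset.range (2 * m), f j = ∑ j ∈ Finset.range (m + 1), f j + ∑ j ∈ Finset.range (m - 1), f (m + 1 + j) := fun f => by
      rw [← Finset.sum_range_add]; congr 2; omega
    rw [hS, Finset.mul_sum]
    congr 1
    · refine Finset.sum_congr rfl fun j hj => ?_
      rw [e1 j (by simp at hj; omega)]; simp
    · refine Finset.sum_congr rfl fun i hi => ?_
      simp at hi
      rw [e2 (m + 1 + i) (by omega) (by omega), show m + 1 + i - (m + 1) = i by omega, show m - 1 - 1 - i = m - 2 - i by omega]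
      ring
  have h0 : PB τ 0 ≠ 0 := by rw [PB_zero hτ]; norm_num
  have g1 := poly_indep (hA.entire hτ) (hB.entire hτ) (PA_zero τ) h0 (PA_ne hτ) (m + 1) v (fun z => by
    have := hs (-z)
    simp only [ev, ev', od] at this
    linear_combination (this + hs z) / 2)
  have hz := entire_dom (hC.entire hτ) (g := fun z => ∑ i ∈ Finset.range (m - 1), v (m + 1 + i) * (PA τ z ^ i * PB τ z ^ (m - 1 - 1 - i)))
    (by
      have a1 := hA.entire hτ
      have a2 := hB.entire hτ
      intro z hz
      have := a1 z hz
      have := a2 z hz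
      refine Finset.analyticAt_fun_sum _ fun i _ => ?_
      fun_prop) (fun z => by
    have := hs (-z)
    simp only [ev, ev', od] at this
    linear_combination (hs z - this) / 2) (PC_ne hτ)
  have g2 := poly_indep (hA.entire hτ) (hB.entire hτ) (PA_zero τ) h0 (PA_ne hτ) (m - 1) (fun i => v (m + 1 + i)) hz
  intro j hj
  by_cases h : j < m + 1
  · exact g1 j h
  · have := g2 (j - (m + 1)) (by omega)
    simpa [show m + 1 + (j - (m + 1)) = j by omega] using this

theorem sum_zmod {N : ℕ} [NeZero N] (F : ZMod N → ℂ) : ∑ x ∈ Finset.range N, F (x : ZMod N) = ∑ u, F u :=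
  Finset.sum_bij' (fun x _ => (x : ZMod N)) (fun u _ => u.val) (by simp) (fun u _ => by simp [ZMod.val_lt])
    (fun x hx => ZMod.val_cast_of_lt (by simpa using hx)) (by simp) (by simp)

theorem per_zmod {N : ℕ} [NeZero N] {f : ℤ → ℂ} (h : ∀ l, f (l + N) = f l) : ∃ F : ZMod N → ℂ, ∀ x : ℤ, f x = F x :=
  ⟨fun u => f u.val, fun x => per_mod h (by
    rw [← ZMod.intCast_zmod_eq_zero_iff_dvd]; simp)⟩

theorem sum_aff {N : ℕ} (hN : 0 < N) {f : ℤ → ℂ} (h : ∀ l, f (l + N) = f l) (u v : ℤ) (hu : IsCoprime u (N : ℤ)) :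
    ∑ x ∈ Finset.range N, f (u * x + v) = ∑ x ∈ Finset.range N, f x := by
  have : NeZero N := ⟨hN.ne'⟩
  obtain ⟨F, hF⟩ := per_zmod h
  simp only [hF]
  have h1 := sum_zmod (fun t : ZMod N => F (u * t + v))
  have h2 := sum_zmod F
  push_cast
  rw [h1, h2]
  obtain ⟨a, b, hab⟩ := hu
  have hi : (a : ZMod N) * u = 1 := by
    have := congrArg (Int.cast : ℤ → ZMod N) hab
    simpa using this
  have hinj : Function.Bijective (fun t : ZMod N => u * t + v) := by
    refine Finite.injective_iff_bijective.mp fun s t hst => ?_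
    have : (u : ZMod N) * s = u * t := by simpa using hst
    calc s = a * u * s := by rw [hi, one_mul]
      _ = a * u * t := by rw [mul_assoc, this, mul_assoc]
      _ = t := by rw [hi, one_mul]
  exact hinj.sum_comp F

def pair (m : ℕ) (a : ℕ → ℤ → ℂ) (C : ℤ → ℤ → ℂ) : ℂ := ∑ x ∈ Finset.range (2 * m), ∑' D : ℕ, a D x * C (-D) x

structure Lam (k : ℤ) (m : ℕ) (a : ℕ → ℤ → ℂ) : Prop where
  per : ∀ (D : ℕ) (x : ℤ), a D (x + 2 * m) = a D x
  supp : ∀ (D : ℕ) (x : ℤ), ¬ (4 * (m : ℤ)) ∣ (D : ℤ) - x ^ 2 → a D x = 0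
  par : ∀ (D : ℕ) (x : ℤ), a D (-x) = (-1) ^ k * a D x
  orth : ∀ E : EllFormData m, JB k E → pair m a E.coeff = 0

theorem JB.parity {k m} {E : EllFormData m} (h : JB k E) (Δ x : ℤ) : E.coeff Δ (-x) = (-1) ^ k * E.coeff Δ x := by
  by_cases hd : (4 * (m : ℤ)) ∣ Δ + x ^ 2
  · obtain ⟨n, hn⟩ := hd
    have := JF.parity h n x
    simp only [neg_sq] at this
    rwa [show 4 * m * n - x ^ 2 = Δ by linarith] at this
  · rw [E.support _ _ hd, E.support _ _ (by rwa [neg_sq]), mul_zero]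

theorem JB.bddN {k m} {E : EllFormData m} (hm : 0 < m) (h : JB k E) : ∃ M : ℕ, ∀ Δ l : ℤ, Δ < -M → E.coeff Δ l = 0 := by
  obtain ⟨B, hB⟩ := h.bdd hm
  exact ⟨B.natAbs, fun Δ l hΔ => hB Δ l (by omega)⟩

def alp (m : ℕ) (a : ℕ → ℤ → ℂ) (C : ℤ → ℤ → ℂ) (n : ℤ) : ℂ :=
  ∑ x ∈ Finset.range (2 * m), ∑' D : ℕ, a D x * C (4 * m * n - D) x

theorem fmul_coeff {w κ : ℤ} {m : ℕ} (hm : 0 < m) {E : EllFormData m} (hE : JB κ E) {f d} (hf : SG w f d) :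
    ∃ E' : EllFormData m, JB (w + κ) E' ∧ ∀ Δ x : ℤ, (4 * (m : ℤ)) ∣ Δ + x ^ 2 →
      E'.coeff Δ x = ∑' i, d i * E.coeff (Δ - 4 * m * i) x := by
  have h := hf.2.2.mul hE
  rw [zero_add] at h
  refine ⟨_, h.mkE hm, fun Δ x hd => ?_⟩
  obtain ⟨n, hn⟩ := hd
  have h1 := mkE_coeff hm h.hol h.ell h.rep n x
  rw [show 4 * (m : ℤ) * n - x ^ 2 = Δ by linarith] at h1
  rw [h1]
  unfold conv
  have hi : Function.Injective (fun i : ℤ => (i, (0 : ℤ))) := fun a b hab => by simpa using hab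
  rw [← hi.tsum_eq]
  · congr 1; funext i
    simp only [if_true, Prod.fst_sub, Prod.snd_sub, sub_zero]
    congr 2; linarith
  · rintro ⟨i, s⟩ hs
    by_cases h0 : s = 0
    · exact ⟨i, by rw [h0]⟩
    · simp [h0] at hs

theorem tsum_nat_fin {f : ℕ → ℂ} (K : ℕ) (h : ∀ D, K ≤ D → f D = 0) : ∑' D, f D = ∑ D ∈ Finset.range K, f D :=
  tsum_eq_sum fun D hD => h D (by simpa using hD)

theorem Lam.alp_orth {k κ : ℤ} {m : ℕ} {a} (hm : 0 < m) (hL : Lam k m a) {E : EllFormData m} (hE : JB κ E) {f d}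
    (hf : SG (k - κ) f d) : ∑' i, d i * alp m a E.coeff (-i) = 0 := by
  obtain ⟨E', h1, h2⟩ := fmul_coeff hm hE hf
  rw [sub_add_cancel] at h1
  obtain ⟨N, hN⟩ := hf.1.bdd
  obtain ⟨M, hM⟩ := hE.bddN hm
  have h3 := hL.orth E' h1
  set K := M + 4 * m * N + 1 with hK
  have z : ∀ (D : ℕ) (i : ℤ) (x : ℤ), (K ≤ D ∨ i ∉ Finset.Icc (-(N : ℤ)) M) → d i * E.coeff (4 * m * (-i) - D) x = 0 := by
    intro D i x h
    by_cases hi : i < -N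
    · rw [hN i hi, zero_mul]
    · rw [hM, mul_zero]
      have hm1 : (1 : ℤ) ≤ m := by exact_mod_cast hm
      rcases h with h | h
      · have : (K : ℤ) ≤ D := by exact_mod_cast h
        rw [hK] at this
        push_cast at this
        nlinarith
      · rw [Finset.mem_Icc] at h
        have : (M : ℤ) < i := by omega
        nlinarith
  have e1 : ∀ (D : ℕ) (x : ℤ), a D x * E'.coeff (-D) x = ∑ i ∈ Finset.Icc (-(N : ℤ)) M, a D x * (d i * E.coeff (4 * m * (-i) - D) x) := by
    intro D x
    by_cases hs : (4 * (m : ℤ)) ∣ D - x ^ 2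
    · rw [h2 _ _ (by rw [show -(D : ℤ) + x ^ 2 = -(D - x ^ 2) by ring]; exact hs.neg_right), ← Finset.mul_sum,
        tsum_eq_sum (s := Finset.Icc (-(N : ℤ)) M)]
      · congr 1; refine Finset.sum_congr rfl fun i _ => ?_
        congr 2; ring
      · intro i hi
        rw [← z D i x (Or.inr hi)]; congr 2; ring
    · simp [hL.supp D x hs]
  rw [tsum_eq_sum (s := Finset.Icc (-(N : ℤ)) M) (fun i hi => by
    unfold alp
    rw [Finset.mul_sum]
    refine Finset.sum_eq_zero fun x _ => ?_
    rw [← tsum_mul_left, ← tsum_zero (β := ℕ)]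
    congr 1; funext D; rw [mul_left_comm, z D i x (Or.inr hi), mul_zero]), ← h3]
  unfold pair alp
  simp only [Finset.mul_sum]
  rw [Finset.sum_comm]
  refine Finset.sum_congr rfl fun x _ => ?_
  rw [tsum_nat_fin K]
  · simp only [e1]
    rw [Finset.sum_comm]
    refine Finset.sum_congr rfl fun i _ => ?_
    rw [← tsum_mul_left, tsum_nat_fin K]
    · exact Finset.sum_congr rfl fun D _ => by ring
    · intro D hD; rw [mul_left_comm, z D i x (Or.inl hD), mul_zero]
  · intro D hD
    rw [e1]; exact Finset.sum_eq_zero fun i _ => by rw [z D i x (Or.inl hD), mul_zero]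

theorem Lam.alp_sf {k κ : ℤ} {m : ℕ} {a} (hm : 0 < m) (hL : Lam k m a) {E : EllFormData m} (hE : JB κ E) :
    ∃ h, SF (2 - (k - κ)) h (alp m a E.coeff) := by
  by_cases hw : Even (k - κ)
  · obtain ⟨M, hM⟩ := hE.bddN hm
    refine sf_dual _ hw _ ⟨M, fun n hn => ?_⟩ fun f d hf => hL.alp_orth hm hE hf
    unfold alp
    refine Finset.sum_eq_zero fun x _ => ?_
    rw [← tsum_zero (β := ℕ)]
    congr 1; funext D
    rw [hM, mul_zero]
    have hm1 : (1 : ℤ) ≤ m := by exact_mod_cast hm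
    nlinarith
  · have : alp m a E.coeff = fun _ => 0 := by
      funext n
      have h1 := sum_aff (N := 2 * m) (by positivity) (f := fun x => ∑' D : ℕ, a D x * E.coeff (4 * m * n - D) x)
        (fun l => by push_cast; simp only [hL.per, E.periodic]) (-1) 0 ⟨-1, 0, by ring⟩
      have hs : (-1 : ℂ) ^ k * (-1) ^ κ = -1 := by
        have : Odd (k + κ) := by rw [← Int.not_even_iff_odd]; intro h; exact hw (by rw [Int.even_add] at h; rw [Int.even_sub]; exact h)
        rw [← zpow_add₀ (by norm_num), this.neg_one_zpow]
      have h2 : ∀ x : ℤ, ∑' D : ℕ, a D (-1 * x + 0) * E.coeff (4 * m * n - D) (-1 * x + 0) = -∑' D : ℕ, a D x * E.coeff (4 * m * n - D) x := by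
        intro x
        rw [← tsum_neg]; congr 1; funext D
        rw [add_zero, neg_one_mul, hL.par, hE.parity]
        linear_combination (a D x * E.coeff (4 * m * n - D) x) * hs
      simp only [h2, Finset.sum_neg_distrib] at h1
      unfold alp
      linear_combination -h1 / 2
    exact ⟨_, this ▸ SF.zero _⟩

def PR : Subring (PowerSeries ℂ) where
  carrier := {f | PConv f}
  mul_mem' h h' := (h.mul h').1
  one_mem' := by simpa using (PConv.const 1).1
  add_mem' h h' := (h.add h').1
  zero_mem' := by simpa using (PConv.const 0).1
  neg_mem' h := by simpa using (PConv.smul (-1) h).1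

def evH (x : ℂ) (hx : ‖x‖ < 1) : PR →+* ℂ where
  toFun f := evP f.1 x
  map_one' := by simpa using (PConv.const 1).2 x hx
  map_mul' f g := (f.2.mul g.2).2 x hx
  map_zero' := by simpa using (PConv.const 0).2 x hx
  map_add' f g := (f.2.add g.2).2 x hx

theorem evP_shift {f : PowerSeries ℂ} {v : ℕ} (h : PConv (PowerSeries.X ^ v * f)) : PConv f ∧
    ∀ x : ℂ, ‖x‖ < 1 → evP (PowerSeries.X ^ v * f) x = x ^ v * evP f x := by
  have key : ∀ x : ℂ, ‖x‖ < 1 → x ≠ 0 → Summable fun n => f.coeff n * x ^ n := by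
    intro x hx h0
    have := ((h x hx).comp_injective (add_left_injective v)).mul_left ((x ^ v)⁻¹)
    refine this.congr fun n => ?_
    simp only [Function.comp, PowerSeries.coeff_X_pow_mul, pow_add]
    field_simp
  have hf : PConv f := by
    intro x hx
    by_cases h0 : x = 0
    · subst h0
      exact summable_of_ne_finset_zero (s := {0}) (by intro n hn; simp at hn; simp [hn])
    · exact key x hx h0
  have hX : ∀ v : ℕ, PConv (PowerSeries.X ^ v) ∧ ∀ x : ℂ, ‖x‖ < 1 → evP (PowerSeries.X ^ v) x = x ^ v := fun v =>
    PConv.of fun x hx => by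
      have := hasSum_single (f := fun n => (PowerSeries.X ^ v : PowerSeries ℂ).coeff n * x ^ n) v
        (fun n hn => by rw [PowerSeries.coeff_X_pow, if_neg hn, zero_mul])
      simpa using this
  exact ⟨hf, fun x hx => by rw [((hX v).1.mul hf).2 x hx, (hX v).2 x hx]⟩

theorem mat_conv {ι : Type*} [Fintype ι] [DecidableEq ι] (P : Matrix ι ι (PowerSeries ℂ)) (G : ι → PowerSeries ℂ)
    (hP : ∀ i j, PConv (P i j)) (hb : ∀ i, PConv ((P.mulVec G) i))
    (hd : ∀ x : ℂ, ‖x‖ < 1 → x ≠ 0 → (Matrix.of fun i j => evP (P i j) x).det ≠ 0) (i : ι) : PConv (G i) := by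
  let P' : Matrix ι ι PR := fun i j => ⟨P i j, hP i j⟩
  let b' : ι → PR := fun i => ⟨_, hb i⟩
  have e1 : P = PR.subtype.mapMatrix P' := rfl
  have hdet : P.det = (P'.det : PR).1 := by rw [e1, ← RingHom.map_det]; rfl
  have hadj : P.adjugate = PR.subtype.mapMatrix P'.adjugate := by rw [e1, RingHom.map_adjugate]
  have hg : ∀ i, P.det * G i = ((P'.adjugate.mulVec b') i : PR).1 := by
    intro i
    have h1 : P.adjugate.mulVec (P.mulVec G) = P.det • G := by
      rw [Matrix.mulVec_mulVec, Matrix.adjugate_mul, Matrix.smul_mulVec, Matrix.one_mulVec]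
    have h2 := congrFun h1 i
    rw [Pi.smul_apply, smul_eq_mul] at h2
    rw [← h2, hadj]
    simp only [Matrix.mulVec, dotProduct, RingHom.mapMatrix_apply, Matrix.map_apply, Subring.subtype_apply, AddSubmonoidClass.coe_finsetSum, Subring.coe_mul]
    rfl
  have hev : ∀ x : ℂ, ‖x‖ < 1 → x ≠ 0 → evP P.det x ≠ 0 := by
    intro x hx h0
    have := RingHom.map_det (evH x hx) P'
    rw [hdet]
    change evH x hx P'.det ≠ 0
    rw [this]
    exact hd x hx h0
  have hne : P.det ≠ 0 := by
    intro h
    refine hev (1/2) (by norm_num) (by norm_num) ?_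
    rw [h]; simp [evP]
  obtain ⟨u, hu⟩ := PowerSeries.X_pow_order_dvd (φ := P.det)
  set v := P.det.order.toNat with hv
  have hu1 := evP_shift (f := u) (v := v) (by rw [← hu, hdet]; exact P'.det.2)
  have hu0 : u.constantCoeff ≠ 0 := by
    have := PowerSeries.coeff_order hne
    rw [← hv] at this
    rw [hu] at this
    have h6 := PowerSeries.coeff_X_pow_mul u v 0
    rw [zero_add] at h6
    rwa [h6, PowerSeries.coeff_zero_eq_constantCoeff] at this
  have hu2 : ∀ x : ℂ, ‖x‖ < 1 → evP u x ≠ 0 := by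
    intro x hx
    by_cases h0 : x = 0
    · rw [h0, evP_zero]; exact hu0
    · intro h
      apply hev x hx h0
      rw [hu, hu1.2 x hx, h, mul_zero]
  obtain ⟨i1, -, i3⟩ := hu1.1.inv hu2
  refine (evP_shift (v := v) ?_).1
  have h5 : PowerSeries.X ^ v * G i = u⁻¹ * ((P'.adjugate.mulVec b') i : PR).1 := by
    rw [← hg, hu]
    have := PowerSeries.mul_inv_cancel u i3
    linear_combination -(PowerSeries.X ^ v * G i) * this
  rw [h5]
  exact (i1.mul (Subtype.prop _)).1

def gS (m : ℕ) (a : ℕ → ℤ → ℂ) (x : ℤ) (τ : ℂ) : ℂ := ∑' D : ℕ, a D x * ee (D * (τ / (4 * m)))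

structure GV (k : ℤ) (m : ℕ) (a : ℕ → ℤ → ℂ) : Prop where
  per : ∀ (D : ℕ) (x : ℤ), a D (x + 2 * m) = a D x
  supp : ∀ (D : ℕ) (x : ℤ), ¬ (4 * (m : ℤ)) ∣ (D : ℤ) - x ^ 2 → a D x = 0
  par : ∀ (D : ℕ) (x : ℤ), a D (-x) = (-1) ^ k * a D x
  conv : ∀ x : ℤ, PConv (PowerSeries.mk fun D => a D x)
  slaw : ∀ τ : ℂ, 0 < τ.im → ∀ x : ℤ, gS m a x (-1 / τ) =
    τ ^ (2 - k) * sqI (τ / (2 * m)) * ∑ y ∈ Finset.range (2 * m), ee (-(x * y : ℂ) / (2 * m)) * gS m a y τ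

theorem gS_ev {m : ℕ} (a : ℕ → ℤ → ℂ) (x : ℤ) (τ : ℂ) :
    gS m a x τ = evP (PowerSeries.mk fun D => a D x) (ee (τ / (4 * m))) := by
  unfold gS evP; congr 1; funext D; rw [PowerSeries.coeff_mk, ee_pow]

theorem gS_per {m : ℕ} {a : ℕ → ℤ → ℂ} (h : ∀ (D : ℕ) (x : ℤ), a D (x + 2 * m) = a D x) (x : ℤ) (τ : ℂ) :
    gS m a (x + (2 * m : ℕ)) τ = gS m a x τ := by unfold gS; push_cast; simp only [h]

theorem GV.hs {k m a} (hm : 0 < m) (hG : GV k m a) (x : ℤ) {τ : ℂ} (h : 0 < τ.im) :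
    HasSum (fun D : ℕ => a D x * ee (D * (τ / (4 * m)))) (gS m a x τ) := by
  have := (hG.conv x).hasSum (norm_ee_lt (im_div4 hm h))
  rw [← gS_ev] at this
  refine hs_congr this fun D => ?_
  rw [PowerSeries.coeff_mk, ee_pow]

theorem sum_rr {m : ℕ} (f : ℕ → ℂ) : ∑ x ∈ Finset.range (2 * m), f x = ∑ x : Fin (2 * m), f x := (Fin.sum_univ_eq_sum_range _ _).symm

theorem alp_row {m : ℕ} (hm : 0 < m) {a : ℕ → ℤ → ℂ} (E : EllFormData m) (M : ℕ)
    (hs : ∀ (D : ℕ) (x : ℤ), ¬ (4 * (m : ℤ)) ∣ (D : ℤ) - x ^ 2 → a D x = 0)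
    (hM : ∀ Δ l : ℤ, Δ < -(4 * m * M : ℕ) → E.coeff Δ l = 0) (n : ℕ) :
    (∑ x : Fin (2 * m), PowerSeries.mk (fun i : ℕ => E.coeff (i - (4 * m * M : ℕ)) (x : ℕ)) * PowerSeries.mk fun D => a D (x : ℕ)).coeff n =
      if 4 * m ∣ n then alp m a E.coeff (n / (4 * m) - M) else 0 := by
  rw [map_sum]
  split_ifs with hd
  · obtain ⟨j, rfl⟩ := hd
    have hj : ((4 * m * j : ℕ) : ℤ) / (4 * m) = j := by push_cast; exact Int.mul_ediv_cancel_left _ (by positivity)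
    rw [hj]
    unfold alp
    rw [sum_rr]
    refine Finset.sum_congr rfl fun x _ => ?_
    rw [mul_comm (PowerSeries.mk _), PowerSeries.coeff_mul, Finset.Nat.sum_antidiagonal_eq_sum_range_succ_mk, tsum_nat_fin (4 * m * j + 1)]
    · refine Finset.sum_congr rfl fun D hD => ?_
      rw [PowerSeries.coeff_mk, PowerSeries.coeff_mk]
      congr 2
      rw [Finset.mem_range] at hD
      push_cast [Nat.cast_sub (show D ≤ 4 * m * j by omega)]; ring
    · intro D hD
      rw [hM, mul_zero]
      have : ((4 * m * j + 1 : ℕ) : ℤ) ≤ D := by exact_mod_cast hD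
      push_cast at this ⊢
      linarith
  · refine Finset.sum_eq_zero fun x _ => ?_
    rw [PowerSeries.coeff_mul]
    refine Finset.sum_eq_zero fun p hp => ?_
    rw [PowerSeries.coeff_mk, PowerSeries.coeff_mk]
    by_cases h1 : (4 * (m : ℤ)) ∣ (p.2 : ℤ) - ((x : ℕ) : ℤ) ^ 2
    · rw [E.support, zero_mul]
      intro h2
      apply hd
      have h3 := h1.add h2
      have hp' : (p.1 : ℤ) + p.2 = n := by exact_mod_cast Finset.HasAntidiagonal.mem_antidiagonal.mp hp
      have h4 : (4 * (m : ℤ)) ∣ (4 * m * M : ℕ) := ⟨M, by push_cast; ring⟩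
      have h5 := h3.add h4
      rw [show (p.2 : ℤ) - ((x : ℕ) : ℤ) ^ 2 + (p.1 - (4 * m * M : ℕ) + ((x : ℕ) : ℤ) ^ 2) + (4 * m * M : ℕ) = n by rw [← hp']; ring] at h5
      exact_mod_cast h5
    · rw [hs _ _ h1, mul_zero]

theorem SF.row {w : ℤ} {m : ℕ} (hm : 0 < m) {h : ℂ → ℂ} {c : ℤ → ℂ} (hh : SF w h c) (M : ℕ) (hM : ∀ n : ℤ, n < -M → c n = 0)
    (F : PowerSeries ℂ) (hF : ∀ n : ℕ, F.coeff n = if 4 * m ∣ n then c (n / (4 * m) - M) else 0) :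
    PConv F ∧ ∀ τ : ℂ, 0 < τ.im → evP F (ee (τ / (4 * m))) = ee ((4 * m * M : ℕ) * (τ / (4 * m))) * h τ := by
  have hm' : (m : ℂ) ≠ 0 := by exact_mod_cast hm.ne'
  have := PConv.of_ee (f := F) (g := fun τ => ee ((4 * m * M : ℕ) * τ) * h (4 * m * τ)) (by
    intro τ hτ
    have h4 : 0 < (4 * m * τ).im := by
      have := im_nat_mul hm (im_nat_mul (m := 1) (by norm_num) hτ); convert this using 2; push_cast; ring
    have h1 := (hh.rep _ h4).mul_left (ee ((4 * m * M : ℕ) * τ))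
    have hi : Function.Injective (fun i : ℕ => (i : ℤ) - M) := fun a b hab => by simpa using hab
    have h2 := (hi.hasSum_iff (by
      intro Δ hΔ
      rw [hM Δ, zero_mul, mul_zero]
      by_contra hc
      exact hΔ ⟨(Δ + M).toNat, by simp; omega⟩)).mpr h1
    have hi2 : Function.Injective (fun i : ℕ => 4 * m * i) := fun a b hab => by
      simpa [hm.ne'] using hab
    refine (hi2.hasSum_iff ?_).mp (hs_congr h2 fun i => ?_)
    · intro n hn
      rw [hF, if_neg, zero_mul]
      rintro ⟨j, rfl⟩; exact hn ⟨j, rfl⟩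
    · simp only [Function.comp]
      rw [hF, if_pos ⟨i, rfl⟩]
      have hj : ((4 * m * i : ℕ) : ℤ) / (4 * m) = i := by push_cast; exact Int.mul_ediv_cancel_left _ (by positivity)
      rw [hj, ee_pow, mul_left_comm, ← ee_add]
      congr 2; push_cast; ring)
  refine ⟨this.1, fun τ hτ => ?_⟩
  rw [this.2 _ (im_div4 hm hτ), mul_div_cancel₀ τ (by simpa using hm')]

theorem Lam.gv {k : ℤ} {m : ℕ} {a} (hm : 0 < m) (hL : Lam k m a) : GV k m a := by
  obtain ⟨κ, E, hE, hind⟩ := basis_exists hm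
  choose M0 hM0 using fun j => (hE j).bddN hm
  choose h hh using fun j => hL.alp_sf hm (hE j)
  set M := ∑ j ∈ Finset.range (2 * m), M0 j with hMd
  have hM : ∀ j : Fin (2 * m), ∀ Δ l : ℤ, Δ < -(4 * m * M : ℕ) → (E j).coeff Δ l = 0 := by
    intro j Δ l hΔ
    refine hM0 j Δ l (hΔ.trans_le (neg_le_neg ?_))
    have h1 : M0 j ≤ M := Finset.single_le_sum (f := M0) (fun _ _ => Nat.zero_le _) (Finset.mem_range.mpr j.2)
    have : M0 j ≤ 4 * m * M := h1.trans (Nat.le_mul_of_pos_left _ (by positivity))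
    exact_mod_cast this
  have hal : ∀ j : Fin (2 * m), ∀ n : ℤ, n < -M → alp m a (E j).coeff n = 0 := by
    intro j n hn
    unfold alp
    refine Finset.sum_eq_zero fun x _ => ?_
    rw [← tsum_zero (β := ℕ)]
    congr 1; funext D
    rw [hM j, mul_zero]
    have hm1 : (1 : ℤ) ≤ m := by exact_mod_cast hm
    push_cast
    nlinarith
  let P : Matrix (Fin (2 * m)) (Fin (2 * m)) (PowerSeries ℂ) := fun j x => PowerSeries.mk fun i : ℕ => (E j).coeff (i - (4 * m * M : ℕ)) (x : ℕ)
  let G : Fin (2 * m) → PowerSeries ℂ := fun x => PowerSeries.mk fun D => a D (x : ℕ)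
  have hps := fun (j x : Fin (2 * m)) => hc_ps hm (E j) (x : ℕ) _ (hM j)
  have hrow : ∀ j, PConv ((P.mulVec G) j) ∧ ∀ τ : ℂ, 0 < τ.im → evP ((P.mulVec G) j) (ee (τ / (4 * m))) = ee ((4 * m * M : ℕ) * (τ / (4 * m))) * h j τ :=
    fun j => (hh j).row hm M (hal j) _ (alp_row hm (E j) M hL.supp (hM j))
  have hdet : ∀ τ : ℂ, 0 < τ.im → ∀ v : Fin (2 * m) → ℂ, (∀ x : Fin (2 * m), ∑ j, v j * hc (E j) (x : ℕ) τ = 0) → v = 0 := by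
    intro τ hτ v hv
    have := hind τ hτ (fun j => if hj : j < 2 * m then v ⟨j, hj⟩ else 0) (fun z => by
      rw [sum_rr]
      simp only [Fin.is_lt, dite_true, theta_dec hm _ hτ, Finset.mul_sum]
      rw [Finset.sum_comm, sum_rr]
      refine Finset.sum_eq_zero fun x _ => ?_
      simp only [← mul_assoc, ← Finset.sum_mul]
      have := hv x
      push_cast at this
      rw [this, zero_mul])
    funext j
    simpa using this j j.2
  have hdet' : ∀ τ : ℂ, 0 < τ.im → (Matrix.of fun j x : Fin (2 * m) => hc (E j) (x : ℕ) τ).det ≠ 0 := by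
    intro τ hτ h0
    obtain ⟨v, hv, hv0⟩ := Matrix.exists_vecMul_eq_zero_iff.mpr h0
    exact hv (hdet τ hτ v fun x => by simpa [Matrix.vecMul, dotProduct] using congrFun hv0 x)
  have hP : ∀ i j, PConv (P i j) := fun j x => (hps j x).1
  have hconv := mat_conv P G hP (fun j => (hrow j).1) (by
    intro x hx h0
    obtain ⟨τ, hτ, rfl⟩ := exists_ee h0 hx
    have h4 : 0 < (4 * m * τ).im := by
      have := im_nat_mul hm (im_nat_mul (m := 1) (by norm_num) hτ); convert this using 2; push_cast; ring
    have e : τ = (4 * m * τ) / (4 * m) := by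
      have hm' : (m : ℂ) ≠ 0 := by exact_mod_cast hm.ne'
      field_simp
    rw [e]
    have : (Matrix.of fun j x => evP (P j x) (ee (4 * m * τ / (4 * m)))) = ee ((4 * m * M : ℕ) * (4 * m * τ / (4 * m))) • Matrix.of fun j x : Fin (2 * m) => hc (E j) (x : ℕ) (4 * m * τ) := by
      ext j x
      simp only [Matrix.of_apply, Matrix.smul_apply, smul_eq_mul]
      exact (hps j x).2 _ h4
    rw [this, Matrix.det_smul]
    exact mul_ne_zero (pow_ne_zero _ (ee_ne _)) (hdet' _ h4))
  have hper : ∀ (x : ℤ), ∃ x0 : Fin (2 * m), (∀ D, a D x = a D (x0 : ℕ)) ∧ ∃ j : ℤ, x = (x0 : ℕ) + 2 * m * j := by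
    intro x
    have h2 : (0 : ℤ) < 2 * m := by positivity
    have h3 := Int.emod_nonneg x h2.ne'
    have h4 := Int.emod_lt_of_pos x h2
    refine ⟨⟨(x % (2 * m)).toNat, by omega⟩, fun D => ?_, x / (2 * m), ?_⟩
    · refine per_mod (f := fun l => a D l) (N := 2 * m) (by intro l; push_cast; exact hL.per D l) ?_
      simp only [Int.toNat_of_nonneg h3]
      push_cast
      exact Int.dvd_self_sub_emod
    · simp only [Int.toNat_of_nonneg h3]
      exact (Int.emod_add_mul_ediv _ _).symm
  have hval : ∀ (j : Fin (2 * m)) (τ : ℂ), 0 < τ.im → ∑ x : Fin (2 * m), hc (E j) (x : ℕ) τ * gS m a (x : ℕ) τ = h j τ := by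
    intro j τ hτ
    have h1 := (hrow j).2 τ hτ
    have h2 := (PConv.sum Finset.univ (fun x _ => ((hP j x).mul (hconv x)).1)).2 _ (norm_ee_lt (im_div4 hm hτ))
    rw [Matrix.mulVec, dotProduct, h2] at h1
    refine mul_left_cancel₀ (ee_ne ((4 * m * M : ℕ) * (τ / (4 * m)))) ?_
    rw [← h1, Finset.mul_sum]
    refine Finset.sum_congr rfl fun x _ => ?_
    rw [((hP j x).mul (hconv x)).2 _ (norm_ee_lt (im_div4 hm hτ)), ← mul_assoc]
    congr 1
    · exact ((hps j x).2 τ hτ).symm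
    · exact gS_ev _ _ _
  refine ⟨hL.per, hL.supp, hL.par, fun x => ?_, fun τ hτ x => ?_⟩
  · obtain ⟨x0, h0, -⟩ := hper x
    simp only [h0]; exact hconv x0
  · obtain ⟨x0, h0, jj, hj⟩ := hper x
    have e1 : gS m a x (-1 / τ) = gS m a (x0 : ℕ) (-1 / τ) := by unfold gS; simp only [h0]
    have hm' : (m : ℂ) ≠ 0 := by exact_mod_cast hm.ne'
    have e2 : ∀ y : ℕ, ee (-(x * y : ℂ) / (2 * m)) = ee (-((x0 : ℕ) * y : ℂ) / (2 * m)) := by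
      intro y
      rw [hj, ← ee_add_int _ (jj * y)]
      congr 1; push_cast; field_simp; ring
    simp only [e1, e2]
    set v : Fin (2 * m) → ℂ := fun x => gS m a (x : ℕ) (-1 / τ) - τ ^ (2 - k) * sqI (τ / (2 * m)) * ∑ y ∈ Finset.range (2 * m), ee (-((x : ℕ) * y : ℂ) / (2 * m)) * gS m a y τ with hv
    have hz : (Matrix.of fun j x : Fin (2 * m) => hc (E j) (x : ℕ) (-1 / τ)).mulVec v = 0 := by
      funext j
      have s1 := hval j _ (im_S hτ)
      rw [(hh j).slaw τ hτ, ← hval j τ hτ] at s1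
      have s2 : ∀ y : Fin (2 * m), _ := fun y => hc_S hm (E j) (hE j) hτ y y.2
      simp only [Matrix.mulVec, dotProduct, Matrix.of_apply, hv, mul_sub, Finset.sum_sub_distrib, s1, Pi.zero_apply]
      rw [show 2 - (k - κ j) = (2 - k) + κ j by ring, zpow_add₀ (ne_zero_of_im hτ), mul_assoc, Finset.mul_sum, sub_eq_zero]
      simp only [← mul_assoc]
      have s3 : ∀ y : Fin (2 * m), τ ^ κ j * hc (E j) (y : ℕ) τ * gS m a (y : ℕ) τ = ∑ x : Fin (2 * m), sqI (τ / (2 * m)) * (hc (E j) (x : ℕ) (-1 / τ) * ee (-((x : ℕ) * (y : ℕ) : ℂ) / (2 * m))) * gS m a (y : ℕ) τ := by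
        intro y
        rw [← Finset.sum_mul, ← Finset.mul_sum]
        congr 1
        have := s2 y
        rw [sum_rr] at this
        exact this.symm
      simp only [s3, sum_rr, Finset.mul_sum]
      rw [Finset.sum_comm]
      refine Finset.sum_congr rfl fun x _ => Finset.sum_congr rfl fun y _ => ?_
      push_cast; ring
    have hv0 : v = 0 := by
      by_contra hne
      exact hdet' _ (im_S hτ) (Matrix.exists_mulVec_eq_zero_iff.mp ⟨v, hne, hz⟩)
    have := congrFun hv0 x0
    exact sub_eq_zero.mp this

def elin {m : ℕ} (s t : ℂ) (E E' : EllFormData m) : EllFormData m where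
  toFun := fun τ z => s * E.toFun τ z + t * E'.toFun τ z
  coeff := fun Δ l => s * E.coeff Δ l + t * E'.coeff Δ l
  holo := fun τ z h => ((E.holo τ z h).const_mul s).add ((E'.holo τ z h).const_mul t)
  elliptic := fun τ h z l u => by beta_reduce; rw [E.elliptic τ h, E'.elliptic τ h]; ring
  expansion := fun τ z h => hs_congr (((E.expansion τ z h).mul_left s).add ((E'.expansion τ z h).mul_left t)) fun p => by ring
  periodic := fun Δ l => by rw [E.periodic, E'.periodic]
  support := fun Δ l h => by rw [E.support Δ l h, E'.support Δ l h]; ring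

theorem JB.lin {k : ℤ} {m : ℕ} {E E' : EllFormData m} (s t : ℂ) (h : JB k E) (h' : JB k E') : JB k (elin s t E E') :=
  (JF.smul s h).add (JF.smul t h')

theorem JB.lin0 {k : ℤ} {m : ℕ} (E : EllFormData m) : JB k (elin 0 0 E E) where
  hol := (elin 0 0 E E).holo
  ell := (elin 0 0 E E).elliptic
  slaw := fun τ z h => by simp [elin]
  rep := (elin 0 0 E E).expansion
  bdd := ⟨0, fun p _ => by simp [elin]⟩

theorem decomp {k : ℤ} {m : ℕ} (hm : 0 < m) (φ : EllFormData m) (hpar : ∀ Δ l : ℤ, φ.coeff Δ (-l) = (-1 : ℂ) ^ k * φ.coeff Δ l)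
    (hb : ∃ M : ℕ, ∀ Δ l : ℤ, Δ < -M → φ.coeff Δ l = 0) (ho : ∀ a, Lam k m a → pair m a φ.coeff = 0) :
    ∃ ψ : EllFormData m, JB k ψ ∧ ∀ Δ l : ℤ, Δ ≤ 0 → ψ.coeff Δ l = φ.coeff Δ l := by
  have : NeZero (2 * m) := ⟨by positivity⟩
  let pol : EllFormData m → (ℕ × ZMod (2 * m) → ℂ) := fun E q => E.coeff (-q.1) q.2.val
  have hval : ∀ (E : EllFormData m) (Δ x : ℤ), E.coeff Δ x = E.coeff Δ (x : ZMod (2 * m)).val := fun E Δ x =>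
    per_mod (f := fun l => E.coeff Δ l) (N := (2 * m : ℕ)) (by intro l; push_cast; exact E.periodic Δ l) (by
      rw [← ZMod.intCast_zmod_eq_zero_iff_dvd]; simp)
  let W : Submodule ℂ (ℕ × ZMod (2 * m) → ℂ) :=
    { carrier := {v | ∃ E : EllFormData m, JB k E ∧ v = pol E}
      add_mem' := by
        rintro _ _ ⟨E, h, rfl⟩ ⟨E', h', rfl⟩
        exact ⟨_, h.lin 1 1 h', by funext q; simp [pol, elin]⟩
      zero_mem' := ⟨_, JB.lin0 φ, by funext q; simp [pol, elin]⟩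
      smul_mem' := by
        rintro c _ ⟨E, h, rfl⟩
        exact ⟨_, h.lin c 0 h, by funext q; simp [pol, elin]⟩ }
  by_cases hmem : pol φ ∈ W
  · obtain ⟨ψ, h1, h2⟩ := hmem
    refine ⟨ψ, h1, fun Δ l hΔ => ?_⟩
    have := congrFun h2 (Δ.natAbs, (l : ZMod (2 * m)))
    simp only [pol] at this
    rw [show -(Δ.natAbs : ℤ) = Δ by omega] at this
    rw [hval, hval φ, this]
  · exfalso
    obtain ⟨f, hf, hW⟩ := Submodule.exists_le_ker_of_notMem hmem
    let a0 : ℕ → ℤ → ℂ := fun D x => f (Pi.single (D, (x : ZMod (2 * m))) 1)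
    have ha0 : ∀ D x, a0 D (x + (2 * m : ℕ)) = a0 D x := by intro D x; simp [a0, show (2 * (m : ZMod (2 * m))) = 0 by exact_mod_cast ZMod.natCast_self (2 * m)]
    let a : ℕ → ℤ → ℂ := fun D x => if (4 * (m : ℤ)) ∣ (D : ℤ) - x ^ 2 then (a0 D x + (-1) ^ k * a0 D (-x)) / 2 else 0
    have hsq : ((-1 : ℂ) ^ k) * (-1) ^ k = 1 := by rw [← mul_zpow]; simp
    have key : ∀ E : EllFormData m, (∀ Δ l : ℤ, E.coeff Δ (-l) = (-1 : ℂ) ^ k * E.coeff Δ l) →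
        (∃ M : ℕ, ∀ Δ l : ℤ, Δ < -M → E.coeff Δ l = 0) → pair m a E.coeff = f (pol E) := by
      rintro E hp ⟨M, hM⟩
      have e1 : pol E = ∑ D ∈ Finset.range (M + 1), ∑ u : ZMod (2 * m), E.coeff (-D) u.val • Pi.single (D, u) (1 : ℂ) := by
        funext ⟨D, u⟩
        simp only [Finset.sum_apply, Pi.smul_apply, Pi.single_apply, Prod.mk.injEq, smul_eq_mul, mul_ite, mul_one, mul_zero, ite_and, pol]
        rw [Finset.sum_eq_single D]
        · simp
        · intro D' _ h; simp [Ne.symm h]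
        · intro h
          simp only [if_true, Finset.sum_ite_eq, Finset.mem_univ]
          rw [hM]; simp at h; omega
      have e2 : ∀ D : ℕ, ∑ x ∈ Finset.range (2 * m), a D x * E.coeff (-D) x = ∑ u : ZMod (2 * m), E.coeff (-D) u.val * f (Pi.single (D, u) 1) := by
        intro D
        have h1 := sum_aff (N := 2 * m) (by positivity) (f := fun x => a0 D x * E.coeff (-D) x)
          (fun l => by simp only [ha0]; push_cast; rw [E.periodic]) (-1) 0 ⟨-1, 0, by ring⟩
        have h2 : ∀ x : ℕ, a D x * E.coeff (-D) x = (a0 D x * E.coeff (-D) x + a0 D (-1 * x + 0) * E.coeff (-D) (-1 * x + 0)) / 2 := by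
          intro x
          rw [add_zero, neg_one_mul, hp]
          simp only [a]
          split_ifs with hd
          · ring
          · rw [E.support]; · ring
            · intro h; apply hd; rw [← dvd_neg]; rw [neg_sub, sub_eq_neg_add]; exact h
        simp only [h2, ← Finset.sum_div, Finset.sum_add_distrib, h1]
        rw [add_self_div_two, ← sum_zmod fun u : ZMod (2 * m) => E.coeff (-D) u.val * f (Pi.single (D, u) 1)]
        refine Finset.sum_congr rfl fun x _ => ?_
        simp only [a0]
        rw [hval E, mul_comm]; simp
      rw [e1]
      simp only [map_sum, map_smul, smul_eq_mul, ← e2]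
      unfold pair
      rw [Finset.sum_comm]
      refine Finset.sum_congr rfl fun x _ => ?_
      rw [tsum_nat_fin (M + 1)]
      intro D hD; rw [hM, mul_zero]; omega
    refine hf ?_
    rw [← key φ hpar hb]
    refine ho a ⟨fun D x => ?_, fun D x h => if_neg h, fun D x => ?_, fun E hE => ?_⟩
    · simp only [a]
      have := ha0 D x
      have h2 := ha0 D (-x - 2 * m)
      push_cast at this h2
      rw [sub_add_cancel] at h2
      have h3 : (4 * (m : ℤ)) ∣ D - (x + 2 * m) ^ 2 ↔ (4 * (m : ℤ)) ∣ D - x ^ 2 := by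
        rw [show (D : ℤ) - x ^ 2 = D - (x + 2 * m) ^ 2 + 4 * m * (x + m) by ring]
        exact (dvd_add_left (dvd_mul_right _ _)).symm
      simp only [h3, this, h2, neg_add']
    · simp only [a, neg_sq, neg_neg]
      split_ifs
      · linear_combination (-a0 D (-x) / 2) * hsq
      · ring
    · rw [key E hE.parity (hE.bddN hm)]
      exact hW ⟨E, hE, rfl⟩

theorem orth_sum {N : ℕ} (hN : 0 < N) (t : ℤ) : ∑ x ∈ Finset.range N, ee ((x * t : ℂ) / N) = if (N : ℤ) ∣ t then (N : ℂ) else 0 := by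
  have hN' : (N : ℂ) ≠ 0 := by exact_mod_cast hN.ne'
  have e : ∀ x : ℕ, ee ((x * t : ℂ) / N) = ee (t / N) ^ x := fun x => by rw [ee_pow]; congr 1; ring
  simp only [e]
  split_ifs with h
  · obtain ⟨j, rfl⟩ := h
    rw [show (((N : ℤ) * j : ℤ) : ℂ) / N = j by push_cast; field_simp, ee_int]
    simp
  · have h1 : ee ((t : ℂ) / N) ≠ 1 := by
      rw [Ne, ee_eq_one_iff]
      rintro ⟨j, hj⟩
      rw [div_eq_iff hN'] at hj
      exact h ⟨j, by rw [mul_comm]; exact_mod_cast hj⟩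
    have h2 := geom_sum_mul (ee ((t : ℂ) / N)) N
    rw [ee_pow, mul_div_cancel₀ _ hN', ee_int, sub_self] at h2
    exact (mul_eq_zero.mp h2).resolve_right (sub_ne_zero.mpr h1)

theorem orth_rr {N : ℕ} (hN : 0 < N) {y z : ℕ} (hy : y < N) (hz : z < N) :
    ∑ x ∈ Finset.range N, ee (((x : ℂ) * ((z - y : ℤ) : ℂ)) / N) = if y = z then (N : ℂ) else 0 := by
  rw [orth_sum hN]
  congr 1
  apply propext
  constructor
  · intro h
    have := Int.eq_zero_of_abs_lt_dvd h (by rw [abs_lt]; omega)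
    omega
  · rintro rfl; simp

theorem parseval {N : ℕ} (hN : 0 < N) (v : ℕ → ℂ) :
    ∑ x ∈ Finset.range N, ‖∑ y ∈ Finset.range N, ee (-(x * y : ℂ) / N) * v y‖ ^ 2 = N * ∑ y ∈ Finset.range N, ‖v y‖ ^ 2 := by
  have hcj : ∀ x z : ℕ, (starRingEnd ℂ) (ee (-(x * z : ℂ) / N)) = ee ((x * z : ℂ) / N) := by
    intro x z
    unfold ee
    rw [← Complex.exp_conj]; congr 1
    simp
    rw [show (starRingEnd ℂ) 2 = 2 from Complex.conj_ofNat 2]; ring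
  have : ((∑ x ∈ Finset.range N, ‖∑ y ∈ Finset.range N, ee (-(x * y : ℂ) / N) * v y‖ ^ 2 : ℝ) : ℂ) = ((N * ∑ y ∈ Finset.range N, ‖v y‖ ^ 2 : ℝ) : ℂ) := by
    push_cast
    simp only [← Complex.mul_conj', map_sum, map_mul, hcj, Finset.sum_mul_sum]
    rw [Finset.sum_comm, Finset.mul_sum]
    refine Finset.sum_congr rfl fun y hy => ?_
    rw [Finset.sum_comm]
    have : ∀ z ∈ Finset.range N, ∑ x ∈ Finset.range N, ee (-(x * y : ℂ) / N) * v y * (ee ((x * z : ℂ) / N) * (starRingEnd ℂ) (v z)) =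
        if y = z then N * (v y * (starRingEnd ℂ) (v y)) else 0 := by
      intro z hz
      have h1 := orth_rr hN (Finset.mem_range.mp hy) (Finset.mem_range.mp hz)
      have h2 : ∀ x : ℕ, ee (-(x * y : ℂ) / N) * v y * (ee ((x * z : ℂ) / N) * (starRingEnd ℂ) (v z)) = ee (((x : ℂ) * ((z - y : ℤ) : ℂ)) / N) * (v y * (starRingEnd ℂ) (v z)) := by
        intro x
        rw [show ((x : ℂ) * ((z - y : ℤ) : ℂ)) / N = -(x * y : ℂ) / N + (x * z : ℂ) / N by push_cast; ring, ee_add]; ring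
      simp only [h2, ← Finset.sum_mul, h1]
      split_ifs with hh
      · rw [hh]
      · rw [zero_mul]
    rw [Finset.sum_congr rfl this, Finset.sum_ite_eq, if_pos hy]
  exact_mod_cast this

theorem evP_coeff {f : PowerSeries ℂ} (hf : PConv f) {r M : ℝ} (h0 : 0 < r) (h1 : r < 1)
    (h : ∀ x : ℂ, ‖x‖ = r → ‖evP f x‖ ≤ M) (n : ℕ) : ‖f.coeff n‖ * r ^ n ≤ M := by
  have h2 := Complex.norm_iteratedDeriv_le_of_forall_mem_sphere_norm_le (c := 0) (f := evP f) n h0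
    ((hf.diff.mono (by rw [closure_ball _ h0.ne']; exact Metric.closedBall_subset_ball h1)).diffContOnCl) (C := M)
    fun z hz => h z (by simpa using hz)
  have h3 := hf.fps.factorial_smul 1 n
  rw [iteratedDeriv_eq_iteratedFDeriv, ← h3] at h2
  simp [FormalMultilinearSeries.ofScalars] at h2
  rw [mul_div_assoc] at h2
  have := le_of_mul_le_mul_left h2 (by positivity)
  rwa [le_div_iff₀ (by positivity)] at this

theorem sqI_norm {m : ℕ} (hm : 0 < m) {τ : ℂ} (hτ : 0 < τ.im) : ‖sqI (τ / (2 * m))‖ ^ 2 * (2 * m) = ‖τ‖ := by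
  rw [← norm_pow, sq_sq (im_nat_div hm hτ)]
  simp
  field_simp

theorem GV.inv {k : ℤ} {m : ℕ} {a} (hm : 0 < m) (hG : GV k m a) (g : Matrix.SpecialLinearGroup (Fin 2) ℤ) (τ : UpperHalfPlane) :
    (g • τ).im ^ (5 / 2 - k : ℝ) * ∑ x ∈ Finset.range (2 * m), ‖gS m a x (g • τ : UpperHalfPlane)‖ ^ 2 =
    τ.im ^ (5 / 2 - k : ℝ) * ∑ x ∈ Finset.range (2 * m), ‖gS m a x τ‖ ^ 2 := by
  have hm' : (m : ℂ) ≠ 0 := by exact_mod_cast hm.ne'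
  set Φ : UpperHalfPlane → ℝ := fun τ => τ.im ^ (5 / 2 - k : ℝ) * ∑ x ∈ Finset.range (2 * m), ‖gS m a x τ‖ ^ 2 with hΦ
  change Φ (g • τ) = Φ τ
  have hS : ∀ τ, Φ (ModularGroup.S • τ) = Φ τ := by
    intro τ
    have hτ := τ.im_pos
    have h0 : 0 < ‖(τ : ℂ)‖ := norm_pos_iff.mpr τ.ne_zero
    have h1 : ((ModularGroup.S • τ : UpperHalfPlane) : ℂ) = -1 / (τ : ℂ) := by
      rw [UpperHalfPlane.modular_S_smul]; simp [neg_div]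
    have h2 : (ModularGroup.S • τ).im = τ.im / ‖(τ : ℂ)‖ ^ 2 := by
      rw [← UpperHalfPlane.coe_im, h1, ← Complex.normSq_eq_norm_sq]; simp [Complex.div_im, neg_div]
    have h3 := sqI_norm hm hτ
    have h4 := parseval (N := 2 * m) (by omega) fun y => gS m a y τ
    simp only [hΦ, h1, h2]
    simp only [hG.slaw _ hτ, norm_mul, mul_pow, ← Finset.mul_sum]
    push_cast at h4 ⊢
    rw [h4, Real.div_rpow hτ.le (by positivity), ← Real.rpow_natCast ‖(τ : ℂ)‖ 2, ← Real.rpow_mul h0.le, norm_zpow, ← Real.rpow_intCast,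
      ← Real.rpow_natCast _ 2, ← Real.rpow_mul h0.le]
    have h5 : ‖(τ : ℂ)‖ ^ (((2 - k : ℤ) : ℝ) * (2 : ℕ)) * ‖(τ : ℂ)‖ = ‖(τ : ℂ)‖ ^ (((2 : ℕ) : ℝ) * (5 / 2 - k)) := by
      conv_lhs => rw [← Real.rpow_add_one h0.ne']
      congr 1; push_cast; ring
    rw [← h5, ← h3]
    have h6 := (Real.rpow_pos_of_pos (h3 ▸ h0) (((2 - k : ℤ) : ℝ) * (2 : ℕ))).ne'
    have h7 := (h3 ▸ h0 : 0 < ‖sqI (τ / (2 * m))‖ ^ 2 * (2 * m)).ne'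
    generalize ‖sqI (τ / (2 * m))‖ ^ 2 = A at *
    generalize (A * (2 * (m : ℝ))) ^ (((2 - k : ℤ) : ℝ) * (2 : ℕ)) = B at *
    have h8 : A ≠ 0 := left_ne_zero_of_mul h7
    field_simp
  have hT : ∀ τ, Φ (ModularGroup.T • τ) = Φ τ := by
    intro τ
    simp only [hΦ, UpperHalfPlane.modular_T_smul]
    rw [UpperHalfPlane.vadd_im]
    congr 1
    refine Finset.sum_congr rfl fun x _ => ?_
    congr 1
    have : gS m a x ((((1 : ℝ) +ᵥ τ : UpperHalfPlane) : ℂ)) = ee ((x : ℂ) ^ 2 / (4 * m)) * gS m a x τ := by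
      unfold gS
      rw [← tsum_mul_left]
      congr 1; funext D
      by_cases h : (4 * (m : ℤ)) ∣ (D : ℤ) - (x : ℤ) ^ 2
      · obtain ⟨j, hj⟩ := h
        have hj' : (D : ℂ) = x ^ 2 + 4 * m * j := by
          have := congrArg (Int.cast : ℤ → ℂ) hj
          push_cast at this
          linear_combination this
        have : ee ((D : ℂ) * ((((1 : ℝ) +ᵥ τ : UpperHalfPlane) : ℂ) / (4 * m))) = ee ((x : ℂ) ^ 2 / (4 * m)) * ee (D * (τ / (4 * m))) := by
          rw [← ee_add, ← ee_add_int ((x : ℂ) ^ 2 / (4 * m) + D * (τ / (4 * m))) j]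
          congr 1
          rw [UpperHalfPlane.coe_vadd, hj']; push_cast; field_simp; ring
        rw [this]; ring
      · rw [hG.supp D x h]; simp
    rw [this, norm_mul, show (x : ℂ) ^ 2 / (4 * m) = (((x : ℝ) ^ 2 / (4 * m) : ℝ) : ℂ) by push_cast; rfl, norm_ee_real, one_mul]
  have hg : g ∈ Subgroup.closure {ModularGroup.S, ModularGroup.T} := by
    rw [SpecialLinearGroup.SL2Z_generators]; trivial
  induction hg using Subgroup.closure_induction generalizing τ with
  | mem x hx => rcases hx with rfl | rfl <;> [exact hS τ; exact hT τ]
  | one => rw [one_smul]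
  | mul x y _ _ hx hy => rw [mul_smul, hx, hy]
  | inv x _ hx => rw [← hx (x⁻¹ • τ), smul_inv_smul]

theorem GV.bd0 {k : ℤ} {m : ℕ} {a} (hm : 0 < m) (hG : GV k m a) : ∃ C : ℝ, 0 ≤ C ∧ ∀ τ : ℂ, 1 / 2 ≤ τ.im →
    ∑ x ∈ Finset.range (2 * m), ‖gS m a x τ‖ ^ 2 ≤ C := by
  have hm' : (0 : ℝ) < m := by exact_mod_cast hm
  set r : ℝ := Real.exp (-(2 * Real.pi * (1 / (8 * m)))) with hr
  have hr1 : r < 1 := Real.exp_lt_one_iff.mpr (by have := Real.pi_pos; rw [neg_lt_zero]; positivity)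
  have h1 : ∀ x : ℕ, ∃ C, ∀ q : ℂ, ‖q‖ ≤ r → ‖evP (PowerSeries.mk fun D => a D (x : ℤ)) q‖ ≤ C := by
    intro x
    obtain ⟨C, hC⟩ := (isCompact_closedBall (0 : ℂ) r).exists_bound_of_continuousOn
      ((hG.conv x).diff.continuousOn.mono (Metric.closedBall_subset_ball hr1))
    exact ⟨C, fun q hq => hC q (by simpa using hq)⟩
  choose C hC using h1
  refine ⟨∑ x ∈ Finset.range (2 * m), C x ^ 2, Finset.sum_nonneg fun _ _ => sq_nonneg _, fun τ hτ => Finset.sum_le_sum fun x _ => ?_⟩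
  rw [gS_ev]
  refine pow_le_pow_left₀ (norm_nonneg _) (hC x _ ?_) 2
  rw [norm_ee, hr]
  apply Real.exp_le_exp.mpr
  rw [show (τ / (4 * m) : ℂ).im = τ.im / (4 * m) by rw [show (4 * m : ℂ) = ((4 * m : ℝ) : ℂ) by push_cast; ring, Complex.div_ofReal_im]]
  have : 1 / (8 * (m : ℝ)) ≤ τ.im / (4 * m) := by rw [div_le_div_iff₀ (by positivity) (by positivity)]; nlinarith
  have := mul_le_mul_of_nonneg_left this Real.two_pi_pos.le
  linarith

theorem GV.bd {k : ℤ} (hk : 2 ≤ k) {m : ℕ} {a} (hm : 0 < m) (hG : GV k m a) : ∃ C : ℝ, 0 ≤ C ∧ ∀ τ : ℂ, 0 < τ.im → τ.im ≤ 1 →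
    ∑ x ∈ Finset.range (2 * m), ‖gS m a x τ‖ ^ 2 ≤ C * τ.im ^ (if k = 2 then -1 else k - 5 / 2 : ℝ) := by
  obtain ⟨C, hC0, hC⟩ := hG.bd0 hm
  refine ⟨C * (if k = 2 then 1 else (1 / 2 : ℝ) ^ (5 / 2 - k : ℝ)), by positivity, fun τ hτ h1 => ?_⟩
  set t : UpperHalfPlane := ⟨τ, hτ⟩
  obtain ⟨g, hg⟩ := ModularGroup.exists_smul_mem_fd t
  have h2 := hG.inv hm g t
  have h3 := ModularGroup.three_le_four_mul_im_sq_of_mem_fd hg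
  have hY := (g • t).im_pos
  have h4 : 1 / 2 ≤ (g • t).im := by nlinarith
  have h5 := hC _ h4
  have hti : t.im = τ.im := rfl
  have htc : (t : ℂ) = τ := rfl
  rw [hti, htc] at h2
  set S := ∑ x ∈ Finset.range (2 * m), ‖gS m a x τ‖ ^ 2
  have h6 : S = τ.im ^ (k - 5 / 2 : ℝ) * ((g • t).im ^ (5 / 2 - k : ℝ) * ∑ x ∈ Finset.range (2 * m), ‖gS m a x (g • t : UpperHalfPlane)‖ ^ 2) := by
    rw [h2, ← mul_assoc, ← Real.rpow_add hτ]; simp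
  have h7 : S ≤ τ.im ^ (k - 5 / 2 : ℝ) * ((g • t).im ^ (5 / 2 - k : ℝ) * C) := by
    rw [h6]; gcongr
  refine h7.trans ?_
  split_ifs with hk2
  · subst hk2
    have h8 : (g • t).im ≤ τ.im⁻¹ := by
      rw [ModularGroup.im_smul_eq_div_normSq, hti, ModularGroup.denom_apply, htc, inv_eq_one_div]
      have e2 : Complex.normSq ((g 1 0 : ℂ) * τ + g 1 1) = (g 1 0 * τ.re + g 1 1) ^ 2 + (g 1 0 * τ.im) ^ 2 := by
        rw [Complex.normSq_apply]; simp; ring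
      have e3 : τ.im ^ 2 ≤ Complex.normSq ((g 1 0 : ℂ) * τ + g 1 1) := by
        rw [e2]
        by_cases hc : g 1 0 = 0
        · have hd : g 1 1 ≠ 0 := by
            intro hd
            have := g.det_coe
            rw [Matrix.det_fin_two] at this
            simp [hc, hd] at this
          have : (1 : ℝ) ≤ (g 1 1 : ℝ) ^ 2 := by exact_mod_cast (show 1 ≤ g 1 1 ^ 2 by have := sq_pos_of_ne_zero hd; omega)
          rw [hc]; simp; nlinarith
        · have : (1 : ℝ) ≤ (g 1 0 : ℝ) ^ 2 := by exact_mod_cast (show 1 ≤ g 1 0 ^ 2 by have := sq_pos_of_ne_zero hc; omega)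
          nlinarith [sq_nonneg ((g 1 0 : ℝ) * τ.re + g 1 1), sq_nonneg τ.im]
      rw [div_le_div_iff₀ (by nlinarith) hτ]; nlinarith
    have h9 : (g • t).im ^ (5 / 2 - (2 : ℤ) : ℝ) ≤ (τ.im⁻¹) ^ (5 / 2 - (2 : ℤ) : ℝ) := Real.rpow_le_rpow hY.le h8 (by norm_num)
    rw [Real.inv_rpow hτ.le, ← Real.rpow_neg hτ.le] at h9
    calc _ ≤ τ.im ^ ((2 : ℤ) - 5 / 2 : ℝ) * (τ.im ^ (-(5 / 2 - (2 : ℤ)) : ℝ) * C) := by gcongr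
      _ = _ := by
        rw [← mul_assoc, ← Real.rpow_add hτ, show ((2 : ℤ) - 5 / 2 + -(5 / 2 - (2 : ℤ)) : ℝ) = -1 by norm_num]; ring
  · have : (g • t).im ^ (5 / 2 - k : ℝ) ≤ (1 / 2 : ℝ) ^ (5 / 2 - k : ℝ) :=
      Real.rpow_le_rpow_of_nonpos (by norm_num) h4 (by have : (3 : ℝ) ≤ k := by exact_mod_cast (by omega : (3 : ℤ) ≤ k)
                                                       linarith)
    calc _ ≤ τ.im ^ (k - 5 / 2 : ℝ) * ((1 / 2 : ℝ) ^ (5 / 2 - k : ℝ) * C) := by gcongr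
      _ = _ := by ring

theorem GV.cbd {k : ℤ} (hk : 2 ≤ k) {m : ℕ} {a} (hm : 0 < m) (hG : GV k m a) : ∃ C : ℝ, 0 ≤ C ∧ ∀ y : ℝ, 0 < y → y ≤ 1 → ∀ (D x : ℕ), x < 2 * m →
    ‖a D x‖ ^ 2 * Real.exp (-(2 * Real.pi * (y / (4 * m)))) ^ (2 * D) ≤ C * y ^ (if k = 2 then -1 else k - 5 / 2 : ℝ) := by
  obtain ⟨C, hC0, hC⟩ := hG.bd hk hm
  have hm' : (0 : ℝ) < m := by exact_mod_cast hm
  refine ⟨C, hC0, fun y h0 h1 D x hx => ?_⟩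
  set M := C * y ^ (if k = 2 then -1 else k - 5 / 2 : ℝ)
  have hr1 : Real.exp (-(2 * Real.pi * (y / (4 * m)))) < 1 := Real.exp_lt_one_iff.mpr (by have := Real.pi_pos; rw [neg_lt_zero]; positivity)
  have h2 := evP_coeff (hG.conv x) (r := Real.exp (-(2 * Real.pi * (y / (4 * m))))) (M := √M) (Real.exp_pos _)
    hr1 (fun q hq => by
      obtain ⟨τ, -, h3⟩ := exists_ee (norm_pos_iff.mp (hq ▸ Real.exp_pos _)) (hq ▸ hr1)
      have hmc : (m : ℂ) ≠ 0 := by exact_mod_cast hm.ne'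
      have h4 : τ = (4 * m * τ) / (4 * m) := by field_simp
      rw [← h3, norm_ee, Real.exp_eq_exp, neg_inj, mul_right_inj' Real.two_pi_pos.ne'] at hq
      have h5 : (4 * m * τ : ℂ).im = y := by
        rw [show (4 * m * τ : ℂ) = ((4 * m : ℝ) : ℂ) * τ by push_cast; ring, Complex.im_ofReal_mul, hq]; field_simp
      rw [← h3, h4, ← gS_ev]
      apply Real.le_sqrt_of_sq_le
      have h6 := hC (4 * m * τ) (h5 ▸ h0) (h5 ▸ h1)
      rw [h5] at h6
      exact (Finset.single_le_sum (f := fun x : ℕ => ‖gS m a x (4 * m * τ)‖ ^ 2) (fun _ _ => sq_nonneg _) (Finset.mem_range.mpr hx)).trans h6) D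
  rw [PowerSeries.coeff_mk] at h2
  have h3 := pow_le_pow_left₀ (by positivity) h2 2
  rw [Real.sq_sqrt (by positivity)] at h3
  rwa [mul_pow, ← pow_mul, mul_comm D 2] at h3

theorem GV.rx {k : ℤ} {m : ℕ} {a} (hm : 0 < m) (hG : GV k m a) (D : ℕ) (x : ℤ) : ∃ y : ℕ, y < 2 * m ∧ a D x = a D y := by
  have h := Int.emod_nonneg x (show (2 * m : ℤ) ≠ 0 by omega)
  have h' := Int.emod_lt_of_pos x (show 0 < (2 * m : ℤ) by omega)
  refine ⟨(x % (2 * m)).toNat, by omega, per_mod (N := 2 * m) (hG.per D) ?_⟩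
  rw [Int.toNat_of_nonneg h]
  exact Int.dvd_self_sub_emod

theorem GV.zero {k : ℤ} (hk : 2 < k) {m : ℕ} {a} (hm : 0 < m) (hG : GV k m a) (D : ℕ) (x : ℤ) : a D x = 0 := by
  obtain ⟨C, hC0, hC⟩ := hG.cbd hk.le hm
  obtain ⟨z, hz, e⟩ := hG.rx hm D x
  rw [e]
  have hk3 : (3 : ℝ) ≤ k := by exact_mod_cast (by omega : (3 : ℤ) ≤ k)
  have t1 : Tendsto (fun y : ℝ => ‖a D z‖ ^ 2 * Real.exp (-(2 * Real.pi * (y / (4 * m)))) ^ (2 * D)) (𝓝[>] 0) (𝓝 (‖a D z‖ ^ 2)) := by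
    refine tendsto_nhdsWithin_of_tendsto_nhds ?_
    have : Continuous fun y : ℝ => ‖a D z‖ ^ 2 * Real.exp (-(2 * Real.pi * (y / (4 * m)))) ^ (2 * D) := by fun_prop
    simpa using this.tendsto 0
  have t2 : Tendsto (fun y : ℝ => C * y ^ (k - 5 / 2 : ℝ)) (𝓝[>] 0) (𝓝 0) := by
    refine tendsto_nhdsWithin_of_tendsto_nhds ?_
    have := ((Real.continuous_rpow_const (q := (k - 5 / 2 : ℝ)) (by linarith)).const_mul C).tendsto 0
    simpa [Real.zero_rpow (by linarith : (k - 5 / 2 : ℝ) ≠ 0)] using this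
  have h := le_of_tendsto_of_tendsto t1 t2 (by
    filter_upwards [self_mem_nhdsWithin, nhdsWithin_le_nhds (Iio_mem_nhds one_pos)] with y h0 h1
    simpa [hk.ne'] using hC y h0 (le_of_lt h1) D z hz)
  have : ‖a D z‖ = 0 := by nlinarith [norm_nonneg (a D z)]
  exact norm_eq_zero.mp this

theorem GV.poly {m : ℕ} {a} (hm : 0 < m) (hG : GV 2 m a) : ∃ C : ℝ, ∀ (D : ℕ) (x : ℤ), ‖a D x‖ ^ 2 ≤ C * (D + 1) := by
  obtain ⟨C, hC0, hC⟩ := hG.cbd le_rfl hm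
  have hm' : (0 : ℝ) < m := by exact_mod_cast hm
  refine ⟨C * Real.exp (Real.pi / m), fun D x => ?_⟩
  obtain ⟨z, hz, e⟩ := hG.rx hm D x
  rw [e]
  have h := hC (1 / (D + 1)) (by positivity) (by rw [div_le_one (by positivity)]; linarith [(Nat.cast_nonneg D : (0 : ℝ) ≤ D)]) D z hz
  rw [if_pos rfl, Real.rpow_neg_one, one_div, inv_inv, ← Real.exp_nat_mul] at h
  have h2 : Real.exp (-(Real.pi / m)) ≤ Real.exp ((2 * D : ℕ) * -(2 * Real.pi * ((D + 1 : ℝ)⁻¹ / (4 * m)))) := by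
    apply Real.exp_le_exp.mpr
    have : ((2 * D : ℕ) : ℝ) * -(2 * Real.pi * ((D + 1 : ℝ)⁻¹ / (4 * m))) = -(Real.pi / m * (D / (D + 1))) := by push_cast; field_simp; ring
    rw [this, neg_le_neg_iff]
    refine mul_le_of_le_one_right (by have := Real.pi_pos; positivity) ((div_le_one (by positivity)).mpr (by linarith))
  have h3 := (mul_le_mul_of_nonneg_left h2 (sq_nonneg ‖a D z‖)).trans h
  rw [Real.exp_neg] at h3
  have := Real.exp_pos (Real.pi / m)
  rw [← div_eq_mul_inv, div_le_iff₀ this] at h3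
  linarith

theorem GV.lam {k : ℤ} {m : ℕ} {a} (hm : 0 < m) (hG : GV k m a) : Lam k m a := by
  refine ⟨hG.per, hG.supp, hG.par, fun E hE => ?_⟩
  have hm' : (m : ℂ) ≠ 0 := by exact_mod_cast hm.ne'
  obtain ⟨M, hM0⟩ := hE.bddN hm
  have hM : ∀ Δ l : ℤ, Δ < -(4 * m * M : ℕ) → E.coeff Δ l = 0 := by
    intro Δ l hΔ
    refine hM0 Δ l (hΔ.trans_le (neg_le_neg ?_))
    have : M ≤ 4 * m * M := Nat.le_mul_of_pos_left _ (by positivity)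
    exact_mod_cast this
  have hps := fun x : ℕ => hc_ps hm E x _ hM
  set f : ℂ → ℂ := fun τ => ∑ x : Fin (2 * m), hc E (x : ℕ) τ * gS m a (x : ℕ) τ with hf
  set F := ∑ x : Fin (2 * m), PowerSeries.mk (fun i : ℕ => E.coeff (i - (4 * m * M : ℕ)) (x : ℕ)) * PowerSeries.mk fun D => a D (x : ℕ) with hF
  have hc := fun x : Fin (2 * m) => (hps x).1.mul (hG.conv (x : ℕ))
  obtain ⟨hF1, hF2⟩ := PConv.sum Finset.univ fun x _ => (hc x).1
  have hev : ∀ τ : ℂ, 0 < τ.im → evP F (ee (τ / (4 * m))) = ee ((4 * m * M : ℕ) * (τ / (4 * m))) * f τ := by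
    intro τ hτ
    have hn := norm_ee_lt (im_div4 hm hτ)
    rw [hF2 _ hn, hf, Finset.mul_sum]
    refine Finset.sum_congr rfl fun x _ => ?_
    rw [(hc x).2 _ hn, (hps x).2 τ hτ, gS_ev, mul_assoc]
  have hco := alp_row hm E M hG.supp hM
  have hfe : ∀ τ : ℂ, 0 < τ.im → f τ = ee (-(M * τ)) * evP F (ee (τ / (4 * m))) := by
    intro τ hτ
    rw [hev τ hτ, ← mul_assoc, ← ee_add, show -(M * τ) + ((4 * m * M : ℕ) : ℂ) * (τ / (4 * m)) = 0 by push_cast; field_simp; ring, ee_zero, one_mul]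
  have hal : ∀ n : ℤ, n < -M → alp m a E.coeff n = 0 := by
    intro n hn
    unfold alp
    refine Finset.sum_eq_zero fun x _ => ?_
    rw [← tsum_zero (β := ℕ)]
    congr 1; funext D
    rw [hM, mul_zero]
    have hm1 : (1 : ℤ) ≤ m := by exact_mod_cast hm
    push_cast
    nlinarith
  have hsf : SF 2 f (alp m a E.coeff) := by
    refine ⟨fun τ hτ => ?_, fun τ hτ => ?_, fun τ hτ => ?_, M, fun n hn => ?_⟩
    · have h1 : f =ᶠ[𝓝 τ] fun τ => ee (-(M * τ)) * evP F (ee (τ / (4 * m))) := by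
        filter_upwards [(isOpen_lt continuous_const Complex.continuous_im).mem_nhds hτ] with t ht using hfe t ht
      refine DifferentiableAt.congr_of_eventuallyEq ?_ h1
      have h2 := (hF1.diff _ (by simpa using norm_ee_lt (im_div4 hm hτ) : ee (τ / (4 * m)) ∈ Metric.ball (0 : ℂ) 1)).differentiableAt
        (Metric.isOpen_ball.mem_nhds (by simpa using norm_ee_lt (im_div4 hm hτ)))
      have h3 : DifferentiableAt ℂ (fun t : ℂ => ee (t / (4 * m))) τ := DifferentiableAt.ee (by fun_prop)
      exact (DifferentiableAt.ee (by fun_prop)).mul (DifferentiableAt.comp (g := evP F) τ h2 h3)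
    · have hτ0 := ne_zero_of_im hτ
      simp only [hf, hG.slaw τ hτ]
      have h2 : ∀ y : Fin (2 * m), τ ^ 2 * (_root_.hc E (y : ℕ) τ * gS m a (y : ℕ) τ) = τ ^ (2 - k) * (sqI (τ / (2 * m)) * ∑ x ∈ Finset.range (2 * m), _root_.hc E x (-1 / τ) * ee (-(x * (y : ℕ) : ℂ) / (2 * m))) * gS m a (y : ℕ) τ := fun y => by
        rw [hc_S hm E hE hτ y y.2, ← mul_assoc (τ ^ (2 - k)), ← zpow_add₀ hτ0]; norm_num [mul_assoc]
      rw [show (τ ^ (2 : ℤ) : ℂ) = τ ^ 2 by norm_cast, Finset.mul_sum]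
      simp only [h2, sum_rr, Finset.mul_sum, Finset.sum_mul]
      rw [Finset.sum_comm]
      refine Finset.sum_congr rfl fun x _ => Finset.sum_congr rfl fun y _ => ?_
      push_cast; ring
    · have h1 := hF1.hasSum (norm_ee_lt (im_div4 hm hτ))
      simp only [hF, hco] at h1
      have hi2 : Function.Injective (fun i : ℕ => 4 * m * i) := fun a b hab => by
        simpa [hm.ne'] using hab
      have h2 := (hi2.hasSum_iff (by
        intro n hn
        rw [if_neg, zero_mul]
        rintro ⟨j, rfl⟩; exact hn ⟨j, rfl⟩)).mpr h1
      have hi : Function.Injective (fun i : ℕ => (i : ℤ) - M) := fun a b hab => by simpa using hab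
      refine (hi.hasSum_iff ?_).mp ?_
      · intro Δ hΔ
        rw [hal Δ, zero_mul]
        by_contra hc
        exact hΔ ⟨(Δ + M).toNat, by simp; omega⟩
      · rw [hfe τ hτ]
        refine hs_congr (h2.mul_left _) fun i => ?_
        simp only [Function.comp]
        have hj : ((4 * m * i : ℕ) : ℤ) / (4 * m) = i := by push_cast; exact Int.mul_ediv_cancel_left _ (by positivity)
        rw [if_pos ⟨i, rfl⟩, hj, ee_pow, mul_left_comm, ← ee_add]
        congr 2; push_cast; field_simp; ring
    · exact hal n hn
  have := hsf.ct
  unfold alp at this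
  simpa [pair] using this

def VpF (p : ℕ) (φ : ℂ → ℂ → ℂ) (τ z : ℂ) : ℂ := p * φ (p * τ) (p * z) + (p : ℂ)⁻¹ * ∑ b ∈ Finset.range p, φ ((τ + b) / p) z
def VpC (p : ℕ) (c : ℤ × ℤ → ℂ) (x : ℤ × ℤ) : ℂ := c (p * x.1, x.2) + if (p : ℤ) ∣ x.1 ∧ (p : ℤ) ∣ x.2 then p * c (x.1 / p, x.2 / p) else 0

theorem JF.vp {m p : ℕ} (hp : p.Prime) {φ c} (h : JF 2 m φ c) : JF 2 (m * p) (VpF p φ) (VpC p c) := by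
  have hp0 : (p : ℂ) ≠ 0 := by exact_mod_cast hp.ne_zero
  have hpi : (0 : ℝ) < p := by exact_mod_cast hp.pos
  have i1 : ∀ τ : ℂ, 0 < τ.im → 0 < (p * τ).im := fun τ hτ => by simp; positivity
  have i2 : ∀ (τ : ℂ) (b : ℕ), 0 < τ.im → 0 < ((τ + b) / p).im := fun τ b hτ => by
    rw [Complex.div_natCast_im]; simp; positivity
  have hmod := h.modular
  refine ⟨fun τ z hτ => ?_, fun τ hτ z lam mu => ?_, fun τ z hτ => ?_, fun τ z hτ => ?_, ?_⟩
  · have h1 : DifferentiableAt ℂ (fun x : ℂ × ℂ => φ (p * x.1) (p * x.2)) (τ, z) :=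
      DifferentiableAt.comp (g := fun x : ℂ × ℂ => φ x.1 x.2) (f := fun x : ℂ × ℂ => ((p : ℂ) * x.1, (p : ℂ) * x.2)) (τ, z) (h.hol _ _ (i1 τ hτ)) (by fun_prop)
    have h2 : ∀ b : ℕ, DifferentiableAt ℂ (fun x : ℂ × ℂ => φ ((x.1 + b) / p) x.2) (τ, z) := fun b =>
      DifferentiableAt.comp (g := fun x : ℂ × ℂ => φ x.1 x.2) (f := fun x : ℂ × ℂ => ((x.1 + b) / p, x.2)) (τ, z) (h.hol _ _ (i2 τ b hτ)) (by fun_prop)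
    exact (h1.const_mul _).add ((DifferentiableAt.fun_sum fun b _ => h2 b).const_mul _)
  · unfold VpF
    rw [show (p : ℂ) * (z + lam * τ + mu) = p * z + lam * (p * τ) + ((p * mu : ℤ) : ℂ) by push_cast; ring, h.ell _ (i1 τ hτ)]
    have : ∀ b : ℕ, φ ((τ + b) / p) (z + lam * τ + mu) = ee (-((m * p : ℕ) : ℂ) * (lam ^ 2 * τ + 2 * lam * z)) * φ ((τ + b) / p) z := fun b => by
      rw [show z + lam * τ + mu = z + ((lam * p : ℤ) : ℂ) * ((τ + b) / p) + ((mu - lam * b : ℤ) : ℂ) by push_cast; field_simp; ring, h.ell _ (i2 τ b hτ)]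
      congr 1
      rw [← ee_add_int _ (m * p * lam ^ 2 * b)]
      congr 1; push_cast; field_simp; ring
    simp only [this, ← Finset.mul_sum]
    rw [show -(m : ℂ) * (lam ^ 2 * (p * τ) + 2 * lam * (p * z)) = -((m * p : ℕ) : ℂ) * (lam ^ 2 * τ + 2 * lam * z) by push_cast; ring]
    ring
  · haveI := Fact.mk hp
    have hτ0 := ne_zero_of_im hτ
    unfold VpF
    have r1 : φ (p * (-1 / τ)) (p * (z / τ)) = (τ / p) ^ 2 * ee ((m * p : ℕ) * z ^ 2 / τ) * φ (τ / p) z := by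
      have := h.slaw (τ / p) z (by simpa using i2 τ 0 hτ)
      convert this using 2
      · field_simp
      · field_simp
      · norm_cast
        congr 2; push_cast; field_simp
    have r2 : φ (-1 / τ / p) (z / τ) = (p * τ) ^ 2 * ee ((m * p : ℕ) * z ^ 2 / τ) * φ (p * τ) (p * z) := by
      have := h.slaw (p * τ) (p * z) (i1 τ hτ)
      convert this using 2
      · field_simp
      · field_simp
      · norm_cast
        congr 2; push_cast; field_simp
    have r3 : ∀ u : ZMod p, u ≠ 0 → φ ((-1 / τ + u.val) / p) (z / τ) = τ ^ 2 * ee ((m * p : ℕ) * z ^ 2 / τ) * φ ((τ + (-u⁻¹ : ZMod p).val) / p) z := by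
      intro u hu
      set b := u.val with hb
      set b' := (-u⁻¹ : ZMod p).val with hb'
      have hd : (p : ℤ) ∣ 1 + b * b' := by
        rw [← ZMod.intCast_zmod_eq_zero_iff_dvd]; simp [hb, hb', hu]
      obtain ⟨e, he⟩ := hd
      have := hmod ((τ + b') / p) (i2 τ b' hτ) z b (-e) p (-b') (by linarith)
      have hden : ((p : ℤ) : ℂ) * ((τ + b') / p) + ((-b' : ℤ) : ℂ) = τ := by push_cast; field_simp; ring
      rw [hden] at this
      have he' : (1 + b * b' : ℂ) = p * e := by exact_mod_cast he
      convert this using 2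
      · push_cast; field_simp; linear_combination -he'
      · norm_cast
    have hz : ∀ F : ℕ → ℂ, ∑ b ∈ Finset.range p, F b = F 0 + ∑ u ∈ Finset.univ.erase (0 : ZMod p), F u.val := fun F => by
      have := sum_zmod (N := p) (fun u : ZMod p => F u.val)
      rw [← Finset.add_sum_erase _ _ (Finset.mem_univ (0 : ZMod p)), ZMod.val_zero] at this
      rw [← this]
      exact Finset.sum_congr rfl fun x hx => by rw [ZMod.val_cast_of_lt (by simpa using hx)]
    rw [hz, hz, Finset.sum_congr rfl fun u hu => r3 u (Finset.ne_of_mem_erase hu), r1, ← Finset.mul_sum]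
    rw [Finset.sum_nbij' (s := Finset.univ.erase (0 : ZMod p)) (t := Finset.univ.erase (0 : ZMod p)) (g := fun u => φ ((τ + u.val) / p) z) (fun u => -u⁻¹) (fun u => -u⁻¹) (by simp) (by simp) (by simp [inv_neg]) (by simp [inv_neg]) (fun _ _ => rfl)]
    simp only [Nat.cast_zero, add_zero, r2]
    rw [show (τ ^ (2 : ℤ) : ℂ) = τ ^ 2 by norm_cast]
    field_simp
    ring
  · unfold VpF VpC
    simp only [add_mul]
    rw [add_comm]
    refine HasSum.add ?_ ?_
    · have h1 := (hasSum_sum (s := Finset.range p) fun b _ => h.rep _ z (i2 τ b hτ)).mul_left (p : ℂ)⁻¹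
      have hi : Function.Injective (fun x : ℤ × ℤ => ((p : ℤ) * x.1, x.2)) := fun x y hxy => by
        simp only [Prod.mk.injEq, mul_eq_mul_left_iff] at hxy
        have : (p : ℤ) ≠ 0 := by exact_mod_cast hp.ne_zero
        exact Prod.ext (by tauto) hxy.2
      have e : ∀ x : ℤ × ℤ, (p : ℂ)⁻¹ * ∑ b ∈ Finset.range p, c x * ee (x.1 * ((τ + b) / p) + x.2 * z) = if (p : ℤ) ∣ x.1 then c x * ee (x.1 * (τ / p) + x.2 * z) else 0 := by
        intro x
        have := orth_sum hp.pos x.1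
        have e2 : ∀ b : ℕ, c x * ee (x.1 * ((τ + b) / p) + x.2 * z) = c x * ee (x.1 * (τ / p) + x.2 * z) * ee (b * x.1 / p) := fun b => by
          rw [mul_assoc, ← ee_add]; congr 2; field_simp; ring
        simp only [e2, ← Finset.mul_sum, this]
        split_ifs
        · field_simp
        · simp
      simp only [e] at h1
      refine hs_congr ((hi.hasSum_iff ?_).mpr h1) fun x => ?_
      · rintro ⟨n, r⟩ hx
        rw [if_neg]
        rintro ⟨j, rfl⟩; exact hx ⟨(j, r), rfl⟩
      · simp only [Function.comp, if_pos (dvd_mul_right _ _)]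
        congr 2; push_cast; field_simp
    · have h1 := (h.rep _ (p * z) (i1 τ hτ)).mul_left (p : ℂ)
      have hpz : (p : ℤ) ≠ 0 := by exact_mod_cast hp.ne_zero
      have hi : Function.Injective (fun x : ℤ × ℤ => ((p : ℤ) * x.1, (p : ℤ) * x.2)) := fun x y hxy => by
        simp only [Prod.mk.injEq, mul_eq_mul_left_iff] at hxy
        exact Prod.ext (by tauto) (by tauto)
      refine (hi.hasSum_iff ?_).mp (hs_congr h1 fun x => ?_)
      · rintro ⟨n, r⟩ hx
        rw [if_neg, zero_mul]
        rintro ⟨⟨j, hj⟩, ⟨i, hi⟩⟩; exact hx ⟨(j, i), by simp_all⟩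
      · simp only [Function.comp, dvd_mul_right, and_self, if_true, Int.mul_ediv_cancel_left _ hpz]
        rw [mul_assoc]; congr 3; push_cast; ring
  · obtain ⟨N, hN⟩ := h.bdd
    have hp1 : (1 : ℤ) ≤ p := by exact_mod_cast hp.pos
    refine ⟨-(p * |N|), fun x hx => ?_⟩
    have hN' := neg_abs_le N
    have hab := abs_nonneg N
    unfold VpC
    rw [hN, zero_add]
    · split_ifs with hd
      · obtain ⟨⟨j, hj⟩, -⟩ := hd
        rw [hN, mul_zero]
        simp only [hj]
        rw [Int.mul_ediv_cancel_left _ (by omega)]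
        rw [hj] at hx
        nlinarith
      · rfl
    · have : x.1 < -|N| := by nlinarith
      simp only
      nlinarith

theorem sum_split (N p : ℕ) (f : ℕ → ℂ) : ∑ X ∈ Finset.range (N * p), f X = ∑ x ∈ Finset.range N, ∑ j ∈ Finset.range p, f (x + N * j) := by
  induction p with
  | zero => simp
  | succ p ih => rw [Nat.mul_succ, Finset.sum_range_add, ih, ← Finset.sum_add_distrib]
                 exact Finset.sum_congr rfl fun x _ => by rw [Finset.sum_range_succ, add_comm x (N * p)]

theorem sum_split0 (N p : ℕ) (hp : 0 < p) (f : ℕ → ℂ) (h : ∀ X, ¬ p ∣ X → f X = 0) : ∑ X ∈ Finset.range (N * p), f X = ∑ x ∈ Finset.range N, f (p * x) := by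
  rw [mul_comm, sum_split, Finset.sum_eq_single_of_mem 0 (by simpa using hp)]
  · simp
  · intro i hi h0
    refine Finset.sum_eq_zero fun x _ => h _ fun hd => ?_
    rw [Nat.dvd_add_left (dvd_mul_right _ _)] at hd
    exact absurd (Nat.le_of_dvd (by omega) hd) (by simpa using hi)

def VS (m p : ℕ) (a : ℕ → ℤ → ℂ) (D : ℕ) (x : ℤ) : ℂ := ∑ j ∈ Finset.range p, a D (x + 2 * m * j) + if (4 * (m : ℤ)) ∣ D - x ^ 2 then p * a (p ^ 2 * D) (p * x) else 0

theorem Lam.vs {m p : ℕ} (hm : 0 < m) (hp : p.Prime) {a} (hL : Lam 2 (m * p) a) : Lam 2 m (VS m p a) := by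
  have hpz : (p : ℤ) ≠ 0 := by exact_mod_cast hp.ne_zero
  have hmz : (4 * (m : ℤ)) ≠ 0 := by positivity
  have per : ∀ D (x : ℤ) (l : ℤ), a D (x + 2 * m * (l + p)) = a D (x + 2 * m * l) := fun D x l => by
    rw [← hL.per D (x + 2 * m * l)]; congr 1; push_cast; ring
  refine ⟨fun D x => ?_, fun D x h => ?_, fun D x => ?_, fun E hE => ?_⟩
  · unfold VS
    congr 1
    · have := sum_aff hp.pos (f := fun l => a D (x + 2 * m * l)) (per D x) 1 1 isCoprime_one_left
      rw [← this]
      refine Finset.sum_congr rfl fun j _ => ?_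
      congr 1; ring
    · simp only [show (D : ℤ) - (x + 2 * m) ^ 2 = D - x ^ 2 - 4 * m * (x + m) by ring, dvd_sub_left (dvd_mul_right _ _), ← hL.per _ (p * x)]
      congr 3; push_cast; ring
  · unfold VS
    rw [if_neg h, add_zero]
    refine Finset.sum_eq_zero fun j _ => hL.supp _ _ fun hd => h ?_
    have h1 : (4 * (m : ℤ)) ∣ D - (x + 2 * m * j) ^ 2 := dvd_trans ⟨p, by push_cast; ring⟩ hd
    rwa [show (D : ℤ) - (x + 2 * m * j) ^ 2 = D - x ^ 2 - 4 * m * (x * j + m * j ^ 2) by ring, dvd_sub_left (dvd_mul_right _ _)] at h1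
  · have hpar : ∀ D x, a D (-x) = a D x := fun D x => by simpa using hL.par D x
    norm_num
    unfold VS
    rw [neg_sq, mul_neg, hpar]
    congr 1
    have := sum_aff hp.pos (f := fun l => a D (x + 2 * m * l)) (per D x) (-1) 0 (isCoprime_one_left.neg_left)
    rw [← this]
    refine Finset.sum_congr rfl fun j _ => ?_
    rw [← hpar]; congr 1; push_cast; ring
  · have hmp : 0 < m * p := Nat.mul_pos hm hp.pos
    have hV := JF.vp hp hE
    have h0 := hL.orth _ (hV.mkE hmp)
    obtain ⟨M, hM⟩ := hE.bddN hm
    have e : ∀ (D : ℕ) (X : ℤ), a D X * (mkE hmp hV.hol hV.ell hV.rep).coeff (-D) X = a D X * E.coeff (-D) X +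
        if (p : ℤ) ∣ X ∧ p ^ 2 ∣ D then p * a D X * E.coeff (-(D / p ^ 2 : ℕ)) (X / p) else 0 := by
      intro D X
      by_cases hs : (4 * (m * p : ℕ) : ℤ) ∣ D - X ^ 2
      · obtain ⟨n, hn⟩ := hs
        rw [show -(D : ℤ) = 4 * (m * p : ℕ) * (-n) - X ^ 2 by linarith, mkE_coeff]
        unfold VpC
        simp only
        rw [show 4 * (m : ℤ) * (p * -n) - X ^ 2 = 4 * (m * p : ℕ) * (-n) - X ^ 2 by push_cast; ring, mul_add]
        congr 1
        by_cases hX : (p : ℤ) ∣ X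
        · obtain ⟨y, rfl⟩ := hX
          by_cases hn' : (p : ℤ) ∣ n
          · obtain ⟨n, rfl⟩ := hn'
            have hD : (D : ℤ) = p ^ 2 * (y ^ 2 + 4 * m * n) := by push_cast at hn; linarith
            have hD' : p ^ 2 ∣ D := by rw [← Int.natCast_dvd_natCast, hD]; exact ⟨_, by push_cast; rfl⟩
            rw [if_pos ⟨⟨-n, by ring⟩, dvd_mul_right _ _⟩, if_pos ⟨dvd_mul_right _ _, hD'⟩]
            rw [show -((p : ℤ) * n) = p * (-n) by ring, Int.mul_ediv_cancel_left _ hpz, Int.mul_ediv_cancel_left _ hpz]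
            rw [show ((D / p ^ 2 : ℕ) : ℤ) = y ^ 2 + 4 * m * n by push_cast; rw [hD, Int.mul_ediv_cancel_left _ (by positivity)]]
            rw [show 4 * (m : ℤ) * (-n) - y ^ 2 = -(y ^ 2 + 4 * m * n) by ring]; ring
          · rw [if_neg (by rw [dvd_neg]; tauto), mul_zero]
            split_ifs with h1
            · rw [E.support, mul_zero]
              obtain ⟨-, ⟨d, rfl⟩⟩ := h1
              rw [Nat.mul_div_cancel_left _ (pow_pos hp.pos 2), Int.mul_ediv_cancel_left _ hpz]
              rintro ⟨i, hi⟩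
              refine hn' ⟨-i, ?_⟩
              push_cast at hn
              refine mul_left_cancel₀ (mul_ne_zero hmz hpz) ?_
              linear_combination (-(p : ℤ) ^ 2) * hi - hn
            · rfl
        · rw [if_neg (by tauto), if_neg (by tauto), mul_zero]
      · simp [hL.supp D X hs]
    have s1 : ∀ (b : ℕ → ℂ) (x : ℤ), Summable fun D : ℕ => b D * E.coeff (-D) x := fun b x =>
      summable_of_ne_finset_zero (s := Finset.range (M + 1)) fun D hD => by
        rw [hM, mul_zero]; rw [Finset.mem_range] at hD; omega
    have hi : Function.Injective (fun D : ℕ => p ^ 2 * D) := fun i j hij => by simpa [hp.ne_zero] using hij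
    have t2 : ∀ x : ℤ, HasSum (fun D : ℕ => if (p : ℤ) ∣ (p * x) ∧ p ^ 2 ∣ D then p * a D (p * x) * E.coeff (-(D / p ^ 2 : ℕ)) (p * x / p) else 0)
        (∑' D : ℕ, p * a (p ^ 2 * D) (p * x) * E.coeff (-D) x) := fun x => by
      refine (hi.hasSum_iff ?_).mp (hs_congr (s1 (fun D => p * a (p ^ 2 * D) (p * x)) x).hasSum fun D => ?_)
      · intro D hD
        rw [if_neg]
        rintro ⟨-, ⟨d, rfl⟩⟩; exact hD ⟨d, rfl⟩
      · simp only [Function.comp, dvd_mul_right, and_self, if_true]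
        rw [Nat.mul_div_cancel_left _ (pow_pos hp.pos 2), Int.mul_ediv_cancel_left _ hpz]
    have t3 : ∀ x : ℕ, ∑' D : ℕ, (a D x * E.coeff (-D) x + if (p : ℤ) ∣ x ∧ p ^ 2 ∣ D then p * a D x * E.coeff (-(D / p ^ 2 : ℕ)) (x / p) else 0) =
       ∑' D : ℕ, a D x * E.coeff (-D) x + ∑' D : ℕ, (if (p : ℤ) ∣ x ∧ p ^ 2 ∣ D then p * a D x * E.coeff (-(D / p ^ 2 : ℕ)) (x / p) else 0) := fun x => by
      refine (s1 _ _).tsum_add ?_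
      by_cases hx : (p : ℤ) ∣ x
      · obtain ⟨y, hy⟩ := hx
        rw [hy]; exact (t2 y).summable
      · simpa [hx] using summable_zero
    unfold pair at h0 ⊢
    simp only [e, t3] at h0
    rw [Finset.sum_add_distrib, show 2 * (m * p) = 2 * m * p by ring, sum_split, sum_split0 _ _ hp.pos] at h0
    · rw [← Finset.sum_add_distrib] at h0
      rw [← h0]
      refine Finset.sum_congr rfl fun x _ => ?_
      have t4 := (t2 x).tsum_eq
      push_cast at t4 ⊢
      rw [t4]
      have : ∀ j : ℕ, ∀ D : ℕ, E.coeff (-D) (x + 2 * m * j) = E.coeff (-D) x := fun j D =>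
        per_int (f := fun l => E.coeff (-D) l) (E.periodic (-D)) x j
      simp only [this]
      rw [← Summable.tsum_finsetSum (fun j _ => s1 _ _), ← Summable.tsum_add (summable_sum fun j _ => s1 _ _) (s1 _ _)]
      congr 1; funext D
      unfold VS
      rw [← Finset.sum_mul, ← add_mul]
      by_cases hd : (4 * (m : ℤ)) ∣ D - (x : ℤ) ^ 2
      · rw [if_pos hd]
      · rw [E.support, mul_zero, mul_zero]
        rwa [show -(D : ℤ) + (x : ℤ) ^ 2 = -(D - (x : ℤ) ^ 2) by ring, dvd_neg]
    · intro X hX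
      have : ¬ (p : ℤ) ∣ X := by exact_mod_cast hX
      simp [this]

theorem sqI_scale {w : ℂ} (hw : w ≠ 0) {q : ℕ} (hq : 0 < q) : sqI (q ^ 2 * w) = q * sqI w := by
  have hq' : (0 : ℝ) < q := by exact_mod_cast hq
  have h1 : -I * w ≠ 0 := by simp [hw]
  unfold sqI
  rw [show -I * (q ^ 2 * w) = (((q : ℝ) ^ 2 : ℝ) : ℂ) * (-I * w) by push_cast; ring,
    Complex.cpow_def_of_ne_zero h1, Complex.cpow_def_of_ne_zero (mul_ne_zero (by exact_mod_cast (by positivity : (q : ℝ) ^ 2 ≠ 0)) h1),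
    Complex.log_ofReal_mul (by positivity) h1, add_mul, Complex.exp_add, Real.log_pow]
  congr 1
  rw [show ((((2 : ℕ) * Real.log q : ℝ)) : ℂ) * (1 / 2) = ((Real.log q : ℝ) : ℂ) by push_cast; ring, ← Complex.ofReal_exp, Real.exp_log hq']
  simp

theorem conv_of {m : ℕ} (hm : 0 < m) {f : ℕ → ℂ} {g : ℂ → ℂ} (h : ∀ τ : ℂ, 0 < τ.im → HasSum (fun D : ℕ => f D * ee (D * (τ / (4 * m)))) (g τ)) :
    PConv (PowerSeries.mk f) := by
  have hm' : (m : ℂ) ≠ 0 := by exact_mod_cast hm.ne'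
  refine (PConv.of_ee (g := fun τ => g (4 * m * τ)) fun τ hτ => ?_).1
  have h4 : 0 < (4 * m * τ).im := by
    have := im_nat_mul hm (im_nat_mul (m := 1) (by norm_num) hτ); convert this using 2; push_cast; ring
  refine hs_congr (h _ h4) fun D => ?_
  rw [PowerSeries.coeff_mk, ee_pow, mul_div_cancel_left₀ τ (by simpa using hm')]

def Lf (q : ℕ) (a : ℕ → ℤ → ℂ) (D : ℕ) (X : ℤ) : ℂ := if (q : ℤ) ∣ X ∧ q ^ 2 ∣ D then a (D / q ^ 2) (X / q) else 0

def Ud (m q : ℕ) (a : ℕ → ℤ → ℂ) (D : ℕ) (x : ℤ) : ℂ := ∑ j ∈ Finset.range q, a (q ^ 2 * D) (q * x + 2 * m * q * j)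

theorem Lf_mul {q : ℕ} (hq : 0 < q) (a : ℕ → ℤ → ℂ) (D : ℕ) (x : ℤ) : Lf q a (q ^ 2 * D) (q * x) = a D x := by
  unfold Lf
  rw [if_pos ⟨dvd_mul_right _ _, dvd_mul_right _ _⟩, Nat.mul_div_cancel_left _ (by positivity), Int.mul_ediv_cancel_left _ (by positivity)]

theorem Lf_not {q : ℕ} (a : ℕ → ℤ → ℂ) (D : ℕ) {x : ℤ} (h : ¬ (q : ℤ) ∣ x) : Lf q a D x = 0 := if_neg fun h' => h h'.1

theorem GV.lf {m q : ℕ} (hm : 0 < m) (hq : 0 < q) {a} (hG : GV 2 m a) : GV 2 (m * q ^ 2) (Lf q a) := by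
  have hqz : (q : ℤ) ≠ 0 := by positivity
  have hqc : (q : ℂ) ≠ 0 := by exact_mod_cast hq.ne'
  have hm' : (m : ℂ) ≠ 0 := by exact_mod_cast hm.ne'
  have hmq : 0 < m * q ^ 2 := by positivity
  have hi : Function.Injective (fun D : ℕ => q ^ 2 * D) := fun i j hij => by simpa [hq.ne'] using hij
  have hs : ∀ (x : ℤ) (τ : ℂ), 0 < τ.im → HasSum (fun D : ℕ => Lf q a D (q * x) * ee (D * (τ / (4 * (m * q ^ 2 : ℕ))))) (gS m a x τ) := fun x τ hτ => by
    refine (hi.hasSum_iff ?_).mp (hs_congr (hG.hs hm x hτ) fun D => ?_)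
    · intro D hD
      unfold Lf
      rw [if_neg, zero_mul]
      rintro ⟨-, ⟨d, rfl⟩⟩; exact hD ⟨d, rfl⟩
    · simp only [Function.comp, Lf_mul hq]
      congr 2; push_cast; field_simp
  have hg : ∀ (x : ℤ) (τ : ℂ), 0 < τ.im → gS (m * q ^ 2) (Lf q a) (q * x) τ = gS m a x τ := fun x τ hτ => (hs x τ hτ).tsum_eq
  have hg0 : ∀ (x : ℤ) (τ : ℂ), ¬ (q : ℤ) ∣ x → gS (m * q ^ 2) (Lf q a) x τ = 0 := fun x τ h => by
    unfold gS; simp [Lf_not a _ h]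
  refine ⟨fun D x => ?_, fun D x h => ?_, fun D x => ?_, fun x => ?_, fun τ hτ x => ?_⟩
  · have hd : (q : ℤ) ∣ x + 2 * (m * q ^ 2 : ℕ) ↔ (q : ℤ) ∣ x := dvd_add_left ⟨2 * m * q, by push_cast; ring⟩
    unfold Lf
    simp only [hd]
    split_ifs with h1
    · obtain ⟨⟨y, rfl⟩, -⟩ := h1
      rw [show (q : ℤ) * y + 2 * (m * q ^ 2 : ℕ) = q * (y + 2 * m * q) by push_cast; ring, Int.mul_ediv_cancel_left _ hqz, Int.mul_ediv_cancel_left _ hqz]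
      exact per_int (f := fun l => a (D / q ^ 2) l) (hG.per _) y q
    · rfl
  · unfold Lf
    split_ifs with h1
    · obtain ⟨⟨y, rfl⟩, ⟨d, rfl⟩⟩ := h1
      rw [Nat.mul_div_cancel_left _ (by positivity), Int.mul_ediv_cancel_left _ hqz]
      refine hG.supp _ _ fun ⟨i, hi⟩ => h ⟨i, ?_⟩
      push_cast; linear_combination (q : ℤ) ^ 2 * hi
    · rfl
  · norm_num
    unfold Lf
    simp only [dvd_neg]
    split_ifs with h1
    · obtain ⟨⟨y, rfl⟩, -⟩ := h1
      rw [← mul_neg, Int.mul_ediv_cancel_left _ hqz, Int.mul_ediv_cancel_left _ hqz]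
      simpa using hG.par _ y
    · rfl
  · by_cases hx : (q : ℤ) ∣ x
    · obtain ⟨y, rfl⟩ := hx
      exact conv_of hmq (hs y)
    · exact conv_of hmq (g := 0) fun τ _ => by simpa [Lf_not a _ hx] using hasSum_zero
  · rw [show 2 * (m * q ^ 2) = 2 * m * q * q by ring, sum_split0 _ _ hq _ (fun Y hY => by rw [hg0 _ _ (by exact_mod_cast hY), mul_zero]), sum_split]
    push_cast
    have e1 : ∀ y j : ℕ, ee (-(x * (q * (y + 2 * m * j)) : ℂ) / (2 * (m * q ^ 2))) * gS (m * q ^ 2) (Lf q a) (q * (y + 2 * m * j)) τ =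
        ee (-(x * y : ℂ) / (2 * m * q)) * gS m a y τ * ee (j * ((-x : ℤ) : ℂ) / q) := fun y j => by
      have : gS m a (y + 2 * m * j) τ = gS m a y τ := per_int (f := fun l => gS m a l τ) (N := 2 * m) (by intro l; have := gS_per hG.per l τ; push_cast at this; exact this) y j
      rw [hg _ _ hτ, this, mul_right_comm (ee (-(x * y : ℂ) / (2 * m * q))), ← ee_add]
      congr 2; push_cast; field_simp; ring
    simp only [e1, ← Finset.mul_sum, orth_sum hq]
    have hsq : sqI (τ / (2 * m)) = q * sqI (τ / (2 * (m * q ^ 2))) := by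
      rw [← sqI_scale (div_ne_zero (ne_zero_of_im hτ) (by simp [hm', hqc])) hq]; congr 1; field_simp
    by_cases hx : (q : ℤ) ∣ x
    · obtain ⟨y, rfl⟩ := hx
      rw [if_pos (by rw [dvd_neg]; exact dvd_mul_right _ _), hg _ _ (im_S hτ), hG.slaw τ hτ, ← Finset.sum_mul, hsq]
      rw [Finset.sum_congr rfl fun (w : ℕ) _ => show ee (-((q * y : ℤ) * w : ℂ) / (2 * m * q)) * gS m a w τ = ee (-(y * w : ℂ) / (2 * m)) * gS m a w τ by
        congr 2; push_cast; field_simp]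
      ring
    · rw [if_neg (by rwa [dvd_neg]), hg0 _ _ hx]; simp

theorem GV.ud {m q : ℕ} (hm : 0 < m) (hq : 0 < q) {a} (hG : GV 2 (m * q ^ 2) a) : GV 2 m (Ud m q a) := by
  have hqz : (q : ℤ) ≠ 0 := by positivity
  have hqc : (q : ℂ) ≠ 0 := by exact_mod_cast hq.ne'
  have hm' : (m : ℂ) ≠ 0 := by exact_mod_cast hm.ne'
  have hmq : 0 < m * q ^ 2 := by positivity
  have hi : Function.Injective (fun D : ℕ => q ^ 2 * D) := fun i j hij => by simpa [hq.ne'] using hij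
  have hs1 : ∀ (x : ℤ) (τ : ℂ), 0 < τ.im → HasSum (fun D : ℕ => a (q ^ 2 * D) (q * x) * ee (D * (τ / (4 * m)))) (gS (m * q ^ 2) a (q * x) τ) := fun x τ hτ => by
    refine hs_congr ((hi.hasSum_iff ?_).mpr (hG.hs hmq (q * x) hτ)) fun D => ?_
    · intro D hD
      rw [hG.supp, zero_mul]
      rintro ⟨d, hd⟩
      have : (q ^ 2 : ℕ) ∣ D := by
        rw [← Int.natCast_dvd_natCast]; exact ⟨4 * m * d + x ^ 2, by push_cast at hd ⊢; linear_combination hd⟩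
      obtain ⟨i, rfl⟩ := this; exact hD ⟨i, rfl⟩
    · simp only [Function.comp]
      congr 2; push_cast; field_simp
  have hs : ∀ (x : ℤ) (τ : ℂ), 0 < τ.im → HasSum (fun D : ℕ => Ud m q a D x * ee (D * (τ / (4 * m)))) (∑ j ∈ Finset.range q, gS (m * q ^ 2) a (q * (x + 2 * m * j)) τ) := fun x τ hτ => by
    refine hs_congr (hasSum_sum (s := Finset.range q) fun j _ => hs1 (x + 2 * m * j) τ hτ) fun D => ?_
    unfold Ud
    rw [Finset.sum_mul]
    refine Finset.sum_congr rfl fun j _ => ?_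
    congr 2; ring
  have hg := fun x τ hτ => (hs x τ hτ).tsum_eq
  have per : ∀ D (x : ℤ) (l : ℤ), a D (q * x + 2 * m * q * (l + q)) = a D (q * x + 2 * m * q * l) := fun D x l => by
    rw [← hG.per D (q * x + 2 * m * q * l)]; congr 1; push_cast; ring
  refine ⟨fun D x => ?_, fun D x h => ?_, fun D x => ?_, fun x => conv_of hm (hs x), fun τ hτ x => ?_⟩
  · have := sum_aff hq (f := fun l => a (q ^ 2 * D) (q * x + 2 * m * q * l)) (per _ x) 1 1 isCoprime_one_left
    unfold Ud
    rw [← this]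
    refine Finset.sum_congr rfl fun j _ => ?_
    congr 1; ring
  · refine Finset.sum_eq_zero fun j _ => hG.supp _ _ fun ⟨d, hd⟩ => h ⟨d + x * j + m * j ^ 2, ?_⟩
    push_cast at hd
    refine mul_left_cancel₀ (pow_ne_zero 2 hqz) ?_
    linear_combination hd
  · have hpar : ∀ D x, a D (-x) = a D x := fun D x => by simpa using hG.par D x
    norm_num
    have := sum_aff hq (f := fun l => a (q ^ 2 * D) (q * x + 2 * m * q * l)) (per _ x) (-1) 0 (isCoprime_one_left.neg_left)
    unfold Ud
    rw [← this]
    refine Finset.sum_congr rfl fun j _ => ?_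
    rw [← hpar]; congr 1; push_cast; ring
  · have hgx : ∀ (x : ℤ) (τ : ℂ), 0 < τ.im → gS m (Ud m q a) x τ = ∑ j ∈ Finset.range q, gS (m * q ^ 2) a (q * (x + 2 * m * j)) τ := hg
    rw [hgx _ _ (im_S hτ)]
    simp only [hG.slaw τ hτ, hgx _ _ hτ, ← Finset.mul_sum]
    rw [Finset.sum_comm]
    have e : ∀ Y : ℕ, ∑ j ∈ Finset.range q, ee (-(((q * (x + 2 * m * j) : ℤ) : ℂ) * Y) / (2 * (m * q ^ 2 : ℕ))) * gS (m * q ^ 2) a Y τ =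
        if (q : ℤ) ∣ Y then q * (ee (-(x * Y : ℂ) / (2 * m * q)) * gS (m * q ^ 2) a Y τ) else 0 := fun Y => by
      have h1 := orth_sum hq (-Y : ℤ)
      simp only [dvd_neg] at h1
      have : ∀ j : ℕ, ee (-(((q * (x + 2 * m * j) : ℤ) : ℂ) * Y) / (2 * (m * q ^ 2 : ℕ))) * gS (m * q ^ 2) a Y τ =
        ee (-(x * Y : ℂ) / (2 * m * q)) * gS (m * q ^ 2) a Y τ * ee (j * ((-Y : ℤ) : ℂ) / q) := fun j => by
        rw [mul_right_comm (ee (-(x * Y : ℂ) / (2 * m * q))), ← ee_add]; congr 2; push_cast; field_simp; ring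
      simp only [this, ← Finset.mul_sum, h1]
      split_ifs <;> ring
    simp only [e]
    rw [show 2 * (m * q ^ 2) = 2 * m * q * q by ring, sum_split0 _ _ hq _ (fun Y hY => if_neg (by exact_mod_cast hY)), sum_split]
    have hsq : sqI (τ / (2 * m)) = q * sqI (τ / (2 * (m * q ^ 2 : ℕ))) := by
      rw [← sqI_scale (div_ne_zero (ne_zero_of_im hτ) (by simp [hm, hq, hm.ne', hq.ne'])) hq]; congr 1; push_cast; field_simp
    rw [hsq]
    simp only [Finset.mul_sum]
    refine Finset.sum_congr rfl fun y _ => Finset.sum_congr rfl fun j _ => ?_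
    rw [if_pos ⟨y + 2 * m * j, by push_cast; ring⟩]
    have : ee (-(x * (q * (y + 2 * m * j) : ℕ) : ℂ) / (2 * m * q)) = ee (-(x * y : ℂ) / (2 * m)) := by
      rw [← ee_add_int _ (-(x * j))]; 
      rw [← ee_add_int (-(x * y : ℂ) / (2 * m)) (-(x * j) - (x * j))]
      congr 1; push_cast; field_simp; ring
    rw [this]; push_cast; ring

theorem int_form {m n r : ℕ} (hm : 0 < m) (hn : m + 1 ≤ n) (hr : r ≤ m) : ∃ E : EllFormData m, JB 2 E ∧
    (∀ Δ l : ℤ, ∃ n : ℤ, E.coeff Δ l = n) ∧ E.coeff (-(4 * m * n + r ^ 2)) (-r) = 1 ∧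
    ∀ n' r' : ℤ, lexlt (n', r') (-n, -r) → E.coeff (4 * m * n' - r' ^ 2) r' = 0 := by
  obtain ⟨c, h1, h2, h3, h4⟩ := (((PA_gf.pow r).mul (PE_gf.pow (m - r))).mul ((Di_gf.pow n).mul ((E4_gf.pow (3 * n - 1 - m)).mul (E6_gf.pow (r + 1))))).cast
    (k' := 2) (m' := m) (γ' := (-n, -r)) (by push_cast [Nat.cast_sub hr, Nat.cast_sub (show m ≤ 3 * n - 1 by omega), Nat.cast_sub (show 1 ≤ 3 * n by omega)]; ring)
    (by omega) (by simp) rfl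
  refine ⟨_, h1.mkE hm, fun Δ l => ?_, ?_, fun n' r' h => ?_⟩
  · simp only [mkE]
    split_ifs
    · exact h2 _
    · exact ⟨0, by simp⟩
  · rw [← h4, ← mkE_coeff hm h1.hol h1.ell h1.rep]; congr 1; ring
  · rw [mkE_coeff hm h1.hol h1.ell h1.rep]; exact h3 _ h

def ev (m D : ℕ) (x : ℤ) (a : {a : ℕ → ℤ → ℂ // Lam 2 m a}) : ℂ := a.1 D x

def fld (m x : ℕ) : ℕ := if x ≤ m then x else 2 * m - x

theorem even_fld {m : ℕ} {f : ℤ → ℂ} (h1 : ∀ x, f (x + 2 * m) = f x) (h2 : ∀ x, f (-x) = f x) {x : ℕ} (hx : x < 2 * m) : f (fld m x : ℕ) = f x := by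
  unfold fld
  split_ifs
  · rfl
  · rw [← h2, ← h1]; congr 1; push_cast [Nat.cast_sub hx.le]; ring

theorem ev_fg {m : ℕ} (hm : 0 < m) : ∃ W : Submodule ℤ ({a : ℕ → ℤ → ℂ // Lam 2 m a} → ℂ), W.FG ∧ ∀ D x, (2 : ℤ) • ev m D x ∈ W := by
  let w : ℕ → ℤ := fun ρ => ((Finset.range (2 * m)).filter fun x => fld m x = ρ).card
  have hfld : ∀ x < 2 * m, fld m x ≤ m := fun x hx => by unfold fld; split_ifs <;> omega
  have hw : ∀ ρ ≤ m, w ρ = 1 ∨ w ρ = 2 := fun ρ hρ => by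
    have h1 : ((Finset.range (2 * m)).filter fun x => fld m x = ρ) ⊆ {ρ, 2 * m - ρ} := fun x hx => by
      simp only [Finset.mem_filter, Finset.mem_range] at hx
      simp only [Finset.mem_insert, Finset.mem_singleton]
      unfold fld at hx
      split_ifs at hx <;> omega
    have h2 := (Finset.card_le_card h1).trans Finset.card_le_two
    have h3 : 0 < ((Finset.range (2 * m)).filter fun x => fld m x = ρ).card := Finset.card_pos.mpr ⟨ρ, by
      simp only [Finset.mem_filter, Finset.mem_range]; unfold fld; rw [if_pos hρ]; omega⟩
    simp only [w]; omega
  let B := 4 * m * (m + 1) + m ^ 2 + 1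
  let W := Submodule.span ℤ (Set.range fun q : Fin B × Fin (m + 1) => w q.2 • ev m q.1 (q.2 : ℕ))
  have key : ∀ (M : ℕ) (N : ℤ) (ρ : ℕ), ρ ≤ m → 0 ≤ 4 * m * N + (ρ : ℤ) ^ 2 → (N + m) * (m + 1) + ρ < M → w ρ • ev m (4 * m * N + (ρ : ℤ) ^ 2).toNat ρ ∈ W := by
    intro M
    induction M with
    | zero =>
      intro N ρ hρ h0 h1
      have h2 : (ρ : ℤ) ≤ m := by exact_mod_cast hρ
      have h3 : -(m : ℤ) ≤ N := by by_contra h; nlinarith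
      push_cast at h1
      nlinarith
    | succ M ih =>
      intro N ρ hρ h0 h1
      by_cases hN : N < m + 1
      · exact Submodule.subset_span ⟨(⟨(4 * m * N + (ρ : ℤ) ^ 2).toNat, by
          zify; rw [Int.toNat_of_nonneg h0]; simp only [B]; push_cast
          have : (ρ : ℤ) ≤ m := by exact_mod_cast hρ
          nlinarith⟩, ⟨ρ, by omega⟩), rfl⟩
      lift N to ℕ using by omega
      obtain ⟨E, hE, hi, hl, hz⟩ := int_form (n := N) hm (by omega) hρ
      obtain ⟨Z, hZ⟩ := hE.bddN hm
      choose C hC using hi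
      have hpar : ∀ Δ x, E.coeff Δ (-x) = E.coeff Δ x := fun Δ x => by simpa using hE.parity Δ x
      have rel : ∑ σ ∈ Finset.range (m + 1), ∑ D ∈ Finset.range (Z + 1), C (-D) σ • (w σ • ev m D σ) = 0 := by
        funext ⟨a, ha⟩
        have h := ha.orth E hE
        have apar : ∀ D x, a D (-x) = a D x := fun D x => by simpa using ha.par D x
        unfold pair at h
        rw [← Finset.sum_fiberwise_of_maps_to (t := Finset.range (m + 1)) (g := fld m) (by
          intro x hx; simp only [Finset.mem_range] at *; have := hfld x hx; omega)] at h
        simp only [Finset.sum_apply, Pi.smul_apply, Pi.zero_apply]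
        rw [← h]
        refine Finset.sum_congr rfl fun σ hσ => ?_
        symm
        rw [Finset.sum_congr rfl (g := fun _ => ∑ D ∈ Finset.range (Z + 1), a D σ * C (-D) σ), Finset.sum_const, nsmul_eq_mul, Finset.mul_sum]
        · refine Finset.sum_congr rfl fun D _ => ?_
          simp only [zsmul_eq_mul, ev, w]; push_cast; ring
        · intro x hx
          simp only [Finset.mem_filter, Finset.mem_range] at hx
          rw [tsum_nat_fin (Z + 1)]
          · refine Finset.sum_congr rfl fun D _ => ?_
            rw [← hC, ← hx.2, even_fld (f := fun l => a D l) (ha.per D) (apar D) hx.1, even_fld (f := fun l => E.coeff (-D) l) (E.periodic _) (hpar _) hx.1]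
          · intro D hD; rw [hZ _ _ (by omega), mul_zero]
      set D0 := 4 * m * N + ρ ^ 2 with hD0
      have e0 : (4 * m * (N : ℤ) + (ρ : ℤ) ^ 2).toNat = D0 := by rw [hD0]; zify; rw [Int.toNat_of_nonneg h0]
      rw [e0]
      have hC0 : C (-D0) ρ = 1 := by
        have := hC (-D0) ρ
        rw [← hpar, hD0] at this; push_cast at this; rw [hl] at this; push_cast [hD0]; exact_mod_cast this.symm
      have hDZ : D0 ∈ Finset.range (Z + 1) := by
        rw [Finset.mem_range]; by_contra h'
        have := hC (-D0) ρ
        rw [hZ _ _ (by omega), hC0] at this; norm_num at this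
      rw [← Finset.sum_product', ← Finset.add_sum_erase _ _ (a := (ρ, D0)) (by simp only [Finset.mem_product, Finset.mem_range] at *; omega)] at rel
      simp only [hC0, one_smul] at rel
      rw [eq_neg_of_add_eq_zero_left rel]
      refine W.neg_mem (W.sum_mem fun q hq => ?_)
      obtain ⟨σ, D⟩ := q
      simp only [Finset.mem_erase, Finset.mem_product, Finset.mem_range, ne_eq, Prod.mk.injEq] at hq ⊢
      by_cases hd : (4 * (m : ℤ)) ∣ D - (σ : ℤ) ^ 2
      · obtain ⟨N', hN'⟩ := hd
        by_cases hlex : lexlt (-N', -σ) (-N, -ρ)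
        · have := hz _ _ hlex
          rw [hpar, show 4 * m * -N' - (-(σ : ℤ)) ^ 2 = -D by linarith, hC] at this
          rw [show C (-D) σ = 0 by exact_mod_cast this, zero_smul]; exact W.zero_mem
        · refine W.smul_mem _ ?_
          have hD : (D : ℤ) = 4 * m * N' + (σ : ℤ) ^ 2 := by linarith
          have := ih N' σ (by omega) (by rw [← hD]; positivity) (by
            unfold lexlt at hlex
            push_neg at hlex
            obtain ⟨l1, l2⟩ := hlex
            simp only at l1 l2
            rcases (show N' ≤ N by omega).lt_or_eq with h | h
            · have : (σ : ℤ) ≤ m := by exact_mod_cast (by omega : σ ≤ m)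
              have hp : (0 : ℤ) ≤ m := by positivity
              push_cast at h1
              nlinarith
            · have h3 := l2 (by rw [h])
              have : σ ≠ ρ := by
                rintro rfl; exact hq.1 ⟨rfl, by rw [hD0]; zify; rw [hD, h]⟩
              rw [h]; push_cast at h1; omega)
          rwa [← hD, Int.toNat_natCast] at this
      · have : ev m D σ = 0 := by funext a; exact a.2.supp _ _ hd
        rw [this, smul_zero, smul_zero]; exact W.zero_mem
  refine ⟨W, Submodule.fg_span (Set.finite_range _), fun D x => ?_⟩
  have hx : ((x % (2 * m)).toNat : ℤ) = x % (2 * m) := Int.toNat_of_nonneg (Int.emod_nonneg _ (by positivity))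
  have hx2 : (x % (2 * m)).toNat < 2 * m := by zify; rw [hx]; exact Int.emod_lt_of_pos _ (by positivity)
  set σ := fld m (x % (2 * m)).toNat with hσ
  have e1 : ev m D x = ev m D σ := by
    funext a
    have := even_fld (f := fun l => a.1 D l) (a.2.per D) (fun x => by simpa using a.2.par D x) hx2
    simp only [ev, hσ]; rw [this, hx]
    refine per_mod (f := fun l => a.1 D l) (a.2.per D) ⟨x / (2 * m), by have := Int.emod_add_mul_ediv x (2 * m); linarith⟩
  rw [e1]
  by_cases hd : (4 * (m : ℤ)) ∣ D - (σ : ℤ) ^ 2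
  · obtain ⟨N', hN'⟩ := hd
    have hD : (D : ℤ) = 4 * m * N' + (σ : ℤ) ^ 2 := by linarith
    have := key (((N' + m) * (m + 1) + σ).toNat + 1) N' σ (hfld _ hx2) (by rw [← hD]; positivity) (by push_cast; have := Int.self_le_toNat ((N' + m) * (m + 1) + σ); omega)
    rw [← hD, Int.toNat_natCast] at this
    rcases hw σ (hfld _ hx2) with h | h
    · rw [h, one_smul] at this; exact W.smul_mem _ this
    · rwa [h] at this
  · have : ev m D σ = 0 := by funext a; exact a.2.supp _ _ hd
    rw [this, smul_zero]; exact W.zero_mem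

theorem nil_lemma {V : Type*} [AddCommGroup V] (htf : ∀ (r : ℤ) (v : V), r ≠ 0 → r • v = 0 → v = 0) (S : V →ₗ[ℤ] V) {W : Submodule ℤ V} (hW : W.FG)
    {p : ℕ} (hp : 2 ≤ p) (y : ℕ → V) (hy : ∀ n, y n ∈ W) (h0 : S (y 0) = (p : ℤ) • y 1) (h1 : ∀ n, S (y (n + 1)) = y n + (p : ℤ) • y (n + 2)) (n : ℕ) : y n = 0 := by
  set L := Submodule.span ℤ (Set.range y) with hL
  have hyL : ∀ n, y n ∈ L := fun n => Submodule.subset_span ⟨n, rfl⟩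
  have hle : L ≤ W := Submodule.span_le.mpr (by rintro _ ⟨n, rfl⟩; exact hy n)
  have hFG : L.FG := by
    have := isNoetherian_of_fg_of_noetherian W hW
    exact isNoetherian_submodule.mp this L hle
  have hS : L ≤ L.comap S := Submodule.span_le.mpr (by
    rintro _ ⟨n, rfl⟩
    rcases n with - | n
    · exact (h0 ▸ L.smul_mem _ (hyL _) : S (y 0) ∈ L)
    · exact (h1 n ▸ L.add_mem (hyL _) (L.smul_mem _ (hyL _)) : S (y (n + 1)) ∈ L))
  let P : Submodule ℤ V := L.map ((p : ℤ) • LinearMap.id)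
  have hP : ∀ v ∈ L, (p : ℤ) • v ∈ P := fun v hv => ⟨v, hv, rfl⟩
  have hSP : ∀ v ∈ P, S v ∈ P := by
    rintro _ ⟨u, hu, rfl⟩
    refine ⟨S u, hS hu, ?_⟩
    simp
  have hSPk : ∀ k, ∀ v ∈ P, (S ^ k) v ∈ P := fun k v hv => by
    induction k with
    | zero => simpa
    | succ k ih => rw [pow_succ', Module.End.mul_apply]; exact hSP _ ih
  have e1 : ∀ n k, n < k → (S ^ k) (y n) ∈ P := fun n => by
    induction n with
    | zero =>
      intro k hk
      obtain ⟨k, rfl⟩ := Nat.exists_eq_succ_of_ne_zero hk.ne'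
      rw [Nat.succ_eq_add_one, pow_succ, Module.End.mul_apply, h0]; exact hSPk _ _ (hP _ (hyL _))
    | succ n ih =>
      intro k hk
      obtain ⟨k, rfl⟩ := Nat.exists_eq_succ_of_ne_zero (by omega : k ≠ 0)
      rw [Nat.succ_eq_add_one, pow_succ, Module.End.mul_apply, h1, map_add]; exact P.add_mem (ih _ (by omega)) (hSPk _ _ (hP _ (hyL _)))
  have e2 : ∀ k n, (S ^ k) (y (n + k)) - y n ∈ P := fun k n => by
    induction k with
    | zero => simp
    | succ k ih =>
      rw [pow_succ, Module.End.mul_apply, ← add_assoc, h1, map_add, add_sub_right_comm]; exact P.add_mem ih (hSPk _ _ (hP _ (hyL _)))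
  obtain ⟨s, hs, hs2⟩ := (Submodule.fg_span_iff_fg_span_finset_subset _).mp hFG
  have e3 : ∃ K, ∀ v ∈ s, ∀ k, K ≤ k → (S ^ k) v ∈ P := by
    have : ∀ v : V, ∃ n, v ∈ s → y n = v := fun v => by
      by_cases h : v ∈ s
      · obtain ⟨n, hn⟩ := hs h; exact ⟨n, fun _ => hn⟩
      · exact ⟨0, fun h' => absurd h' h⟩
    choose g hg using this
    refine ⟨s.sup g + 1, fun v hv k hk => ?_⟩
    rw [← hg v hv]
    exact e1 _ _ (by have := Finset.le_sup (f := g) hv; omega)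
  obtain ⟨K, hK⟩ := e3
  have e4 : L ≤ P.comap (S ^ K) := by
    rw [hL, hs2]; exact Submodule.span_le.mpr fun v hv => hK v hv K le_rfl
  have e5 : L ≤ Ideal.span {(p : ℤ)} • L := by
    rw [hL]
    refine Submodule.span_le.mpr ?_
    rintro _ ⟨n, rfl⟩
    have : y n ∈ P := by
      have := P.sub_mem (e4 (hyL (n + K))) (e2 K n)
      rwa [sub_sub_cancel] at this
    obtain ⟨u, hu, hu2⟩ := this
    rw [← hu2]
    exact Submodule.smul_mem_smul (Ideal.mem_span_singleton_self _) hu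
  obtain ⟨r, hr, hr2⟩ := Submodule.exists_sub_one_mem_and_smul_eq_zero_of_fg_of_le_smul _ _ hFG e5
  refine htf r _ ?_ (hr2 _ (hyL n))
  rintro rfl
  obtain ⟨c, hc⟩ := Ideal.mem_span_singleton.mp hr
  have : (p : ℤ) ∣ 1 := ⟨-c, by linarith⟩
  have := Int.le_of_dvd one_pos this
  omega

def HT (m p : ℕ) (a : ℕ → ℤ → ℂ) (D : ℕ) (x : ℤ) : ℂ := VS m p (VS (m * p) p (Lf p a)) D x / p - (p + 1) * a D x

theorem Lam.lin {k m a b} (ha : Lam k m a) (hb : Lam k m b) (s t : ℂ) (hm : 0 < m) : Lam k m fun D x => s * a D x + t * b D x := by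
  refine ⟨fun D x => by simp only [ha.per, hb.per], fun D x h => by simp only [ha.supp D x h, hb.supp D x h]; ring, fun D x => by simp only [ha.par, hb.par]; ring, fun E hE => ?_⟩
  obtain ⟨M, hM⟩ := hE.bddN hm
  have h : ∀ c : ℕ → ℤ → ℂ, pair m c E.coeff = ∑ x ∈ Finset.range (2 * m), ∑ D ∈ Finset.range (M + 1), c D x * E.coeff (-D) x := fun c =>
    Finset.sum_congr rfl fun x _ => tsum_nat_fin _ fun D hD => by rw [hM _ _ (by omega), mul_zero]
  have h1 := ha.orth E hE
  have h2 := hb.orth E hE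
  rw [h] at *
  simp only [add_mul, Finset.sum_add_distrib, mul_assoc, ← Finset.mul_sum, h1, h2]; ring

theorem HT_lam {m p : ℕ} (hm : 0 < m) (hp : p.Prime) {a} (ha : Lam 2 m a) : Lam 2 m (HT m p a) := by
  have h1 := ((ha.gv hm).lf hm hp.pos).lam (by have := hp.pos; positivity)
  rw [show m * p ^ 2 = m * p * p by ring] at h1
  have h2 := ((h1.vs (Nat.mul_pos hm hp.pos) hp).vs hm hp).lin ha (1 / p) (-(p + 1)) hm
  convert h2 using 3
  unfold HT; ring

theorem b1_eq {m p : ℕ} (hp : p.Prime) {a} (ha : Lam 2 m a) (D : ℕ) (X : ℤ) :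
    VS (m * p) p (Lf p a) D X = p * (Lf p a D X + if (4 * (m * p : ℤ)) ∣ D - X ^ 2 then a D X else 0) := by
  have hpz : (p : ℤ) ≠ 0 := by exact_mod_cast hp.ne_zero
  unfold VS
  rw [Lf_mul hp.pos, Finset.sum_congr rfl (g := fun _ => Lf p a D X), Finset.sum_const, Finset.card_range, nsmul_eq_mul, mul_add]
  · push_cast
    simp only [mul_ite, mul_zero]
  · intro j _
    by_cases h : (p : ℤ) ∣ X
    · obtain ⟨x, rfl⟩ := h
      unfold Lf
      rw [show (p : ℤ) * x + 2 * (m * p : ℕ) * j = p * (x + 2 * m * j) by push_cast; ring, Int.mul_ediv_cancel_left _ hpz, Int.mul_ediv_cancel_left _ hpz,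
        per_int (f := fun l => a (D / p ^ 2) l) (ha.per _) x j]
      simp
    · rw [Lf_not _ _ h, Lf_not _ _ ((dvd_add_left (⟨2 * m * j, by push_cast; ring⟩ : (p : ℤ) ∣ _)).not.mpr h)]

theorem HT_eq {m p : ℕ} (hp : p.Prime) (hpm : ¬ p ∣ 2 * m) {a} (ha : Lam 2 m a) (D : ℕ) (x : ℤ) :
    HT m p a D x = ∑ j ∈ Finset.range p, Lf p a D (x + 2 * m * j) + ((((Finset.range p).filter fun j : ℕ => (p : ℤ) ∣ D - (x + 2 * m * j) ^ 2).card : ℂ) - 1) * a D x + p * a (p ^ 2 * D) (p * x) := by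
  have hpc : (p : ℂ) ≠ 0 := by exact_mod_cast hp.ne_zero
  have hco : IsCoprime (4 * (m : ℤ)) (p ^ 2 : ℤ) := by
    have h : IsCoprime (2 * (m : ℤ)) (p : ℤ) := by
      have := (Nat.Prime.coprime_iff_not_dvd hp).mpr hpm
      exact_mod_cast (Nat.isCoprime_iff_coprime.mpr this).symm
    have h2 : IsCoprime (2 : ℤ) p := h.of_mul_left_left
    rw [show (4 : ℤ) * m = 2 * (2 * m) by ring]
    exact (h2.mul_left h).pow_right
  have e1 : (if (4 * (m : ℤ)) ∣ D - x ^ 2 then (p : ℂ) * VS (m * p) p (Lf p a) (p ^ 2 * D) (p * x) else 0) = p ^ 2 * (a D x + a (p ^ 2 * D) (p * x)) := by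
    by_cases h : (4 * (m : ℤ)) ∣ D - x ^ 2
    · rw [if_pos h, b1_eq hp ha, Lf_mul hp.pos, if_pos]
      · ring
      · obtain ⟨c, hc⟩ := h
        exact ⟨p * c, by push_cast; linear_combination (p : ℤ) ^ 2 * hc⟩
    · rw [if_neg h, ha.supp _ _ h, ha.supp, add_zero, mul_zero]
      intro h'
      refine h (hco.dvd_of_dvd_mul_left ?_)
      exact (show (p : ℤ) ^ 2 * ((D : ℤ) - x ^ 2) = ((p ^ 2 * D : ℕ) : ℤ) - (p * x) ^ 2 by push_cast; ring) ▸ h'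
  have e2 : ∑ j ∈ Finset.range p, (if (4 * (m * p : ℤ)) ∣ D - (x + 2 * m * j) ^ 2 then a D (x + 2 * m * j) else 0) =
      (((Finset.range p).filter fun j : ℕ => (p : ℤ) ∣ D - (x + 2 * m * j) ^ 2).card : ℂ) * a D x := by
    rw [Finset.card_filter, Nat.cast_sum, Finset.sum_mul]
    refine Finset.sum_congr rfl fun j _ => ?_
    rw [per_int (f := fun l => a D l) (ha.per _) x j]
    by_cases h : (4 * (m : ℤ)) ∣ D - x ^ 2
    · have : (4 * (m * p : ℤ)) ∣ D - (x + 2 * m * j) ^ 2 ↔ (p : ℤ) ∣ D - (x + 2 * m * j) ^ 2 := by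
        refine ⟨fun h => (Dvd.intro_left (4 * (m : ℤ)) (by ring)).trans h, fun h' => ?_⟩
        rw [← mul_assoc]
        refine (hco.of_isCoprime_of_dvd_right (dvd_pow_self _ two_ne_zero)).mul_dvd ?_ h'
        obtain ⟨c, hc⟩ := h
        exact ⟨c - x * j - m * j ^ 2, by linear_combination hc⟩
      simp only [this]
      split_ifs <;> simp
    · rw [ha.supp _ _ h]; simp
  unfold HT
  change (∑ j ∈ Finset.range p, VS (m * p) p (Lf p a) D (x + 2 * m * j) + (if (4 * (m : ℤ)) ∣ D - x ^ 2 then (p : ℂ) * VS (m * p) p (Lf p a) (p ^ 2 * D) (p * x) else 0)) / p - _ = _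
  rw [e1, Finset.sum_congr rfl fun j _ => b1_eq hp ha D _, ← Finset.mul_sum, Finset.sum_add_distrib, e2]
  field_simp; ring

theorem cnt {m p : ℕ} (hp : p.Prime) (hpm : ¬ p ∣ 2 * m) (D : ℕ) (x : ℤ) :
    (((Finset.range p).filter fun j : ℕ => (p : ℤ) ∣ D - (x + 2 * m * j) ^ 2).card : ℂ) = ((Finset.range p).filter fun t : ℕ => (p : ℤ) ∣ D - (t : ℤ) ^ 2).card := by
  have h : IsCoprime (2 * (m : ℤ)) (p : ℤ) := by
    have := (Nat.Prime.coprime_iff_not_dvd hp).mpr hpm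
    exact_mod_cast (Nat.isCoprime_iff_coprime.mpr this).symm
  have := sum_aff hp.pos (f := fun t => if (p : ℤ) ∣ D - t ^ 2 then (1 : ℂ) else 0) (fun l => by
    have : (p : ℤ) ∣ D - (l + p) ^ 2 ↔ (p : ℤ) ∣ D - l ^ 2 := by
      rw [show (D : ℤ) - (l + p) ^ 2 = D - l ^ 2 + p * (-2 * l - p) by ring, dvd_add_left (dvd_mul_right _ _)]
    simp only [this]) (2 * m) x h
  simp only [Finset.card_filter, Nat.cast_sum, Nat.cast_ite, Nat.cast_one, Nat.cast_zero]
  rw [← this]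
  refine Finset.sum_congr rfl fun j _ => ?_
  rw [add_comm x]

theorem cnt_dvd {p : ℕ} (hp : p.Prime) {D : ℕ} (h : p ∣ D) : ((Finset.range p).filter fun t : ℕ => (p : ℤ) ∣ D - (t : ℤ) ^ 2).card = 1 := by
  rw [Finset.card_eq_one]
  refine ⟨0, Finset.ext fun t => ?_⟩
  simp only [Finset.mem_filter, Finset.mem_range, Finset.mem_singleton]
  have h' : (p : ℤ) ∣ D := by exact_mod_cast h
  constructor
  · rintro ⟨h1, h2⟩
    rw [dvd_sub_right h'] at h2
    have : p ∣ t := hp.dvd_of_dvd_pow (n := 2) (by exact_mod_cast h2)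
    exact Nat.eq_zero_of_dvd_of_lt this h1
  · rintro rfl; exact ⟨hp.pos, by simpa using h'⟩

theorem cnt_sq {p s : ℕ} (hp : p.Prime) (h2 : p ≠ 2) (h : ¬ p ∣ s) : ((Finset.range p).filter fun t : ℕ => (p : ℤ) ∣ (s ^ 2 : ℕ) - (t : ℤ) ^ 2).card = 2 := by
  have hlt := Nat.mod_lt s hp.pos
  have h0 : s % p ≠ 0 := fun h' => h (Nat.dvd_of_mod_eq_zero h')
  have hne : s % p ≠ p - s % p := fun h' => by
    rcases hp.eq_two_or_odd with h3 | h3 <;> omega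
  rw [Finset.card_eq_two]
  refine ⟨_, _, hne, Finset.ext fun t => ?_⟩
  simp only [Finset.mem_filter, Finset.mem_range, Finset.mem_singleton, Finset.mem_insert]
  have hs := Nat.mod_add_div s p
  have hsz : ((s % p : ℕ) : ℤ) + p * (s / p : ℕ) = s := by exact_mod_cast hs
  constructor
  · rintro ⟨h1, h3⟩
    rw [show ((s ^ 2 : ℕ) : ℤ) - (t : ℤ) ^ 2 = (s - t) * (s + t) by push_cast; ring] at h3
    rcases (Nat.prime_iff_prime_int.mp hp).dvd_or_dvd h3 with h4 | h4
    · left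
      have : (p : ℤ) ∣ ((s % p : ℕ) : ℤ) - t := by
        rw [show ((s % p : ℕ) : ℤ) - t = (s - t) - p * (s / p : ℕ) by linarith]; exact dvd_sub h4 (dvd_mul_right _ _)
      have := Int.eq_zero_of_abs_lt_dvd this (by rw [abs_lt]; omega)
      omega
    · right
      have : (p : ℤ) ∣ ((s % p : ℕ) : ℤ) + t - p := by
        rw [show ((s % p : ℕ) : ℤ) + t - p = (s + t) - p * ((s / p : ℕ) + 1) by linarith]; exact dvd_sub h4 (dvd_mul_right _ _)
      have := Int.eq_zero_of_abs_lt_dvd this (by rw [abs_lt]; omega)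
      omega
  · rintro (rfl | rfl)
    · refine ⟨hlt, ?_⟩
      rw [show ((s ^ 2 : ℕ) : ℤ) - ((s % p : ℕ) : ℤ) ^ 2 = (s - (s % p : ℕ)) * (s + (s % p : ℕ)) by push_cast; ring]
      exact Dvd.dvd.mul_right (⟨((s / p : ℕ) : ℤ), by linarith⟩ : (p : ℤ) ∣ _) _
    · refine ⟨by omega, ?_⟩
      rw [show ((s ^ 2 : ℕ) : ℤ) - ((p - s % p : ℕ) : ℤ) ^ 2 = (s - (p - s % p : ℕ)) * (s + (p - s % p : ℕ)) by push_cast; ring]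
      exact Dvd.dvd.mul_left (⟨((s / p : ℕ) : ℤ) + 1, by rw [Nat.cast_sub hlt.le]; linarith⟩ : (p : ℤ) ∣ _) _

theorem hecke_nil {m p : ℕ} (hm : 0 < m) (hp : p.Prime) (hpm : ¬ p ∣ 2 * m) {D : ℕ} (hD : ¬ p ^ 2 ∣ D) (x : ℤ) {c : ℕ} (hc : c = 0 ∨ c = 1)
    (hcnt : ((Finset.range p).filter fun t : ℕ => (p : ℤ) ∣ D - (t : ℤ) ^ 2).card = c + 1) {a} (ha : Lam 2 m a) (n : ℕ) :
    (c = 0 → a (p ^ (2 * n) * D) (p ^ n * x) = 0) ∧ (c = 1 → a (p ^ (2 * (n + 1)) * D) (p ^ (n + 1) * x) = a (p ^ (2 * n) * D) (p ^ n * x)) := by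
  obtain ⟨W, hW, hWe⟩ := ev_fg hm
  let S := LinearMap.funLeft ℤ ℂ (fun a : {a : ℕ → ℤ → ℂ // Lam 2 m a} => (⟨_, HT_lam hm hp a.2⟩ : {a : ℕ → ℤ → ℂ // Lam 2 m a}))
  let y : ℕ → {a : ℕ → ℤ → ℂ // Lam 2 m a} → ℂ := fun n => ev m (p ^ (2 * n) * D) (p ^ n * x)
  have y0 : S (y 0) = (c : ℤ) • y 0 + (p : ℤ) • y 1 := by
    funext ⟨a, ha⟩
    change HT m p a _ _ = (c : ℤ) • a _ _ + (p : ℤ) • a _ _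
    rw [HT_eq hp hpm ha, cnt hp hpm, Finset.sum_eq_zero fun j _ => show Lf p a _ _ = 0 from if_neg fun h => hD (by simpa using h.2)]
    simp [hcnt]
  have y1 : ∀ n, S (y (n + 1)) = y n + (p : ℤ) • y (n + 2) := fun n => by
    funext ⟨a, ha⟩
    change HT m p a _ _ = a _ _ + (p : ℤ) • a _ _
    rw [HT_eq hp hpm ha, cnt hp hpm, cnt_dvd hp ((dvd_pow_self p (by omega)).mul_right _), Finset.sum_eq_single_of_mem 0 (Finset.mem_range.mpr hp.pos)]
    · rw [show p ^ (2 * (n + 1)) * D = p ^ 2 * (p ^ (2 * n) * D) by ring, show (p : ℤ) ^ (n + 1) * x + 2 * m * (0 : ℕ) = p * (p ^ n * x) by push_cast; ring, Lf_mul hp.pos,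
        show p ^ (2 * (n + 2)) * D = p ^ 2 * (p ^ 2 * (p ^ (2 * n) * D)) by ring, show (p : ℤ) * (p ^ (n + 1) * x) = p ^ (n + 2) * x by ring]
      simp
    · intro j hj hj0
      refine Lf_not _ _ fun h => ?_
      rw [pow_succ', mul_assoc, dvd_add_right (dvd_mul_right _ _)] at h
      have h : p ∣ 2 * m * j := by exact_mod_cast h
      rcases hp.dvd_mul.mp h with h | h
      · exact hpm h
      · exact hj0 (Nat.eq_zero_of_dvd_of_lt h (Finset.mem_range.mp hj))
  have htf : ∀ (r : ℤ) (v : {a : ℕ → ℤ → ℂ // Lam 2 m a} → ℂ), r ≠ 0 → r • v = 0 → v = 0 := fun r v hr h => (smul_eq_zero.mp h).resolve_left hr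
  have hyW : ∀ n, (2 : ℤ) • y n ∈ W := fun n => hWe _ _
  constructor
  · rintro rfl
    have := nil_lemma htf S hW hp.two_le (fun n => (2 : ℤ) • y n) hyW (by simp only [map_smul, y0]; module) (fun n => by simp only [map_smul, y1]; module) n
    exact congrFun (htf _ _ two_ne_zero this) ⟨a, ha⟩
  · rintro rfl
    have := nil_lemma htf S hW hp.two_le (fun n => (2 : ℤ) • (y (n + 1) - y n)) (fun n => by rw [smul_sub]; exact W.sub_mem (hyW _) (hyW _))
      (by simp only [map_smul, map_sub, y0, y1]; module) (fun n => by simp only [map_smul, map_sub, y1]; module) n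
    exact sub_eq_zero.mp (congrFun (htf _ _ two_ne_zero this) ⟨a, ha⟩)

theorem lam_sq {m : ℕ} (hm : 0 < m) {a} (ha : Lam 2 m a) (s : ℕ) : 0 < s → s.Coprime (2 * m) → ∀ x : ℤ, a (s ^ 2) (s * x) = a 1 x := by
  induction s using Nat.strong_induction_on with
  | _ s ih =>
    intro hs hc x
    by_cases h1 : s = 1
    · subst h1; simp
    have hp := Nat.minFac_prime h1
    set p := s.minFac
    obtain ⟨i, t, ht, hst⟩ := Nat.exists_eq_pow_mul_and_not_dvd hs.ne' p hp.ne_one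
    have hi : i ≠ 0 := by rintro rfl; apply ht; rw [pow_zero, one_mul] at hst; rw [← hst]; exact Nat.minFac_dvd s
    have hpc : p.Coprime (2 * m) := hc.coprime_dvd_left (Nat.minFac_dvd s)
    have hpm : ¬ p ∣ 2 * m := (Nat.Prime.coprime_iff_not_dvd hp).mp hpc
    have h2 : p ≠ 2 := by rintro h; exact hpm (h ▸ dvd_mul_right 2 m)
    have key : ∀ n, a (p ^ (2 * n) * t ^ 2) (p ^ n * (t * x)) = a (t ^ 2) (t * x) := fun n => by
      induction n with
      | zero => simp
      | succ n ih' =>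
        rw [(hecke_nil hm hp hpm (D := t ^ 2) (fun h => ht ((Nat.pow_dvd_pow_iff two_ne_zero).mp h)) (t * x) (Or.inr rfl) (cnt_sq hp h2 ht) ha n).2 rfl, ih']
    have ht0 : 0 < t := by rcases Nat.eq_zero_or_pos t with h | h; · simp [h] at ht
                           · exact h
    have hlt : t < s := by rw [hst]; exact lt_mul_of_one_lt_left ht0 (Nat.one_lt_pow hi hp.one_lt)
    rw [← ih t hlt ht0 (hc.coprime_dvd_left ⟨p ^ i, by rw [hst, mul_comm]⟩) x, ← key i]
    nth_rw 1 [hst]; nth_rw 1 [hst]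
    congr 1
    · ring
    · push_cast; ring

theorem lam_ns {m : ℕ} (hm : 0 < m) {a} (ha : Lam 2 m a) {D : ℕ} (hc : D.Coprime (2 * m)) (hD : ¬ IsSquare D) (x : ℤ) : a D x = 0 := by
  obtain ⟨d, b, hbd, hsf⟩ := Nat.sq_mul_squarefree D
  have hd1 : d ≠ 1 := by rintro rfl; exact hD ⟨b, by rw [← hbd]; ring⟩
  have hD0 : D ≠ 0 := by rintro rfl; exact hD ⟨0, rfl⟩
  have hb0 : b ≠ 0 := by rintro rfl; apply hD0; rw [← hbd]; simp
  have hp := Nat.minFac_prime hd1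
  obtain ⟨e, he⟩ := Nat.minFac_dvd d
  set p := d.minFac
  have hpe : ¬ p ∣ e := fun ⟨f, hf⟩ => hp.one_lt.ne' (Nat.isUnit_iff.mp (hsf p ⟨f, by rw [mul_assoc, ← hf]; exact he⟩))
  obtain ⟨i, t, ht, hst⟩ := Nat.exists_eq_pow_mul_and_not_dvd hb0 p hp.ne_one
  have hpc : p.Coprime (2 * m) := hc.coprime_dvd_left (by rw [← hbd, he]; exact Dvd.intro_left (b ^ 2 * e) (by ring))
  obtain ⟨u, v, huv⟩ := Nat.isCoprime_iff_coprime.mpr (hpc.pow_left i)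
  push_cast at huv
  have e1 : a D x = a (p ^ (2 * i) * (p * (e * t ^ 2))) (p ^ i * (u * x)) := by
    rw [← per_int (f := fun l => a (p ^ (2 * i) * (p * (e * t ^ 2))) l) (ha.per _) _ (v * x)]
    congr 1
    · rw [← hbd, hst]; conv_lhs => rw [he]
      ring
    · linear_combination -x * huv
  rw [e1]
  refine (hecke_nil hm hp ((Nat.Prime.coprime_iff_not_dvd hp).mp hpc) ?_ (u * x) (Or.inl rfl) (cnt_dvd hp (dvd_mul_right _ _)) ha i).1 rfl
  rw [sq]
  intro h
  rcases hp.dvd_mul.mp (Nat.dvd_of_mul_dvd_mul_left hp.pos h) with h | h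
  · exact hpe h
  · exact ht (hp.dvd_of_dvd_pow h)

def AA (m₁ m₂ : ℕ) (x s : ℤ) : Prop := 2 * (m₁ : ℤ) ∣ x + s ∧ 2 * (m₂ : ℤ) ∣ s - x

def aR (m₁ m₂ D : ℕ) (x : ℤ) : ℂ := ∑' s : ℤ, if s ^ 2 = D ∧ AA m₁ m₂ x s then 1 else 0

theorem AA.cross {m₁ m₂ : ℕ} (h1 : 0 < m₁) {x y w z : ℤ} (h : AA m₁ m₂ x y) (h' : AA m₁ m₂ w z) : 2 * ((m₁ : ℤ) * m₂) ∣ y * w - x * z := by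
  have hg0 : (0 : ℤ) < ((Int.gcd m₁ m₂ : ℕ) : ℤ) := by exact_mod_cast Nat.gcd_pos_of_pos_left _ h1
  obtain ⟨μ, hμ⟩ := Int.gcd_dvd_left (m₁ : ℤ) m₂
  obtain ⟨ν, hν⟩ := Int.gcd_dvd_right (m₁ : ℤ) m₂
  have hco : IsCoprime μ ν := by
    refine ⟨Int.gcdA m₁ m₂, Int.gcdB m₁ m₂, ?_⟩
    have := Int.gcd_eq_gcd_ab (m₁ : ℤ) m₂
    nth_rw 2 [hμ] at this; nth_rw 4 [hν] at this
    refine mul_left_cancel₀ hg0.ne' ?_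
    linear_combination -this
  set g : ℤ := ((Int.gcd m₁ m₂ : ℕ) : ℤ)
  unfold AA at h h'; rw [hμ, hν] at h h'
  obtain ⟨⟨α, hα⟩, ⟨β, hβ⟩⟩ := h
  obtain ⟨⟨α', hα'⟩, ⟨β', hβ'⟩⟩ := h'
  have hx : x = g * (μ * α - ν * β) := by linarith
  have hw : w = g * (μ * α' - ν * β') := by linarith
  rw [hμ, hν, show 2 * (g * μ * (g * ν)) = 2 * g ^ 2 * (μ * ν) by ring,
    show y * w - x * z = 2 * g ^ 2 * (μ * α * (μ * α' - ν * β') - (μ * α - ν * β) * (μ * α')) by linear_combination w * hα - x * hα' + 2 * g * μ * α * hw - 2 * g * μ * α' * hx]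
  refine mul_dvd_mul_left _ (hco.mul_dvd ?_ ?_)
  · exact ⟨α * (μ * α' - ν * β') - (μ * α - ν * β) * α', by ring⟩
  · exact ⟨-μ * α * β' + β * μ * α', by ring⟩

theorem AA.per {m₁ m₂ : ℕ} (x s : ℤ) : (AA m₁ m₂ (x + 2 * ((m₁ : ℤ) * m₂)) s ↔ AA m₁ m₂ x s) ∧ (AA m₁ m₂ x (s + 2 * ((m₁ : ℤ) * m₂)) ↔ AA m₁ m₂ x s) := by
  unfold AA
  have a1 : 2 * (m₁ : ℤ) ∣ 2 * (m₁ * m₂) := ⟨m₂, by ring⟩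
  have a2 : 2 * (m₂ : ℤ) ∣ 2 * (m₁ * m₂) := ⟨m₁, by ring⟩
  rw [add_right_comm, ← sub_sub, ← add_assoc, add_sub_right_comm, dvd_add_left a1, dvd_add_left a2, dvd_sub_left a2]
  exact ⟨Iff.rfl, Iff.rfl⟩

theorem AA.symm {m₁ m₂ : ℕ} (x s : ℤ) : AA m₁ m₂ x s ↔ AA m₁ m₂ s x := by unfold AA; rw [add_comm, dvd_sub_comm]

theorem AA.neg {m₁ m₂ : ℕ} (x s : ℤ) : AA m₁ m₂ (-x) (-s) ↔ AA m₁ m₂ x s := by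
  unfold AA; rw [← neg_add, dvd_neg, show -s - -x = -(s - x) by ring, dvd_neg]

theorem AF {m₁ m₂ : ℕ} (h1 : 0 < m₁) (h2 : 0 < m₂) : ∀ x w : ℤ,
    ∑ y ∈ Finset.range (2 * (m₁ * m₂)), (if AA m₁ m₂ x y then ee (-(y * w : ℂ) / (2 * (m₁ * m₂))) else 0) =
      ∑ y ∈ Finset.range (2 * (m₁ * m₂)), if AA m₁ m₂ w y then ee (-(y * x : ℂ) / (2 * (m₁ * m₂))) else 0 := by
  have hN : 0 < 2 * (m₁ * m₂) := by positivity
  have hc : (m₁ : ℂ) ≠ 0 ∧ (m₂ : ℂ) ≠ 0 := ⟨by exact_mod_cast h1.ne', by exact_mod_cast h2.ne'⟩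
  obtain ⟨hc1, hc2⟩ := hc
  have hee : ∀ a b : ℤ, 2 * ((m₁ : ℤ) * m₂) ∣ a - b → ee (-(a : ℂ) / (2 * (m₁ * m₂))) = ee (-(b : ℂ) / (2 * (m₁ * m₂))) := by
    rintro a b ⟨c, hc⟩
    rw [← ee_add_int (-(b : ℂ) / _) (-c), show a = b + 2 * (m₁ * m₂) * c by linarith]
    congr 1; push_cast; field_simp; ring
  let B : ℤ → ℤ → ℂ := fun x w => ∑ y ∈ Finset.range (2 * (m₁ * m₂)), if AA m₁ m₂ x y then ee (-((y * w : ℤ) : ℂ) / (2 * (m₁ * m₂))) else 0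
  have shift : ∀ x w y0 : ℤ, AA m₁ m₂ x y0 → B x w = ee (-((y0 * w : ℤ) : ℂ) / (2 * (m₁ * m₂))) * B 0 w := fun x w y0 h0 => by
    simp only [B]
    rw [← sum_aff hN (f := fun y => if AA m₁ m₂ x y then ee (-((y * w : ℤ) : ℂ) / (2 * (m₁ * m₂))) else 0) (fun l => by
      push_cast; simp only [AA.per]; congr 1; have := hee ((l + 2 * (m₁ * m₂)) * w) (l * w) ⟨w, by ring⟩; push_cast at this; exact this) 1 y0 isCoprime_one_left, Finset.mul_sum]
    refine Finset.sum_congr rfl fun y _ => ?_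
    have : AA m₁ m₂ x (1 * y + y0) ↔ AA m₁ m₂ 0 y := by
      unfold AA at h0 ⊢
      rw [show x + (1 * (y : ℤ) + y0) = (0 + y) + (x + y0) by ring, show 1 * (y : ℤ) + y0 - x = (y - 0) + (y0 - x) by ring, dvd_add_left h0.1, dvd_add_left h0.2]
    simp only [this, mul_ite, mul_zero, ← ee_add]
    congr 2; push_cast; ring
  have adm : ∀ w z : ℤ, AA m₁ m₂ w z → B 0 w = B 0 0 := fun w z hz => by
    refine Finset.sum_congr rfl fun y _ => ?_
    split_ifs with h
    · exact hee _ _ (by simpa using h.cross h1 hz)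
    · rfl
  have nadm : ∀ w : ℤ, (∀ z, ¬ AA m₁ m₂ w z) → B 0 w = 0 := fun w hw => by
    set g : ℤ := ((Int.gcd m₁ m₂ : ℕ) : ℤ) with hg
    obtain ⟨μ, hμ⟩ := Int.gcd_dvd_left (m₁ : ℤ) m₂
    obtain ⟨ν, hν⟩ := Int.gcd_dvd_right (m₁ : ℤ) m₂
    have hgw : ¬ g ∣ w := by
      rintro ⟨w', rfl⟩
      have := Int.gcd_eq_gcd_ab (m₁ : ℤ) m₂
      refine hw (-(g * w') + 2 * m₁ * Int.gcdA m₁ m₂ * w') ⟨⟨Int.gcdA m₁ m₂ * w', by ring⟩, ⟨-Int.gcdB m₁ m₂ * w', ?_⟩⟩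
      linear_combination -2 * w' * this
    have hgc : (g : ℂ) ≠ 0 := by
      have : (g : ℤ) ≠ 0 := by rw [hg]; exact_mod_cast (Nat.gcd_pos_of_pos_left m₂ h1).ne'
      exact_mod_cast this
    have hs := shift 0 w (2 * m₁ * ν) ⟨⟨ν, by ring⟩, ⟨μ, by
      have : (m₁ : ℤ) * (g * ν) = m₂ * (g * μ) := by rw [← hν, ← hμ]; ring
      have hg0 : g ≠ 0 := by exact_mod_cast hgc
      have := mul_left_cancel₀ hg0 (show g * ((m₁ : ℤ) * ν) = g * (m₂ * μ) by linarith)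
      linarith⟩⟩
    by_contra hB
    have h3 : ee (-((2 * m₁ * ν * w : ℤ) : ℂ) / (2 * (m₁ * m₂))) = 1 := by
      have := mul_right_cancel₀ hB (hs.symm.trans (one_mul _).symm); exact this
    have hνc : (m₂ : ℂ) = g * ν := by exact_mod_cast hν
    have hν0 : (ν : ℂ) ≠ 0 := fun h => hc2 (by rw [hνc, h, mul_zero])
    rw [show -((2 * m₁ * ν * w : ℤ) : ℂ) / (2 * (m₁ * m₂)) = -(w : ℂ) / g by rw [hνc]; push_cast; field_simp, ee_eq_one_iff] at h3
    obtain ⟨n, hn⟩ := h3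
    refine hgw ⟨-n, ?_⟩
    have : (w : ℂ) = g * (-n) := by field_simp at hn; linear_combination -hn
    exact_mod_cast this
  have main : ∀ x w, B x w = B w x := fun x w => by
    have hz : ∀ x w, (∀ z, ¬ AA m₁ m₂ x z) → B x w = 0 := fun x w h => Finset.sum_eq_zero fun y _ => if_neg (h _)
    by_cases hx : ∃ y, AA m₁ m₂ x y
    · obtain ⟨y, hy⟩ := hx
      by_cases hw : ∃ z, AA m₁ m₂ w z
      · obtain ⟨z, hw⟩ := hw
        rw [shift x w y hy, shift w x z hw, adm w z hw, adm x y hy, hee (y * w) (z * x) (by have := hy.cross h1 hw; rwa [mul_comm z x])]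
      · push_neg at hw
        rw [shift x w y hy, nadm w hw, hz w x hw, mul_zero]
    · push_neg at hx
      rw [hz x w hx]
      by_cases hw : ∃ z, AA m₁ m₂ w z
      · obtain ⟨z, hw⟩ := hw
        rw [shift w x z hw, nadm x hx, mul_zero]
      · push_neg at hw; rw [hz w x hw]
  intro x w
  have := main x w
  simp only [B] at this; push_cast at this; exact this

theorem aR_gv {m₁ m₂ : ℕ} (h1 : 0 < m₁) (h2 : 0 < m₂) : GV 2 (m₁ * m₂) (aR m₁ m₂) := by
  have hm : 0 < m₁ * m₂ := by positivity
  set m := m₁ * m₂ with hmdef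
  have hm' : (m : ℂ) ≠ 0 := by exact_mod_cast hm.ne'
  have hmz : (m : ℤ) = (m₁ : ℤ) * m₂ := by rw [hmdef]; push_cast; rfl
  have hmc : (m : ℂ) = (m₁ : ℂ) * m₂ := by rw [hmdef]; push_cast; rfl
  have hs : ∀ (x : ℤ) (τ : ℂ), 0 < τ.im → HasSum (fun D : ℕ => aR m₁ m₂ D x * ee (D * (τ / (4 * m)))) (∑ y ∈ Finset.range (2 * m), if AA m₁ m₂ x y then jTheta m y τ 0 else 0) := fun x τ hτ => by
    have s0 : Summable fun s : ℤ => ee ((s : ℂ) ^ 2 * (τ / (4 * m))) := by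
      refine (jTheta_hasSum (m := 1) one_pos 0 (im_div4 hm hτ) 0).1.summable.congr fun s => ?_
      congr 1; push_cast; ring
    have s1 : Summable fun s : ℤ => if AA m₁ m₂ x s then ee ((s : ℂ) ^ 2 * (τ / (4 * m))) else 0 := by
      refine (s0.indicator {s | AA m₁ m₂ x s}).congr fun s => ?_
      simp only [Set.indicator_apply, Set.mem_setOf_eq]
    have s2 := s1.hasSum
    rw [← hasSum_residues (by positivity : 0 < 2 * m) s2] at s2
    have s3 := s2.tsum_fiberwise (fun s : ℤ => s.natAbs ^ 2)
    have hv : (∑ y ∈ Finset.range (2 * m), if AA m₁ m₂ x y then jTheta m y τ 0 else 0) = ∑ l ∈ Finset.range (2 * m),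
      ∑' n : ℤ, if AA m₁ m₂ x (l + (2 * m : ℕ) * n) then ee (((l + (2 * m : ℕ) * n : ℤ) : ℂ) ^ 2 * (τ / (4 * m))) else 0 := by
      refine Finset.sum_congr rfl fun y _ => ?_
      have : ∀ n : ℤ, AA m₁ m₂ x (y + (2 * m : ℕ) * n) ↔ AA m₁ m₂ x y := fun n => by
        have := per_int (f := fun s => if AA m₁ m₂ x s then (1 : ℂ) else 0) (N := (2 * m : ℕ)) (fun l => by push_cast; rw [hmz]; simp only [AA.per]) y n
        by_cases ha : AA m₁ m₂ x (y + (2 * m : ℕ) * n) <;> by_cases hb : AA m₁ m₂ x y <;> simp_all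
      simp only [this]
      split_ifs
      · unfold jTheta; congr 1; funext n; congr 1; push_cast; ring
      · simp
    rw [hv]
    refine hs_congr s3 fun D => ?_
    rw [tsum_subtype ((fun s : ℤ => s.natAbs ^ 2) ⁻¹' {D}) (fun s : ℤ => if AA m₁ m₂ x s then ee ((s : ℂ) ^ 2 * (τ / (4 * m))) else 0)]
    unfold aR
    rw [← tsum_mul_right]
    congr 1; funext s
    have : s ∈ (fun s : ℤ => s.natAbs ^ 2) ⁻¹' {D} ↔ s ^ 2 = D := by
      simp only [Set.mem_preimage, Set.mem_singleton_iff]; zify; rw [sq_abs]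
    simp only [Set.indicator_apply, this]
    by_cases h : s ^ 2 = (D : ℤ)
    · simp only [h, true_and, if_true]
      have : (s : ℂ) ^ 2 = D := by exact_mod_cast h
      rw [this]; split_ifs <;> simp
    · simp [h]
  have hg : ∀ (x : ℤ) (τ : ℂ), 0 < τ.im → gS m (aR m₁ m₂) x τ = ∑ y ∈ Finset.range (2 * m), if AA m₁ m₂ x y then jTheta m y τ 0 else 0 := fun x τ hτ => (hs x τ hτ).tsum_eq
  refine ⟨fun D x => ?_, fun D x h => ?_, fun D x => ?_, fun x => conv_of hm (hs x), fun τ hτ x => ?_⟩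
  · unfold aR; rw [hmz]; simp only [AA.per]
  · unfold aR
    rw [tsum_congr fun s => if_neg _, tsum_zero]
    rintro s ⟨h3, ⟨c, hc⟩, ⟨d, hd⟩⟩
    refine h ⟨c * d, ?_⟩
    rw [← h3, hmz]; linear_combination (s - x) * hc + 2 * m₁ * c * hd
  · norm_num
    unfold aR
    rw [← (Equiv.neg ℤ).tsum_eq]
    simp only [Equiv.neg_apply, AA.neg, neg_sq]
  · rw [hg _ _ (im_S hτ), sub_self, zpow_zero, one_mul]
    simp only [hg _ _ hτ]
    have hS : ∀ y : ℤ, jTheta m y (-1 / τ) 0 = sqI (τ / (2 * m)) * ∑ j ∈ Finset.range (2 * m), ee (-(y * j : ℂ) / (2 * m)) * jTheta m j τ 0 := fun y => by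
      have := jTheta_S hm y hτ 0
      simpa [ee_zero] using this
    have e : ∀ w : ℕ, ∑ y ∈ Finset.range (2 * m), ee (-(x * y : ℂ) / (2 * m)) * (if AA m₁ m₂ y w then jTheta m w τ 0 else 0) =
        ∑ y ∈ Finset.range (2 * m), (if AA m₁ m₂ x y then ee (-(y * w : ℂ) / (2 * m)) else 0) * jTheta m w τ 0 := fun w => by
      have := AF h1 h2 x w
      rw [← hmdef] at this
      simp only [← hmc] at this
      have this : _ = _ := this
      push_cast at this
      rw [← Finset.sum_mul, this, Finset.sum_mul]
      refine Finset.sum_congr rfl fun y _ => ?_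
      rw [AA.symm]; split_ifs
      · rw [mul_comm (x : ℂ)]
      · simp
    simp only [hS]
    have l1 : ∀ y : ℕ, (if AA m₁ m₂ x y then sqI (τ / (2 * m)) * ∑ j ∈ Finset.range (2 * m), ee (-(((y : ℤ) : ℂ) * j) / (2 * m)) * jTheta m j τ 0 else 0) =
        sqI (τ / (2 * m)) * ∑ j ∈ Finset.range (2 * m), (if AA m₁ m₂ x y then ee (-(y * j : ℂ) / (2 * m)) else 0) * jTheta m j τ 0 := fun y => by
      split_ifs <;> simp
    simp only [l1]
    rw [← Finset.mul_sum, Finset.sum_comm]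
    simp only [← e]
    rw [Finset.sum_comm]
    simp only [Finset.mul_sum]
    try norm_cast

theorem GV.fcl {m : ℕ} (hm : 0 < m) {a} (hG : GV 2 m a) (lam : ℤ → ℂ) (h : ∀ D : ℕ, ∑ x ∈ Finset.range (2 * m), lam x * a D x = 0) (D : ℕ) :
    ∑ y ∈ Finset.range (2 * m), (∑ x ∈ Finset.range (2 * m), lam x * ee (-(x * y : ℂ) / (2 * m))) * a D y = 0 := by
  have hm' : (m : ℂ) ≠ 0 := by exact_mod_cast hm.ne'
  have hs : ∀ (mu : ℕ → ℂ) (τ : ℂ), 0 < τ.im → HasSum (fun D : ℕ => (∑ y ∈ Finset.range (2 * m), mu y * a D y) * ee (D * (τ / (4 * m)))) (∑ y ∈ Finset.range (2 * m), mu y * gS m a y τ) := fun mu τ hτ => by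
    refine hs_congr (hasSum_sum fun (y : ℕ) _ => (hG.hs hm y hτ).mul_left (mu y)) fun D => ?_
    rw [Finset.sum_mul]; exact Finset.sum_congr rfl fun y _ => by ring
  have hz : ∀ τ : ℂ, 0 < τ.im → ∑ y ∈ Finset.range (2 * m), (∑ x ∈ Finset.range (2 * m), lam x * ee (-(x * y : ℂ) / (2 * m))) * gS m a y τ = 0 := fun τ hτ => by
    have h1 := hs (fun x => lam x) (-1 / τ) (im_S hτ)
    simp only [h, zero_mul] at h1
    have h2 := h1.unique hasSum_zero
    simp only [hG.slaw τ hτ, sub_self, zpow_zero, one_mul] at h2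
    refine (mul_eq_zero.mp (?_ : sqI (τ / (2 * m)) * _ = 0)).resolve_left (sq_ne ?_)
    · rw [← h2, Finset.mul_sum]
      simp only [Finset.sum_mul, Finset.mul_sum]
      rw [Finset.sum_comm]
      refine Finset.sum_congr rfl fun x _ => Finset.sum_congr rfl fun y _ => ?_
      push_cast; ring
    · exact im_nat_div hm hτ
  have hs' := hs fun y => ∑ x ∈ Finset.range (2 * m), lam x * ee (-(x * y : ℂ) / (2 * m))
  have h3 := evP_coeff (conv_of hm hs') (r := 1 / 2) (M := 0) (by norm_num) (by norm_num) (fun x hx => by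
    obtain ⟨τ, hτ, rfl⟩ := exists_ee (x := x) (by rintro rfl; norm_num at hx) (by rw [hx]; norm_num)
    have h4 : 0 < (4 * m * τ).im := by
      have := im_nat_mul hm (im_nat_mul (m := 1) (by norm_num) hτ); convert this using 2; push_cast; ring
    have h5 := hs' _ h4
    rw [hz _ h4] at h5
    unfold evP
    rw [HasSum.tsum_eq (hs_congr h5 fun D => by rw [PowerSeries.coeff_mk, ee_pow, show (4 * m * τ) / (4 * m) = τ by field_simp]), norm_zero]) D
  rw [PowerSeries.coeff_mk] at h3
  have h4 : (0 : ℝ) < (1 / 2) ^ D := by positivity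
  exact norm_le_zero_iff.mp (nonpos_of_mul_nonpos_left h3 h4)

theorem hee2 {N : ℕ} (hN : 0 < N) {a b : ℤ} (h : 2 * (N : ℤ) ∣ a - b) : ee ((a : ℂ) / (2 * N)) = ee ((b : ℂ) / (2 * N)) := by
  have : (N : ℂ) ≠ 0 := by exact_mod_cast hN.ne'
  obtain ⟨c, hc⟩ := h
  rw [← ee_add_int ((b : ℂ) / _) c, show a = b + 2 * N * c by linarith]
  congr 1; push_cast; field_simp

theorem gauss_ex {Q R : ℕ} (hev : 2 ∣ Q * R) (hc : IsCoprime (R : ℤ) Q) : ∃ b e : ℤ, b * R - 1 = Q * e ∧ 2 ∣ b * Q ∧ 2 ∣ R * e := by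
  by_cases hQ : 2 ∣ Q
  · obtain ⟨Q', rfl⟩ := hQ
    have h2 : IsCoprime (R : ℤ) ((2 : ℤ) * ((2 * Q' : ℕ) : ℤ)) := IsCoprime.mul_right (by push_cast at hc; exact hc.of_mul_right_left) hc
    obtain ⟨b, c, h⟩ := h2
    exact ⟨b, -2 * c, by linear_combination h, by push_cast; exact ⟨b * Q', by ring⟩, ⟨-(R * c), by ring⟩⟩
  · have hR : (2 : ℤ) ∣ R := by exact_mod_cast (Nat.prime_two.dvd_mul.mp hev).resolve_left hQ
    obtain ⟨b, c, h⟩ := hc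
    rcases Int.even_or_odd b with hb | hb
    · exact ⟨b, -c, by linear_combination h, hb.two_dvd.mul_right _, hR.mul_right _⟩
    · refine ⟨b + Q, R - c, by linear_combination h, Dvd.dvd.mul_right ?_ _, hR.mul_right _⟩
      have : Odd (Q : ℤ) := by rw [Int.odd_iff]; omega
      exact (hb.add_odd this).two_dvd

theorem gauss {N Q R : ℕ} (hN : 0 < N) (hNe : N = Q * R) {b e : ℤ} (h1 : b * R - 1 = Q * e) (h2 : 2 ∣ b * Q) (h3 : 2 ∣ R * e) :
    ∃ G : ℂ, G ≠ 0 ∧ ∀ w : ℤ, ∑ y ∈ Finset.range N, ee (((R * b * y ^ 2 - 2 * y * w : ℤ) : ℂ) / (2 * N)) = if (R : ℤ) ∣ w then ee (((-w ^ 2 : ℤ) : ℂ) / (2 * N)) * G else 0 := by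
  have hc : (N : ℂ) ≠ 0 := by exact_mod_cast hN.ne'
  have hz : (N : ℤ) = Q * R := by exact_mod_cast hNe
  have hR0 : (R : ℂ) ≠ 0 := by rintro h; apply hc; rw [hNe]; push_cast; rw [h, mul_zero]
  have hQ0 : (Q : ℂ) ≠ 0 := by rintro h; apply hc; rw [hNe]; push_cast; rw [h, zero_mul]
  obtain ⟨b', hb'⟩ := h2
  obtain ⟨e', he'⟩ := h3
  let f : ℤ → ℤ → ℂ := fun w y => ee (((R * b * y ^ 2 - 2 * y * w : ℤ) : ℂ) / (2 * N))
  have hp : ∀ w l, f w (l + N) = f w l := fun w l => hee2 hN ⟨R * b * l + b' * R ^ 2 - w, by rw [hz]; linear_combination (Q * R ^ 3 : ℤ) * hb'⟩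
  have hsh : ∀ w v, ∑ y ∈ Finset.range N, f w y = ∑ y ∈ Finset.range N, f w (1 * y + v) := fun w v => (sum_aff hN (hp w) 1 v isCoprime_one_left).symm
  have hval : ∀ w : ℤ, ∑ y ∈ Finset.range N, f w y = if (R : ℤ) ∣ w then ee (((-w ^ 2 : ℤ) : ℂ) / (2 * N)) * ∑ y ∈ Finset.range N, f 0 y else 0 := fun w => by
    split_ifs with hw
    · obtain ⟨v, rfl⟩ := hw
      rw [hsh _ (R * v), Finset.mul_sum]
      refine Finset.sum_congr rfl fun y _ => ?_
      rw [← ee_add, ← add_div]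
      simp only [f]
      rw [← Int.cast_add]
      refine hee2 hN ⟨v * y * e + e' * v ^ 2, ?_⟩
      rw [hz]
      linear_combination (2 * R * v * y + R ^ 2 * v ^ 2 : ℤ) * h1 + Q * R * v ^ 2 * he'
    · by_contra hne
      apply hw
      have h4 := hsh w Q
      have h5 : ∀ y : ℕ, f w (1 * y + Q) = ee (-(w : ℂ) / R) * f w y := fun y => by
        simp only [f]
        rw [show -(w : ℂ) / R = ((-2 * Q * w : ℤ) : ℂ) / (2 * N) by rw [hNe]; push_cast; field_simp, ← ee_add, ← add_div, ← Int.cast_add]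
        refine hee2 hN ⟨b * y + b', ?_⟩
        rw [hz]; linear_combination (Q * R : ℤ) * hb'
      simp only [h5] at h4
      rw [← Finset.mul_sum] at h4
      have h6 : ee (-(w : ℂ) / R) = 1 := by
        have := mul_right_cancel₀ hne ((one_mul _).trans h4); exact this.symm
      obtain ⟨n, hn⟩ := (ee_eq_one_iff _).mp h6
      refine ⟨-n, ?_⟩
      have : (w : ℂ) = R * (-n) := by field_simp at hn; linear_combination -hn
      exact_mod_cast this
  refine ⟨_, fun h0 => ?_, hval⟩
  have h7 : ∀ w : ℤ, ∑ y ∈ Finset.range N, f w y = 0 := fun w => by rw [hval, h0]; simp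
  have h8 : ∑ w ∈ Finset.range N, ∑ y ∈ Finset.range N, f w y = N := by
    rw [Finset.sum_comm, Finset.sum_eq_single_of_mem 0 (by simpa using hN)]
    · simp [f, ee_zero]
    · intro y hy hy0
      have : ∀ w : ℕ, f w y = ee (((R * b * y ^ 2 : ℤ) : ℂ) / (2 * N)) * ee ((w * (-y : ℤ) : ℂ) / N) := fun w => by
        rw [← ee_add]; simp only [f]; congr 1; push_cast; field_simp; ring
      simp only [this]
      rw [← Finset.mul_sum, orth_sum hN, if_neg, mul_zero]
      rw [dvd_neg]; intro hd
      have hd' : N ∣ y := by exact_mod_cast hd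
      exact absurd (Nat.le_of_dvd (by omega) hd') (by simpa using hy)
  simp only [h7, Finset.sum_const_zero] at h8
  exact hc h8.symm

theorem GV.tcl {m : ℕ} (hm : 0 < m) {a} (hG : GV 2 m a) (lam : ℤ → ℂ) (j : ℤ) {D : ℕ} (h : ∑ x ∈ Finset.range (2 * m), lam x * a D x = 0) :
    ∑ x ∈ Finset.range (2 * m), (lam x * ee (((j * x ^ 2 : ℤ) : ℂ) / (2 * (2 * m : ℕ)))) * a D x = 0 := by
  have : ∀ x : ℕ, (lam x * ee (((j * x ^ 2 : ℤ) : ℂ) / (2 * (2 * m : ℕ)))) * a D x = ee (((j * D : ℤ) : ℂ) / (2 * (2 * m : ℕ))) * (lam x * a D x) := fun x => by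
    by_cases hx : (4 * (m : ℤ)) ∣ (D : ℤ) - (x : ℤ) ^ 2
    · rw [hee2 (N := 2 * m) (a := j * x ^ 2) (b := j * D) (by positivity) (by
        obtain ⟨c, hc⟩ := hx; exact ⟨-j * c, by push_cast; linear_combination -j * hc⟩)]
      ring
    · rw [hG.supp D x hx]; simp
  simp only [this]
  rw [← Finset.mul_sum, h, mul_zero]

theorem GV.key {m : ℕ} (hm : 0 < m) {a} (hG : GV 2 m a) {q Q' R : ℕ} (hN : 2 * m = q * Q' * R) (hc : IsCoprime (R : ℤ) (q * Q' : ℕ)) {x0 : ℤ} (hx0 : (q : ℤ) ∣ x0)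
    (hz : ∀ l : ℤ, ¬ (q : ℤ) ∣ l → ∀ D, a D (-x0 + R * l) = 0) (D : ℕ) {j : ℕ} (hj : j < q) : a D (x0 + R * (Q' * j)) = a D x0 := by
  set Q := q * Q' with hQ
  have hN0 : 0 < 2 * m := by positivity
  have hm' : (m : ℂ) ≠ 0 := by exact_mod_cast hm.ne'
  have hQ'0 : 0 < Q' := Nat.pos_of_ne_zero fun h => by simp [hQ, h] at hN; omega
  have hq0 : 0 < q := by omega
  have hQ0 : 0 < Q := by positivity
  have hQc : (Q : ℂ) ≠ 0 := by exact_mod_cast hQ0.ne'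
  have hqc : (q : ℂ) ≠ 0 := by exact_mod_cast hq0.ne'
  have hQ'c : (Q' : ℂ) ≠ 0 := by exact_mod_cast hQ'0.ne'
  have hR0 : 0 < R := Nat.pos_of_ne_zero fun h => by simp [h] at hN; omega
  have hRc : (R : ℂ) ≠ 0 := by exact_mod_cast hR0.ne'
  obtain ⟨b, e, g1, g2, g3⟩ := gauss_ex ⟨m, hN.symm⟩ hc
  obtain ⟨G, hG0, hg⟩ := gauss hN0 hN g1 g2 g3
  have hNz : 2 * (m : ℤ) = Q * R := by exact_mod_cast hN
  have hNc : 2 * (m : ℂ) = Q * R := by exact_mod_cast hN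
  have hper : ∀ (x : ℤ) (D : ℕ), a D (x + (2 * m : ℕ)) = a D x := fun x D => by push_cast; exact hG.per D x
  -- step 1
  have st1 : ∀ y : ℤ, (∀ D, a D y = 0) → ∀ D, ∑ w ∈ Finset.range (2 * m), (if (R : ℤ) ∣ y + w then ee (((-2 * y * w : ℤ) : ℂ) / (2 * (2 * m : ℕ))) else 0) * a D w = 0 := by
    intro y hy D
    have i1 : ∀ D : ℕ, ∑ x ∈ Finset.range (2 * m), (if ((2 * m : ℕ) : ℤ) ∣ (x : ℤ) - y then 1 else 0 : ℂ) * a D x = 0 := fun D => Finset.sum_eq_zero fun x _ => by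
      split_ifs with h
      · rw [per_mod (f := a D) (fun l => hper l D) h, hy, mul_zero]
      · rw [zero_mul]
    have i2 := hG.fcl hm (fun x => if ((2 * m : ℕ) : ℤ) ∣ x - y then 1 else 0) i1
    have i3 : ∀ D, ∑ x ∈ Finset.range (2 * m), ee (((-2 * x * y : ℤ) : ℂ) / (2 * (2 * m : ℕ))) * a D x = 0 := fun D => by
      rw [← i2 D]
      refine Finset.sum_congr rfl fun x _ => ?_
      congr 1
      have := sum_aff hN0 (f := fun l => (if ((2 * m : ℕ) : ℤ) ∣ l - y then 1 else 0) * ee (((-2 * l * x : ℤ) : ℂ) / (2 * (2 * m : ℕ)))) (fun l => by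
        simp only [add_sub_right_comm, dvd_add_left (dvd_refl ((2 * m : ℕ) : ℤ))]; rw [hee2 hN0 (a := -2 * (l + (2 * m : ℕ)) * x) (b := -2 * l * x) ⟨-x, by ring⟩]) 1 y isCoprime_one_left
      rw [Finset.sum_eq_single_of_mem 0 (by simpa using hN0) (fun t ht h0 => by
        rw [if_neg, zero_mul]; intro hd
        have hd' : 2 * m ∣ t := by rw [one_mul, add_sub_cancel_right] at hd; exact_mod_cast hd
        exact absurd (Nat.le_of_dvd (by omega) hd') (by simpa using ht))] at this
      simp only [Nat.cast_zero, mul_zero, zero_add, sub_self, dvd_zero, if_true, one_mul] at this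
      rw [show (-2 * (x : ℤ) * y) = -2 * y * x by ring, this]
      refine Finset.sum_congr rfl fun l _ => ?_
      congr 2; push_cast; field_simp
    have i4 := fun D => hG.tcl hm (fun x => ee (((-2 * x * y : ℤ) : ℂ) / (2 * (2 * m : ℕ)))) (R * b) (i3 D)
    have i5 := hG.fcl hm (fun x => ee (((-2 * x * y : ℤ) : ℂ) / (2 * (2 * m : ℕ))) * ee (((R * b * x ^ 2 : ℤ) : ℂ) / (2 * (2 * m : ℕ)))) i4
    have i6 := hG.tcl hm (fun w => if (R : ℤ) ∣ y + w then ee (((-(y + w) ^ 2 : ℤ) : ℂ) / (2 * (2 * m : ℕ))) * G else 0) 1 (D := D) (by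
      refine Eq.trans (Finset.sum_congr rfl fun w _ => ?_) (i5 D)
      rw [← hg]
      congr 1
      refine Finset.sum_congr rfl fun x _ => ?_
      rw [← ee_add, ← ee_add]; congr 1; push_cast; field_simp; ring)
    refine (mul_eq_zero.mp (?_ : (ee (((-y ^ 2 : ℤ) : ℂ) / (2 * (2 * m : ℕ))) * G) * _ = 0)).resolve_left (mul_ne_zero (ee_ne _) hG0)
    rw [Finset.mul_sum]
    refine Eq.trans (Finset.sum_congr rfl fun w _ => ?_) i6
    split_ifs
    · rw [show ee (((-(y + w) ^ 2 : ℤ) : ℂ) / (2 * (2 * m : ℕ))) * G * ee (((1 * w ^ 2 : ℤ) : ℂ) / (2 * (2 * m : ℕ))) * a D w =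
        ee (((-(y + w) ^ 2 : ℤ) : ℂ) / (2 * (2 * m : ℕ))) * ee (((1 * w ^ 2 : ℤ) : ℂ) / (2 * (2 * m : ℕ))) * (G * a D w) by ring, ← ee_add,
        show ∀ u v : ℂ, u * G * (v * a D w) = u * v * (G * a D w) by intros; ring, ← ee_add]
      congr 2; push_cast; field_simp; ring
    · simp
  -- step 2
  have st2 : ∀ l : ℤ, ¬ (q : ℤ) ∣ l → ∀ D, ∑ k ∈ Finset.range Q, ee ((k * (-(R * l - x0) : ℤ) : ℂ) / Q) * a D (x0 + R * k) = 0 := by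
    intro l hl D
    have j1 := st1 _ (hz l hl) D
    set y := -x0 + R * l with hy
    rw [← sum_aff hN0 (f := fun w => (if (R : ℤ) ∣ y + w then ee (((-2 * y * w : ℤ) : ℂ) / (2 * (2 * m : ℕ))) else 0) * a D w) (fun w => by
      rw [hper, hee2 hN0 (a := -2 * y * (w + (2 * m : ℕ))) (b := -2 * y * w) ⟨-y, by ring⟩]; simp only [← add_assoc, dvd_add_left (show (R : ℤ) ∣ (2 * m : ℕ) from ⟨Q, by push_cast; rw [hNz]; ring⟩)]) 1 x0 isCoprime_one_left,
      hN, sum_split0 _ _ hR0] at j1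
    · refine (mul_eq_zero.mp (?_ : ee ((-(y * x0) : ℂ) / (Q * R)) * _ = 0)).resolve_left (ee_ne _)
      rw [← j1, Finset.mul_sum]
      refine Finset.sum_congr rfl fun k _ => ?_
      rw [if_pos ⟨l + k, by rw [hy]; push_cast; ring⟩, ← mul_assoc, ← ee_add]
      push_cast
      rw [show (1 : ℤ) * (R * k) + x0 = x0 + R * k by ring]
      congr 2; rw [hy]; push_cast; field_simp; ring
    · intro X hX
      rw [if_neg, zero_mul]
      intro hd; apply hX
      have : (R : ℤ) ∣ R * l + X := by convert hd using 1; rw [hy]; ring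
      rw [dvd_add_right (dvd_mul_right _ _)] at this; exact_mod_cast this
  -- step 3
  have st3 : ∀ u : ℤ, ¬ (q : ℤ) ∣ u → ∑ k ∈ Finset.range Q, ee ((k * (-u : ℤ) : ℂ) / Q) * a D (x0 + R * k) = 0 := by
    intro u hu
    obtain ⟨α, β, h⟩ := hc
    have hl : R * (α * (u + x0)) - x0 = u - Q * (β * (u + x0)) := by linear_combination (u + x0) * h
    rw [← st2 (α * (u + x0)) (fun hd => hu ?_) D]
    · refine Finset.sum_congr rfl fun k _ => ?_
      rw [hl]; congr 1
      rw [← ee_add_int _ (k * (β * (u + x0)))]; congr 1; push_cast; field_simp; ring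
    · have : u = R * (α * (u + x0)) - x0 + q * (Q' * (β * (u + x0))) := by rw [hl, hQ]; push_cast; ring
      rw [this]
      exact ((hd.mul_left _).sub hx0).add (dvd_mul_right _ _)
  have st4 : ∀ k0 : ℕ, k0 < Q → (Q : ℂ) * a D (x0 + R * k0) = ∑ u ∈ Finset.range Q, ee ((u * k0 : ℂ) / Q) * ∑ k ∈ Finset.range Q, ee ((k * (-u : ℤ) : ℂ) / Q) * a D (x0 + R * k) := fun k0 hk0 => by
    simp only [Finset.mul_sum]
    rw [Finset.sum_comm, Finset.sum_eq_single_of_mem k0 (by simpa using hk0)]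
    · have : ∀ u : ℕ, ee ((u * k0 : ℂ) / Q) * (ee ((k0 * (-u : ℤ) : ℂ) / Q) * a D (x0 + R * k0)) = a D (x0 + R * k0) := fun u => by
        rw [← mul_assoc, ← ee_add, show (u * k0 : ℂ) / Q + (k0 * (-u : ℤ) : ℂ) / Q = 0 by push_cast; ring, ee_zero, one_mul]
      rw [Finset.sum_congr rfl fun u _ => this u]; simp
    · intro k hk hne
      have := orth_rr hQ0 (y := k) (z := k0) (by simpa using hk) hk0
      rw [if_neg hne] at this
      rw [← mul_zero (a D (x0 + R * k)), ← this, Finset.mul_sum]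
      refine Finset.sum_congr rfl fun u _ => ?_
      rw [← mul_assoc, ← ee_add, mul_comm]; congr 2; push_cast; ring
  have e1 := st4 (Q' * j) (by rw [hQ, mul_comm q]; exact Nat.mul_lt_mul_of_pos_left hj hQ'0)
  have e2 := st4 0 hQ0
  push_cast at e1 e2
  rw [mul_zero, add_zero] at e2
  apply mul_left_cancel₀ hQc
  rw [e1, e2]
  refine Finset.sum_congr rfl fun u _ => ?_
  by_cases hu : (q : ℤ) ∣ u
  · obtain ⟨v, hv⟩ := hu
    have hv' : (u : ℂ) = q * v := by exact_mod_cast hv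
    rw [show (u * (Q' * j) : ℂ) / Q = ((v * j : ℤ) : ℂ) by rw [hv', hQ]; push_cast; field_simp, ee_int, mul_zero, zero_div, ee_zero]
  · have := st3 u hu
    push_cast at this
    rw [this]; simp

def Sp (m : ℕ) : Submodule ℂ (ℕ → ℤ → ℂ) := Submodule.span ℂ {f | ∃ m₁ m₂, m₁ * m₂ = m ∧ f = aR m₁ m₂}

theorem Sp_lam {m : ℕ} (hm : 0 < m) {a} (h : a ∈ Sp m) : Lam 2 m a := by
  refine Submodule.span_induction (p := fun f _ => Lam 2 m f) ?_ ?_ ?_ ?_ h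
  · rintro _ ⟨m₁, m₂, rfl, rfl⟩
    exact (aR_gv (Nat.pos_of_mul_pos_right hm) (Nat.pos_of_mul_pos_left hm)).lam hm
  · have := (aR_gv one_pos hm).lam (by simpa using hm)
    rw [one_mul] at this
    convert this.lin this 0 0 hm using 2; simp; rfl
  · intro x y _ _ hx hy
    convert hx.lin hy 1 1 hm using 2; simp; rfl
  · intro c x _ hx
    convert hx.lin hx c 0 hm using 2; simp; rfl

theorem Lf_aR {q : ℕ} (hq : 0 < q) (m₁ m₂ : ℕ) : Lf q (aR m₁ m₂) = aR (q * m₁) (q * m₂) := by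
  have hqz : (q : ℤ) ≠ 0 := by positivity
  have hi : Function.Injective fun s : ℤ => (q : ℤ) * s := fun a b h => mul_left_cancel₀ hqz h
  funext D X
  by_cases h : (q : ℤ) ∣ X ∧ q ^ 2 ∣ D
  · obtain ⟨⟨x, rfl⟩, ⟨d, rfl⟩⟩ := h
    rw [Lf_mul hq]
    unfold aR
    refine Eq.trans ?_ (hi.tsum_eq (f := fun S : ℤ => if S ^ 2 = (q ^ 2 * d : ℕ) ∧ AA (q * m₁) (q * m₂) (q * x) S then (1 : ℂ) else 0) ?_)
    · refine tsum_congr fun s => ?_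
      have : ((q : ℤ) * s) ^ 2 = (q ^ 2 * d : ℕ) ↔ s ^ 2 = d := by
        push_cast; rw [mul_pow]; exact mul_right_inj' (pow_ne_zero 2 hqz)
      have h2 : AA (q * m₁) (q * m₂) (q * x) (q * s) ↔ AA m₁ m₂ x s := by
        unfold AA; push_cast
        rw [← mul_add, ← mul_sub, mul_left_comm, mul_left_comm 2, mul_dvd_mul_iff_left hqz, mul_dvd_mul_iff_left hqz]
      simp only [this, h2]
    · intro S hS
      have hS' := (ite_ne_right_iff.mp (Function.mem_support.mp hS)).1.1
      have : (q : ℤ) ∣ S := by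
        rw [← Int.pow_dvd_pow_iff two_ne_zero, hS']; exact ⟨d, by push_cast; ring⟩
      obtain ⟨s, rfl⟩ := this; exact ⟨s, rfl⟩
  · rw [Lf, if_neg h]
    unfold aR
    rw [tsum_congr fun s => if_neg _, tsum_zero]
    rintro s ⟨h3, h4⟩
    obtain ⟨⟨α, hα⟩, ⟨β, hβ⟩⟩ := h4
    push_cast at hα hβ
    refine h ⟨⟨m₁ * α - m₂ * β, by linarith⟩, ?_⟩
    have : (q : ℤ) ^ 2 ∣ D := by rw [← h3]; exact pow_dvd_pow_of_dvd ⟨m₁ * α + m₂ * β, by linarith⟩ 2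
    exact_mod_cast this

theorem aR_one {m v : ℕ} (hm : 0 < m) (h : m ∣ v * (v + 1)) : (m.gcd (v + 1)) * (m.gcd v) = m ∧
    ∀ x : ℤ, aR (m.gcd (v + 1)) (m.gcd v) 1 x = (if 2 * (m : ℤ) ∣ x - (2 * v + 1) then 1 else 0) + if 2 * (m : ℤ) ∣ x + (2 * v + 1) then 1 else 0 := by
  have h1 : m.gcd (v + 1) * m.gcd v = m := by
    rw [mul_comm, ← Nat.Coprime.gcd_mul m (by simp : Nat.Coprime v (v + 1)), Nat.gcd_eq_left h]
  refine ⟨h1, fun x => ?_⟩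
  set m₁ := m.gcd (v + 1)
  set m₂ := m.gcd v
  have d1 : (m₁ : ℤ) ∣ v + 1 := by exact_mod_cast Nat.gcd_dvd_right m (v + 1)
  have d2 : (m₂ : ℤ) ∣ v := by exact_mod_cast Nat.gcd_dvd_right m v
  have hco : IsCoprime (m₁ : ℤ) m₂ := by
    refine IsCoprime.of_isCoprime_of_dvd_left (IsCoprime.of_isCoprime_of_dvd_right ?_ d2) d1
    exact ⟨1, -1, by ring⟩
  have key : ∀ x : ℤ, AA m₁ m₂ x 1 ↔ 2 * (m : ℤ) ∣ x - (2 * v + 1) := fun x => by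
    unfold AA
    have e1 : 2 * (m₁ : ℤ) ∣ 2 * (v + 1) := mul_dvd_mul_left _ d1
    have e2 : 2 * (m₂ : ℤ) ∣ 2 * v := mul_dvd_mul_left _ d2
    have hmz : (m : ℤ) = m₁ * m₂ := by exact_mod_cast h1.symm
    rw [show x + 1 = (x - (2 * v + 1)) + 2 * (v + 1) by ring, dvd_add_left e1, show 1 - x = -((x - (2 * v + 1)) + 2 * v) by ring, dvd_neg, dvd_add_left e2, hmz]
    constructor
    · rintro ⟨⟨α, hα⟩, h4⟩
      rw [hα, mul_assoc] at h4 ⊢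
      have h5 := Int.dvd_of_mul_dvd_mul_left two_ne_zero h4
      exact mul_dvd_mul_left _ (hco.mul_dvd (dvd_mul_right _ _) h5)
    · exact fun h4 => ⟨(mul_dvd_mul_left 2 (dvd_mul_right _ _)).trans h4, (mul_dvd_mul_left 2 (dvd_mul_left _ _)).trans h4⟩
  unfold aR
  have hf : ∀ s ∉ ({1, -1} : Finset ℤ), (if s ^ 2 = ((1 : ℕ) : ℤ) ∧ AA m₁ m₂ x s then (1 : ℂ) else 0) = 0 := fun s hs => by
    rw [if_neg]; rintro ⟨h2, -⟩; apply hs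
    rw [Nat.cast_one, _root_.sq_eq_one_iff] at h2
    simpa using h2
  rw [tsum_eq_sum hf, Finset.sum_pair (by norm_num)]
  have k2 : AA m₁ m₂ x (-1) ↔ 2 * (m : ℤ) ∣ x + (2 * v + 1) := by
    rw [← AA.neg, neg_neg, key, ← dvd_neg]; ring_nf
  simp [key, k2]

theorem stepE {m : ℕ} (hm : 0 < m) {a} (ha : GV 2 m a) : ∃ b ∈ Sp m, ∀ (D : ℕ) (x : ℤ), IsCoprime x ((2 * m : ℕ) : ℤ) → a D x = b D x := by
  have hL := ha.lam hm
  let c : ℕ → ℂ := fun v => 1 / 2 * a 1 (2 * v + 1)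
  let I := (Finset.range m).filter fun v => m ∣ v * (v + 1)
  let b : ℕ → ℤ → ℂ := ∑ v ∈ I, c v • aR (m.gcd (v + 1)) (m.gcd v)
  have hb : b ∈ Sp m := Submodule.sum_mem _ fun v hv => Submodule.smul_mem _ _ (Submodule.subset_span ⟨_, _, (aR_one hm (Finset.mem_filter.mp hv).2).1, rfl⟩)
  have hper : ∀ l, a 1 (l + (2 * m : ℕ)) = a 1 l := fun l => by push_cast; exact ha.per 1 l
  have hb1 : ∀ x, b 1 x = a 1 x := by
    intro x
    by_cases hx : (4 * (m : ℤ)) ∣ ((1 : ℕ) : ℤ) - x ^ 2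
    · have hlp : ∀ w : ℤ, (m : ℤ) ∣ w * (w + 1) → ∑ v ∈ I, c v * (if 2 * (m : ℤ) ∣ (2 * w + 1) - (2 * v + 1) then 1 else 0) = 1 / 2 * a 1 (2 * w + 1) := fun w hw => by
        have hmz : (m : ℤ) ≠ 0 := by positivity
        have h0 := Int.emod_nonneg w hmz
        have h1 := Int.emod_lt_of_pos w (by positivity : (0 : ℤ) < m)
        have h2 : ((w % m).toNat : ℤ) = w % m := Int.toNat_of_nonneg h0
        have h3 : (m : ℤ) ∣ w - (w % m).toNat := by rw [h2]; exact Int.dvd_self_sub_emod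
        have e2 : ∀ v : ℕ, (2 * (m : ℤ) ∣ (2 * w + 1) - (2 * v + 1)) ↔ (m : ℤ) ∣ w - v := fun v => by
          rw [show 2 * w + 1 - (2 * (v : ℤ) + 1) = 2 * (w - v) by ring, mul_dvd_mul_iff_left two_ne_zero]
        have hd3 : (m : ℤ) ∣ (((w % m).toNat * ((w % m).toNat + 1) : ℕ) : ℤ) := by
          obtain ⟨t, ht⟩ := h3
          push_cast
          rw [show ((w % m).toNat : ℤ) = w + m * (-t) by linarith, show (w + m * (-t)) * (w + m * (-t) + 1) = w * (w + 1) + m * (-t * (2 * w + 1) + m * t ^ 2) by ring]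
          exact hw.add (dvd_mul_right _ _)
        rw [Finset.sum_eq_single_of_mem (w % m).toNat (Finset.mem_filter.mpr ⟨Finset.mem_range.mpr (by omega), by exact_mod_cast hd3⟩), if_pos ((e2 _).mpr h3), mul_one]
        · simp only [c]; congr 1
          exact (per_mod hper (by push_cast; rw [e2]; exact h3)).symm
        · intro v hv hne
          rw [if_neg, mul_zero]
          rw [e2]; intro hd
          have hv' := Finset.mem_range.mp (Finset.mem_filter.mp hv).1
          apply hne
          have h6 : (v : ℤ) % m = w % m := (Int.emod_eq_emod_iff_emod_sub_eq_zero.mpr (Int.emod_eq_zero_of_dvd hd)).symm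
          rw [Int.emod_eq_of_lt (by positivity) (by exact_mod_cast hv')] at h6
          omega
      have hodd : Odd x := by
        by_contra ho
        rw [Int.not_odd_iff_even] at ho
        obtain ⟨t, rfl⟩ := ho
        obtain ⟨u, hu⟩ := hx
        push_cast at hu
        ring_nf at hu; omega
      obtain ⟨w, rfl⟩ := hodd
      have hw : (m : ℤ) ∣ w * (w + 1) := by
        obtain ⟨u, hu⟩ := hx
        exact ⟨-u, by push_cast at hu; linarith⟩
      have hpar := ha.par 1 (2 * w + 1)
      rw [show ((-1 : ℂ)) ^ (2 : ℤ) = 1 by norm_num, one_mul] at hpar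
      have k1 := hlp w hw
      have k2 := hlp (-w - 1) (by convert hw using 1; ring)
      rw [show 2 * (-w - 1) + 1 = -(2 * w + 1) by ring, hpar] at k2
      have : b 1 (2 * w + 1) = ∑ v ∈ I, c v * (if 2 * (m : ℤ) ∣ (2 * w + 1) - (2 * v + 1) then 1 else 0) + ∑ v ∈ I, c v * (if 2 * (m : ℤ) ∣ -(2 * w + 1) - (2 * v + 1) then 1 else 0) := by
        rw [← Finset.sum_add_distrib]
        simp only [b, Finset.sum_apply, Pi.smul_apply, smul_eq_mul]
        refine Finset.sum_congr rfl fun v hv => ?_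
        rw [(aR_one hm (Finset.mem_filter.mp hv).2).2, mul_add]
        congr 3
        rw [← dvd_neg]; congr 1; ring_nf
      rw [this, k1, k2]; ring
    · rw [ha.supp 1 x hx, (Sp_lam hm hb).supp 1 x hx]
  refine ⟨b, hb, fun D x hx => ?_⟩
  have hLd := hL.lin (Sp_lam hm hb) 1 (-1) hm
  rw [← sub_eq_zero]
  by_cases hs : (4 * (m : ℤ)) ∣ (D : ℤ) - x ^ 2
  swap
  · rw [ha.supp D x hs, (Sp_lam hm hb).supp D x hs, sub_self]
  have hD : D.Coprime (2 * m) := by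
    rw [← Nat.isCoprime_iff_coprime]
    obtain ⟨t, ht⟩ := hs
    rw [show (D : ℤ) = x ^ 2 + (2 * m : ℕ) * (2 * t) by push_cast; linarith]
    exact IsCoprime.add_mul_left_left (hx.pow_left) _
  have e : a D x - b D x = 1 * a D x + -1 * b D x := by ring
  rw [e]
  by_cases hsq : IsSquare D
  · obtain ⟨s, rfl⟩ := hsq
    have hs' : s.Coprime (2 * m) := hD.coprime_mul_right
    have hs0 : 0 < s := by
      rcases Nat.eq_zero_or_pos s with rfl | h
      · simp at hs'
      · exact h
    obtain ⟨u, w, huw⟩ := Nat.isCoprime_iff_coprime.mpr hs'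
    have h1 := lam_sq hm hLd s hs0 hs' (u * x)
    rw [← sq]
    rw [per_mod (f := fun x => 1 * a (s ^ 2) x + -1 * b (s ^ 2) x) (N := 2 * (m : ℤ)) (hLd.per (s ^ 2)) (l := x) (l' := s * (u * x)) ⟨w * x, by push_cast at huw; linear_combination -x * huw⟩, h1, hb1]
    ring
  · exact lam_ns hm hLd hD hsq x

theorem Sp_lf {m q : ℕ} (hq : 0 < q) {a} (h : a ∈ Sp m) : Lf q a ∈ Sp (m * q ^ 2) := by
  refine Submodule.span_induction (p := fun f _ => Lf q f ∈ Sp (m * q ^ 2)) ?_ ?_ ?_ ?_ h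
  · rintro _ ⟨m₁, m₂, rfl, rfl⟩
    rw [Lf_aR hq]
    exact Submodule.subset_span ⟨_, _, by ring, rfl⟩
  · convert (Sp (m * q ^ 2)).zero_mem using 1; funext D x; simp [Lf]
  · intro x y _ _ hx hy
    convert (Sp (m * q ^ 2)).add_mem hx hy using 1; funext D t; simp only [Lf, Pi.add_apply]; split_ifs <;> simp
  · intro c x _ hx
    convert (Sp (m * q ^ 2)).smul_mem c hx using 1; funext D t; simp only [Lf, Pi.smul_apply]; split_ifs <;> simp

theorem GV.lin {k m a b} (hm : 0 < m) (ha : GV k m a) (hb : GV k m b) (s t : ℂ) : GV k m fun D x => s * a D x + t * b D x :=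
  ((ha.lam hm).lin (hb.lam hm) s t hm).gv hm

theorem GV.old {m : ℕ} (hm : 0 < m) (IH : ∀ m' < m, 0 < m' → ∀ a, GV 2 m' a → a ∈ Sp m') (S : ℕ) : S ∣ 2 * m → ∀ a, GV 2 m a →
    (∀ D x, IsCoprime x (S : ℤ) → a D x = 0) → a ∈ Sp m := by
  induction S using Nat.strong_induction_on with
  | _ S ih =>
  intro hS a ha hv
  have hS0 : S ≠ 0 := by rintro rfl; simp at hS; omega
  by_cases h1 : S = 1
  · have : a = 0 := by funext D x; exact hv D x (by rw [h1]; exact isCoprime_one_right)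
    rw [this]; exact Submodule.zero_mem _
  set q := S.minFac with hqd
  have hq : q.Prime := Nat.minFac_prime h1
  have hqS : q ∣ S := Nat.minFac_dvd S
  have hqz : Prime (q : ℤ) := Nat.prime_iff_prime_int.mp hq
  set S' := S / q ^ S.factorization q with hS'
  have hSS : q ^ S.factorization q * S' = S := Nat.ordProj_mul_ordCompl_eq_self S q
  have hS'S : S' ∣ S := Dvd.intro_left _ hSS
  have hcS : q.Coprime S' := Nat.coprime_ordCompl hq hS0
  have hlt : S' < S := lt_of_le_of_ne (Nat.le_of_dvd (by omega) hS'S) fun h => by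
    rw [h] at hcS; exact hq.one_lt.ne' (Nat.eq_one_of_dvd_coprimes hcS dvd_rfl hqS)
  -- decomposition of 2m
  set Q := q ^ (2 * m).factorization q with hQ
  set R := 2 * m / Q with hR
  have hN : Q * R = 2 * m := Nat.ordProj_mul_ordCompl_eq_self (2 * m) q
  have hcR : q.Coprime R := Nat.coprime_ordCompl hq (by positivity)
  have hcRz : IsCoprime (q : ℤ) R := Nat.isCoprime_iff_coprime.mpr hcR
  have hqQ : q ∣ Q := by
    have : q ∣ Q * R := hN ▸ hqS.trans hS
    exact (hcR.dvd_mul_right).mp this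
  obtain ⟨Q', hQ'⟩ := hqQ
  have hS'R : (S' : ℤ) ∣ R := by
    have h2 : S' ∣ Q * R := hN ▸ hS'S.trans hS
    exact_mod_cast (Nat.Coprime.pow_left _ hcS).symm.dvd_of_dvd_mul_left h2
  have key : ∀ x0 : ℤ, (q : ℤ) ∣ x0 → IsCoprime x0 (S' : ℤ) → ∀ D : ℕ, ∀ j < q, a D (x0 + R * (Q' * j)) = a D x0 := fun x0 hx0 hc D j hj => by
    refine ha.key hm (by rw [← hQ', hN]) (by rw [← hQ', hQ, Nat.cast_pow]; exact hcRz.symm.pow_right) hx0 (fun l hl D => hv D _ ?_) D hj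
    rw [← hSS, Nat.cast_mul, Nat.cast_pow]
    refine IsCoprime.mul_right (IsCoprime.pow_right ?_) ?_
    · rw [isCoprime_comm, hqz.irreducible.coprime_iff_not_dvd, dvd_add_right (dvd_neg.mpr hx0)]
      exact fun h => hl (hcRz.dvd_of_dvd_mul_left h)
    · obtain ⟨r, hr⟩ := hS'R
      rw [hr, mul_assoc]
      exact IsCoprime.add_mul_left_left hc.neg_left _
  have hun : ∀ x : ℤ, ¬ (q : ℤ) ∣ x → IsCoprime x (S' : ℤ) → ∀ D, a D x = 0 := fun x hx hc D => hv D x (by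
    rw [← hSS, Nat.cast_mul, Nat.cast_pow]
    exact IsCoprime.mul_right (IsCoprime.pow_right ((hqz.irreducible.coprime_iff_not_dvd.mpr hx).symm)) hc)
  have hn : 2 * (m : ℤ) = q * (R * Q') := by
    have : 2 * m = q * (R * Q') := by rw [← hN, hQ']; ring
    exact_mod_cast this
  by_cases hq2 : q ^ 2 ∣ m
  · obtain ⟨m', hm'⟩ := hq2
    rw [mul_comm] at hm'
    have hm'0 : 0 < m' := Nat.pos_of_ne_zero fun h => by simp [h] at hm'; omega
    have hq0 := hq.pos
    have hud := (show GV 2 (m' * q ^ 2) a from hm' ▸ ha).ud hm'0 hq0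
    have hlf := hud.lf hm'0 hq0
    rw [← hm'] at hlf
    have hlt' : m' < m := by rw [hm']; exact lt_mul_of_one_lt_right hm'0 (Nat.one_lt_pow two_ne_zero hq.one_lt)
    have hsp := Sp_lf hq0 (IH m' hlt' hm'0 _ hud)
    rw [← hm'] at hsp
    have hRQ : (R : ℤ) * Q' = 2 * m' * q := by
      have h3 : (q : ℤ) * (R * Q') = q * (2 * m' * q) := by rw [← hn, hm']; push_cast; ring
      exact mul_left_cancel₀ hqz.ne_zero h3
    have hqc : (q : ℂ) ≠ 0 := by exact_mod_cast hq0.ne'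
    have h4 := ih S' hlt (hS'S.trans hS) _ (ha.lin hm hlf 1 (-(1 / q))) (fun D x hx => by
      by_cases hqx : (q : ℤ) ∣ x
      · obtain ⟨x', rfl⟩ := hqx
        by_cases hD : q ^ 2 ∣ D
        · obtain ⟨D', rfl⟩ := hD
          rw [Lf_mul hq0]
          unfold Ud
          rw [Finset.sum_congr rfl fun (j : ℕ) hj => show a (q ^ 2 * D') (q * x' + 2 * m' * q * j) = a (q ^ 2 * D') (q * x') from by
            rw [← hRQ, mul_assoc]; exact key _ (dvd_mul_right _ _) hx _ j (by simpa using hj)]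
          simp; field_simp; ring
        · have : ¬ (4 * (m : ℤ)) ∣ (D : ℤ) - (q * x') ^ 2 := fun h => hD (by
            have h5 : (q : ℤ) ^ 2 ∣ (D : ℤ) - (q * x') ^ 2 := (Dvd.intro_left (4 * m' : ℤ) (by rw [hm']; push_cast; ring)).trans h
            rw [mul_pow, dvd_sub_left (dvd_mul_right _ _)] at h5
            exact_mod_cast h5)
          rw [ha.supp _ _ this, hlf.supp _ _ this]; simp
      · rw [hun x hqx hx, Lf_not _ _ hqx]; simp)
    have h5 := (Sp m).add_mem h4 ((Sp m).smul_mem (1 / (q : ℂ)) hsp)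
    convert h5 using 1
    funext D x; simp
  · refine ih S' hlt (hS'S.trans hS) a ha fun D x hx => ?_
    by_cases hqx : (q : ℤ) ∣ x
    · by_contra hne
      have h6 := key x hqx hx D 1 hq.one_lt
      simp only [Nat.cast_one, mul_one] at h6
      have s1 : (4 * (m : ℤ)) ∣ (D : ℤ) - x ^ 2 := by_contra fun h => hne (ha.supp D x h)
      have s2 : (4 * (m : ℤ)) ∣ (D : ℤ) - (x + R * Q') ^ 2 := by_contra fun h => hne (h6 ▸ ha.supp D _ h)
      have s3 := dvd_sub s1 s2
      set n : ℤ := R * Q'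
      have hn0 : n ≠ 0 := fun h => by rw [h, mul_zero] at hn; omega
      rw [show 4 * (m : ℤ) = n * (2 * q) by linarith, show (D : ℤ) - x ^ 2 - (D - (x + n) ^ 2) = n * (2 * x + n) by ring] at s3
      obtain ⟨c, hc⟩ := Int.dvd_of_mul_dvd_mul_left hn0 s3
      have hne2 : n = 2 * (q * c - x) := by linarith
      obtain ⟨x', rfl⟩ := hqx
      apply hq2
      have : (q : ℤ) ^ 2 ∣ m := ⟨c - x', by rw [hne2] at hn; linarith⟩
      exact_mod_cast this
    · exact hun x hqx hx D

theorem gv_span (m : ℕ) : 0 < m → ∀ a, GV 2 m a → a ∈ Sp m := by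
  induction m using Nat.strong_induction_on with
  | _ m ih =>
  intro hm a ha
  obtain ⟨b, hb, h⟩ := stepE hm ha
  have h1 := GV.old hm ih (2 * m) dvd_rfl _ (ha.lin hm ((Sp_lam hm hb).gv hm) 1 (-1)) fun D x hx => by rw [h D x hx]; ring
  convert (Sp m).add_mem h1 hb using 1
  funext D x; simp

theorem pair_aR {m m₁ m₂ : ℕ} (hm : 0 < m) (hmm : m₁ * m₂ = m) {C : ℤ → ℤ → ℂ} (hper : ∀ Δ l : ℤ, C Δ (l + 2 * (m : ℤ)) = C Δ l)
    (hb : ∃ M : ℕ, ∀ Δ l : ℤ, Δ < -M → C Δ l = 0) : pair m (aR m₁ m₂) C = Rfactor m C m₁ m₂ := by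
  obtain ⟨M, hM⟩ := hb
  have hM2 : ∀ s ∉ Finset.Icc (-M : ℤ) M, ∀ x, C (-s ^ 2) x = 0 := fun s hs x => hM _ _ (by
    rw [Finset.mem_Icc, not_and_or, not_le, not_le] at hs
    rcases hs with h | h <;> nlinarith)
  have sm : ∀ x : ℤ, Summable fun s : ℤ => if AA m₁ m₂ x s then C (-s ^ 2) x else 0 := fun x =>
    summable_of_ne_finset_zero (s := Finset.Icc (-M : ℤ) M) fun s hs => by rw [hM2 s hs]; simp
  have p1 : pair m (aR m₁ m₂) C = ∑ x ∈ Finset.range (2 * m), ∑' s : ℤ, if AA m₁ m₂ x s then C (-s ^ 2) x else 0 := by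
    refine Finset.sum_congr rfl fun x _ => ?_
    rw [← ((sm x).hasSum.tsum_fiberwise (fun s : ℤ => s.natAbs ^ 2)).tsum_eq]
    refine tsum_congr fun D => ?_
    rw [tsum_subtype ((fun s : ℤ => s.natAbs ^ 2) ⁻¹' {D}) (fun s : ℤ => if AA m₁ m₂ x s then C (-s ^ 2) x else 0)]
    unfold aR
    rw [← tsum_mul_right]
    refine tsum_congr fun s => ?_
    have : s ∈ (fun s : ℤ => s.natAbs ^ 2) ⁻¹' {D} ↔ s ^ 2 = D := by
      simp only [Set.mem_preimage, Set.mem_singleton_iff]; zify; rw [sq_abs]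
    simp only [Set.indicator_apply, this]
    by_cases h : s ^ 2 = (D : ℤ)
    · simp only [h, true_and, if_true]; split_ifs <;> simp
    · simp [h]
  rw [p1, ← Summable.tsum_finsetSum (f := fun (x : ℕ) (s : ℤ) => if AA m₁ m₂ x s then C (-s ^ 2) x else 0) fun (x : ℕ) _ => sm (x : ℤ)]
  have h1 : 0 < m₁ := Nat.pos_of_ne_zero fun h => by simp [h] at hmm; omega
  have h2 : 0 < m₂ := Nat.pos_of_ne_zero fun h => by simp [h] at hmm; omega
  unfold Rfactor
  have ht0 : 0 < m₁.gcd m₂ := Nat.gcd_pos_of_pos_left _ h1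
  obtain ⟨μ, hμ⟩ := Nat.gcd_dvd_left m₁ m₂
  obtain ⟨ν, hν⟩ := Nat.gcd_dvd_right m₁ m₂
  set t := m₁.gcd m₂ with ht
  rw [show m₁ / t = μ by rw [hμ]; exact Nat.mul_div_cancel_left _ ht0, show m₂ / t = ν by rw [hν]; exact Nat.mul_div_cancel_left _ ht0]
  have hco : μ.Coprime ν := by
    have : t * μ.gcd ν = t * 1 := by rw [← Nat.gcd_mul_left, ← hμ, ← hν, mul_one]
    exact Nat.eq_of_mul_eq_mul_left ht0 this
  have hμ0 : 0 < μ := Nat.pos_of_ne_zero fun h => by simp [h] at hμ; omega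
  have hν0 : 0 < ν := Nat.pos_of_ne_zero fun h => by simp [h] at hν; omega
  have htz : (t : ℤ) ≠ 0 := by positivity
  have hmt : 2 * m = t * (2 * μ * ν) * t := by rw [← hmm, hμ, hν]; ring
  have hmz : 2 * (m : ℤ) = t ^ 2 * (2 * μ * ν) := by rw [show 2 * (m : ℤ) = ((2 * m : ℕ) : ℤ) by push_cast; rfl, hmt]; push_cast; ring
  have hdv : 2 * (m : ℤ) / (t : ℤ) ^ 2 = 2 * μ * ν := by rw [hmz]; exact Int.mul_ediv_cancel_left _ (pow_ne_zero 2 htz)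
  have hi : Function.Injective fun r : ℤ => (t : ℤ) * r := fun a b h => mul_left_cancel₀ htz h
  have hAt : ∀ x s : ℤ, AA m₁ m₂ x s → (t : ℤ) ∣ x ∧ (t : ℤ) ∣ s := fun x s h => by
    unfold AA at h; rw [hμ, hν] at h; push_cast at h
    obtain ⟨⟨α, hα⟩, ⟨β, hβ⟩⟩ := h
    exact ⟨⟨μ * α - ν * β, by linarith⟩, ⟨μ * α + ν * β, by linarith⟩⟩
  have hbz : (μ : ℤ) * Nat.gcdA μ ν + ν * Nat.gcdB μ ν = 1 := by
    have := Nat.gcd_eq_gcd_ab μ ν; rw [hco] at this; exact_mod_cast this.symm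
  have hA : ∀ x r : ℤ, AA m₁ m₂ (t * x) (t * r) ↔ 2 * (μ : ℤ) * ν ∣ x - lstar μ ν r := fun x r => by
    unfold AA lstar; rw [hμ, hν]; push_cast
    rw [← mul_add, ← mul_sub, mul_left_comm, mul_left_comm 2, mul_dvd_mul_iff_left htz, mul_dvd_mul_iff_left htz,
      show x + r = (x - r * (μ * Nat.gcdA μ ν - ν * Nat.gcdB μ ν)) + 2 * μ * (r * Nat.gcdA μ ν) by linear_combination (-r) * hbz, dvd_add_left (dvd_mul_right _ _),
      show r - x = -(x - r * (μ * Nat.gcdA μ ν - ν * Nat.gcdB μ ν)) + 2 * ν * (r * Nat.gcdB μ ν) by linear_combination (-r) * hbz, dvd_add_left (dvd_mul_right _ _), dvd_neg]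
    constructor
    · rintro ⟨⟨α, hα⟩, h4⟩
      rw [hα, mul_assoc] at h4
      have h5 := Int.dvd_of_mul_dvd_mul_left two_ne_zero h4
      rw [hα, mul_assoc, mul_assoc]
      exact mul_dvd_mul_left _ ((Nat.isCoprime_iff_coprime.mpr hco).mul_dvd (dvd_mul_right _ _) h5)
    · exact fun h4 => ⟨(dvd_mul_right _ _).trans h4, (Dvd.intro_left (μ : ℤ) (by ring)).trans h4⟩
  refine Eq.trans (hi.tsum_eq ?_).symm (tsum_congr fun r => ?_)
  · intro s hs
    by_contra hns
    refine hs (Finset.sum_eq_zero fun x _ => if_neg fun h => hns ?_)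
    obtain ⟨r, hr⟩ := (hAt _ _ h).2
    exact ⟨r, hr.symm⟩
  · rw [hmt, sum_split0 _ _ ht0]
    · unfold CoeffU
      let F : ℤ → ℂ := fun x => if 2 * (μ : ℤ) * ν ∣ x - lstar μ ν r then C (-(t * r) ^ 2) (t * x) else 0
      have hp : ∀ l, F (l + (t * (2 * μ * ν) : ℕ)) = F l := fun l => by
        have : (t : ℤ) * (l + (t * (2 * μ * ν) : ℕ)) = t * l + 2 * m := by rw [hmz]; push_cast; ring
        simp only [F, this, hper, add_sub_right_comm, dvd_add_left (show 2 * (μ : ℤ) * ν ∣ (t * (2 * μ * ν) : ℕ) from ⟨t, by push_cast; ring⟩)]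
      have h6 := sum_aff (by positivity : 0 < t * (2 * μ * ν)) hp 1 (lstar μ ν r) isCoprime_one_left
      simp only [F] at h6
      rw [sum_split0 t (2 * μ * ν) (by positivity)] at h6
      · simp only [Nat.cast_mul, hA]
        rw [← h6]
        refine Finset.sum_congr rfl fun j _ => ?_
        rw [if_pos (by push_cast; exact ⟨j, by ring⟩), hdv]
        congr 1 <;> push_cast <;> ring
      · intro X hX
        rw [if_neg]
        rw [one_mul, add_sub_cancel_right]; exact fun h => hX (by exact_mod_cast h)
    · intro X hX
      exact if_neg fun h => hX (by exact_mod_cast (hAt _ _ h).1)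

theorem hb_weak {m : ℕ} (hm : 0 < m) (φ : EllFormData m) (hw : IsWeakC m φ.coeff) : ∃ M : ℕ, ∀ Δ l : ℤ, Δ < -M → φ.coeff Δ l = 0 := by
  refine ⟨m ^ 2, fun Δ l hΔ => ?_⟩
  by_cases hs : (4 * (m : ℤ)) ∣ Δ + l ^ 2
  swap
  · exact φ.support _ _ hs
  have hmz : (0 : ℤ) < m := by exact_mod_cast hm
  set r := (l + m) % (2 * m) - m with hr
  have r0 := Int.emod_nonneg (l + m) (by positivity : (2 * (m : ℤ)) ≠ 0)
  have r1 := Int.emod_lt_of_pos (l + m) (by positivity : (0 : ℤ) < 2 * m)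
  have h1 : 2 * (m : ℤ) ∣ l - r := by
    have := Int.dvd_self_sub_emod (x := l + m) (m := 2 * m); convert this using 1; rw [hr]; ring
  rw [per_mod (φ.periodic Δ) h1]
  obtain ⟨c, hc⟩ := hs
  obtain ⟨d, hd⟩ := h1
  have h2 : Δ = 4 * m * (c - d * (r + m * d)) - r ^ 2 := by
    have h3 : l = r + 2 * m * d := by linarith
    rw [h3] at hc; linear_combination hc
  rw [h2]
  refine hw _ _ ?_
  push_cast at hΔ
  have h4 : r ^ 2 ≤ m ^ 2 := by nlinarith
  by_contra h5
  rw [not_lt] at h5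
  have := mul_nonneg (by positivity : (0 : ℤ) ≤ 4 * m) h5
  linarith

theorem pair_sp {m : ℕ} (hm : 0 < m) {C : ℤ → ℤ → ℂ} (hb : ∃ M : ℕ, ∀ Δ l : ℤ, Δ < -M → C Δ l = 0)
    (h : ∀ m₁ m₂, m₁ * m₂ = m → pair m (aR m₁ m₂) C = 0) {a} (ha : a ∈ Sp m) : pair m a C = 0 := by
  obtain ⟨M, hM⟩ := hb
  have e : ∀ c : ℕ → ℤ → ℂ, pair m c C = ∑ x ∈ Finset.range (2 * m), ∑ D ∈ Finset.range (M + 1), c D x * C (-D) x := fun c =>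
    Finset.sum_congr rfl fun x _ => tsum_nat_fin _ fun D hD => by rw [hM _ _ (by omega), mul_zero]
  refine Submodule.span_induction (p := fun f _ => pair m f C = 0) ?_ ?_ ?_ ?_ ha
  · rintro _ ⟨m₁, m₂, h1, rfl⟩; exact h _ _ h1
  · rw [e]; simp
  · intro x y _ _ hx hy
    rw [e] at *
    simp only [Pi.add_apply, add_mul, Finset.sum_add_distrib, hx, hy, add_zero]
  · intro c x _ hx
    rw [e] at *
    simp only [Pi.smul_apply, smul_eq_mul, mul_assoc, ← Finset.mul_sum, hx, mul_zero]

theorem fin_core {k : ℤ} {m : ℕ} (hm : 0 < m) (φ ψ : EllFormData m) (hpar : ∀ Δ l : ℤ, φ.coeff Δ (-l) = (-1 : ℂ) ^ k * φ.coeff Δ l)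
    (hw : IsWeakC m φ.coeff) (hJ : JB k ψ) (h : ∀ Δ l : ℤ, Δ < 0 → ψ.coeff Δ l = φ.coeff Δ l) :
    ModularLaw k m ψ.toFun ∧ IsWeakC m ψ.coeff ∧ (∀ Δ l : ℤ, (elin 1 (-1) φ ψ).coeff Δ (-l) = (-1 : ℂ) ^ k * (elin 1 (-1) φ ψ).coeff Δ l) ∧
      ∀ τ z : ℂ, 0 < τ.im → φ.toFun τ z = ψ.toFun τ z + (elin 1 (-1) φ ψ).toFun τ z := by
  refine ⟨JF.modular hJ, fun n r hn => ?_, fun Δ l => ?_, fun τ z _ => ?_⟩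
  · have hm' : (0 : ℤ) < m := by exact_mod_cast hm
    rw [h _ _ (by nlinarith [sq_nonneg r]), hw n r hn]
  · simp only [elin, hpar, hJ.parity]; ring
  · simp only [elin]; ring

theorem pair_lin {m : ℕ} (a : ℕ → ℤ → ℂ) (s t : ℂ) {E E' : EllFormData m} (hb : ∃ M : ℕ, ∀ Δ l : ℤ, Δ < -M → E.coeff Δ l = 0)
    (hb' : ∃ M : ℕ, ∀ Δ l : ℤ, Δ < -M → E'.coeff Δ l = 0) :
    pair m a (elin s t E E').coeff = s * pair m a E.coeff + t * pair m a E'.coeff ∧ ∃ M : ℕ, ∀ Δ l : ℤ, Δ < -M → (elin s t E E').coeff Δ l = 0 := by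
  obtain ⟨M, hM⟩ := hb
  obtain ⟨M', hM'⟩ := hb'
  have e : ∀ C : ℤ → ℤ → ℂ, (∀ Δ l : ℤ, Δ < -(M + M' : ℕ) → C Δ l = 0) → pair m a C = ∑ x ∈ Finset.range (2 * m), ∑ D ∈ Finset.range (M + M' + 1), a D x * C (-D) x := fun C hC =>
    Finset.sum_congr rfl fun x _ => tsum_nat_fin _ fun D hD => by rw [hC _ _ (by omega), mul_zero]
  have h1 : ∀ Δ l : ℤ, Δ < -(M + M' : ℕ) → (elin s t E E').coeff Δ l = 0 := fun Δ l h => by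
    simp only [elin]; rw [hM _ _ (by omega), hM' _ _ (by omega)]; ring
  refine ⟨?_, M + M', h1⟩
  rw [e _ h1, e _ fun Δ l h => hM _ _ (by omega), e _ fun Δ l h => hM' _ _ (by omega)]
  simp only [elin, Finset.mul_sum, ← Finset.sum_add_distrib]
  exact Finset.sum_congr rfl fun x _ => Finset.sum_congr rfl fun D _ => by ring

theorem back2 {m : ℕ} (hm : 0 < m) {φ ψ ρ : EllFormData m} (hw : IsWeakC m φ.coeff) (hM : ModularLaw 2 m ψ.toFun) (hw' : IsWeakC m ψ.coeff)
    (hc : IsCuspC ρ.coeff) (he : ∀ τ z : ℂ, 0 < τ.im → φ.toFun τ z = ψ.toFun τ z + ρ.toFun τ z) (m₁ m₂ : ℕ) (h12 : m₁ * m₂ = m) :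
    Rfactor m φ.coeff m₁ m₂ = 0 := by
  have hJ : JB 2 ψ := ⟨ψ.holo, ψ.elliptic, fun τ z h => by
    have := hM τ h z 0 (-1) 1 0 (by norm_num)
    simpa using this, ψ.expansion, 0, fun p hp => hw' _ _ hp⟩
  have h1 : φ.coeff = (elin 1 1 ψ ρ).coeff := by
    ext Δ l
    by_cases hd : (4 * (m : ℤ)) ∣ Δ + l ^ 2
    · obtain ⟨n, hn⟩ := hd
      rw [show Δ = 4 * m * n - l ^ 2 by linarith]
      refine coeff_eq_iff φ (c := fun p => (elin 1 1 ψ ρ).coeff (4 * (m : ℤ) * p.1 - p.2 ^ 2) p.2) (fun τ z h => ?_) n l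
      have := (elin 1 1 ψ ρ).expansion τ z h
      rwa [show (elin 1 1 ψ ρ).toFun τ z = φ.toFun τ z by simp only [elin]; rw [he τ z h]; ring] at this
    · rw [φ.support _ _ hd, (elin 1 1 ψ ρ).support _ _ hd]
  rw [← pair_aR hm h12 φ.periodic (hb_weak hm φ hw), h1, (pair_lin _ 1 1 (hb_weak hm ψ hw') ⟨0, fun Δ l h => hc _ _ (by simpa using h.le)⟩).1]
  subst h12
  rw [((aR_gv (Nat.pos_of_mul_pos_right hm) (Nat.pos_of_mul_pos_left hm)).lam hm).orth ψ hJ]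
  have : pair (m₁ * m₂) (aR m₁ m₂) ρ.coeff = 0 := Finset.sum_eq_zero fun x _ => by
    rw [tsum_congr fun D : ℕ => show _ = (0 : ℂ) by rw [hc (-(D : ℤ)) x (by omega), mul_zero], tsum_zero]
  rw [this]; ring

theorem core2 {m : ℕ} (hm : 0 < m) (φ : EllFormData m) (hpar : ∀ Δ l : ℤ, φ.coeff Δ (-l) = (-1 : ℂ) ^ (2 : ℤ) * φ.coeff Δ l)
    (hb : ∃ M : ℕ, ∀ Δ l : ℤ, Δ < -M → φ.coeff Δ l = 0) (h : ∀ m₁ m₂, m₁ * m₂ = m → pair m (aR m₁ m₂) φ.coeff = 0) :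
    ∃ ψ : EllFormData m, JB 2 ψ ∧ ∀ Δ l : ℤ, Δ ≤ 0 → ψ.coeff Δ l = φ.coeff Δ l :=
  decomp hm φ hpar hb fun a ha => pair_sp hm hb h (gv_span m hm a (ha.gv hm))

def thE {m : ℕ} (hm : 0 < m) (M t : ℕ) (h : m = M * t ^ 2) : EllFormData m where
  toFun := fun τ z => jTheta M 0 τ (t * z)
  coeff := fun Δ l => if Δ = 0 ∧ 2 * (M : ℤ) * t ∣ l then 1 else 0
  holo := fun τ z hτ => by
    have hM : 0 < M := Nat.pos_of_ne_zero fun h0 => by simp [h0] at h; omega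
    exact DifferentiableAt.comp (τ, z) (f := fun p : ℂ × ℂ => (p.1, (t * p.2 : ℂ))) (jTheta_hol hM 0 τ (t * z) hτ) (by fun_prop)
  elliptic := fun τ hτ z lam mu => by
    have hM : 0 < M := Nat.pos_of_ne_zero fun h0 => by simp [h0] at h; omega
    have := jTheta_ell hM 0 τ hτ (t * z) (t * lam) (t * mu)
    push_cast at this
    beta_reduce
    rw [show (t : ℂ) * (z + lam * τ + mu) = t * z + t * lam * τ + t * mu by ring, this, h]
    congr 2; push_cast; ring
  expansion := fun τ z hτ => by
    have hM : 0 < M := Nat.pos_of_ne_zero fun h0 => by simp [h0] at h; omega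
    have ht : 0 < t := Nat.pos_of_ne_zero fun h0 => by simp [h0] at h; omega
    have hM' : (M : ℂ) ≠ 0 := by exact_mod_cast hM.ne'
    have h1 := (jTheta_hasSum hM 0 hτ (t * z)).1
    have hi : Function.Injective fun n : ℤ => ((M * n ^ 2, 2 * M * t * n) : ℤ × ℤ) := fun a b hab => by
      have := (Prod.ext_iff.mp hab).2
      exact mul_left_cancel₀ (by positivity : (2 * (M : ℤ) * t) ≠ 0) this
    rw [← hi.hasSum_iff]
    · refine hs_congr h1 fun n => ?_
      simp only [Function.comp]
      rw [if_pos ⟨by rw [h]; push_cast; ring, dvd_mul_right _ _⟩, one_mul]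
      congr 1; push_cast; field_simp; ring
    · rintro ⟨n, r⟩ hn
      simp only
      rw [if_neg, zero_mul]
      rintro ⟨h2, c, hc⟩
      refine hn ⟨c, Prod.ext ?_ hc.symm⟩
      refine mul_left_cancel₀ (by positivity : (4 * (M : ℤ) * t ^ 2) ≠ 0) ?_
      rw [h, hc] at h2; push_cast at h2; simp only; linarith
  periodic := fun Δ l => by
    have : 2 * (M : ℤ) * t ∣ 2 * m := ⟨t, by rw [h]; push_cast; ring⟩
    simp only [dvd_add_left this]
  support := fun Δ l hn => if_neg fun ⟨h1, c, hc⟩ => hn ⟨M * c ^ 2, by rw [h1, hc, h]; push_cast; ring⟩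

theorem aR0 (m₁ m₂ : ℕ) (x : ℤ) : aR m₁ m₂ 0 x = if 2 * (m₁ : ℤ) ∣ x ∧ 2 * (m₂ : ℤ) ∣ x then 1 else 0 := by
  unfold aR
  rw [tsum_eq_single 0 fun s hs => by simp [hs]]
  simp [AA]

theorem aR_symm {m₁ m₂ : ℕ} (h1 : 0 < m₁) (h2 : 0 < m₂) : aR m₂ m₁ = aR m₁ m₂ := by
  ext D x
  have := (aR_gv h1 h2).par D x
  rw [show ((-1 : ℂ) ^ (2 : ℤ)) = 1 by norm_num, one_mul] at this
  rw [← this]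
  unfold aR
  refine tsum_congr fun s => if_congr (and_congr_right fun _ => ?_) rfl rfl
  unfold AA
  rw [and_comm, sub_neg_eq_add, neg_add_eq_sub, add_comm]

theorem pair_thE {m : ℕ} (hm : 0 < m) {p e i j : ℕ} (hp : 0 < p) (he : m = p ^ e) (hi : 2 * i ≤ e) (hj : 2 * j ≤ e)
    (h : m = p ^ (e - 2 * i) * (p ^ i) ^ 2) :
    pair m (aR (p ^ j) (p ^ (e - j))) (thE hm (p ^ (e - 2 * i)) (p ^ i) h).coeff = p ^ min i j := by
  have h0 : ∀ x : ℤ, ∑' D : ℕ, aR (p ^ j) (p ^ (e - j)) D x * (thE hm (p ^ (e - 2 * i)) (p ^ i) h).coeff (-D) x =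
      if 2 * (p : ℤ) ^ (e - min i j) ∣ x then 1 else 0 := fun x => by
    rw [tsum_eq_single 0 fun D hD => by simp [thE, hD], aR0]
    simp only [thE]
    have e1 : 2 * ((p ^ (e - 2 * i) : ℕ) : ℤ) * (p ^ i : ℕ) = 2 * (p : ℤ) ^ (e - i) := by
      push_cast; rw [mul_assoc, ← pow_add]; congr 2; omega
    rw [e1, ite_zero_mul_ite_zero, mul_one]
    refine if_congr ?_ rfl rfl
    have d : ∀ {a b : ℕ}, a ≤ b → 2 * (p : ℤ) ^ a ∣ 2 * (p : ℤ) ^ b := fun h => mul_dvd_mul_left _ (pow_dvd_pow _ h)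
    push_cast
    constructor
    · rintro ⟨⟨_, h2⟩, _, h3⟩
      rcases le_total i j with h4 | h4
      · rwa [min_eq_left h4]
      · rwa [min_eq_right h4]
    · intro h5
      exact ⟨⟨(d (by omega)).trans h5, (d (by omega)).trans h5⟩, by simp, (d (by omega)).trans h5⟩
  unfold pair
  simp only [h0]
  rw [show 2 * m = p ^ min i j * (2 * p ^ (e - min i j)) by rw [he, mul_left_comm, ← pow_add]; congr 2; omega, sum_split0 _ _ (by positivity)]
  · rw [Finset.sum_congr rfl fun x _ => if_pos (by push_cast; exact dvd_mul_right _ _)]; simp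
  · exact fun X hX => if_neg fun h => hX (by exact_mod_cast h)

theorem match0 {m p e : ℕ} (hm : 0 < m) (hp : 1 < p) (he : m = p ^ e) (v : ℕ → ℂ) (K : ℕ) : 2 * K ≤ e →
    ∃ E : EllFormData m, (∀ Δ l, Δ ≠ 0 → E.coeff Δ l = 0) ∧ IsEvenC E.coeff ∧ ∀ j ≤ K, pair m (aR (p ^ j) (p ^ (e - j))) E.coeff = v j := by
  have hr : ∀ i, 2 * i ≤ e → m = p ^ (e - 2 * i) * (p ^ i) ^ 2 := fun i hi => by
    rw [he, ← pow_mul, ← pow_add]; congr 1; omega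
  have hbb : ∀ E : EllFormData m, (∀ Δ l, Δ ≠ 0 → E.coeff Δ l = 0) → ∃ M : ℕ, ∀ Δ l : ℤ, Δ < -M → E.coeff Δ l = 0 := fun E h =>
    ⟨0, fun Δ l hΔ => h Δ l (by simp at hΔ; omega)⟩
  have h1 : ∀ i (hi : 2 * i ≤ e), ∀ Δ l, Δ ≠ 0 → (thE hm _ _ (hr i hi)).coeff Δ l = 0 := fun i hi Δ l hΔ => by simp [thE, hΔ]
  have h2 : ∀ i (hi : 2 * i ≤ e), IsEvenC (thE hm _ _ (hr i hi)).coeff := fun i hi Δ l => by simp [thE]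
  have l0 : ∀ (s t : ℂ) (E E' : EllFormData m), (∀ Δ l, Δ ≠ 0 → E.coeff Δ l = 0) → (∀ Δ l, Δ ≠ 0 → E'.coeff Δ l = 0) → ∀ Δ l, Δ ≠ 0 → (elin s t E E').coeff Δ l = 0 :=
    fun s t E E' h h' Δ l hΔ => by simp [elin, h Δ l hΔ, h' Δ l hΔ]
  have l1 : ∀ (s t : ℂ) (E E' : EllFormData m), IsEvenC E.coeff → IsEvenC E'.coeff → IsEvenC (elin s t E E').coeff :=
    fun s t E E' h h' Δ l => by simp [elin, h Δ l, h' Δ l]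
  induction K with
  | zero =>
    intro _
    let T := thE hm _ _ (hr 0 (by omega))
    have hT := h1 0 (by omega)
    refine ⟨elin (v 0) 0 T T, l0 _ _ _ _ hT hT, l1 _ _ _ _ (h2 0 (by omega)) (h2 0 (by omega)), fun j hj => ?_⟩
    obtain rfl : j = 0 := by omega
    rw [(pair_lin _ _ _ (hbb _ hT) (hbb _ hT)).1, pair_thE hm (by omega) he (by omega) (by omega)]; simp
  | succ K ih =>
    intro hK
    obtain ⟨E, hE, hE', hv⟩ := ih (by omega)
    let T := thE hm _ _ (hr K (by omega))
    let T' := thE hm _ _ (hr (K + 1) (by omega))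
    have hT := h1 K (by omega)
    have hT' := h1 (K + 1) (by omega)
    have hZ := l0 1 (-1) _ _ hT' hT
    have hp0 : (p : ℂ) ^ (K + 1) - p ^ K ≠ 0 := by
      rw [sub_ne_zero]; exact_mod_cast (Nat.pow_lt_pow_right hp (Nat.lt_succ_self K)).ne'
    refine ⟨elin 1 ((v (K + 1) - pair m (aR (p ^ (K + 1)) (p ^ (e - (K + 1)))) E.coeff) / ((p : ℂ) ^ (K + 1) - p ^ K)) E (elin 1 (-1) T' T), l0 _ _ _ _ hE hZ,
      l1 _ _ _ _ hE' (l1 _ _ _ _ (h2 (K + 1) (by omega)) (h2 K (by omega))), fun j hj => ?_⟩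
    rw [(pair_lin _ _ _ (hbb _ hE) (hbb _ hZ)).1, (pair_lin _ _ _ (hbb _ hT') (hbb _ hT)).1, pair_thE hm (by omega) he (by omega) (by omega), pair_thE hm (by omega) he (by omega) (by omega)]
    rcases Nat.lt_or_ge K j with h | h
    · obtain rfl : j = K + 1 := by omega
      rw [min_self, min_eq_left (by omega)]; field_simp; ring
    · rw [min_eq_right (by omega), min_eq_right h, hv j h]; ring

theorem weak_elliptic_decomposition (k : ℤ) (hk : 2 ≤ k) (m : ℕ) (hm : 0 < m)
    (φ : EllFormData m)
    (hpar : ∀ Δ l : ℤ, φ.coeff Δ (-l) = (-1 : ℂ) ^ k * φ.coeff Δ l)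
    (hweak : IsWeakC m φ.coeff) :
    ((2 < k →
      ∃ ψ ρ : EllFormData m, ModularLaw k m ψ.toFun ∧ IsWeakC m ψ.coeff ∧
        (∀ Δ l : ℤ, ρ.coeff Δ (-l) = (-1 : ℂ) ^ k * ρ.coeff Δ l) ∧ IsCuspC ρ.coeff ∧
        ∀ τ z : ℂ, 0 < τ.im → φ.toFun τ z = ψ.toFun τ z + ρ.toFun τ z) ∧
    (k = 2 →
      ((∃ ψ ρ : EllFormData m, ModularLaw k m ψ.toFun ∧ IsWeakC m ψ.coeff ∧
          (∀ Δ l : ℤ, ρ.coeff Δ (-l) = (-1 : ℂ) ^ k * ρ.coeff Δ l) ∧ IsCuspC ρ.coeff ∧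
          ∀ τ z : ℂ, 0 < τ.im → φ.toFun τ z = ψ.toFun τ z + ρ.toFun τ z) ↔
        (∀ m₁ m₂ : ℕ, m₁ * m₂ = m → Rfactor m φ.coeff m₁ m₂ = 0))) ∧
    (k = 2 → IsPrimePow m →
      ∃ ψ ρ : EllFormData m, ModularLaw k m ψ.toFun ∧ IsWeakC m ψ.coeff ∧
        (∀ Δ l : ℤ, ρ.coeff Δ (-l) = (-1 : ℂ) ^ k * ρ.coeff Δ l) ∧ IsHolC ρ.coeff ∧
        ∀ τ z : ℂ, 0 < τ.im → φ.toFun τ z = ψ.toFun τ z + ρ.toFun τ z)) := by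
  have hb := hb_weak hm φ hweak
  refine ⟨fun h2 => ?_, fun h2 => ?_, fun h2 hpp => ?_⟩
  · obtain ⟨ψ, hJ, h⟩ := decomp hm φ hpar hb fun a ha => Finset.sum_eq_zero fun x _ => by
      simp only [(ha.gv hm).zero h2 hm, zero_mul, tsum_zero]
    obtain ⟨q1, q2, q3, q4⟩ := fin_core hm φ ψ hpar hweak hJ fun Δ l hΔ => h Δ l hΔ.le
    exact ⟨ψ, _, q1, q2, q3, fun Δ l hΔ => by simp [elin, h Δ l hΔ], q4⟩
  · subst h2
    constructor
    · rintro ⟨ψ, ρ, q1, q2, -, q4, q5⟩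
      exact back2 hm hweak q1 q2 q4 q5
    · intro hR
      obtain ⟨ψ, hJ, h⟩ := core2 hm φ hpar hb fun m₁ m₂ h12 => by rw [pair_aR hm h12 φ.periodic hb, hR _ _ h12]
      obtain ⟨q1, q2, q3, q4⟩ := fin_core hm φ ψ hpar hweak hJ fun Δ l hΔ => h Δ l hΔ.le
      exact ⟨ψ, _, q1, q2, q3, fun Δ l hΔ => by simp [elin, h Δ l hΔ], q4⟩
  · subst h2
    obtain ⟨p, e, hp, -, he⟩ := hpp
    have hp := hp.nat_prime
    obtain ⟨E, hE, hE', hv⟩ := match0 hm hp.one_lt he.symm (fun j => pair m (aR (p ^ j) (p ^ (e - j))) φ.coeff) (e / 2) (by omega)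
    have l := fun a => pair_lin a 1 (-1) hb (E' := E) ⟨0, fun Δ l hΔ => hE Δ l (by simp at hΔ; omega)⟩
    have hj : ∀ j, 2 * j ≤ e → pair m (aR (p ^ j) (p ^ (e - j))) (elin 1 (-1) φ E).coeff = 0 := fun j hj => by
      rw [(l _).1, hv j (by omega)]; ring
    obtain ⟨ψ, hJ, h⟩ := core2 hm (elin 1 (-1) φ E) (fun Δ x => by simp only [elin]; rw [hpar, hE']; norm_num) (l (aR 1 1)).2 fun m₁ m₂ h12 => by
      have hpos : ∀ i, 0 < p ^ i := fun i => pow_pos hp.pos i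
      obtain ⟨j, hje, rfl⟩ := (Nat.dvd_prime_pow hp).mp (he ▸ Dvd.intro _ h12)
      obtain rfl : m₂ = p ^ (e - j) := Nat.eq_of_mul_eq_mul_left (hpos j) (by rw [h12, ← pow_add, ← he]; congr 1; omega)
      rcases le_total (2 * j) e with h | h
      · exact hj j h
      · rw [← aR_symm (hpos _) (hpos _)]
        have := hj (e - j) (by omega)
        rwa [show e - (e - j) = j by omega] at this
    have h' : ∀ Δ x : ℤ, Δ < 0 → ψ.coeff Δ x = φ.coeff Δ x := fun Δ x hΔ => by
      rw [h Δ x hΔ.le]; simp [elin, hE Δ x hΔ.ne]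
    obtain ⟨q1, q2, q3, q4⟩ := fin_core hm φ ψ hpar hweak hJ h'
    exact ⟨ψ, _, q1, q2, q3, fun Δ x hΔ => by simp [elin, h' Δ x hΔ], q4⟩
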